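/- The algebra H∞(𝔻×ℕ) is a B-ring (has Bass stable rank 1): for every pair f, g ∈ H∞(𝔻×ℕ) that is unimodular, i.e., such that there exist u, v ∈ H∞(𝔻×ℕ) with u(z,n)f(z,n) + v(z,n)g(z,n) = 1 for all (z,n) ∈ 𝔻×ℕ, there exists G ∈ H∞(𝔻×ℕ) such that f + gG is invertible in H∞(𝔻×ℕ), i.e., inf_{(z,n)∈𝔻×ℕ}|f(z,n) + g(z,n)G(z,n)| > 0. -/

import Mathlib

/-- Membership in `H^∞(𝔻 × ℕ)`: a function on the countable disjoint union of
unit disks whose every slice `z ↦ f z n` is holomorphic on `𝔻 = {z : |z| < 1}`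
and which is uniformly bounded. -/
def MemHinfN (f : ℂ → ℕ → ℂ) : Prop :=
  (∀ n : ℕ, DifferentiableOn ℂ (fun z => f z n) (Metric.ball 0 1)) ∧
    ∃ M : ℝ, ∀ z ∈ Metric.ball (0 : ℂ) 1, ∀ n : ℕ, ‖f z n‖ ≤ M

section
open Complex MeasureTheory Set

/-- `f` is real differentiable at `z` and its Wirtinger derivative `∂f/∂z̄` equals `d`. -/
def HasDbarAt (f : ℂ → ℂ) (d z : ℂ) : Prop :=
  ∃ f' : ℂ →L[ℝ] ℂ, HasFDerivAt f f' z ∧ f' 1 + I * f' I = 2 * d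

namespace HasDbarAt
variable {f g : ℂ → ℂ} {d e z : ℂ}

theorem of_differentiableAt (h : DifferentiableAt ℂ f z) : HasDbarAt f 0 z := by
  refine ⟨(fderiv ℂ f z).restrictScalars ℝ, h.hasFDerivAt.restrictScalars ℝ, ?_⟩
  have : fderiv ℂ f z I = I * fderiv ℂ f z 1 := by simp
  simp only [ContinuousLinearMap.coe_restrictScalars', this]
  rw [← mul_assoc, I_mul_I]; ring

theorem differentiableAt (h : HasDbarAt f 0 z) : DifferentiableAt ℂ f z := by
  obtain ⟨f', hf, h0⟩ := h
  rw [differentiableAt_complex_iff_differentiableAt_real]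
  refine ⟨hf.differentiableAt, ?_⟩
  rw [hf.fderiv, smul_eq_mul]
  have h1 : I * (f' 1 + I * f' I) = 0 := by rw [h0]; simp
  rw [mul_add, ← mul_assoc, I_mul_I] at h1
  linear_combination -h1

theorem congr_of_eventuallyEq (h : HasDbarAt f d z) (hg : g =ᶠ[nhds z] f) : HasDbarAt g d z :=
  let ⟨f', hf, h0⟩ := h
  ⟨f', hf.congr_of_eventuallyEq hg, h0⟩

theorem unique (h : HasDbarAt f d z) (h' : HasDbarAt f e z) : d = e := by
  obtain ⟨f', hf, h0⟩ := h
  obtain ⟨g', hg, h1⟩ := h'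
  rw [hf.unique hg, h1] at h0
  exact (mul_left_cancel₀ two_ne_zero h0).symm

theorem add (hf : HasDbarAt f d z) (hg : HasDbarAt g e z) :
    HasDbarAt (fun w => f w + g w) (d + e) z := by
  obtain ⟨f', hf, h0⟩ := hf
  obtain ⟨g', hg, h1⟩ := hg
  refine ⟨f' + g', hf.add hg, ?_⟩
  simp only [add_apply]
  linear_combination h0 + h1

theorem mul (hf : HasDbarAt f d z) (hg : HasDbarAt g e z) :
    HasDbarAt (fun w => f w * g w) (f z * e + d * g z) z := by
  obtain ⟨f', hf, h0⟩ := hf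
  obtain ⟨g', hg, h1⟩ := hg
  refine ⟨f z • g' + g z • f', hf.mul hg, ?_⟩
  simp only [add_apply, smul_apply, smul_eq_mul]
  linear_combination f z * h1 + g z * h0

theorem const_mul (c : ℂ) (hf : HasDbarAt f d z) : HasDbarAt (fun w => c * f w) (c * d) z := by
  have := (of_differentiableAt (differentiableAt_const c) (z := z)).mul hf
  simpa using this

theorem sub (hf : HasDbarAt f d z) (hg : HasDbarAt g e z) :
    HasDbarAt (fun w => f w - g w) (d - e) z := by
  have := hf.add (hg.const_mul (-1))
  simpa [sub_eq_add_neg] using this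

theorem sum {ι : Type*} {s : Finset ι} {F : ι → ℂ → ℂ} {D : ι → ℂ}
    (h : ∀ i ∈ s, HasDbarAt (F i) (D i) z) :
    HasDbarAt (fun w => ∑ i ∈ s, F i w) (∑ i ∈ s, D i) z := by
  classical
  induction s using Finset.induction_on with
  | empty => simpa using of_differentiableAt (differentiableAt_const (0 : ℂ))
  | insert i s hi ih =>
    simp only [Finset.sum_insert hi]
    exact (h i (Finset.mem_insert_self _ _)).add
      (ih fun j hj => h j (Finset.mem_insert_of_mem hj))

theorem comp {φ : ℂ → ℂ} (hφ : DifferentiableAt ℂ φ (f z)) (hf : HasDbarAt f d z) :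
    HasDbarAt (fun w => φ (f w)) (deriv φ (f z) * d) z := by
  obtain ⟨f', hf, h0⟩ := hf
  refine ⟨((fderiv ℂ φ (f z)).restrictScalars ℝ).comp f',
    (hφ.hasFDerivAt.restrictScalars ℝ).comp z hf, ?_⟩
  have key : ∀ c : ℂ, fderiv ℂ φ (f z) c = c * deriv φ (f z) := fun c => by simp
  simp only [ContinuousLinearMap.comp_apply, ContinuousLinearMap.coe_restrictScalars', key]
  linear_combination deriv φ (f z) * h0

theorem exp (hf : HasDbarAt f d z) :
    HasDbarAt (fun w => Complex.exp (f w)) (Complex.exp (f z) * d) z := by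
  have := hf.comp (φ := Complex.exp) Complex.differentiableAt_exp
  simpa using this

end HasDbarAt
end

section
open Complex MeasureTheory Set Metric
open scoped Real Convolution

theorem integrableOn_ball_inv_norm (r : ℝ) :
    IntegrableOn (fun z : ℂ => ‖z‖⁻¹) (ball 0 r) := by
  have := (integrableOn_fun_norm_addHaar (E := ℂ) (F := ℝ) volume (f := fun y => y⁻¹) (r := r)).2
  apply this
  have h1 : IntegrableOn (fun _ : ℝ => (1 : ℝ)) (Ioo 0 r) := by
    simp [IntegrableOn]
  refine h1.congr_fun (fun y hy => ?_) measurableSet_Ioo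
  have : y ≠ 0 := hy.1.ne'
  simp [Complex.finrank_real_complex, this]

theorem integral_ball_inv_norm {r : ℝ} (hr : 0 ≤ r) :
    ∫ z in ball (0 : ℂ) r, ‖z‖⁻¹ = 2 * π * r := by
  rw [← integral_indicator measurableSet_ball]
  have : (ball (0 : ℂ) r).indicator (fun z => ‖z‖⁻¹)
      = fun z => (Iio r).indicator (fun y : ℝ => y⁻¹) ‖z‖ := by
    ext z; simp [indicator]
  rw [this, integral_fun_norm_addHaar (E := ℂ) volume]
  have h2 : ∫ y in Ioi (0:ℝ), y ^ (Module.finrank ℝ ℂ - 1) • (Iio r).indicator (fun y : ℝ => y⁻¹) y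
      = ∫ y in Ioi (0:ℝ), (Iio r).indicator (fun y : ℝ => (1:ℝ)) y := by
    refine setIntegral_congr_fun measurableSet_Ioi fun y hy => ?_
    have : y ≠ 0 := (mem_Ioi.1 hy).ne'
    by_cases hyr : y < r <;> simp [Complex.finrank_real_complex, hyr, this]
  rw [h2, setIntegral_indicator measurableSet_Iio]
  have : Ioi (0:ℝ) ∩ Iio r = Ioo 0 r := rfl
  rw [this]
  simp [Complex.finrank_real_complex, Measure.real, hr]
  ring

theorem locallyIntegrable_inv : LocallyIntegrable (fun z : ℂ => z⁻¹) := by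
  intro x
  refine ⟨ball 0 (‖x‖ + 1), isOpen_ball.mem_nhds (by simp), ?_⟩
  have h := integrableOn_ball_inv_norm (‖x‖ + 1)
  refine h.mono' (by fun_prop) (Filter.Eventually.of_forall fun z => ?_)
  simp

/-- The Cauchy transform, a right inverse of the `∂̄` operator. -/
noncomputable def cauchyTransform (ρ : ℂ → ℂ) (z : ℂ) : ℂ := (π : ℂ)⁻¹ * ∫ t, ρ t * (z - t)⁻¹

/-- Pompeiu's formula in polar form. -/
theorem integral_dbar_mul_inv {ρ : ℂ → ℂ} (hρ : ContDiff ℝ 1 ρ) (hc : HasCompactSupport ρ) (x : ℂ) :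
    ∫ ζ, (fderiv ℝ ρ (x + ζ) 1 + I * fderiv ℝ ρ (x + ζ) I) * ζ⁻¹ = -(2 * π * ρ x) := by
  rw [← Complex.integral_comp_polarCoord_symm]
  have hfd : Continuous (fderiv ℝ ρ) := hρ.continuous_fderiv one_ne_zero
  set e : ℝ → ℂ := fun θ => Real.cos θ + Real.sin θ * I with he
  have hecont : Continuous e := by fun_prop
  have hnorm : ∀ θ, ‖e θ‖ = 1 := fun θ => by
    simp only [he, ofReal_cos, ofReal_sin, cos_add_sin_I]; exact norm_exp_ofReal_mul_I θ
  have hee : ∀ θ, (Real.cos θ - Real.sin θ * I) * e θ = 1 := fun θ => by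
    have h := Real.cos_sq_add_sin_sq θ
    have h' : (Real.cos θ : ℂ) ^ 2 + (Real.sin θ : ℂ) ^ 2 = 1 := by exact_mod_cast h
    simp only [he]; linear_combination h' - (Real.sin θ : ℂ)^2 * I_sq
  obtain ⟨R, hR0, hR⟩ : ∃ R, 0 < R ∧ ∀ ζ, R ≤ ‖ζ‖ → x + ζ ∉ tsupport ρ := by
    obtain ⟨R, hR⟩ := hc.isCompact.isBounded.exists_norm_le
    refine ⟨max 1 (R + ‖x‖ + 1), by positivity, fun ζ hζ hmem => ?_⟩
    have h1 := hR _ hmem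
    have h2 : ‖ζ‖ ≤ ‖x + ζ‖ + ‖x‖ := by
      calc ‖ζ‖ = ‖(x + ζ) - x‖ := by simp
        _ ≤ _ := norm_sub_le _ _
    have := le_max_right 1 (R + ‖x‖ + 1)
    linarith
  have hfd0 : ∀ ζ, R ≤ ‖ζ‖ → fderiv ℝ ρ (x + ζ) = 0 := fun ζ hζ =>
    image_eq_zero_of_notMem_tsupport fun h => hR ζ hζ (tsupport_fderiv_subset ℝ h)
  -- radial and angular derivatives
  set A : ℝ × ℝ → ℂ := fun p => fderiv ℝ ρ (x + p.1 * e p.2) (e p.2) with hA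
  set B : ℝ × ℝ → ℂ := fun p => I * fderiv ℝ ρ (x + p.1 * e p.2) (I * e p.2) with hB
  have hpt : ∀ p ∈ _root_.polarCoord.target, p.1 • ((fderiv ℝ ρ (x + Complex.polarCoord.symm p) 1
      + I * fderiv ℝ ρ (x + Complex.polarCoord.symm p) I) * (Complex.polarCoord.symm p)⁻¹)
      = A p + B p := by
    rintro ⟨r, θ⟩ hp
    have hr : (r : ℂ) ≠ 0 := by
      simp only [polarCoord_target, mem_prod, mem_Ioi] at hp
      exact_mod_cast hp.1.ne'
    have h1 : Complex.polarCoord.symm (r, θ) = r * e θ := by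
      simp [Complex.polarCoord_symm_apply, he]
    rw [h1]
    have hlin : ∀ (L : ℂ →L[ℝ] ℂ), L (e θ) = Real.cos θ * L 1 + Real.sin θ * L I := fun L => by
      have : e θ = (Real.cos θ) • (1:ℂ) + Real.sin θ • I := by simp [he]
      rw [this, map_add, map_smul, map_smul]; simp
    have hlin2 : ∀ (L : ℂ →L[ℝ] ℂ), L (I * e θ) = Real.cos θ * L I - Real.sin θ * L 1 := fun L => by
      have : I * e θ = (Real.cos θ) • I - Real.sin θ • (1:ℂ) := by
        simp only [he, real_smul]; linear_combination (Real.sin θ : ℂ) * I_sq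
      rw [this, map_sub, map_smul, map_smul]; simp
    have hinv : (e θ)⁻¹ = Real.cos θ - Real.sin θ * I :=
      inv_eq_of_mul_eq_one_left (hee θ)
    simp only [hA, hB, hlin, hlin2, mul_inv, hinv, real_smul]
    set L := fderiv ℝ ρ (x + r * e θ)
    have : (r : ℂ) * ((L 1 + I * L I) * ((r:ℂ)⁻¹ * (Real.cos θ - Real.sin θ * I)))
      = (L 1 + I * L I) * (Real.cos θ - Real.sin θ * I) := by
      field_simp
    rw [this]
    linear_combination -(Real.sin θ : ℂ) * L I * I_sq
  have hmeas : MeasurableSet _root_.polarCoord.target := _root_.polarCoord.open_target.measurableSet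
  rw [setIntegral_congr_fun hmeas hpt]
  have hAc : Continuous A := by
    simp only [hA]
    exact (hfd.comp (by fun_prop)).clm_apply (by fun_prop)
  have hBc : Continuous B := by
    simp only [hB]
    exact continuous_const.mul ((hfd.comp (by fun_prop)).clm_apply (by fun_prop))
  have hzero : ∀ r θ, R ≤ r → fderiv ℝ ρ (x + r * e θ) = 0 := fun r θ h => by
    apply hfd0; rw [norm_mul, hnorm]; simp [abs_of_pos (hR0.trans_le h), h]
  have hFint : ∀ F : ℝ × ℝ → ℂ, Continuous F → (∀ r θ, R ≤ r → F (r, θ) = 0) →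
      IntegrableOn F (Ioi 0 ×ˢ Ioo (-π) π) := fun F hF h0 => by
    have h1 : IntegrableOn F (Icc 0 R ×ˢ Icc (-π) π) :=
      hF.continuousOn.integrableOn_compact (isCompact_Icc.prod isCompact_Icc)
    have h2 : IntegrableOn F (Ioo 0 R ×ˢ Ioo (-π) π) :=
      h1.mono_set (prod_mono Ioo_subset_Icc_self Ioo_subset_Icc_self)
    refine h2.of_forall_sdiff_eq_zero (measurableSet_Ioi.prod measurableSet_Ioo) ?_
    rintro ⟨r, θ⟩ ⟨h3, h4⟩
    apply h0
    by_contra hlt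
    exact h4 ⟨⟨h3.1, not_le.1 hlt⟩, h3.2⟩
  have hAi := hFint A hAc fun r θ h => by simp [hA, hzero r θ h]
  have hBi := hFint B hBc fun r θ h => by simp [hB, hzero r θ h]
  have htar : _root_.polarCoord.target = Ioi (0:ℝ) ×ˢ Ioo (-π) π := polarCoord_target
  rw [htar]
  rw [integral_add hAi hBi]
  have hderiv : ∀ (γ : ℝ → ℂ) (γ' : ℂ) (t : ℝ), HasDerivAt γ γ' t →
      HasDerivAt (fun s => ρ (γ s)) (fderiv ℝ ρ (γ t) γ') t := fun γ γ' t h =>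
    ((hρ.differentiable one_ne_zero (γ t)).hasFDerivAt).comp_hasDerivAt t h
  -- the angular part integrates to zero
  have hB0 : ∫ p in Ioi (0:ℝ) ×ˢ Ioo (-π) π, B p = 0 := by
    rw [Measure.volume_eq_prod] at hBi ⊢
    rw [setIntegral_prod _ hBi]
    refine setIntegral_eq_zero_of_forall_eq_zero fun r hr => ?_
    have hr0 : (r : ℂ) ≠ 0 := by exact_mod_cast (mem_Ioi.1 hr).ne'
    rw [← integral_Ioc_eq_integral_Ioo,
      ← intervalIntegral.integral_of_le (by linarith [Real.pi_pos])]
    have hd : ∀ θ ∈ uIcc (-π) π, HasDerivAt (fun s : ℝ => I * (r:ℂ)⁻¹ * ρ (x + r * e s)) (B (r, θ)) θ := by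
      intro θ _
      have h1 : HasDerivAt e (I * e θ) θ := by
        have hc := (Real.hasDerivAt_cos θ).ofReal_comp
        have hs := ((Real.hasDerivAt_sin θ).ofReal_comp).mul_const I
        refine (hc.add hs).congr_deriv ?_
        simp only [he, ofReal_neg]; linear_combination -(Real.sin θ : ℂ) * I_sq
      have h2 := (hderiv (fun s => x + r * e s) _ θ ((h1.const_mul (r:ℂ)).const_add x)).const_mul
        (I * (r:ℂ)⁻¹)
      refine h2.congr_deriv ?_
      have : (r : ℂ) * (I * e θ) = r • (I * e θ) := by simp
      simp only [hB]
      rw [this, map_smul, real_smul]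
      field_simp
    rw [intervalIntegral.integral_eq_sub_of_hasDerivAt hd
      (hBc.comp (by fun_prop : Continuous fun θ : ℝ => (r, θ))).continuousOn.intervalIntegrable]
    simp [he]
  -- the radial part
  have hA0 : ∫ p in Ioi (0:ℝ) ×ˢ Ioo (-π) π, A p = -(2 * π * ρ x) := by
    rw [Measure.volume_eq_prod] at hAi ⊢
    rw [← setIntegral_prod_swap, setIntegral_prod (fun z : ℝ × ℝ => A z.swap) hAi.swap]
    have hin : ∀ θ ∈ Ioo (-π) π, ∫ r in Ioi (0:ℝ), A (Prod.swap (θ, r)) = -ρ x := by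
      intro θ _
      have hd : ∀ r ∈ Ici (0:ℝ), HasDerivAt (fun s : ℝ => ρ (x + s * e θ)) (A (r, θ)) r := by
        intro r _
        have h1 : HasDerivAt (fun s : ℝ => x + s * e θ) (e θ) r := by
          have := ((ofRealCLM.hasDerivAt (x := r)).mul_const (e θ)).const_add x
          simpa using this
        exact hderiv _ _ r h1
      have hAi' : IntegrableOn (fun r => A (r, θ)) (Ioi 0) := by
        have h1 : IntegrableOn (fun r => A (r, θ)) (Icc 0 R) :=
          (hAc.comp (by fun_prop : Continuous fun r : ℝ => (r, θ))).continuousOn.integrableOn_Icc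
        have h2 := h1.mono_set (Ioo_subset_Icc_self)
        refine h2.of_forall_sdiff_eq_zero measurableSet_Ioi ?_
        rintro r ⟨h3, h4⟩
        have : R ≤ r := by
          by_contra hlt
          exact h4 ⟨h3, not_le.1 hlt⟩
        simp [hA, hzero r θ this]
      have hlim : Filter.Tendsto (fun s : ℝ => ρ (x + s * e θ)) Filter.atTop (nhds 0) := by
        refine tendsto_const_nhds.congr' ?_
        filter_upwards [Filter.eventually_ge_atTop R] with s hs
        symm
        refine image_eq_zero_of_notMem_tsupport (hR _ ?_)
        rw [norm_mul, hnorm]; simp [abs_of_pos (hR0.trans_le hs), hs]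
      have := integral_Ioi_of_hasDerivAt_of_tendsto' hd hAi' hlim
      simpa using this
    rw [setIntegral_congr_fun measurableSet_Ioo hin]
    rw [setIntegral_const, Measure.real, Real.volume_Ioo,
      ENNReal.toReal_ofReal (by linarith [Real.pi_pos]), real_smul]
    push_cast
    ring
  rw [hA0, hB0, add_zero]

theorem cauchyTransform_eq_convolution (ρ : ℂ → ℂ) :
    cauchyTransform ρ = fun z => (π : ℂ)⁻¹ * (ρ ⋆[ContinuousLinearMap.mul ℝ ℂ, volume]
      (fun z : ℂ => z⁻¹)) z := by
  ext z; simp [cauchyTransform, convolution]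

/-- The Cauchy transform solves the `∂̄`-equation. -/
theorem hasDbarAt_cauchyTransform {ρ : ℂ → ℂ} (hρ : ContDiff ℝ 1 ρ) (hc : HasCompactSupport ρ)
    (z : ℂ) : HasDbarAt (cauchyTransform ρ) (ρ z) z := by
  have h := hc.hasFDerivAt_convolution_left (ContinuousLinearMap.mul ℝ ℂ) (μ := volume) hρ
    locallyIntegrable_inv z
  rw [cauchyTransform_eq_convolution]
  have hpi : (π : ℂ) ≠ 0 := by exact_mod_cast Real.pi_ne_zero
  have key : HasDbarAt (ρ ⋆[ContinuousLinearMap.mul ℝ ℂ, volume] (fun z : ℂ => z⁻¹)) (π * ρ z) z := by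
    refine ⟨_, h, ?_⟩
    have hFint : Integrable (fun t => ((ContinuousLinearMap.mul ℝ ℂ).precompL ℂ) (fderiv ℝ ρ t)
        ((z - t)⁻¹)) := by
      have hex := (hc.fderiv ℝ).convolutionExists_left (μ := volume)
        ((ContinuousLinearMap.mul ℝ ℂ).precompL ℂ)
        (hρ.continuous_fderiv one_ne_zero) locallyIntegrable_inv z
      exact hex
    have hv : ∀ v : ℂ, ((fderiv ℝ ρ ⋆[(ContinuousLinearMap.mul ℝ ℂ).precompL ℂ, volume]
        (fun z : ℂ => z⁻¹)) z) v = ∫ t, fderiv ℝ ρ t v * (z - t)⁻¹ := fun v => by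
      rw [convolution, ContinuousLinearMap.integral_apply hFint]
      rfl
    have hi : ∀ v : ℂ, Integrable fun t => fderiv ℝ ρ t v * (z - t)⁻¹ := fun v =>
      hFint.apply_continuousLinearMap v
    rw [hv, hv, ← integral_const_mul, ← integral_add (hi 1) ((hi I).const_mul I),
      ← integral_add_left_eq_self _ z]
    have := integral_dbar_mul_inv hρ hc z
    calc _ = ∫ ζ, -((fderiv ℝ ρ (z + ζ) 1 + I * fderiv ℝ ρ (z + ζ) I) * ζ⁻¹) := by
          congr 1; ext ζ
          have : z - (z + ζ) = -ζ := by ring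
          rw [this, inv_neg]; ring
      _ = _ := by rw [integral_neg, this]; ring
  have := key.const_mul (π : ℂ)⁻¹
  rwa [← mul_assoc, inv_mul_cancel₀ hpi, one_mul] at this

theorem norm_cauchyTransform_le_aux {ρ : ℂ → ℂ} {K r : ℝ} {c z : ℂ} (hr : 0 ≤ r)
    (h : ∀ t, t ≠ c → ‖ρ t * (z - t)⁻¹‖ ≤ (ball c r).indicator (fun t => K * ‖t - c‖⁻¹) t) :
    ‖cauchyTransform ρ z‖ ≤ 2 * K * r := by
  have hpi := Real.pi_pos
  have hi : Integrable ((ball c r).indicator (fun t => K * ‖t - c‖⁻¹)) := by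
    have h1 : Integrable ((ball (0 : ℂ) r).indicator fun t => K * ‖t‖⁻¹) :=
      (integrable_indicator_iff measurableSet_ball).2 ((integrableOn_ball_inv_norm r).const_mul K)
    convert! h1.comp_sub_right c using 1
    ext t; simp [indicator, dist_eq_norm]
  have hval : ∫ t, (ball c r).indicator (fun t => K * ‖t - c‖⁻¹) t = K * (2 * π * r) := by
    rw [← integral_ball_inv_norm hr, ← integral_const_mul, ← integral_indicator measurableSet_ball,
      ← integral_sub_right_eq_self ((ball (0 : ℂ) r).indicator fun t => K * ‖t‖⁻¹) c]
    congr 1; ext t; simp [indicator, dist_eq_norm]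
  have h2 : ‖∫ t, ρ t * (z - t)⁻¹‖ ≤ K * (2 * π * r) := by
    rw [← hval]
    refine norm_integral_le_of_norm_le hi ?_
    have : ∀ᵐ t : ℂ, t ≠ c := compl_mem_ae_iff.2 (measure_singleton c)
    filter_upwards [this] with t ht using h t ht
  rw [cauchyTransform, norm_mul, norm_inv, norm_real, Real.norm_of_nonneg hpi.le]
  calc π⁻¹ * _ ≤ π⁻¹ * (K * (2 * π * r)) := by gcongr
    _ = _ := by field_simp

theorem norm_cauchyTransform_le {ρ : ℂ → ℂ} {M R : ℝ} {w : ℂ} (hM : ∀ z, ‖ρ z‖ ≤ M)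
    (hR : 0 < R) (hs : ∀ z, ρ z ≠ 0 → ‖z - w‖ ≤ R) (z : ℂ) :
    ‖cauchyTransform ρ z‖ * (‖z - w‖ + R) ≤ 24 * M * R ^ 2 := by
  have hM0 : 0 ≤ M := (norm_nonneg _).trans (hM 0)
  rcases le_or_gt ‖z - w‖ (2 * R) with hz | hz
  · have h := norm_cauchyTransform_le_aux (ρ := ρ) (K := M) (r := 4 * R) (c := z) (z := z)
      (by positivity) fun t _ => by
        by_cases ht : ρ t = 0
        · simp only [ht, zero_mul, norm_zero]
          exact indicator_nonneg (fun _ _ => by positivity) _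
        · have hb : t ∈ ball z (4 * R) := by
            rw [mem_ball, dist_eq_norm]
            have := hs t ht
            have h3 : ‖t - z‖ ≤ ‖t - w‖ + ‖z - w‖ := by
              simpa [norm_sub_rev] using norm_sub_le (t - w) (z - w)
            linarith
          rw [indicator_of_mem hb, norm_mul, norm_inv, norm_sub_rev z t]
          gcongr; exact hM t
    calc _ ≤ (2 * M * (4 * R)) * (2 * R + R) := by gcongr
      _ = _ := by ring
  · have hz0 : 0 < ‖z - w‖ := by linarith
    have h := norm_cauchyTransform_le_aux (ρ := ρ) (K := M * (2 / ‖z - w‖) * (2 * R)) (r := 2 * R)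
      (c := w) (z := z) (by positivity) fun t htw => by
        by_cases ht : ρ t = 0
        · simp only [ht, zero_mul, norm_zero]
          exact indicator_nonneg (fun _ _ => by positivity) _
        · have h1 := hs t ht
          have hb : t ∈ ball w (2 * R) := by
            rw [mem_ball, dist_eq_norm]; linarith
          have h3 : ‖z - w‖ ≤ ‖z - t‖ + ‖t - w‖ := by
            simpa using norm_add_le (z - t) (t - w)
          have h0 : 0 < ‖t - w‖ := norm_pos_iff.2 (sub_ne_zero.2 htw)
          have h4 : ‖z - t‖⁻¹ ≤ 2 / ‖z - w‖ := by
            rw [inv_le_comm₀ (by linarith) (by positivity), inv_div]; linarith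
          have h5 : 1 ≤ 2 * R * ‖t - w‖⁻¹ := by
            rw [← div_eq_mul_inv, one_le_div h0]; linarith
          rw [indicator_of_mem hb, norm_mul, norm_inv]
          calc _ ≤ M * (2 / ‖z - w‖) * 1 := by
                rw [mul_one]; gcongr; exact hM t
            _ ≤ M * (2 / ‖z - w‖) * (2 * R * ‖t - w‖⁻¹) := by gcongr
            _ = _ := by ring
    calc _ ≤ (2 * (M * (2 / ‖z - w‖) * (2 * R)) * (2 * R)) * (‖z - w‖ + ‖z - w‖ / 2) := by
          gcongr; linarith
      _ = _ := by field_simp; ring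
end

section
open Complex Set
open scoped Real

theorem sum_mul_exp_neg_sum_le {ι : Type*} (s : Finset ι) (y t : ι → ℝ) (ht : ∀ i, 0 ≤ t i) :
    ∑ i ∈ s, t i * Real.exp (-∑ j ∈ s with y j ≤ y i, t j) ≤ 1 - Real.exp (-∑ i ∈ s, t i) := by
  classical
  induction s using Finset.induction_on_max_value y with
  | empty => simp
  | insert a s ha hmax ih =>
    rw [Finset.sum_insert ha, Finset.sum_insert ha]
    have h1 : ∑ i ∈ s, t i * Real.exp (-∑ j ∈ insert a s with y j ≤ y i, t j)
        ≤ ∑ i ∈ s, t i * Real.exp (-∑ j ∈ s with y j ≤ y i, t j) := by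
      refine Finset.sum_le_sum fun i _ => mul_le_mul_of_nonneg_left ?_ (ht i)
      exact Real.exp_le_exp.2 (neg_le_neg (Finset.sum_le_sum_of_subset_of_nonneg
        (Finset.filter_subset_filter _ (Finset.subset_insert _ _)) fun j _ _ => ht j))
    have h2 : (insert a s).filter (fun j => y j ≤ y a) = insert a s := by
      refine Finset.filter_true_of_mem fun j hj => ?_
      rcases Finset.mem_insert.1 hj with rfl | hj
      · exact le_rfl
      · exact hmax j hj
    rw [h2, Finset.sum_insert ha, neg_add, Real.exp_add]
    set E := Real.exp (-∑ i ∈ s, t i)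
    have hE : 0 < E := Real.exp_pos _
    have h3 : t a * Real.exp (-t a) ≤ 1 - Real.exp (-t a) := by
      have h4 := Real.add_one_le_exp (t a)
      have h5 : Real.exp (t a) * Real.exp (-t a) = 1 := by rw [← Real.exp_add]; simp
      nlinarith [Real.exp_pos (-t a)]
    nlinarith

/-- The constant in `sum_poisson_le`. -/
noncomputable def packConst : ℝ := 3 * ∑' m : ℤ, ((1 : ℝ) + (m : ℝ) ^ 2)⁻¹

theorem summable_inv_one_add_sq : Summable fun m : ℤ => ((1 : ℝ) + (m : ℝ) ^ 2)⁻¹ := by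
  have h : Summable fun m : ℤ => 1 / (m : ℝ) ^ 2 := Real.summable_one_div_int_pow.2 one_lt_two
  refine Summable.of_norm_bounded_eventually h ?_
  filter_upwards [(Set.finite_singleton (0 : ℤ)).compl_mem_cofinite] with m hm
  have hm' : (m : ℝ) ≠ 0 := by exact_mod_cast hm
  rw [Real.norm_of_nonneg (by positivity), one_div]
  have : 0 < (m : ℝ) ^ 2 := by positivity
  gcongr; linarith

theorem sum_poisson_le {ι : Type*} (s : Finset ι) (x y : ι → ℝ) (C₀ : ℝ) (hy : ∀ i ∈ s, 0 < y i)
    (hC : ∀ a b : ℝ, 0 < b → ∑ i ∈ s with |x i - a| ≤ b ∧ y i ≤ b, y i ≤ C₀ * b)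
    (a b : ℝ) (hb : 0 < b) :
    ∑ i ∈ s with y i ≤ b, y i * (b / ((x i - a) ^ 2 + b ^ 2)) ≤ packConst * C₀ := by
  classical
  set m : ι → ℤ := fun i => ⌊(x i - a) / b⌋ with hm
  have hC0 : 0 ≤ C₀ := by
    have h1 := hC 0 1 one_pos
    have h2 : 0 ≤ ∑ i ∈ s with |x i - 0| ≤ 1 ∧ y i ≤ 1, y i :=
      Finset.sum_nonneg fun i hi => (hy i (Finset.mem_filter.1 hi).1).le
    linarith
  set T := s.filter fun i => y i ≤ b
  have hgroup : ∀ k ∈ T.image m, ∑ i ∈ T with m i = k, y i * (b / ((x i - a) ^ 2 + b ^ 2))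
      ≤ (1 + (k : ℝ) ^ 2)⁻¹ * (3 * C₀) := by
    intro k _
    have h1 : ∀ i ∈ T.filter (fun i => m i = k), y i * (b / ((x i - a) ^ 2 + b ^ 2))
        ≤ y i * ((1 + (k : ℝ) ^ 2)⁻¹ * (3 / b)) := by
      intro i hi
      have hi' := Finset.mem_filter.1 hi
      have hyi := hy i (Finset.mem_filter.1 hi'.1).1
      refine mul_le_mul_of_nonneg_left ?_ hyi.le
      have hk1 : (k : ℝ) ≤ (x i - a) / b := by rw [← hi'.2]; exact Int.floor_le _
      have hk2 : (x i - a) / b < k + 1 := by rw [← hi'.2]; exact Int.lt_floor_add_one _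
      set u := (x i - a) / b with hu
      have hxu : x i - a = u * b := by rw [hu]; field_simp
      rw [hxu]
      have h4 : (u * b) ^ 2 + b ^ 2 = (1 + u ^ 2) * b ^ 2 := by ring
      have h5 : (1 + (k : ℝ) ^ 2) ≤ 3 * (1 + u ^ 2) := by
        nlinarith [sq_nonneg (u + (u - k)), sq_nonneg (u - k), sq_nonneg (3 * u - k), sq_nonneg (k:ℝ),
          sq_nonneg (2 * u - k)]
      rw [h4]
      have h6 : (1 + u ^ 2)⁻¹ ≤ 3 * (1 + (k : ℝ) ^ 2)⁻¹ := by
        rw [← div_eq_mul_inv, inv_le_comm₀ (by positivity) (by positivity), inv_div]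
        linarith
      calc b / ((1 + u ^ 2) * b ^ 2) = (1 + u ^ 2)⁻¹ * (1 / b) := by field_simp
        _ ≤ (3 * (1 + (k : ℝ) ^ 2)⁻¹) * (1 / b) := by gcongr
        _ = _ := by ring
    calc _ ≤ ∑ i ∈ T with m i = k, y i * ((1 + (k : ℝ) ^ 2)⁻¹ * (3 / b)) := Finset.sum_le_sum h1
      _ = (∑ i ∈ T with m i = k, y i) * ((1 + (k : ℝ) ^ 2)⁻¹ * (3 / b)) := by
        rw [Finset.sum_mul]
      _ ≤ (C₀ * b) * ((1 + (k : ℝ) ^ 2)⁻¹ * (3 / b)) := by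
        gcongr
        refine le_trans (Finset.sum_le_sum_of_subset_of_nonneg ?_ ?_) (hC (a + k * b) b hb)
        · intro i hi
          have hi' := Finset.mem_filter.1 hi
          have hi'' := Finset.mem_filter.1 hi'.1
          refine Finset.mem_filter.2 ⟨hi''.1, ?_, hi''.2⟩
          have hk1 : (k : ℝ) ≤ (x i - a) / b := by rw [← hi'.2]; exact Int.floor_le _
          have hk2 : (x i - a) / b < k + 1 := by rw [← hi'.2]; exact Int.lt_floor_add_one _
          rw [le_div_iff₀ hb] at hk1
          rw [div_lt_iff₀ hb] at hk2
          rw [abs_le]; constructor <;> nlinarith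
        · intro i hi _
          exact (hy i (Finset.mem_filter.1 hi).1).le
      _ = _ := by field_simp
  calc ∑ i ∈ T, y i * (b / ((x i - a) ^ 2 + b ^ 2))
      = ∑ k ∈ T.image m, ∑ i ∈ T with m i = k, y i * (b / ((x i - a) ^ 2 + b ^ 2)) :=
        (Finset.sum_fiberwise_of_maps_to (fun i hi => Finset.mem_image_of_mem m hi) _).symm
    _ ≤ ∑ k ∈ T.image m, (1 + (k : ℝ) ^ 2)⁻¹ * (3 * C₀) := Finset.sum_le_sum hgroup
    _ = (∑ k ∈ T.image m, (1 + (k : ℝ) ^ 2)⁻¹) * (3 * C₀) := by rw [Finset.sum_mul]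
    _ ≤ (∑' m : ℤ, ((1 : ℝ) + (m : ℝ) ^ 2)⁻¹) * (3 * C₀) := by
      gcongr
      exact summable_inv_one_add_sq.sum_le_tsum _ fun k _ => by positivity
    _ = _ := by unfold packConst; ring
end

section
open Complex Set
open scoped Real ComplexConjugate

/-- The constant in Jones' theorem `exists_dbar_solution`. -/
noncomputable def jonesConst (M K C₀ : ℝ) : ℝ :=
  24 * M * (K + 2) * Real.exp (16 * (K + 2) * (packConst * C₀)) * K ^ 2

section JonesKernel
variable {ι : Type*} (s : Finset ι) (ω : ι → ℂ) (i : ι)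

/-- The exponent in Jones' kernel. -/
noncomputable def jonesExponent (z : ℂ) : ℂ :=
  -∑ j ∈ s with (ω j).im ≤ (ω i).im, I * ((ω j).im : ℂ) / (z - conj (ω j))

/-- Jones' kernel. -/
noncomputable def jonesKernel (z : ℂ) : ℂ :=
  ((ω i).im : ℂ) / (z - conj (ω i)) * exp (jonesExponent s ω i z)

variable {s ω i}

theorem sub_conj_ne_zero {z w : ℂ} (h : 0 < z.im + w.im) : z - conj w ≠ 0 := fun h0 => by
  have := congrArg Complex.im h0
  simp at this
  linarith

theorem re_div_sub_conj (y : ℝ) (z w : ℂ) : (I * (y : ℂ) / (z - conj w)).re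
    = y * ((z.im + w.im) / ((w.re - z.re) ^ 2 + (z.im + w.im) ^ 2)) := by
  rw [div_re]
  simp [normSq_apply]
  ring

theorem jonesExponent_re (z : ℂ) : (jonesExponent s ω i z).re
    = -∑ j ∈ s with (ω j).im ≤ (ω i).im, (ω j).im *
      ((z.im + (ω j).im) / (((ω j).re - z.re) ^ 2 + (z.im + (ω j).im) ^ 2)) := by
  simp only [jonesExponent, neg_re, re_sum, re_div_sub_conj]

theorem differentiableAt_jonesExponent {z : ℂ}
    (hz : ∀ j ∈ s, (ω j).im ≤ (ω i).im → 0 < z.im + (ω j).im) :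
    DifferentiableAt ℂ (jonesExponent s ω i) z := by
  unfold jonesExponent
  refine DifferentiableAt.neg (DifferentiableAt.fun_sum fun j hj => ?_)
  have hj' := Finset.mem_filter.1 hj
  have := sub_conj_ne_zero (hz j hj'.1 hj'.2)
  fun_prop (disch := assumption)

theorem differentiableAt_jonesKernel (hi : i ∈ s) {z : ℂ}
    (hz : ∀ j ∈ s, (ω j).im ≤ (ω i).im → 0 < z.im + (ω j).im) :
    DifferentiableAt ℂ (jonesKernel s ω i) z := by
  have h1 := differentiableAt_jonesExponent hz
  have h2 := sub_conj_ne_zero (hz i hi le_rfl)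
  unfold jonesKernel
  fun_prop (disch := assumption)

theorem jonesKernel_ne_zero (hi : 0 < (ω i).im) {z : ℂ} (hz : 0 < z.im + (ω i).im) :
    jonesKernel s ω i z ≠ 0 := by
  have h2 := sub_conj_ne_zero hz
  have h3 : ((ω i).im : ℂ) ≠ 0 := by exact_mod_cast hi.ne'
  unfold jonesKernel
  have := exp_ne_zero (jonesExponent s ω i z)
  positivity

theorem norm_jonesKernel (hi : 0 < (ω i).im) (z : ℂ) : ‖jonesKernel s ω i z‖
    = (ω i).im / ‖z - conj (ω i)‖ * Real.exp (jonesExponent s ω i z).re := by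
  rw [jonesKernel, norm_mul, norm_div, norm_real, norm_exp, Real.norm_of_nonneg hi.le]

theorem norm_jonesKernel_le_one (hs : ∀ j ∈ s, 0 < (ω j).im) (hi : i ∈ s) {z : ℂ} (hz : 0 ≤ z.im) :
    ‖jonesKernel s ω i z‖ ≤ 1 := by
  rw [norm_jonesKernel (hs i hi)]
  have h1 : (ω i).im ≤ ‖z - conj (ω i)‖ := by
    have := abs_im_le_norm (z - conj (ω i))
    simp only [sub_im, conj_im, sub_neg_eq_add] at this
    have := (le_abs_self _).trans this
    linarith
  have h2 : (jonesExponent s ω i z).re ≤ 0 := by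
    rw [jonesExponent_re, neg_nonpos]
    refine Finset.sum_nonneg fun j hj => ?_
    have := hs j (Finset.mem_filter.1 hj).1
    positivity
  have h3 : (ω i).im / ‖z - conj (ω i)‖ ≤ 1 := div_le_one_of_le₀ h1 (norm_nonneg _)
  exact mul_le_one₀ h3 (Real.exp_nonneg _) (Real.exp_le_one_iff.2 h2)

end JonesKernel

/-- **Jones' theorem**: bounded solutions of `∂̄ W = ∑ ρ i` when the pieces `ρ i` live on
hyperbolic discs around points `ω i` satisfying a Carleson condition. -/
theorem exists_dbar_solution {ι : Type*} (s : Finset ι) (ω : ι → ℂ) (ρ : ι → ℂ → ℂ) {M K C₀ : ℝ}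
    (hM₀ : 0 ≤ M) (hK : 0 < K) (hω : ∀ i ∈ s, 0 < (ω i).im) (hρ : ∀ i ∈ s, ContDiff ℝ 1 (ρ i))
    (hc : ∀ i ∈ s, HasCompactSupport (ρ i)) (hM : ∀ i ∈ s, ∀ z, ‖ρ i z‖ ≤ M / (ω i).im)
    (hsupp : ∀ i ∈ s, ∀ z ∈ tsupport (ρ i), ‖z - ω i‖ ≤ K * (ω i).im ∧
      ∀ j ∈ s, (ω j).im ≤ (ω i).im → (ω i).im / 4 ≤ z.im + (ω j).im)
    (hC : ∀ a b : ℝ, 0 < b →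
      ∑ i ∈ s with |(ω i).re - a| ≤ b ∧ (ω i).im ≤ b, (ω i).im ≤ C₀ * b) :
    ∃ W : ℂ → ℂ, (∀ z : ℂ, (∀ i ∈ s, 0 < z.im + (ω i).im) → HasDbarAt W (∑ i ∈ s, ρ i z) z) ∧
      (∃ B, ∀ z : ℂ, 0 ≤ z.im → ‖W z‖ ≤ B) ∧ ∀ x : ℝ, ‖W x‖ ≤ jonesConst M K C₀ := by
  set q := jonesKernel s ω with hq
  set P := 16 * (K + 2) * (packConst * C₀) with hP
  set r : ι → ℂ → ℂ := fun i z => ρ i z * (q i z)⁻¹ with hr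
  have hsub : ∀ i, tsupport (r i) ⊆ tsupport (ρ i) := fun i => tsupport_mul_subset_left
  have hrc : ∀ i ∈ s, ContDiff ℝ 1 (r i) := by
    intro i hi
    refine contDiff_iff_contDiffAt.2 fun z => ?_
    by_cases hz : z ∈ tsupport (r i)
    swap
    · exact contDiffAt_const.congr_of_eventuallyEq (notMem_tsupport_iff_eventuallyEq.1 hz)
    have hz' := hsupp i hi z (hsub i hz)
    have hU : IsOpen {w : ℂ | ∀ j ∈ s.filter (fun j => (ω j).im ≤ (ω i).im), 0 < w.im + (ω j).im} := by
      have : {w : ℂ | ∀ j ∈ s.filter (fun j => (ω j).im ≤ (ω i).im), 0 < w.im + (ω j).im}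
          = ⋂ j ∈ s.filter (fun j => (ω j).im ≤ (ω i).im), {w : ℂ | 0 < w.im + (ω j).im} := by
        ext w; simp
      rw [this]
      exact isOpen_biInter_finset fun j _ => isOpen_lt continuous_const (by fun_prop)
    have hzU : z ∈ {w : ℂ | ∀ j ∈ s.filter (fun j => (ω j).im ≤ (ω i).im), 0 < w.im + (ω j).im} := by
      intro j hj
      have hj' := Finset.mem_filter.1 hj
      have := hz'.2 j hj'.1 hj'.2
      linarith [hω i hi]
    have hqd : DifferentiableOn ℂ (q i)
        {w : ℂ | ∀ j ∈ s.filter (fun j => (ω j).im ≤ (ω i).im), 0 < w.im + (ω j).im} := fun w hw =>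
      (differentiableAt_jonesKernel hi fun j hj hji =>
        hw j (Finset.mem_filter.2 ⟨hj, hji⟩)).differentiableWithinAt
    have hqa : ContDiffAt ℂ 1 (q i) z := (hqd.analyticAt (hU.mem_nhds hzU)).contDiffAt
    refine (hρ i hi).contDiffAt.mul ((hqa.restrict_scalars ℝ).inv ?_)
    exact jonesKernel_ne_zero (hω i hi) (hzU i (Finset.mem_filter.2 ⟨hi, le_rfl⟩))
  have hrs : ∀ i ∈ s, HasCompactSupport (r i) := fun i hi => (hc i hi).mul_right
  have hM0 : ∀ i ∈ s, 0 ≤ M / (ω i).im := fun i hi => (norm_nonneg _).trans (hM i hi 0)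
  have hrb : ∀ i ∈ s, ∀ z, ‖r i z‖ ≤ M / (ω i).im * ((K + 2) * Real.exp P) := by
    intro i hi z
    have hyi := hω i hi
    by_cases hz : ρ i z = 0
    · simp only [hr, hz, zero_mul, norm_zero]
      have := hM0 i hi
      positivity
    have hzs := hsupp i hi z (subset_tsupport _ hz)
    have hzi := hzs.2 i hi le_rfl
    simp only [hr, norm_mul, norm_inv]
    refine mul_le_mul (hM i hi z) ?_ (by positivity) (hM0 i hi)
    rw [hq, norm_jonesKernel hyi, mul_inv, inv_div, ← Real.exp_neg]
    have h1 : ‖z - conj (ω i)‖ / (ω i).im ≤ K + 2 := by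
      rw [div_le_iff₀ hyi]
      have h2 : ‖z - conj (ω i)‖ ≤ ‖z - ω i‖ + ‖ω i - conj (ω i)‖ := by
        simpa using norm_add_le (z - ω i) (ω i - conj (ω i))
      have h3 : ‖ω i - conj (ω i)‖ = 2 * (ω i).im := by
        rw [sub_conj, norm_mul, norm_I, norm_real, Real.norm_of_nonneg (by positivity), mul_one]
      linarith [hzs.1]
    have h4 : -(jonesExponent s ω i z).re ≤ P := by
      rw [jonesExponent_re, neg_neg]
      have h5 := sum_poisson_le s (fun j => (ω j).re) (fun j => (ω j).im) C₀ hω hC z.re (ω i).im hyi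
      calc _ ≤ ∑ j ∈ s with (ω j).im ≤ (ω i).im, 16 * (K + 2) * ((ω j).im *
              ((ω i).im / (((ω j).re - z.re) ^ 2 + (ω i).im ^ 2))) := by
            refine Finset.sum_le_sum fun j hj => ?_
            have hj' := Finset.mem_filter.1 hj
            have hyj := hω j hj'.1
            have hY := hzs.2 j hj'.1 hj'.2
            have hzim : z.im - (ω i).im ≤ K * (ω i).im := by
              have := (le_abs_self _).trans (abs_im_le_norm (z - ω i))
              simp only [sub_im] at this
              linarith [hzs.1]
            set Y := z.im + (ω j).im
            have hYu : Y ≤ (K + 2) * (ω i).im := by simp only [Y]; linarith [hj'.2]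
            set D := ((ω j).re - z.re) ^ 2
            have hD : 0 ≤ D := sq_nonneg _
            have hden : (D + (ω i).im ^ 2) / 16 ≤ D + Y ^ 2 := by nlinarith
            have : Y / (D + Y ^ 2) ≤ 16 * (K + 2) * ((ω i).im / (D + (ω i).im ^ 2)) := by
              calc Y / (D + Y ^ 2) ≤ ((K + 2) * (ω i).im) / ((D + (ω i).im ^ 2) / 16) := by
                    gcongr
                _ = _ := by field_simp
            calc _ ≤ (ω j).im * (16 * (K + 2) * ((ω i).im / (D + (ω i).im ^ 2))) := by gcongr
              _ = _ := by ring
        _ = 16 * (K + 2) * ∑ j ∈ s with (ω j).im ≤ (ω i).im, ((ω j).im *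
              ((ω i).im / (((ω j).re - z.re) ^ 2 + (ω i).im ^ 2))) := by rw [Finset.mul_sum]
        _ ≤ _ := by rw [hP]; gcongr
    gcongr
  have hu : ∀ i ∈ s, ∀ z, ‖cauchyTransform (r i) z‖ * (‖z - ω i‖ + K * (ω i).im)
      ≤ 24 * (M / (ω i).im * ((K + 2) * Real.exp P)) * (K * (ω i).im) ^ 2 := by
    intro i hi z
    refine norm_cauchyTransform_le (hrb i hi) (mul_pos hK (hω i hi)) (fun w hw => ?_) z
    have : ρ i w ≠ 0 := fun h => hw (by simp [hr, h])
    exact (hsupp i hi w (subset_tsupport _ this)).1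
  refine ⟨fun z => ∑ i ∈ s, q i z * cauchyTransform (r i) z, ?_, ?_, ?_⟩
  · intro z hz
    refine HasDbarAt.sum fun i hi => ?_
    have h1 := HasDbarAt.of_differentiableAt
      (differentiableAt_jonesKernel hi fun j hj _ => hz j hj)
    have h2 := h1.mul (hasDbarAt_cauchyTransform (hrc i hi) (hrs i hi) z)
    have h3 : q i z ≠ 0 := jonesKernel_ne_zero (hω i hi) (hz i hi)
    have h4 : jonesKernel s ω i z * r i z + 0 * cauchyTransform (r i) z = ρ i z := by
      simp only [hr]; rw [← hq]; field_simp; ring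
    rwa [h4] at h2
  · refine ⟨∑ i ∈ s, (24 * (M / (ω i).im * ((K + 2) * Real.exp P)) * (K * (ω i).im) ^ 2)
      / (K * (ω i).im), fun z hz => (norm_sum_le _ _).trans (Finset.sum_le_sum fun i hi => ?_)⟩
    have hyi := hω i hi
    have h1 := norm_jonesKernel_le_one hω hi hz
    have h2 := hu i hi z
    rw [norm_mul]
    calc _ ≤ 1 * ‖cauchyTransform (r i) z‖ := by gcongr
      _ ≤ _ := by
        rw [one_mul, le_div_iff₀ (by positivity)]
        refine le_trans ?_ h2
        gcongr
        linarith [norm_nonneg (z - ω i)]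
  · intro x
    set t : ι → ℝ := fun j => (ω j).im ^ 2 / ‖(x : ℂ) - ω j‖ ^ 2 with ht
    have hnn : ∀ j, ‖(x : ℂ) - ω j‖ ^ 2 = ((ω j).re - x) ^ 2 + (ω j).im ^ 2 := fun j => by
      rw [← normSq_eq_norm_sq, normSq_apply]; simp; ring
    have hnc : ∀ j, ‖(x : ℂ) - conj (ω j)‖ = ‖(x : ℂ) - ω j‖ := fun j => by
      rw [← norm_conj]; simp
    have hmain := sum_mul_exp_neg_sum_le s (fun j => (ω j).im) t fun j => by positivity
    have hJ : 0 ≤ jonesConst M K C₀ := by unfold jonesConst; positivity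
    have hterm : ∀ i ∈ s, ‖q i x * cauchyTransform (r i) x‖ ≤ jonesConst M K C₀ *
        (t i * Real.exp (-∑ j ∈ s with (ω j).im ≤ (ω i).im, t j)) := by
      intro i hi
      have hyi := hω i hi
      have hxi : 0 < ‖(x : ℂ) - ω i‖ := by
        rw [norm_pos_iff]
        intro h
        have := congrArg Complex.im h
        simp at this
        linarith
      have he : (jonesExponent s ω i x).re = -∑ j ∈ s with (ω j).im ≤ (ω i).im, t j := by
        rw [jonesExponent_re]
        congr 1
        refine Finset.sum_congr rfl fun j hj => ?_
        simp only [ht, hnn, ofReal_im, ofReal_re, zero_add]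
        ring
      have hu' : ‖cauchyTransform (r i) x‖ ≤
          (24 * (M / (ω i).im * ((K + 2) * Real.exp P)) * (K * (ω i).im) ^ 2) / ‖(x : ℂ) - ω i‖ := by
        rw [le_div_iff₀ hxi]
        refine le_trans ?_ (hu i hi x)
        gcongr
        have : 0 < K * (ω i).im := by positivity
        linarith
      rw [norm_mul, hq, norm_jonesKernel hyi, he, hnc]
      calc _ ≤ (ω i).im / ‖(x : ℂ) - ω i‖ * Real.exp (-∑ j ∈ s with (ω j).im ≤ (ω i).im, t j) *
            ((24 * (M / (ω i).im * ((K + 2) * Real.exp P)) * (K * (ω i).im) ^ 2)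
              / ‖(x : ℂ) - ω i‖) := by gcongr
        _ = _ := by
          simp only [ht, jonesConst, ← hP]
          field_simp
    calc _ ≤ ∑ i ∈ s, ‖q i x * cauchyTransform (r i) x‖ := norm_sum_le _ _
      _ ≤ ∑ i ∈ s, jonesConst M K C₀ *
        (t i * Real.exp (-∑ j ∈ s with (ω j).im ≤ (ω i).im, t j)) := Finset.sum_le_sum hterm
      _ = jonesConst M K C₀ * ∑ i ∈ s,
        (t i * Real.exp (-∑ j ∈ s with (ω j).im ≤ (ω i).im, t j)) := by rw [Finset.mul_sum]
      _ ≤ jonesConst M K C₀ := by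
        refine mul_le_of_le_one_right hJ (hmain.trans ?_)
        linarith [Real.exp_pos (-∑ i ∈ s, t i)]
end

section
open Complex Set Metric
open scoped Real ComplexConjugate

/-- Increments of a bounded monotone function over disjoint intervals. -/
theorem sum_increments_le {ι : Type*} (s : Finset ι) (a b : ι → ℝ) {Φ : ℝ → ℝ} {A : ℝ}
    (hΦ : Monotone Φ) (hA : ∀ t, |Φ t| ≤ A) (hab : ∀ i ∈ s, a i < b i)
    (hd : ∀ i ∈ s, ∀ j ∈ s, i ≠ j → b i ≤ a j ∨ b j ≤ a i) :
    ∑ i ∈ s, (Φ (b i) - Φ (a i)) ≤ 2 * A := by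
  classical
  suffices h : ∀ X, (∀ i ∈ s, b i ≤ X) → ∑ i ∈ s, (Φ (b i) - Φ (a i)) ≤ Φ X + A by
    obtain ⟨X, hX⟩ := (s.image b).exists_le
    have h1 := h X fun i hi => hX _ (Finset.mem_image_of_mem b hi)
    have h2 := (abs_le.1 (hA X)).2
    linarith
  induction s using Finset.induction_on_max_value a with
  | empty => intro X _; simpa using by linarith [(abs_le.1 (hA X)).1]
  | insert k s hk hmax ih =>
    intro X hX
    rw [Finset.sum_insert hk]
    have h1 := ih (fun i hi => hab i (Finset.mem_insert_of_mem hi))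
      (fun i hi j hj => hd i (Finset.mem_insert_of_mem hi) j (Finset.mem_insert_of_mem hj)) (a k)
      (fun i hi => by
        have hne : i ≠ k := fun h => hk (h ▸ hi)
        rcases hd i (Finset.mem_insert_of_mem hi) k (Finset.mem_insert_self _ _) hne with h | h
        · exact h
        · have h2 := hmax i hi
          have h3 := hab k (Finset.mem_insert_self _ _)
          linarith)
    have h2 := hΦ (hX k (Finset.mem_insert_self _ _))
    linarith

/-- A bounded increasing function whose slope at distance `m` from `0` is about
`m^(-1/2) / (1 + m)`. -/
noncomputable def slopeFun (t : ℝ) : ℝ :=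
  if 0 ≤ t then √t / (1 + √t) else -(√(-t) / (1 + √(-t)))

theorem slopeFun_neg (t : ℝ) : slopeFun (-t) = -slopeFun t := by
  unfold slopeFun
  rcases lt_trichotomy t 0 with h | h | h
  · rw [if_pos (by linarith), if_neg (by linarith)]; simp
  · simp [h]
  · rw [if_neg (by linarith), if_pos h.le]; simp

theorem slopeFun_nonneg {t : ℝ} (h : 0 ≤ t) : 0 ≤ slopeFun t := by
  rw [slopeFun, if_pos h]; positivity

theorem abs_slopeFun_le (t : ℝ) : |slopeFun t| ≤ 1 := by
  have h : ∀ t, 0 ≤ t → |slopeFun t| ≤ 1 := fun t ht => by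
    rw [abs_of_nonneg (slopeFun_nonneg ht), slopeFun, if_pos ht]
    exact div_le_one_of_le₀ (by linarith) (by positivity)
  rcases le_total 0 t with ht | ht
  · exact h t ht
  · rw [← abs_neg, ← slopeFun_neg]; exact h _ (by linarith)

theorem slopeFun_sub_ge_aux {a b m : ℝ} (ha : 0 ≤ a) (hab : a ≤ b) (hb : b ≤ m) (hm : 0 < m) :
    (b - a) / (4 * √m * (1 + m)) ≤ slopeFun b - slopeFun a := by
  rcases hab.eq_or_lt with h | h
  · simp [h]
  have hb0 : 0 < b := ha.trans_lt h
  rw [slopeFun, slopeFun, if_pos ha, if_pos hb0.le]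
  have hA := Real.sqrt_nonneg a
  have hB := Real.sqrt_pos.2 hb0
  have h1 : √a ≤ √m := Real.sqrt_le_sqrt (hab.trans hb)
  have h2 : √b ≤ √m := Real.sqrt_le_sqrt hb
  have hM : 0 < √m := Real.sqrt_pos.2 hm
  have hm2 : √m ^ 2 = m := Real.sq_sqrt hm.le
  have e : √b / (1 + √b) - √a / (1 + √a) = (b - a) / ((√a + √b) * ((1 + √a) * (1 + √b))) := by
    have ha2 : √a ^ 2 = a := Real.sq_sqrt ha
    have hb2 : √b ^ 2 = b := Real.sq_sqrt hb0.le
    have : √a + √b ≠ 0 := by positivity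
    rw [div_sub_div _ _ (by positivity) (by positivity), div_eq_div_iff (by positivity) (by positivity)]
    rw [← ha2, ← hb2]
    simp only [Real.sqrt_sq hA, Real.sqrt_sq hB.le]
    ring
  rw [e]
  have h3 : (1 + √a) * (1 + √b) ≤ 2 * (1 + m) := by
    calc (1 + √a) * (1 + √b) ≤ (1 + √m) * (1 + √m) := by gcongr
      _ ≤ 2 * (1 + m) := by nlinarith [sq_nonneg (√m - 1)]
  have h4 : √a + √b ≤ 2 * √m := by linarith
  apply div_le_div_of_nonneg_left (by linarith) (by positivity)
  calc (√a + √b) * ((1 + √a) * (1 + √b)) ≤ (2 * √m) * (2 * (1 + m)) := by gcongr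
    _ = _ := by ring

theorem slopeFun_sub_ge {a b m : ℝ} (ha : |a| ≤ m) (hb : |b| ≤ m) (hab : a ≤ b) (hm : 0 < m) :
    (b - a) / (4 * √m * (1 + m)) ≤ slopeFun b - slopeFun a := by
  rw [abs_le] at ha hb
  rcases le_total 0 a with h | h
  · exact slopeFun_sub_ge_aux h hab hb.2 hm
  rcases le_total b 0 with h' | h'
  · have := slopeFun_sub_ge_aux (a := -b) (b := -a) (m := m) (by linarith) (by linarith)
      (by linarith) hm
    rw [slopeFun_neg, slopeFun_neg] at this
    convert this using 1 <;> ring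
  · have h1 := slopeFun_sub_ge_aux (a := 0) le_rfl h' hb.2 hm
    have h2 := slopeFun_sub_ge_aux (a := 0) (b := -a) le_rfl (by linarith) (by linarith) hm
    have h0 : slopeFun 0 = 0 := by simp [slopeFun]
    rw [h0] at h1 h2
    rw [slopeFun_neg] at h2
    have : (b - a) / (4 * √m * (1 + m)) = (b - 0) / (4 * √m * (1 + m))
      + (-a - 0) / (4 * √m * (1 + m)) := by ring
    linarith

theorem monotone_slopeFun : Monotone slopeFun := by
  intro a b hab
  have h := slopeFun_sub_ge (a := a) (b := b) (m := |a| + |b| + 1)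
    (by linarith [abs_nonneg b]) (by linarith [abs_nonneg a]) hab (by positivity)
  have : 0 ≤ (b - a) / (4 * √(|a| + |b| + 1) * (1 + (|a| + |b| + 1))) :=
    div_nonneg (by linarith) (by positivity)
  linarith

theorem log_one_add_le_sqrt_sqrt {s : ℝ} (hs : 0 ≤ s) : Real.log (1 + s) ≤ 4 * √(√s) := by
  have h1 : 1 + s ≤ (1 + √(√s)) ^ 4 := by
    have h2 : √(√s) ^ 4 = s := by
      rw [show (4:ℕ) = 2 * 2 from rfl, pow_mul, Real.sq_sqrt (Real.sqrt_nonneg s), Real.sq_sqrt hs]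
    have h3 := Real.sqrt_nonneg (√s)
    nlinarith [pow_nonneg h3 2, pow_nonneg h3 3]
  have h3 := Real.sqrt_nonneg (√s)
  calc Real.log (1 + s) ≤ Real.log ((1 + √(√s)) ^ 4) := Real.log_le_log (by linarith) h1
    _ = 4 * Real.log (1 + √(√s)) := by rw [Real.log_pow]; norm_num
    _ ≤ 4 * √(√s) := by
      have := Real.log_le_sub_one_of_pos (x := 1 + √(√s)) (by linarith)
      linarith

/-- Green-function bound for a single point; `D` is the relative distance and `Y` the relative
height. -/
theorem half_log_le {D Y : ℝ} (hD : 0 < D) (hY : 0 < Y) (hDY : |1 - Y| ≤ D) :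
    Real.log (1 + 4 * Y / D ^ 2) / 2 ≤ 100 * Y / (√(3 * D) * (1 + 3 * D)) := by
  have hs3 : √(3 * D) ^ 2 = 3 * D := Real.sq_sqrt (by positivity)
  have hS : 0 < √(3 * D) := Real.sqrt_pos.2 (by positivity)
  rw [le_div_iff₀ (by positivity)]
  rcases le_or_gt (1 / 2) D with h | h
  · have h1 : Real.log (1 + 4 * Y / D ^ 2) ≤ 4 * Y / D ^ 2 := by
      have := Real.log_le_sub_one_of_pos (x := 1 + 4 * Y / D ^ 2) (by positivity)
      linarith
    have h2 : √(3 * D) ≤ 4 * D := by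
      rw [Real.sqrt_le_left (by positivity)]; nlinarith
    calc _ ≤ (4 * Y / D ^ 2) / 2 * (4 * D * (5 * D)) := by
          gcongr
          linarith
      _ = 40 * Y := by field_simp; ring
      _ ≤ _ := by linarith
  · rw [abs_le] at hDY
    have h1 := log_one_add_le_sqrt_sqrt (s := 4 * Y / D ^ 2) (by positivity)
    have h2 : √(4 * Y / D ^ 2) ≤ 3 / D := by
      rw [Real.sqrt_le_left (by positivity), div_pow]
      gcongr
      linarith
    have h3 : √(√(4 * Y / D ^ 2)) ≤ 3 / √(3 * D) := by
      rw [Real.sqrt_le_left (by positivity), div_pow, hs3]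
      refine h2.trans (le_of_eq ?_)
      field_simp
    calc _ ≤ (4 * (3 / √(3 * D))) / 2 * (√(3 * D) * (5 / 2)) := by
          gcongr
          · linarith
          · linarith
      _ = 15 := by field_simp; norm_num
      _ ≤ _ := by linarith

theorem norm_sub_conj_sq (z w : ℂ) : ‖z - conj w‖ ^ 2 = ‖z - w‖ ^ 2 + 4 * z.im * w.im := by
  rw [← normSq_eq_norm_sq, ← normSq_eq_norm_sq, normSq_apply, normSq_apply]
  simp; ring

/-- Finite Blaschke product for the half-plane. -/
noncomputable def blaschke {ι : Type*} (s : Finset ι) (w : ι → ℂ) (z : ℂ) : ℂ :=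
  ∏ k ∈ s, (z - w k) / (z - conj (w k))

section Blaschke
variable {ι : Type*} {s : Finset ι} {w : ι → ℂ}

theorem exp_le_norm_blaschke {θ : ℝ} {l : ι → ℝ} (hθ : 0 < θ) (hw : ∀ k ∈ s, 0 < (w k).im)
    (hl : ∀ k ∈ s, θ * (w k).im ≤ l k)
    (hd : ∀ j ∈ s, ∀ k ∈ s, j ≠ k → (w j).re + l j / 2 ≤ (w k).re - l k / 2 ∨
      (w k).re + l k / 2 ≤ (w j).re - l j / 2)
    {z : ℂ} (hz : 0 < z.im) (hzw : ∀ k ∈ s, l k / 4 ≤ ‖z - w k‖) :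
    Real.exp (-(800 / θ)) ≤ ‖blaschke s w z‖ := by
  have hl0 : ∀ k ∈ s, 0 < l k := fun k hk => (mul_pos hθ (hw k hk)).trans_le (hl k hk)
  have hD0 : ∀ k ∈ s, 0 < ‖z - w k‖ := fun k hk => by linarith [hzw k hk, hl0 k hk]
  set a : ι → ℝ := fun k => ((w k).re - l k / 2 - z.re) / z.im with ha
  set b : ι → ℝ := fun k => ((w k).re + l k / 2 - z.re) / z.im with hb
  have hinc := sum_increments_le s a b monotone_slopeFun abs_slopeFun_le
    (fun i hi => by simp only [ha, hb]; gcongr; linarith [hl0 i hi])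
    (fun i hi j hj hij => by
      rcases hd i hi j hj hij with h | h
      · left; simp only [ha, hb]; gcongr
      · right; simp only [ha, hb]; gcongr)
  have hterm : ∀ k ∈ s, Real.log (1 + 4 * z.im * (w k).im / ‖z - w k‖ ^ 2) / 2
      ≤ 400 / θ * (slopeFun (b k) - slopeFun (a k)) := by
    intro k hk
    have hy := hw k hk
    have hD := hD0 k hk
    have h1 := half_log_le (D := ‖z - w k‖ / z.im) (Y := (w k).im / z.im) (by positivity)
      (by positivity) (by
        have h2 := abs_im_le_norm (z - w k)
        rw [sub_im] at h2
        have h3 : 1 - (w k).im / z.im = (z.im - (w k).im) / z.im := by field_simp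
        rw [h3, abs_div, abs_of_pos hz]
        gcongr)
    have h4 : 4 * ((w k).im / z.im) / (‖z - w k‖ / z.im) ^ 2
        = 4 * z.im * (w k).im / ‖z - w k‖ ^ 2 := by field_simp
    rw [h4] at h1
    refine h1.trans ?_
    have hre := abs_re_le_norm (z - w k)
    rw [sub_re, abs_le] at hre
    have h5 := slopeFun_sub_ge (a := a k) (b := b k) (m := 3 * (‖z - w k‖ / z.im))
      (by
        simp only [ha]; rw [abs_div, abs_of_pos hz, ← mul_div_assoc]; gcongr
        rw [abs_le]; constructor <;> linarith [hzw k hk, hl0 k hk])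
      (by
        simp only [hb]; rw [abs_div, abs_of_pos hz, ← mul_div_assoc]; gcongr
        rw [abs_le]; constructor <;> linarith [hzw k hk, hl0 k hk])
      (by simp only [ha, hb]; gcongr; linarith [hl0 k hk]) (by positivity)
    have h6 : b k - a k = l k / z.im := by simp only [ha, hb]; ring
    rw [h6] at h5
    set S := √(3 * (‖z - w k‖ / z.im)) * (1 + 3 * (‖z - w k‖ / z.im)) with hS
    have hSpos : 0 < S := by
      have : 0 < √(3 * (‖z - w k‖ / z.im)) := Real.sqrt_pos.2 (by positivity)
      positivity
    have h7 : l k / z.im / (4 * √(3 * (‖z - w k‖ / z.im)) * (1 + 3 * (‖z - w k‖ / z.im)))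
        = l k / z.im / (4 * S) := by rw [hS]; ring
    rw [h7] at h5
    calc 100 * ((w k).im / z.im) / S = 400 / θ * (θ * (w k).im / z.im / (4 * S)) := by
          field_simp; norm_num
      _ ≤ 400 / θ * (l k / z.im / (4 * S)) := by
          gcongr; exact hl k hk
      _ ≤ _ := by gcongr
  have hsum : ∑ k ∈ s, Real.log (1 + 4 * z.im * (w k).im / ‖z - w k‖ ^ 2) / 2 ≤ 800 / θ := by
    refine (Finset.sum_le_sum hterm).trans ?_
    rw [← Finset.mul_sum]
    calc _ ≤ 400 / θ * (2 * 1) := by gcongr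
      _ = _ := by ring
  have hnorm : ∀ k ∈ s, ‖(z - w k) / (z - conj (w k))‖
      = Real.exp (-(Real.log (1 + 4 * z.im * (w k).im / ‖z - w k‖ ^ 2) / 2)) := by
    intro k hk
    have hy := hw k hk
    have hD := hD0 k hk
    have h1 := norm_sub_conj_sq z (w k)
    have h2 : 1 + 4 * z.im * (w k).im / ‖z - w k‖ ^ 2 = (‖z - conj (w k)‖ / ‖z - w k‖) ^ 2 := by
      rw [div_pow, h1]; field_simp
    have h3 : 0 < ‖z - conj (w k)‖ := norm_pos_iff.2 (sub_conj_ne_zero (by linarith))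
    rw [h2, Real.log_pow, norm_div, Nat.cast_ofNat, mul_div_cancel_left₀ _ two_ne_zero, Real.exp_neg,
      Real.exp_log (by positivity), inv_div]
  rw [blaschke, norm_prod, Finset.prod_congr rfl hnorm, ← Real.exp_sum, Finset.sum_neg_distrib]
  gcongr

end Blaschke
end

section
open Complex Set Metric Filter Topology Bornology
open scoped Real ComplexConjugate

section Blaschke
variable {ι : Type*} {s : Finset ι} {w : ι → ℂ}

theorem norm_blaschke_ofReal {z : ℂ} (hw : ∀ k ∈ s, 0 < (w k).im) (hz : z.im = 0) :
    ‖blaschke s w z‖ = 1 := by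
  rw [blaschke, norm_prod]
  refine Finset.prod_eq_one fun k hk => ?_
  have h1 := norm_sub_conj_sq z (w k)
  rw [hz] at h1
  have h2 : ‖z - conj (w k)‖ = ‖z - w k‖ := by
    rw [← sq_eq_sq₀ (norm_nonneg _) (norm_nonneg _)]; linarith
  have h3 : 0 < ‖z - conj (w k)‖ := norm_pos_iff.2 (sub_conj_ne_zero (by rw [hz]; linarith [hw k hk]))
  rw [norm_div, ← h2, div_self h3.ne']

theorem tendsto_blaschke : Tendsto (blaschke s w) (cobounded ℂ) (𝓝 1) := by
  have : Tendsto (fun z => ∏ k ∈ s, (z - w k) / (z - conj (w k))) (cobounded ℂ)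
      (𝓝 (∏ k ∈ s, 1)) := by
    refine tendsto_finsetProd s fun k _ => ?_
    have h1 : Tendsto (fun z : ℂ => z - conj (w k)) (cobounded ℂ) (cobounded ℂ) := by
      have := tendsto_add_const_cobounded (-conj (w k))
      simp only [sub_eq_add_neg]; exact this
    have h2 := (tendsto_inv₀_cobounded.comp h1).const_mul (conj (w k) - w k) |>.const_add 1
    rw [mul_zero, add_zero] at h2
    refine h2.congr' ?_
    have h3 : ∀ᶠ z in cobounded ℂ, z ≠ conj (w k) := by
      refine isCobounded_def.1 (isBounded_compl_iff.1 ?_)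
      refine (isBounded_singleton (x := conj (w k))).subset fun z hz => ?_
      simpa using hz
    filter_upwards [h3] with z hz
    have : z - conj (w k) ≠ 0 := sub_ne_zero.2 hz
    simp only [Function.comp]
    field_simp
    ring
  rw [Finset.prod_const_one] at this
  exact this

theorem norm_pow_le_norm_blaschke {θ η e : ℝ} {l : ι → ℝ} {g : ℂ → ℂ} {n : ℕ} (hθ : 0 < θ)
    (hη : 0 < η) (hw : ∀ k ∈ s, 0 < (w k).im) (hl : ∀ k ∈ s, θ * (w k).im ≤ l k)
    (hd : ∀ j ∈ s, ∀ k ∈ s, j ≠ k → (w j).re + l j / 2 ≤ (w k).re - l k / 2 ∨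
      (w k).re + l k / 2 ≤ (w j).re - l j / 2)
    (hg : DifferentiableOn ℂ g {z | -η < z.im}) (hg1 : ∀ z, -η < z.im → ‖g z‖ ≤ 1)
    (he : ∀ k ∈ s, ∀ z ∈ closedBall (w k) (l k / 4), -η < z.im → ‖g z‖ ≤ e)
    (hn : e ^ n ≤ Real.exp (-(800 / θ))) {p : ℂ} (hp : 0 < p.im)
    (hpw : ∀ k ∈ s, l k / 4 < ‖p - w k‖) :
    ‖g p‖ ^ n ≤ ‖blaschke s w p‖ := by
  have hl0 : ∀ k ∈ s, 0 < l k := fun k hk => (mul_pos hθ (hw k hk)).trans_le (hl k hk)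
  have hBne : ∀ z : ℂ, 0 ≤ z.im → (∀ k ∈ s, l k / 4 ≤ ‖z - w k‖) → blaschke s w z ≠ 0 := by
    intro z hz hzk
    refine Finset.prod_ne_zero_iff.2 fun k hk => div_ne_zero ?_ (sub_conj_ne_zero ?_)
    · exact norm_pos_iff.1 (by linarith [hzk k hk, hl0 k hk])
    · linarith [hw k hk]
  have hB0 : 0 < ‖blaschke s w p‖ := norm_pos_iff.2 (hBne p hp.le fun k hk => (hpw k hk).le)
  suffices h : ∀ c : ℝ, 1 < c → ‖g p ^ n / blaschke s w p‖ ≤ c by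
    have h1 : ‖g p ^ n / blaschke s w p‖ ≤ 1 := le_of_forall_gt_imp_ge_of_dense h
    rwa [norm_div, norm_pow, div_le_one hB0] at h1
  intro c hc
  have hev : ∀ᶠ z in cobounded ℂ, c⁻¹ < ‖blaschke s w z‖ := by
    have := (tendsto_blaschke (s := s) (w := w)).norm
    rw [norm_one] at this
    exact this.eventually_const_lt (inv_lt_one_of_one_lt₀ hc)
  obtain ⟨R, hR⟩ : ∃ R : ℝ, ∀ z : ℂ, R ≤ ‖z‖ → c⁻¹ < ‖blaschke s w z‖ := by
    rw [← comap_norm_atTop] at hev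
    obtain ⟨t, ht, hts⟩ := hev
    obtain ⟨R, hR⟩ := mem_atTop_sets.1 ht
    exact ⟨R, fun z hz => hts (hR _ hz)⟩
  set R' := max R (‖p‖ + 1)
  set U : Set ℂ := {z | 0 < z.im} ∩ ball 0 R' ∩ ⋂ k ∈ s, {z | l k / 4 < ‖z - w k‖} with hU
  have hUo : IsOpen U := by
    refine ((isOpen_lt continuous_const continuous_im).inter isOpen_ball).inter ?_
    exact isOpen_biInter_finset fun k _ => isOpen_lt continuous_const (by fun_prop)
  have hUcl : closure U ⊆ {z | 0 ≤ z.im ∧ ∀ k ∈ s, l k / 4 ≤ ‖z - w k‖} := by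
    have hcl : IsClosed {z : ℂ | 0 ≤ z.im ∧ ∀ k ∈ s, l k / 4 ≤ ‖z - w k‖} := by
      have : {z : ℂ | 0 ≤ z.im ∧ ∀ k ∈ s, l k / 4 ≤ ‖z - w k‖}
          = {z | 0 ≤ z.im} ∩ ⋂ k ∈ s, {z | l k / 4 ≤ ‖z - w k‖} := by ext z; simp
      rw [this]
      refine (isClosed_le continuous_const continuous_im).inter ?_
      exact isClosed_biInter fun k _ => isClosed_le continuous_const (by fun_prop)
    refine closure_minimal (fun z hz => ⟨(mem_ofPred.1 hz.1.1).le, fun k hk => ?_⟩) hcl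
    exact (mem_ofPred.1 (mem_iInter₂.1 hz.2 k hk)).le
  have hpU : p ∈ U := by
    refine ⟨⟨hp, ?_⟩, mem_iInter₂.2 fun k hk => hpw k hk⟩
    rw [mem_ball_zero_iff]
    exact (lt_add_one _).trans_le (le_max_right _ _)
  have hdiff : ∀ z ∈ closure U, DifferentiableAt ℂ (fun z => g z ^ n / blaschke s w z) z := by
    intro z hz
    obtain ⟨hz0, hzk⟩ := hUcl hz
    have h1 : DifferentiableAt ℂ g z :=
      hg.differentiableAt ((isOpen_lt continuous_const continuous_im).mem_nhds
        (show -η < z.im by linarith))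
    have h2 : DifferentiableAt ℂ (blaschke s w) z := by
      unfold blaschke
      refine DifferentiableAt.fun_finsetProd fun k hk => ?_
      have := sub_conj_ne_zero (z := z) (w := w k) (by linarith [hw k hk])
      fun_prop (disch := assumption)
    exact (h1.pow n).div h2 (hBne z hz0 hzk)
  have hdc : DiffContOnCl ℂ (fun z => g z ^ n / blaschke s w z) U :=
    DifferentiableOn.diffContOnCl fun z hz => (hdiff z hz).differentiableWithinAt
  have hUb : IsBounded U := isBounded_ball.subset fun z hz => hz.1.2
  refine norm_le_of_forall_mem_frontier_norm_le hUb hdc (fun z hz => ?_) (subset_closure hpU)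
  have hzc := frontier_subset_closure hz
  obtain ⟨hz0, hzk⟩ := hUcl hzc
  have hBz : 0 < ‖blaschke s w z‖ := norm_pos_iff.2 (hBne z hz0 hzk)
  have hgz := hg1 z (by linarith)
  rw [norm_div, norm_pow, div_le_iff₀ hBz]
  have hgn : ‖g z‖ ^ n ≤ 1 := pow_le_one₀ (norm_nonneg _) hgz
  rcases hz0.eq_or_lt with h0 | h0
  · rw [norm_blaschke_ofReal hw h0.symm]; linarith
  have hzU : z ∉ U := by
    rw [frontier, hUo.interior_eq] at hz; exact hz.2
  by_cases hzR : R' ≤ ‖z‖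
  · have h1 := hR z ((le_max_left _ _).trans hzR)
    have h2 : 1 ≤ c * ‖blaschke s w z‖ := by
      have h3 : c * c⁻¹ = 1 := mul_inv_cancel₀ (by linarith)
      nlinarith
    linarith
  · obtain ⟨k, hk, hkz⟩ : ∃ k ∈ s, ‖z - w k‖ ≤ l k / 4 := by
      by_contra! hcon
      exact hzU ⟨⟨h0, by rwa [mem_ball_zero_iff, ← not_le]⟩, mem_iInter₂.2 fun k hk => hcon k hk⟩
    have h1 := he k hk z (by rwa [mem_closedBall, dist_eq_norm]) (by linarith)
    have h2 := exp_le_norm_blaschke hθ hw hl hd h0 hzk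
    calc ‖g z‖ ^ n ≤ e ^ n := by gcongr
      _ ≤ 1 * ‖blaschke s w z‖ := by linarith
      _ ≤ _ := by gcongr

/-- **Hall's lemma** (in a form suited to dyadic cells): the part of the real line lying below
small hyperbolic discs on which `g` is small has small harmonic measure. -/
theorem sum_length_le {θ η e γ : ℝ} {l : ι → ℝ} {g : ℂ → ℂ} (hθ : 0 < θ)
    (hη : 0 < η) (hw : ∀ k ∈ s, 0 < (w k).im) (hl : ∀ k ∈ s, θ * (w k).im ≤ l k)
    (hl2 : ∀ k ∈ s, l k ≤ 2 * θ * (w k).im)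
    (hd : ∀ j ∈ s, ∀ k ∈ s, j ≠ k → (w j).re + l j / 2 ≤ (w k).re - l k / 2 ∨
      (w k).re + l k / 2 ≤ (w j).re - l j / 2)
    (hg : DifferentiableOn ℂ g {z | -η < z.im}) (hg1 : ∀ z, -η < z.im → ‖g z‖ ≤ 1)
    (he : ∀ k ∈ s, ∀ z ∈ closedBall (w k) (l k / 4), -η < z.im → ‖g z‖ ≤ e) (he0 : 0 < e) (he1 : e < 1)
    {p : ℂ} (hp : 0 < p.im) (hpw : ∀ k ∈ s, l k / 4 < ‖p - w k‖) (hγ : 0 < γ) (hγp : γ ≤ ‖g p‖) :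
    ∑ k ∈ s, l k * (p.im / ‖p - conj (w k)‖ ^ 2)
      ≤ (800 / Real.log (1 / e) + θ) * Real.log (1 / γ) := by
  set L := Real.log (1 / e) with hL
  have hL0 : 0 < L := Real.log_pos (by rw [one_div]; exact (one_lt_inv₀ he0).2 he1)
  set n := ⌈800 / θ / L⌉₊ with hn
  have hn1 : 800 / θ / L ≤ n := Nat.le_ceil _
  have hn2 : (n : ℝ) < 800 / θ / L + 1 := Nat.ceil_lt_add_one (by positivity)
  have hen : e ^ n ≤ Real.exp (-(800 / θ)) := by
    have h1 : e = Real.exp (-L) := by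
      rw [hL, one_div, Real.log_inv, neg_neg, Real.exp_log he0]
    rw [h1, ← Real.exp_nat_mul]
    gcongr
    rw [div_le_iff₀ hL0] at hn1
    linarith
  have hmain := norm_pow_le_norm_blaschke hθ hη hw hl hd hg hg1 he hen hp hpw
  have hl0 : ∀ k ∈ s, 0 < l k := fun k hk => (mul_pos hθ (hw k hk)).trans_le (hl k hk)
  have hterm : ∀ k ∈ s, l k * (p.im / ‖p - conj (w k)‖ ^ 2)
      ≤ θ * -Real.log ‖(p - w k) / (p - conj (w k))‖ := by
    intro k hk
    have hy := hw k hk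
    have hc : 0 < ‖p - conj (w k)‖ := norm_pos_iff.2 (sub_conj_ne_zero (by linarith))
    have hD : 0 < ‖p - w k‖ := by linarith [hl0 k hk, hpw k hk]
    have h1 := norm_sub_conj_sq p (w k)
    have h2 : Real.log (‖(p - w k) / (p - conj (w k))‖ ^ 2)
        ≤ ‖(p - w k) / (p - conj (w k))‖ ^ 2 - 1 :=
      Real.log_le_sub_one_of_pos (by rw [norm_div]; positivity)
    rw [Real.log_pow] at h2
    have h3 : ‖(p - w k) / (p - conj (w k))‖ ^ 2 - 1
        = -(4 * p.im * (w k).im / ‖p - conj (w k)‖ ^ 2) := by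
      rw [norm_div, div_pow]; field_simp; linarith
    rw [h3] at h2
    push_cast at h2
    calc _ ≤ 2 * θ * (w k).im * (p.im / ‖p - conj (w k)‖ ^ 2) := by gcongr; exact hl2 k hk
      _ = θ * ((4 * p.im * (w k).im / ‖p - conj (w k)‖ ^ 2) / 2) := by ring
      _ ≤ _ := by gcongr; linarith
  refine (Finset.sum_le_sum hterm).trans ?_
  rw [← Finset.mul_sum, Finset.sum_neg_distrib, ← Real.log_prod, ← norm_prod]
  swap
  · intro k hk
    have hy := hw k hk
    have hc : 0 < ‖p - conj (w k)‖ := norm_pos_iff.2 (sub_conj_ne_zero (by linarith))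
    have hD : 0 < ‖p - w k‖ := by linarith [hl0 k hk, hpw k hk]
    rw [norm_div]; positivity
  change θ * -Real.log ‖blaschke s w p‖ ≤ _
  have hB : n * Real.log γ ≤ Real.log ‖blaschke s w p‖ := by
    rw [← Real.log_pow]
    exact Real.log_le_log (by positivity) (le_trans (by gcongr) hmain)
  have hγ1 : γ ≤ 1 := hγp.trans (hg1 p (by linarith))
  have hlog : 0 ≤ Real.log (1 / γ) := Real.log_nonneg (by rw [one_div]; exact (one_le_inv₀ hγ).2 hγ1)
  have hlog' : Real.log (1 / γ) = -Real.log γ := by rw [one_div, Real.log_inv]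
  calc θ * -Real.log ‖blaschke s w p‖ ≤ θ * (n * Real.log (1 / γ)) := by
        gcongr; rw [hlog']; linarith
    _ ≤ θ * ((800 / θ / L + 1) * Real.log (1 / γ)) := by gcongr
    _ = _ := by field_simp

end Blaschke
end

section
open Set

/-- Width of the cells in row `r` of the grid with `2 ^ l` rows per generation. -/
noncomputable def cellWidth (l r : ℕ) : ℝ := (1 / 2) ^ (r / 2 ^ l + l + 1)

/-- Height of the top of row `r`. -/
noncomputable def rowTop (l r : ℕ) : ℝ :=
  (1 / 2) ^ (r / 2 ^ l) * (1 - (r % 2 ^ l : ℕ) / 2 ^ (l + 1))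

/-- Index of the cell of row `r` lying above the cell `i` of row `r + 1`. -/
def parentCell (l r : ℕ) (i : ℤ) : ℤ := if (r + 1) % 2 ^ l = 0 then i / 2 else i

/-- Index of the cell of row `r` whose base contains `x`. -/
noncomputable def cellAt (l r : ℕ) (x : ℝ) : ℤ := ⌊x / cellWidth l r⌋

variable {l r : ℕ} {i j : ℤ}

theorem cellWidth_pos (l r : ℕ) : 0 < cellWidth l r := by unfold cellWidth; positivity

theorem succ_div_mod_cases (l r : ℕ) :
    ((r + 1) % 2 ^ l ≠ 0 ∧ (r + 1) / 2 ^ l = r / 2 ^ l ∧ (r + 1) % 2 ^ l = r % 2 ^ l + 1) ∨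
    ((r + 1) % 2 ^ l = 0 ∧ (r + 1) / 2 ^ l = r / 2 ^ l + 1 ∧ r % 2 ^ l + 1 = 2 ^ l) := by
  have hp : 0 < 2 ^ l := by positivity
  have h1 := Nat.div_add_mod r (2 ^ l)
  have h2 := Nat.mod_lt r hp
  rcases lt_or_eq_of_le (Nat.succ_le_of_lt h2) with h | h
  · left
    have e : r + 1 = (r % 2 ^ l + 1) + 2 ^ l * (r / 2 ^ l) := by omega
    have h3 : (r + 1) % 2 ^ l = r % 2 ^ l + 1 := by
      rw [e, Nat.add_mul_mod_self_left, Nat.mod_eq_of_lt h]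
    have h4 : (r + 1) / 2 ^ l = r / 2 ^ l := by
      rw [e, Nat.add_mul_div_left _ _ hp, Nat.div_eq_of_lt h, zero_add]
    exact ⟨by omega, h4, h3⟩
  · right
    have e : r + 1 = 0 + 2 ^ l * (r / 2 ^ l + 1) := by rw [mul_add]; omega
    refine ⟨by rw [e, Nat.add_mul_mod_self_left, Nat.zero_mod], ?_, h⟩
    rw [e, Nat.add_mul_div_left _ _ hp, Nat.zero_div, zero_add]

theorem parentCell_cases (l r : ℕ) :
    (cellWidth l r = cellWidth l (r + 1) ∧ ∀ i, parentCell l r i = i) ∨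
    (cellWidth l r = 2 * cellWidth l (r + 1) ∧ ∀ i, parentCell l r i = i / 2) := by
  unfold cellWidth parentCell
  rcases succ_div_mod_cases l r with ⟨h1, h2, -⟩ | ⟨h1, h2, -⟩
  · left; simp [h1, h2]
  · right
    refine ⟨?_, fun i => by simp [h1]⟩
    rw [h2]; ring

theorem cellWidth_succ_le : cellWidth l (r + 1) ≤ cellWidth l r := by
  rcases parentCell_cases l r with h | h <;> linarith [h.1, cellWidth_pos l (r + 1)]

theorem cellWidth_le_two_mul_succ : cellWidth l r ≤ 2 * cellWidth l (r + 1) := by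
  rcases parentCell_cases l r with h | h <;> linarith [h.1, cellWidth_pos l (r + 1)]

theorem rowTop_sub_succ (l r : ℕ) : rowTop l r - rowTop l (r + 1) = cellWidth l r := by
  unfold rowTop cellWidth
  rcases succ_div_mod_cases l r with ⟨-, h2, h3⟩ | ⟨h1, h2, h3⟩
  · rw [h2, h3]; push_cast
    rw [add_assoc, pow_add (1 / 2 : ℝ) _ (l + 1), one_div_pow (n := l + 1)]; ring
  · rw [h2, h1]
    have : ((r % 2 ^ l : ℕ) : ℝ) = 2 ^ l - 1 := by
      rw [eq_sub_iff_add_eq]; exact_mod_cast h3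
    rw [this, add_assoc, pow_add (1 / 2 : ℝ) _ (l + 1), one_div_pow (n := l + 1), pow_succ (1 / 2 : ℝ)]
    rw [pow_succ]
    push_cast
    field_simp
    ring

theorem rowTop_le_gen (l r : ℕ) : rowTop l r ≤ (1 / 2) ^ (r / 2 ^ l) := by
  unfold rowTop
  refine mul_le_of_le_one_right (by positivity) ?_
  have : (0 : ℝ) ≤ (r % 2 ^ l : ℕ) / 2 ^ (l + 1) := by positivity
  linarith

theorem half_gen_le (l r : ℕ) :
    (1 / 2) ^ (r / 2 ^ l) * (1 / 2) + cellWidth l r ≤ rowTop l r := by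
  unfold rowTop cellWidth
  have h : ((r % 2 ^ l : ℕ) : ℝ) ≤ 2 ^ l - 1 := by
    have := Nat.succ_le_of_lt (Nat.mod_lt r (show 0 < 2 ^ l by positivity))
    rw [le_sub_iff_add_le]; exact_mod_cast this
  rw [add_assoc, pow_add (1 / 2 : ℝ) _ (l + 1), ← mul_add]
  gcongr
  rw [one_div_pow (n := l + 1)]
  calc (1 / 2 : ℝ) + 1 / 2 ^ (l + 1) = 1 - (2 ^ l - 1) / 2 ^ (l + 1) := by
        rw [pow_succ]; field_simp; ring
    _ ≤ _ := by gcongr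

theorem cellWidth_eq (l r : ℕ) : cellWidth l r = (1 / 2) ^ (r / 2 ^ l) * (1 / 2) ^ (l + 1) := by
  rw [cellWidth, add_assoc, pow_add]

theorem rowTop_pos (l r : ℕ) : 0 < rowTop l r := by
  have := half_gen_le l r
  have := cellWidth_pos l r
  have : (0 : ℝ) < (1 / 2) ^ (r / 2 ^ l) * (1 / 2) := by positivity
  linarith

theorem mul_rowTop_le_cellWidth (l r : ℕ) : (1 / 2) ^ (l + 1) * rowTop l r ≤ cellWidth l r := by
  rw [cellWidth_eq, mul_comm]
  gcongr
  exact rowTop_le_gen l r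

theorem half_gen_le_succ (l r : ℕ) : (1 / 2) ^ (r / 2 ^ l) * (1 / 2) ≤ rowTop l (r + 1) := by
  linarith [half_gen_le l r, rowTop_sub_succ l r]

theorem cellWidth_le_mul_rowTop_succ (l r : ℕ) :
    cellWidth l r ≤ 2 * (1 / 2) ^ (l + 1) * rowTop l (r + 1) := by
  have := half_gen_le_succ l r
  rw [cellWidth_eq]
  have h : (0 : ℝ) < (1 / 2) ^ (l + 1) := by positivity
  nlinarith

theorem cellWidth_le_rowTop_succ (l r : ℕ) : cellWidth l r ≤ rowTop l (r + 1) := by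
  refine (cellWidth_le_mul_rowTop_succ l r).trans (mul_le_of_le_one_left (rowTop_pos _ _).le ?_)
  rw [pow_succ]
  have : (1 / 2 : ℝ) ^ l ≤ 1 := pow_le_one₀ (by norm_num) (by norm_num)
  linarith

theorem rowTop_antitone (l : ℕ) : Antitone (rowTop l) :=
  antitone_nat_of_succ_le fun r => by linarith [rowTop_sub_succ l r, cellWidth_pos l r]

theorem cellWidth_antitone (l : ℕ) : Antitone (cellWidth l) :=
  antitone_nat_of_succ_le fun _ => cellWidth_succ_le

theorem rowTop_add_mul (l r m : ℕ) : rowTop l (r + 2 ^ l * m) = (1 / 2) ^ m * rowTop l r := by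
  unfold rowTop
  rw [Nat.add_mul_mod_self_left, Nat.add_mul_div_left _ _ (by positivity), pow_add]
  ring

theorem sum_cellWidth (l a : ℕ) {b : ℕ} (h : a ≤ b) :
    ∑ r ∈ Finset.Ico a b, cellWidth l r = rowTop l a - rowTop l b := by
  induction b, h using Nat.le_induction with
  | base => simp
  | succ b hb ih => rw [Finset.sum_Ico_succ_top hb, ih, ← rowTop_sub_succ]; ring

theorem sum_cellWidth_le (l a : ℕ) {b : ℕ} :
    ∑ r ∈ Finset.Ico a b, cellWidth l r ≤ rowTop l a := by
  rcases le_or_gt a b with h | h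
  · rw [sum_cellWidth l a h]; linarith [rowTop_pos l b]
  · rw [Finset.Ico_eq_empty (by omega)]; simpa using (rowTop_pos l a).le

theorem parentCell_mono (h : i ≤ j) : parentCell l r i ≤ parentCell l r j := by
  unfold parentCell; split_ifs <;> omega

theorem parentCell_sub_one : parentCell l r (i - 1) = parentCell l r i ∨
    parentCell l r (i - 1) = parentCell l r i - 1 := by
  unfold parentCell; split_ifs <;> omega

theorem parentCell_mul_of_ne (h : parentCell l r (i - 1) ≠ parentCell l r i) :
    (parentCell l r i : ℝ) * cellWidth l r = i * cellWidth l (r + 1) := by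
  rcases parentCell_cases l r with ⟨h1, h2⟩ | ⟨h1, h2⟩
  · rw [h1, h2]
  · rw [h2, h2] at h
    rw [h1, h2]
    have : i = 2 * (i / 2) := by omega
    have : (i : ℝ) = 2 * ((i / 2 : ℤ) : ℝ) := by exact_mod_cast this
    rw [this]; ring

theorem parentCell_cellAt (l r : ℕ) (x : ℝ) :
    parentCell l r (cellAt l (r + 1) x) = cellAt l r x := by
  unfold cellAt
  rcases parentCell_cases l r with ⟨h1, h2⟩ | ⟨h1, h2⟩
  · rw [h2, h1]
  · rw [h2, h1]
    have := Int.floor_div_natCast (x / cellWidth l (r + 1)) 2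
    rw [mul_comm, ← div_div]
    exact_mod_cast this.symm

theorem cellAt_mul (l r : ℕ) (i : ℤ) : cellAt l r (i * cellWidth l r) = i := by
  rw [cellAt, mul_div_cancel_right₀ _ (cellWidth_pos l r).ne', Int.floor_intCast]

theorem cellAt_eq_iff {x : ℝ} : cellAt l r x = i ↔
    i * cellWidth l r ≤ x ∧ x < (i + 1) * cellWidth l r := by
  rw [cellAt, Int.floor_eq_iff, le_div_iff₀ (cellWidth_pos l r), div_lt_iff₀ (cellWidth_pos l r)]

theorem cellAt_congr {x y : ℝ} {r' : ℕ} (h : cellAt l r x = cellAt l r y) (hr : r' ≤ r) :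
    cellAt l r' x = cellAt l r' y := by
  induction r, hr using Nat.le_induction with
  | base => exact h
  | succ r hr ih => exact ih (by rw [← parentCell_cellAt, h, parentCell_cellAt])

/-- Separated points in an interval are few. -/
theorem card_le_of_separated {ι : Type*} (s : Finset ι) (x : ι → ℝ) {A B d : ℝ} (hd : 0 < d)
    (hAB : A ≤ B)
    (hx : ∀ i ∈ s, x i ∈ Icc A B) (hs : ∀ i ∈ s, ∀ j ∈ s, i ≠ j → d ≤ |x i - x j|) :
    (s.card : ℝ) ≤ (B - A) / d + 1 := by
  have hmaps : ∀ i ∈ s, ⌊(x i - A) / d⌋ ∈ Finset.Icc (0 : ℤ) ⌊(B - A) / d⌋ := by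
    intro i hi
    have := hx i hi
    rw [Finset.mem_Icc]
    refine ⟨Int.floor_nonneg.2 (div_nonneg (by linarith [this.1]) hd.le), Int.floor_mono ?_⟩
    gcongr
    exact this.2
  have hinj : Set.InjOn (fun i => ⌊(x i - A) / d⌋) (s : Set ι) := by
    intro i hi j hj hij
    by_contra hne
    have h1 := Int.abs_sub_lt_one_of_floor_eq_floor hij
    have h2 := hs i hi j hj hne
    rw [← sub_div, abs_div, abs_of_pos hd, div_lt_one hd] at h1
    rw [sub_sub_sub_cancel_right] at h1
    linarith
  have h := Finset.card_le_card_of_injOn _ hmaps hinj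
  have h0 : 0 ≤ ⌊(B - A) / d⌋ := Int.floor_nonneg.2 (div_nonneg (by linarith) hd.le)
  rw [Int.card_Icc] at h
  have h3 : (s.card : ℤ) ≤ ⌊(B - A) / d⌋ + 1 := by omega
  have h4 : (s.card : ℝ) ≤ ⌊(B - A) / d⌋ + 1 := by exact_mod_cast h3
  linarith [Int.floor_le ((B - A) / d)]

/-- Pairwise disjoint intervals inside an interval have small total length. -/
theorem sum_length_le_of_disjoint {ι : Type*} (s : Finset ι) (x w : ι → ℝ) {A B : ℝ} (hAB : A ≤ B)
    (hw : ∀ i ∈ s, 0 ≤ w i)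
    (hx : ∀ i ∈ s, A ≤ x i ∧ x i + w i ≤ B)
    (hs : ∀ i ∈ s, ∀ j ∈ s, i ≠ j → Disjoint (Ico (x i) (x i + w i)) (Ico (x j) (x j + w j))) :
    ∑ i ∈ s, w i ≤ B - A := by
  have h1 : MeasureTheory.volume (⋃ i ∈ s, Ico (x i) (x i + w i)) =
      ∑ i ∈ s, MeasureTheory.volume (Ico (x i) (x i + w i)) :=
    MeasureTheory.measure_biUnion_finset (fun i hi j hj hij => hs i hi j hj hij)
      fun i _ => measurableSet_Ico
  have h2 : MeasureTheory.volume (⋃ i ∈ s, Ico (x i) (x i + w i)) ≤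
      MeasureTheory.volume (Ico A B) :=
    MeasureTheory.measure_mono (iUnion₂_subset fun i hi => Ico_subset_Ico (hx i hi).1 (hx i hi).2)
  rw [h1] at h2
  simp only [Real.volume_Ico, add_sub_cancel_left] at h2
  rw [← ENNReal.ofReal_sum_of_nonneg hw] at h2
  exact (ENNReal.ofReal_le_ofReal_iff (by linarith)).1 h2

end

section
open Set
open scoped Classical

/-- Index of the dyadic interval of generation `n` that contains `x`. -/
noncomputable def dyadicAt (n : ℕ) (x : ℝ) : ℤ := ⌊x * 2 ^ n⌋

/-- Left end of a cell. -/
noncomputable def cellPos (l : ℕ) (q : ℕ × ℤ) : ℝ := q.2 * cellWidth l q.1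

/-- The finite set of cells under consideration. -/
noncomputable def gridCells (l P : ℕ) : Finset (ℕ × ℤ) :=
  Finset.range (P + 1) ×ˢ Finset.Icc 0 (2 ^ (P + l + 1))

/-- The region obtained by following the columns downwards: it is entered at `bad` cells and left
at `big` cells. -/
def IsInside (bad big : ℕ → ℤ → Prop) (l : ℕ) : ℕ → ℤ → Prop
  | 0, _ => False
  | r + 1, i => (IsInside bad big l r (parentCell l r i) ∧ ¬ big (r + 1) i) ∨
      (¬ IsInside bad big l r (parentCell l r i) ∧ bad (r + 1) i)

/-- Cells at which a column enters or leaves the inside region. -/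
def IsSwitch (bad big : ℕ → ℤ → Prop) (l : ℕ) : ℕ → ℤ → Prop
  | 0, _ => False
  | r + 1, i => ¬ (IsInside bad big l (r + 1) i ↔ IsInside bad big l r (parentCell l r i))

variable {l r n m : ℕ} {i j : ℤ} {x y : ℝ}

theorem dyadicAt_eq_iff : dyadicAt n x = j ↔ j * (1 / 2) ^ n ≤ x ∧ x < (j + 1) * (1 / 2) ^ n := by
  have : (0 : ℝ) < 2 ^ n := by positivity
  rw [dyadicAt, Int.floor_eq_iff, one_div_pow, mul_one_div, mul_one_div, div_le_iff₀ this,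
    lt_div_iff₀ this]

theorem cellAt_eq_dyadicAt : cellAt l r x = dyadicAt (r / 2 ^ l + l + 1) x := by
  rw [cellAt, dyadicAt, cellWidth, one_div_pow, div_div_eq_mul_div, div_one]

theorem dyadicAt_congr (h : dyadicAt m x = dyadicAt m y) (hn : n ≤ m) :
    dyadicAt n x = dyadicAt n y := by
  obtain ⟨k, rfl⟩ := Nat.exists_eq_add_of_le hn
  have key : ∀ x : ℝ, dyadicAt n x = dyadicAt (n + k) x / (2 ^ k : ℕ) := by
    intro x
    rw [dyadicAt, dyadicAt, ← Int.floor_div_natCast]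
    congr 1
    push_cast
    rw [pow_add]
    field_simp
  rw [key, key, h]

theorem cellAt_cellPos (q : ℕ × ℤ) : cellAt l q.1 (cellPos l q) = q.2 := cellAt_mul _ _ _

theorem mem_Ico_cell {q : ℕ × ℤ} : x ∈ Ico (cellPos l q) (cellPos l q + cellWidth l q.1) ↔
    cellAt l q.1 x = q.2 := by
  rw [cellAt_eq_iff, mem_Ico, cellPos, add_mul, one_mul]

theorem disjoint_cells {q p : ℕ × ℤ} (h : q.1 ≤ p.1) (hne : cellAt l q.1 (cellPos l p) ≠ q.2) :
    Disjoint (Ico (cellPos l q) (cellPos l q + cellWidth l q.1))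
      (Ico (cellPos l p) (cellPos l p + cellWidth l p.1)) := by
  rw [Set.disjoint_left]
  intro x hx hx'
  rw [mem_Ico_cell] at hx hx'
  exact hne (by rw [← hx]; exact cellAt_congr (by rw [hx', cellAt_cellPos]) h)

theorem cell_le_dyadic {q : ℕ × ℤ} (h : n ≤ q.1 / 2 ^ l + l + 1)
    (hj : dyadicAt n (cellPos l q) = j) :
    j * (1 / 2) ^ n ≤ cellPos l q ∧ cellPos l q + cellWidth l q.1 ≤ (j + 1) * (1 / 2) ^ n := by
  refine ⟨(dyadicAt_eq_iff.1 hj).1, ?_⟩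
  refine le_of_forall_lt_imp_le_of_dense fun x hx => ?_
  rcases lt_or_ge x (cellPos l q) with hx' | hx'
  · exact hx'.le.trans (dyadicAt_eq_iff.1 hj).2.le
  · have h1 : cellAt l q.1 x = cellAt l q.1 (cellPos l q) := by
      rw [cellAt_cellPos]; exact mem_Ico_cell.1 ⟨hx', hx⟩
    rw [cellAt_eq_dyadicAt, cellAt_eq_dyadicAt] at h1
    have h2 := dyadicAt_congr h1 h
    rw [hj] at h2
    exact (dyadicAt_eq_iff.1 h2).2.le

theorem sum_union_le_add {ι : Type*} [DecidableEq ι] (A B : Finset ι) {w : ι → ℝ} (hw : ∀ i, 0 ≤ w i) :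
    ∑ q ∈ A ∪ B, w q ≤ ∑ q ∈ A, w q + ∑ q ∈ B, w q := by
  rw [← Finset.sum_union_inter]
  have : 0 ≤ ∑ q ∈ A ∩ B, w q := Finset.sum_nonneg fun _ _ => hw _
  linarith

theorem sum_biUnion_le_sum {ι κ : Type*} [DecidableEq ι] (F : Finset κ) (D : κ → Finset ι) {w : ι → ℝ}
    (hw : ∀ i, 0 ≤ w i) : ∑ q ∈ F.biUnion D, w q ≤ ∑ f ∈ F, ∑ q ∈ D f, w q := by
  induction F using Finset.induction_on with
  | empty => simp
  | insert a F ha ih =>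
    rw [Finset.biUnion_insert, Finset.sum_insert ha]
    linarith [sum_union_le_add (D a) (F.biUnion D) hw]

theorem sum_le_of_cover {ι κ : Type*} {s A : Finset ι} {F : Finset κ} {D : κ → Finset ι} {w : ι → ℝ}
    (hw : ∀ i, 0 ≤ w i) (h : ∀ q ∈ s, q ∈ A ∨ ∃ f ∈ F, q ∈ D f) :
    ∑ q ∈ s, w q ≤ ∑ q ∈ A, w q + ∑ f ∈ F, ∑ q ∈ D f, w q := by
  have h1 : s ⊆ A ∪ F.biUnion D := by
    intro q hq
    simpa using h q hq
  linarith [Finset.sum_le_sum_of_subset_of_nonneg h1 fun i _ _ => hw i,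
    sum_union_le_add A (F.biUnion D) hw, sum_biUnion_le_sum F D hw]

section Column
variable {bad big : ℕ → ℤ → Prop}

theorem isInside_succ_cellAt : IsInside bad big l (r + 1) (cellAt l (r + 1) x) ↔
    (IsInside bad big l r (cellAt l r x) ∧ ¬ big (r + 1) (cellAt l (r + 1) x)) ∨
      (¬ IsInside bad big l r (cellAt l r x) ∧ bad (r + 1) (cellAt l (r + 1) x)) := by
  rw [IsInside, parentCell_cellAt]

theorem isSwitch_succ_cellAt : IsSwitch bad big l (r + 1) (cellAt l (r + 1) x) ↔
    ¬ (IsInside bad big l (r + 1) (cellAt l (r + 1) x) ↔ IsInside bad big l r (cellAt l r x)) := by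
  rw [IsSwitch, parentCell_cellAt]

theorem not_isSwitch_of_not_bad {r' : ℕ} (hb : ∀ k, r ≤ k → k ≤ r' → ¬ bad k (cellAt l k x))
    (hs : IsSwitch bad big l r (cellAt l r x)) (hr : r < r') :
    ¬ IsSwitch bad big l r' (cellAt l r' x) := by
  have h0 : ¬ IsInside bad big l r (cellAt l r x) := by
    cases r with
    | zero => exact hs.elim
    | succ r =>
      rw [isSwitch_succ_cellAt] at hs
      have := hb _ le_rfl hr.le
      rw [isInside_succ_cellAt] at hs ⊢
      tauto
  have h1 : ∀ k, r ≤ k → k ≤ r' → ¬ IsInside bad big l k (cellAt l k x) := by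
    intro k hk
    induction k, hk using Nat.le_induction with
    | base => exact fun _ => h0
    | succ k hk ih =>
      intro hk'
      have h2 := ih (by omega)
      have h3 := hb (k + 1) (by omega) hk'
      rw [isInside_succ_cellAt]; tauto
  obtain ⟨k, rfl⟩ : ∃ k, r' = k + 1 := ⟨r' - 1, by omega⟩
  rw [isSwitch_succ_cellAt]
  have := h1 k (by omega) (by omega)
  have := h1 (k + 1) (by omega) (by omega)
  tauto

theorem not_isSwitch_of_not_big {r' : ℕ} (hb : ∀ k, r ≤ k → k ≤ r' → ¬ big k (cellAt l k x))
    (hs : IsSwitch bad big l r (cellAt l r x)) (hr : r < r') :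
    ¬ IsSwitch bad big l r' (cellAt l r' x) := by
  have h0 : IsInside bad big l r (cellAt l r x) := by
    cases r with
    | zero => exact hs.elim
    | succ r =>
      rw [isSwitch_succ_cellAt] at hs
      have := hb _ le_rfl hr.le
      rw [isInside_succ_cellAt] at hs ⊢
      tauto
  have h1 : ∀ k, r ≤ k → k ≤ r' → IsInside bad big l k (cellAt l k x) := by
    intro k hk
    induction k, hk using Nat.le_induction with
    | base => exact fun _ => h0
    | succ k hk ih =>
      intro hk'
      have h2 := ih (by omega)
      have h3 := hb (k + 1) (by omega) hk'
      rw [isInside_succ_cellAt]; tauto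
  obtain ⟨k, rfl⟩ : ∃ k, r' = k + 1 := ⟨r' - 1, by omega⟩
  rw [isSwitch_succ_cellAt]
  have := h1 k (by omega) (by omega)
  have := h1 (k + 1) (by omega) (by omega)
  tauto

theorem IsInside.not_big (hbb : ∀ r i, bad r i → ¬ big r i)
    (h : IsInside bad big l r i) : ¬ big r i := by
  cases r with
  | zero => exact h.elim
  | succ r =>
    rcases h with h | h
    · exact h.2
    · exact hbb _ _ h.2

theorem not_bad_of_not_isInside (hbb : ∀ r i, bad r i → ¬ big r i) (h0 : ∀ i, ¬ bad 0 i)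
    (h : ¬ IsInside bad big l r i) : ¬ bad r i := by
  cases r with
  | zero => exact h0 i
  | succ r =>
    rw [IsInside] at h
    have := hbb (r + 1) i
    tauto

/-- A finite set of cells forming an antichain inside a dyadic interval has small total width. -/
theorem sum_width_le_of_antichain (s : Finset (ℕ × ℤ)) (hn : ∀ q ∈ s, n ≤ q.1 / 2 ^ l + l + 1)
    (hj : ∀ q ∈ s, dyadicAt n (cellPos l q) = j)
    (h : ∀ q ∈ s, ∀ p ∈ s, q.1 < p.1 → cellAt l q.1 (cellPos l p) ≠ q.2) :
    ∑ q ∈ s, cellWidth l q.1 ≤ (1 / 2) ^ n := by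
  have hd : ∀ q ∈ s, ∀ p ∈ s, q.1 ≤ p.1 → q ≠ p → cellAt l q.1 (cellPos l p) ≠ q.2 := by
    intro q hq p hp hqp hne
    rcases hqp.lt_or_eq with h' | h'
    · exact h q hq p hp h'
    · rw [h', cellAt_cellPos]
      intro h2
      exact hne (Prod.ext h' h2.symm)
  have := sum_length_le_of_disjoint s (cellPos l) (fun q => cellWidth l q.1)
    (A := j * (1 / 2) ^ n) (B := (j + 1) * (1 / 2) ^ n) (by gcongr; simp)
    (fun q _ => (cellWidth_pos l q.1).le)
    (fun q hq => cell_le_dyadic (hn q hq) (hj q hq)) ?_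
  · linarith
  · intro q hq p hp hqp
    rcases le_total q.1 p.1 with h' | h'
    · exact disjoint_cells h' (hd q hq p hp h' hqp)
    · exact (disjoint_cells h' (hd p hp q hq h' hqp.symm)).symm

end Column
end

section
open Set
open scoped Classical

/-- The switch cells of generation at least `n` in a dyadic interval. -/
noncomputable def boxSwitches (bad big : ℕ → ℤ → Prop) (l P n : ℕ) (j : ℤ) : Finset (ℕ × ℤ) :=
  (gridCells l P).filter fun q =>
    IsSwitch bad big l q.1 q.2 ∧ n ≤ q.1 / 2 ^ l ∧ dyadicAt n (cellPos l q) = j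

/-- A dyadic interval such that one of the cells just above it is `big`. -/
def IsBigBox (big : ℕ → ℤ → Prop) (l P n : ℕ) (j : ℤ) : Prop :=
  ∃ q ∈ gridCells l P, big q.1 q.2 ∧ q.1 / 2 ^ l = n ∧ dyadicAt n (cellPos l q) = j

variable {bad big : ℕ → ℤ → Prop} {l P n : ℕ} {j : ℤ} {M : ℝ}

theorem sum_descendants_le (f : ℕ × ℤ) (m : ℕ) :
    ∑ q ∈ (gridCells l P).filter (fun q => f.1 ≤ q.1 ∧ cellAt l f.1 (cellPos l q) = f.2 ∧
      q.1 / 2 ^ l < f.1 / 2 ^ l + m), cellWidth l q.1 ≤ 2 ^ l * m * cellWidth l f.1 := by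
  set s := (gridCells l P).filter (fun q => f.1 ≤ q.1 ∧ cellAt l f.1 (cellPos l q) = f.2 ∧
      q.1 / 2 ^ l < f.1 / 2 ^ l + m) with hs
  set R := Finset.Ico (2 ^ l * (f.1 / 2 ^ l)) (2 ^ l * (f.1 / 2 ^ l + m)) with hR
  have hmaps : ∀ q ∈ s, q.1 ∈ R := by
    intro q hq
    rw [hs, Finset.mem_filter] at hq
    rw [hR, Finset.mem_Ico]
    constructor
    · exact (Nat.mul_div_le f.1 (2 ^ l)).trans hq.2.1
    · have := hq.2.2.2
      rwa [Nat.div_lt_iff_lt_mul (by positivity), mul_comm] at this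
  rw [← Finset.sum_fiberwise_of_maps_to hmaps]
  calc _ ≤ ∑ r ∈ R, cellWidth l f.1 := by
        refine Finset.sum_le_sum fun r _ => ?_
        have e : cellWidth l f.1 = (1 / 2) ^ (f.1 / 2 ^ l + l + 1) := rfl
        rw [e]
        refine sum_width_le_of_antichain (j := f.2) _ ?_ ?_ ?_
        · intro q hq
          rw [Finset.mem_filter, hs, Finset.mem_filter] at hq
          gcongr
          exact hq.1.2.1
        · intro q hq
          rw [Finset.mem_filter, hs, Finset.mem_filter] at hq
          rw [← cellAt_eq_dyadicAt]; exact hq.1.2.2.1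
        · intro q hq p hp hqp
          rw [Finset.mem_filter] at hq hp
          omega
    _ = _ := by
        rw [Finset.sum_const, hR, Nat.card_Ico, nsmul_eq_mul, ← Nat.mul_sub, Nat.add_sub_cancel_left]
        push_cast; ring

theorem exists_first_cell {p : ℕ → Prop} {a b : ℕ} (h : ∃ k, a ≤ k ∧ k ≤ b ∧ p k) :
    ∃ k, a ≤ k ∧ k ≤ b ∧ p k ∧ ∀ k' < k, a ≤ k' → ¬ p k' := by
  refine ⟨Nat.find h, (Nat.find_spec h).1, (Nat.find_spec h).2.1, (Nat.find_spec h).2.2, ?_⟩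
  intro k' hk' ha hp
  exact Nat.find_min h hk' ⟨ha, hk'.le.trans (Nat.find_spec h).2.1, hp⟩

theorem mem_gridCells {q : ℕ × ℤ} : q ∈ gridCells l P ↔ q.1 ≤ P ∧ 0 ≤ q.2 ∧ q.2 ≤ 2 ^ (P + l + 1) := by
  simp [gridCells]

theorem cellAt_mem_gridCells {q : ℕ × ℤ} (hq : q ∈ gridCells l P) {k : ℕ} (hk : k ≤ q.1) :
    (k, cellAt l k (cellPos l q)) ∈ gridCells l P := by
  rw [mem_gridCells] at *
  have h0 : 0 ≤ cellPos l q := mul_nonneg (by exact_mod_cast hq.2.1) (cellWidth_pos _ _).le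
  have h1 : 0 ≤ cellAt l k (cellPos l q) := Int.floor_nonneg.2 (div_nonneg h0 (cellWidth_pos _ _).le)
  refine ⟨hk.trans hq.1, h1, le_trans ?_ hq.2.2⟩
  have h2 : cellPos l q / cellWidth l k ≤ q.2 := by
    rw [div_le_iff₀ (cellWidth_pos _ _), cellPos]
    have : (0 : ℝ) ≤ q.2 := by exact_mod_cast hq.2.1
    gcongr
    exact cellWidth_antitone l hk
  have h3 : (cellAt l k (cellPos l q) : ℝ) ≤ q.2 := (Int.floor_le _).trans h2
  exact_mod_cast h3

theorem cellAt_cellPos_cellAt {k : ℕ} (x : ℝ) (k' : ℕ) (h : k' ≤ k) :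
    cellAt l k' (cellPos l (k, cellAt l k x)) = cellAt l k' x :=
  cellAt_congr (cellAt_cellPos (l := l) (k, cellAt l k x)) h

theorem dyadicAt_cellPos_cellAt {k n : ℕ} (x : ℝ) (h : n ≤ k / 2 ^ l + l + 1) :
    dyadicAt n (cellPos l (k, cellAt l k x)) = dyadicAt n x :=
  dyadicAt_congr (by rw [← cellAt_eq_dyadicAt, ← cellAt_eq_dyadicAt]
                     exact cellAt_cellPos (l := l) (k, cellAt l k x)) h

theorem dyadicAt_dyadicAt_mul {k m : ℕ} (x : ℝ) (h : k ≤ m) :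
    dyadicAt k (dyadicAt m x * (1 / 2) ^ m) = dyadicAt k x := by
  refine dyadicAt_congr ?_ h
  rw [dyadicAt_eq_iff]
  refine ⟨le_rfl, ?_⟩
  gcongr
  linarith

theorem sum_boxSwitches_le_of_isBigBox
    (hHall : ∀ n j, IsBigBox big l P n j → ∀ F ⊆ gridCells l P,
      (∀ q ∈ F, bad q.1 q.2 ∧ n ≤ q.1 / 2 ^ l ∧ dyadicAt n (cellPos l q) = j) →
      (∀ q ∈ F, ∀ p ∈ F, q.1 < p.1 → cellAt l q.1 (cellPos l p) ≠ q.2) →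
      ∑ q ∈ F, cellWidth l q.1 ≤ 1 / 4 * (1 / 2) ^ n)
    (hM : 0 ≤ M) (hIH : ∀ n' > n, ∀ j, ∑ q ∈ boxSwitches bad big l P n' j, cellWidth l q.1 ≤ M * (1 / 2) ^ n')
    (hbig : IsBigBox big l P n j) :
    ∑ q ∈ boxSwitches bad big l P n j, cellWidth l q.1 ≤
      (1 + (2 ^ l * (l + 1) + M) / 4) * (1 / 2) ^ n := by
  set F := (gridCells l P).filter fun q => (bad q.1 q.2 ∧ n ≤ q.1 / 2 ^ l ∧
    dyadicAt n (cellPos l q) = j) ∧ ∀ k < q.1, 2 ^ l * n ≤ k → ¬ bad k (cellAt l k (cellPos l q)) with hF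
  set A := (boxSwitches bad big l P n j).filter fun q =>
    ∀ k, 2 ^ l * n ≤ k → k ≤ q.1 → ¬ bad k (cellAt l k (cellPos l q)) with hA
  have hgen : ∀ k, 2 ^ l * n ≤ k ↔ n ≤ k / 2 ^ l := fun k => by
    rw [Nat.le_div_iff_mul_le (by positivity), mul_comm]
  have hcov := sum_le_of_cover (s := boxSwitches bad big l P n j) (A := A) (F := F)
    (D := fun f => (gridCells l P).filter (fun q => f.1 ≤ q.1 ∧ cellAt l f.1 (cellPos l q) = f.2 ∧
      q.1 / 2 ^ l < f.1 / 2 ^ l + (l + 1)) ∪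
      boxSwitches bad big l P (f.1 / 2 ^ l + l + 1) f.2)
    (w := fun q => cellWidth l q.1) (fun q => (cellWidth_pos l q.1).le) ?_
  · refine hcov.trans ?_
    have h1 : ∑ q ∈ A, cellWidth l q.1 ≤ (1 / 2) ^ n := by
      refine sum_width_le_of_antichain (j := j) _ ?_ ?_ ?_
      · intro q hq
        rw [hA, Finset.mem_filter, boxSwitches, Finset.mem_filter] at hq
        omega
      · intro q hq
        rw [hA, Finset.mem_filter, boxSwitches, Finset.mem_filter] at hq
        exact hq.1.2.2.2
      · intro q hq p hp hqp heq
        rw [hA, Finset.mem_filter, boxSwitches, Finset.mem_filter] at hq hp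
        have h1 := hp.1.2.1
        rw [← cellAt_cellPos (l := l) p] at h1
        refine not_isSwitch_of_not_bad (r := q.1) ?_ ?_ hqp h1
        · intro k hk hk'
          exact hp.2 k (((hgen _).2 hq.1.2.2.1).trans hk) hk'
        · rw [heq]; exact hq.1.2.1
    have h2 : ∑ q ∈ F, cellWidth l q.1 ≤ 1 / 4 * (1 / 2) ^ n := by
      refine hHall n j hbig F (Finset.filter_subset _ _) ?_ ?_
      · intro q hq
        rw [hF, Finset.mem_filter] at hq
        exact hq.2.1
      · intro q hq p hp hqp heq
        rw [hF, Finset.mem_filter] at hq hp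
        refine hp.2.2 q.1 hqp ((hgen _).2 hq.2.1.2.1) ?_
        rw [heq]; exact hq.2.1.1
    have h3 : ∀ f ∈ F, ∑ q ∈ (gridCells l P).filter (fun q => f.1 ≤ q.1 ∧
        cellAt l f.1 (cellPos l q) = f.2 ∧ q.1 / 2 ^ l < f.1 / 2 ^ l + (l + 1)) ∪
        boxSwitches bad big l P (f.1 / 2 ^ l + l + 1) f.2, cellWidth l q.1 ≤
        (2 ^ l * (l + 1) + M) * cellWidth l f.1 := by
      intro f hf
      rw [hF, Finset.mem_filter] at hf
      refine (sum_union_le_add _ _ fun q : ℕ × ℤ => (cellWidth_pos l q.1).le).trans ?_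
      have h4 := sum_descendants_le (l := l) (P := P) f (l + 1)
      have h5 := hIH (f.1 / 2 ^ l + l + 1) (by have := hf.2.1.2.1; omega) f.2
      push_cast at h4
      rw [← cellWidth] at h5
      linarith
    refine (add_le_add h1 (Finset.sum_le_sum h3)).trans ?_
    rw [← Finset.mul_sum]
    have h4 : 0 ≤ (2 : ℝ) ^ l * (l + 1) + M := by positivity
    nlinarith [mul_le_mul_of_nonneg_left h2 h4]
  · intro q hq
    by_cases hqA : q ∈ A
    · exact Or.inl hqA
    right
    rw [hA, Finset.mem_filter] at hqA
    push Not at hqA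
    obtain ⟨k, hk1, hk2, hk3⟩ := hqA hq
    obtain ⟨k, hk1, hk2, hk3, hk4⟩ := exists_first_cell
      (p := fun k => bad k (cellAt l k (cellPos l q))) ⟨k, hk1, hk2, hk3⟩
    rw [boxSwitches, Finset.mem_filter] at hq
    have hk5 := (hgen _).1 hk1
    refine ⟨(k, cellAt l k (cellPos l q)), ?_, ?_⟩
    · rw [hF, Finset.mem_filter]
      refine ⟨cellAt_mem_gridCells hq.1 hk2, ⟨hk3, hk5, ?_⟩, ?_⟩
      · rw [dyadicAt_cellPos_cellAt _ (by omega)]; exact hq.2.2.2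
      · intro k' hk' hk''
        rw [cellAt_cellPos_cellAt _ _ (le_of_lt hk')]
        exact hk4 k' hk' hk''
    · rw [Finset.mem_union, Finset.mem_filter, boxSwitches, Finset.mem_filter]
      by_cases hlt : q.1 / 2 ^ l < k / 2 ^ l + (l + 1)
      · exact Or.inl ⟨hq.1, hk2, rfl, hlt⟩
      · refine Or.inr ⟨hq.1, hq.2.1, ?_, ?_⟩
        · simp only; omega
        · simp only; rw [← cellAt_eq_dyadicAt]

theorem sum_boxSwitches_le
    (hHall : ∀ n j, IsBigBox big l P n j → ∀ F ⊆ gridCells l P,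
      (∀ q ∈ F, bad q.1 q.2 ∧ n ≤ q.1 / 2 ^ l ∧ dyadicAt n (cellPos l q) = j) →
      (∀ q ∈ F, ∀ p ∈ F, q.1 < p.1 → cellAt l q.1 (cellPos l p) ≠ q.2) →
      ∑ q ∈ F, cellWidth l q.1 ≤ 1 / 4 * (1 / 2) ^ n) (n : ℕ) (j : ℤ) :
    ∑ q ∈ boxSwitches bad big l P n j, cellWidth l q.1 ≤ (4 + 2 ^ l * (l + 1)) * (1 / 2) ^ n := by
  set M : ℝ := 4 + 2 ^ l * (l + 1) with hMdef
  have hM : 0 ≤ M := by positivity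
  suffices h : ∀ k n j, P / 2 ^ l < n + k →
      ∑ q ∈ boxSwitches bad big l P n j, cellWidth l q.1 ≤ M * (1 / 2) ^ n from
    h (P / 2 ^ l + 1) n j (by omega)
  intro k
  induction k with
  | zero =>
    intro n j hn
    rw [boxSwitches, Finset.filter_false_of_mem, Finset.sum_empty]
    · positivity
    · intro q hq h
      have := Nat.div_le_div_right (c := 2 ^ l) (mem_gridCells.1 hq).1
      omega
  | succ k ih =>
    intro n j hn
    have hbigbox : ∀ n' j', n ≤ n' → IsBigBox big l P n' j' →
        ∑ q ∈ boxSwitches bad big l P n' j', cellWidth l q.1 ≤ (M - 1) * (1 / 2) ^ n' := by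
      intro n' j' hn' hb
      refine (sum_boxSwitches_le_of_isBigBox hHall hM (fun n'' hn'' j => ih n'' j (by omega))
        hb).trans ?_
      gcongr
      have : (0 : ℝ) ≤ 2 ^ l * (l + 1) := by positivity
      linarith
    set F := ((Finset.range (P + 1) ×ˢ gridCells l P).image
      (fun t => (t.1, dyadicAt t.1 (cellPos l t.2)))).filter fun t : ℕ × ℤ =>
      n ≤ t.1 ∧ IsBigBox big l P t.1 t.2 ∧ dyadicAt n (t.2 * (1 / 2) ^ t.1) = j ∧
        ∀ k < t.1, n ≤ k → ¬ IsBigBox big l P k (dyadicAt k (t.2 * (1 / 2) ^ t.1)) with hF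
    set A := (boxSwitches bad big l P n j).filter fun q =>
      ∀ k, n ≤ k → k ≤ q.1 / 2 ^ l → ¬ IsBigBox big l P k (dyadicAt k (cellPos l q)) with hA
    have hcov := sum_le_of_cover (s := boxSwitches bad big l P n j) (A := A) (F := F)
      (D := fun t => boxSwitches bad big l P t.1 t.2)
      (w := fun q => cellWidth l q.1) (fun q => (cellWidth_pos l q.1).le) ?_
    · refine hcov.trans ?_
      have h1 : ∑ q ∈ A, cellWidth l q.1 ≤ (1 / 2) ^ n := by
        refine sum_width_le_of_antichain (j := j) _ ?_ ?_ ?_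
        · intro q hq
          rw [hA, Finset.mem_filter, boxSwitches, Finset.mem_filter] at hq
          omega
        · intro q hq
          rw [hA, Finset.mem_filter, boxSwitches, Finset.mem_filter] at hq
          exact hq.1.2.2.2
        · intro q hq p hp hqp heq
          rw [hA, Finset.mem_filter, boxSwitches, Finset.mem_filter] at hq hp
          have h1 := hp.1.2.1
          rw [← cellAt_cellPos (l := l) p] at h1
          refine not_isSwitch_of_not_big (r := q.1) ?_ ?_ hqp h1
          · intro k hk hk' hb
            have hn : n ≤ k / 2 ^ l := hq.1.2.2.1.trans (Nat.div_le_div_right hk)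
            refine hp.2 (k / 2 ^ l) hn (Nat.div_le_div_right hk')
              ⟨_, cellAt_mem_gridCells hp.1.1 hk', hb, rfl, ?_⟩
            exact dyadicAt_cellPos_cellAt _ (by omega)
          · rw [heq]; exact hq.1.2.1
      have h2 : ∑ t ∈ F, (1 / 2 : ℝ) ^ t.1 ≤ (1 / 2) ^ n := by
        have hle := fun t (ht : t ∈ F) => (Finset.mem_filter.1 ht).2
        have hnn : ∀ (t : ℕ × ℤ) (x : ℝ), x ∈ Ico (t.2 * (1 / 2 : ℝ) ^ t.1)
            (t.2 * (1 / 2 : ℝ) ^ t.1 + (1 / 2) ^ t.1) ↔ dyadicAt t.1 x = t.2 := by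
          intro t x; rw [dyadicAt_eq_iff, mem_Ico, add_mul, one_mul]
        have := sum_length_le_of_disjoint F (fun t => t.2 * (1 / 2 : ℝ) ^ t.1)
          (fun t => (1 / 2 : ℝ) ^ t.1)
          (A := j * (1 / 2) ^ n) (B := (j + 1) * (1 / 2) ^ n) (by gcongr; simp)
          (fun t _ => by positivity) ?_ ?_
        · linarith
        · intro t ht
          have ht' := hle t ht
          refine ⟨(dyadicAt_eq_iff.1 ht'.2.2.1).1, ?_⟩
          refine le_of_forall_lt_imp_le_of_dense fun x hx => ?_
          rcases lt_or_ge x (t.2 * (1 / 2 : ℝ) ^ t.1) with hx' | hx'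
          · exact hx'.le.trans (dyadicAt_eq_iff.1 ht'.2.2.1).2.le
          · have h3 := (hnn t x).1 ⟨hx', hx⟩
            have h4 := dyadicAt_dyadicAt_mul x ht'.1
            rw [h3, ht'.2.2.1] at h4
            exact (dyadicAt_eq_iff.1 h4.symm).2.le
        · have key : ∀ t ∈ F, ∀ u ∈ F, t ≠ u → t.1 ≤ u.1 → ∀ x,
              dyadicAt t.1 x = t.2 → dyadicAt u.1 x = u.2 → False := by
            intro t ht u hu htu hle' x hx hx'
            have ht' := hle t ht
            have hu' := hle u hu
            rcases hle'.lt_or_eq with hlt | heq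
            · refine hu'.2.2.2 t.1 hlt ht'.1 ?_
              rw [← hx', dyadicAt_dyadicAt_mul x hle', hx]
              exact ht'.2.1
            · exact htu (Prod.ext heq (by rw [← hx, ← hx', heq]))
          intro t ht u hu htu
          rw [Set.disjoint_left]
          intro x hx hx'
          rw [hnn] at hx hx'
          rcases le_total t.1 u.1 with h' | h'
          · exact key t ht u hu htu h' x hx hx'
          · exact key u hu t ht htu.symm h' x hx' hx
      have h3 : ∀ t ∈ F, ∑ q ∈ boxSwitches bad big l P t.1 t.2, cellWidth l q.1 ≤
          (M - 1) * (1 / 2) ^ t.1 := by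
        intro t ht
        rw [hF, Finset.mem_filter] at ht
        exact hbigbox _ _ ht.2.1 ht.2.2.1
      refine (add_le_add h1 (Finset.sum_le_sum h3)).trans ?_
      rw [← Finset.mul_sum]
      have h4 : 0 ≤ M - 1 := by
        have : (0 : ℝ) ≤ 2 ^ l * (l + 1) := by positivity
        linarith
      nlinarith [mul_le_mul_of_nonneg_left h2 h4]
    · intro q hq
      by_cases hqA : q ∈ A
      · exact Or.inl hqA
      right
      rw [hA, Finset.mem_filter] at hqA
      push Not at hqA
      obtain ⟨k, hk1, hk2, hk3⟩ := hqA hq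
      obtain ⟨k, hk1, hk2, hk3, hk4⟩ := exists_first_cell
        (p := fun k => IsBigBox big l P k (dyadicAt k (cellPos l q))) ⟨k, hk1, hk2, hk3⟩
      rw [boxSwitches, Finset.mem_filter] at hq
      refine ⟨(k, dyadicAt k (cellPos l q)), ?_, ?_⟩
      · rw [hF, Finset.mem_filter, Finset.mem_image]
        refine ⟨⟨(k, q), ?_, rfl⟩, hk1, hk3, ?_, ?_⟩
        · rw [Finset.mem_product, Finset.mem_range]
          have := (mem_gridCells.1 hq.1).1
          have := Nat.div_le_self q.1 (2 ^ l)
          exact ⟨by simp only; omega, hq.1⟩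
        · rw [dyadicAt_dyadicAt_mul _ hk1]; exact hq.2.2.2
        · intro k' hk' hk''
          rw [dyadicAt_dyadicAt_mul _ (le_of_lt hk')]
          exact hk4 k' hk' hk''
      · rw [boxSwitches, Finset.mem_filter]
        exact ⟨hq.1, hq.2.1, hk2, rfl⟩

end

section
open Set
open scoped Classical

/-- Carleson condition for a finite set of cells. -/
def HasCarleson (l : ℕ) (C : ℝ) (E : Finset (ℕ × ℤ)) : Prop :=
  ∀ a b : ℝ, 0 < b →
    ∑ q ∈ E with |cellPos l q - a| ≤ b ∧ rowTop l q.1 ≤ b, cellWidth l q.1 ≤ C * b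

/-- The left edge of the cell separates the inside from the outside. -/
def IsLeftMismatch (bad big : ℕ → ℤ → Prop) (l r : ℕ) (i : ℤ) : Prop :=
  ¬ (IsInside bad big l r i ↔ IsInside bad big l r (i - 1))

variable {bad big : ℕ → ℤ → Prop} {l P r : ℕ} {i : ℤ} {C C' M A : ℝ} {E E' : Finset (ℕ × ℤ)}

theorem HasCarleson.nonneg (h : HasCarleson l C E) : 0 ≤ C := by
  have := h 0 1 one_pos
  rw [mul_one] at this
  exact (Finset.sum_nonneg fun q _ => (cellWidth_pos l q.1).le).trans this

theorem HasCarleson.union (h : HasCarleson l C E) (h' : HasCarleson l C' E') :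
    HasCarleson l (C + C') (E ∪ E') := by
  intro a b hb
  rw [Finset.filter_union]
  have := sum_union_le_add (E.filter fun q => |cellPos l q - a| ≤ b ∧ rowTop l q.1 ≤ b)
    (E'.filter fun q => |cellPos l q - a| ≤ b ∧ rowTop l q.1 ≤ b)
    (w := fun q => cellWidth l q.1) fun q => (cellWidth_pos l q.1).le
  linarith [h a b hb, h' a b hb]

theorem HasCarleson.subset (h : HasCarleson l C E) (h' : E' ⊆ E) : HasCarleson l C E' := by
  intro a b hb
  exact (Finset.sum_le_sum_of_subset_of_nonneg (Finset.filter_subset_filter _ h')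
    fun q _ _ => (cellWidth_pos l q.1).le).trans (h a b hb)

theorem cellWidth_le_rowTop (l r : ℕ) : cellWidth l r ≤ rowTop l r := by
  linarith [rowTop_sub_succ l r, rowTop_pos l (r + 1)]

theorem rowTop_le_two_mul_succ (l r : ℕ) : rowTop l r ≤ 2 * rowTop l (r + 1) := by
  linarith [rowTop_sub_succ l r, cellWidth_le_rowTop_succ l r]

theorem card_cells_le (s : Finset ℤ) (r : ℕ) {a b : ℝ} (hb : 0 ≤ b)
    (h : ∀ i ∈ s, |(i : ℝ) * cellWidth l r - a| ≤ b) :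
    (s.card : ℝ) ≤ 2 * b / cellWidth l r + 1 := by
  have hw := cellWidth_pos l r
  have := card_le_of_separated s (fun i => (i : ℝ) * cellWidth l r) (A := a - b) (B := a + b) hw
    (by linarith) (fun i hi => by have := abs_le.1 (h i hi); constructor <;> linarith) ?_
  · convert this using 3; ring
  · intro i _ j _ hij
    rw [← sub_mul, abs_mul, abs_of_pos hw]
    refine le_mul_of_one_le_left hw.le ?_
    have : 1 ≤ |i - j| := Int.one_le_abs (sub_ne_zero.2 hij)
    exact_mod_cast this

theorem rowTop_le_two_mul_of_le_succ {r r' : ℕ} (h : r' ≤ r + 1) :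
    rowTop l r ≤ 2 * rowTop l r' :=
  (rowTop_le_two_mul_succ l r).trans (by linarith [rowTop_antitone l h])

theorem cellWidth_le_two_mul_of_le_succ {r r' : ℕ} (h : r' ≤ r + 1) :
    cellWidth l r ≤ 2 * cellWidth l r' :=
  (cellWidth_le_two_mul_succ (l := l) (r := r)).trans (by linarith [cellWidth_antitone l h])

theorem HasCarleson.of_near (h : HasCarleson l C E) (hA : 0 ≤ A)
    (hn : ∀ q ∈ E', ∃ e ∈ E, e.1 ≤ q.1 + 1 ∧ q.1 ≤ e.1 + 1 ∧
      |cellPos l q - cellPos l e| ≤ A * cellWidth l e.1) :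
    HasCarleson l (6 * (4 * A + 1) * (2 + 2 * A) * C) E' := by
  intro a b hb
  set W := E'.filter fun q => |cellPos l q - a| ≤ b ∧ rowTop l q.1 ≤ b with hW
  have hcov := sum_le_of_cover (s := W) (A := ∅)
    (F := E.filter fun q => |cellPos l q - a| ≤ (2 + 2 * A) * b ∧ rowTop l q.1 ≤ (2 + 2 * A) * b)
    (D := fun e => W.filter fun q => e.1 ≤ q.1 + 1 ∧ q.1 ≤ e.1 + 1 ∧
      |cellPos l q - cellPos l e| ≤ A * cellWidth l e.1)
    (w := fun q => cellWidth l q.1) (fun q => (cellWidth_pos l q.1).le) ?_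
  · refine hcov.trans ?_
    rw [Finset.sum_empty, zero_add]
    have h1 : ∀ e ∈ E.filter fun q => |cellPos l q - a| ≤ (2 + 2 * A) * b ∧
        rowTop l q.1 ≤ (2 + 2 * A) * b,
        ∑ q ∈ W.filter fun q => e.1 ≤ q.1 + 1 ∧ q.1 ≤ e.1 + 1 ∧
          |cellPos l q - cellPos l e| ≤ A * cellWidth l e.1, cellWidth l q.1 ≤
        6 * (4 * A + 1) * cellWidth l e.1 := by
      intro e _
      set s := W.filter fun q => e.1 ≤ q.1 + 1 ∧ q.1 ≤ e.1 + 1 ∧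
          |cellPos l q - cellPos l e| ≤ A * cellWidth l e.1 with hs
      have hmaps : ∀ q ∈ s, q.1 ∈ Finset.Icc (e.1 - 1) (e.1 + 1) := by
        intro q hq
        rw [hs, Finset.mem_filter] at hq
        rw [Finset.mem_Icc]; omega
      rw [← Finset.sum_fiberwise_of_maps_to hmaps]
      calc _ ≤ ∑ r ∈ Finset.Icc (e.1 - 1) (e.1 + 1), (4 * A + 1) * (2 * cellWidth l e.1) := by
            refine Finset.sum_le_sum fun r hr => ?_
            rw [Finset.mem_Icc] at hr
            have hw := cellWidth_le_two_mul_of_le_succ (l := l) (r := r) (r' := e.1) (by omega)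
            have hw' := cellWidth_le_two_mul_of_le_succ (l := l) (r := e.1) (r' := r) (by omega)
            have hwr := cellWidth_pos l r
            have hcard : ((s.filter fun q => q.1 = r).card : ℝ) ≤ 4 * A + 1 := by
              have h2 := card_cells_le (l := l) ((s.filter fun q => q.1 = r).image Prod.snd) r
                (a := cellPos l e) (b := A * cellWidth l e.1)
                (mul_nonneg hA (cellWidth_pos _ _).le) ?_
              · rw [Finset.card_image_of_injOn] at h2
                · refine h2.trans ?_
                  gcongr
                  rw [div_le_iff₀ hwr]
                  nlinarith
                · intro q hq p hp hqp
                  simp only [Finset.coe_filter, mem_ofPred] at hq hp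
                  exact Prod.ext (hq.2.trans hp.2.symm) hqp
              · intro i hi
                obtain ⟨q, hq, rfl⟩ := Finset.mem_image.1 hi
                rw [Finset.mem_filter, hs, Finset.mem_filter] at hq
                rw [← hq.2]
                exact hq.1.2.2.2
            rw [Finset.sum_congr rfl (g := fun _ => cellWidth l r)
              (fun q hq => by rw [(Finset.mem_filter.1 hq).2]), Finset.sum_const, nsmul_eq_mul]
            gcongr
        _ ≤ 3 * ((4 * A + 1) * (2 * cellWidth l e.1)) := by
            rw [Finset.sum_const, Nat.card_Icc, nsmul_eq_mul]
            have := cellWidth_pos l e.1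
            gcongr
            have : e.1 + 1 + 1 - (e.1 - 1) ≤ 3 := by omega
            exact_mod_cast this
        _ = _ := by ring
    refine (Finset.sum_le_sum h1).trans ?_
    rw [← Finset.mul_sum]
    have := h a ((2 + 2 * A) * b) (by positivity)
    calc _ ≤ 6 * (4 * A + 1) * (C * ((2 + 2 * A) * b)) := by gcongr
      _ = _ := by ring
  · intro q hq
    right
    have hq' := Finset.mem_filter.1 hq
    obtain ⟨e, he, h1, h2, h3⟩ := hn q hq'.1
    refine ⟨e, Finset.mem_filter.2 ⟨he, ?_, ?_⟩, Finset.mem_filter.2 ⟨hq, h1, h2, h3⟩⟩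
    · have h4 := rowTop_le_two_mul_of_le_succ (l := l) (r := e.1) (r' := q.1) h2
      have h5 := cellWidth_le_rowTop l e.1
      have h6 := abs_sub_le (cellPos l e) (cellPos l q) a
      rw [abs_sub_comm] at h3
      have h7 : A * cellWidth l e.1 ≤ A * (2 * b) := by
        gcongr
        linarith [hq'.2.2]
      nlinarith [hq'.2.1]
    · have h4 := rowTop_le_two_mul_of_le_succ (l := l) (r := e.1) (r' := q.1) h2
      have : 0 ≤ A * b := by positivity
      nlinarith [hq'.2.2]

theorem exists_generation {b : ℝ} (hb : 0 < b) : ∃ n : ℕ, (1 / 2 : ℝ) ^ n ≤ 2 * b ∧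
    ∀ r, rowTop l r ≤ b → n ≤ r / 2 ^ l := by
  rcases le_or_gt (1 / 2) b with h | h
  · exact ⟨0, by norm_num; linarith, fun _ _ => Nat.zero_le _⟩
  · obtain ⟨n, h1, h2⟩ := exists_nat_pow_near_of_lt_one hb (by linarith) (show (0 : ℝ) < 1 / 2 by norm_num)
      (by norm_num)
    refine ⟨n, ?_, fun r hr => ?_⟩
    · rw [pow_succ] at h1; linarith
    · have h3 := half_gen_le l r
      have h4 : (1 / 2 : ℝ) ^ (r / 2 ^ l + 1) < (1 / 2) ^ n := by
        rw [pow_succ]; linarith [cellWidth_pos l r]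
      have := (pow_lt_pow_iff_right_of_lt_one₀ (show (0 : ℝ) < 1 / 2 by norm_num) (by norm_num)).1 h4
      omega

theorem hasCarleson_switches (hM : 0 ≤ M)
    (h : ∀ n j, ∑ q ∈ boxSwitches bad big l P n j, cellWidth l q.1 ≤ M * (1 / 2) ^ n) :
    HasCarleson l (6 * M) ((gridCells l P).filter fun q => IsSwitch bad big l q.1 q.2) := by
  intro a b hb
  obtain ⟨n, hn1, hn2⟩ := exists_generation (l := l) hb
  have hp : (0 : ℝ) < (1 / 2) ^ n := by positivity
  have hcov := sum_le_of_cover (s := ((gridCells l P).filter fun q => IsSwitch bad big l q.1 q.2).filter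
      fun q => |cellPos l q - a| ≤ b ∧ rowTop l q.1 ≤ b) (A := ∅)
    (F := Finset.Icc (dyadicAt n (a - b)) (dyadicAt n (a + b)))
    (D := fun j => boxSwitches bad big l P n j)
    (w := fun q => cellWidth l q.1) (fun q => (cellWidth_pos l q.1).le) ?_
  · refine hcov.trans ?_
    rw [Finset.sum_empty, zero_add]
    refine (Finset.sum_le_sum fun j _ => h n j).trans ?_
    rw [Finset.sum_const, nsmul_eq_mul]
    have h1 := dyadicAt_eq_iff.1 (rfl : dyadicAt n (a - b) = _)
    have h2 := dyadicAt_eq_iff.1 (rfl : dyadicAt n (a + b) = _)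
    have hle : dyadicAt n (a - b) ≤ dyadicAt n (a + b) := by
      unfold dyadicAt
      gcongr
      linarith
    rw [Int.card_Icc]
    have h3 : (((dyadicAt n (a + b) + 1 - dyadicAt n (a - b)).toNat : ℕ) : ℝ) =
        dyadicAt n (a + b) + 1 - dyadicAt n (a - b) := by
      have : ((dyadicAt n (a + b) + 1 - dyadicAt n (a - b)).toNat : ℤ) =
        dyadicAt n (a + b) + 1 - dyadicAt n (a - b) := Int.toNat_of_nonneg (by linarith)
      exact_mod_cast this
    rw [h3]
    nlinarith [mul_le_mul_of_nonneg_left hn1 hM]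
  · intro q hq
    right
    rw [Finset.mem_filter, Finset.mem_filter] at hq
    have h1 := abs_le.1 hq.2.1
    refine ⟨dyadicAt n (cellPos l q), ?_, ?_⟩
    · rw [Finset.mem_Icc]
      unfold dyadicAt
      constructor <;> gcongr <;> linarith
    · rw [boxSwitches, Finset.mem_filter]
      exact ⟨hq.1.1, hq.1.2, hn2 _ hq.2.2, rfl⟩

end

section
open Set
open scoped Classical

variable {bad big : ℕ → ℤ → Prop} {l P r : ℕ} {i : ℤ} {C : ℝ}

theorem IsInside.mem_range (h0 : ∀ r i, bad r i → 0 ≤ i ∧ i < 2 ^ (r / 2 ^ l + l + 1))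
    (h : IsInside bad big l r i) : 0 ≤ i ∧ i < 2 ^ (r / 2 ^ l + l + 1) := by
  induction r generalizing i with
  | zero => exact h.elim
  | succ r ih =>
    rcases h with h | h
    · have := ih h.1
      unfold parentCell at this
      rcases succ_div_mod_cases l r with ⟨h1, h2, -⟩ | ⟨h1, h2, -⟩
      · rw [if_neg h1] at this; rw [h2]; exact this
      · rw [if_pos h1] at this
        rw [h2, show r / 2 ^ l + 1 + l + 1 = (r / 2 ^ l + l + 1) + 1 by ring, pow_succ]
        omega
    · exact h0 _ _ h.2

theorem parentCell_mem_range (h : 0 ≤ i ∧ i ≤ 2 ^ (P + l + 1)) :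
    0 ≤ parentCell l r i ∧ parentCell l r i ≤ 2 ^ (P + l + 1) := by
  unfold parentCell; split_ifs <;> omega

/-- The left mismatches of a row in a window. -/
noncomputable def rowMismatches (bad big : ℕ → ℤ → Prop) (l P : ℕ) (a b : ℝ) (r : ℕ) : Finset ℤ :=
  (Finset.Icc 0 (2 ^ (P + l + 1))).filter fun i =>
    IsLeftMismatch bad big l r i ∧ |i * cellWidth l r - a| ≤ b

/-- The switches of a row in a window. -/
noncomputable def rowSwitches (bad big : ℕ → ℤ → Prop) (l P : ℕ) (a b : ℝ) (r : ℕ) : Finset ℤ :=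
  (Finset.Icc 0 (2 ^ (P + l + 1))).filter fun i =>
    IsSwitch bad big l r i ∧ |i * cellWidth l r - a| ≤ b

theorem card_rowMismatches_succ_le (h0 : ∀ r i, bad r i → 0 ≤ i ∧ i < 2 ^ (r / 2 ^ l + l + 1))
    {a b b' : ℝ} (hb : b + cellWidth l (r + 1) ≤ b') :
    (rowMismatches bad big l P a b (r + 1)).card ≤
      (rowMismatches bad big l P a b r).card + 2 * (rowSwitches bad big l P a b' (r + 1)).card := by
  set S := rowSwitches bad big l P a b' (r + 1) with hS
  set Y := (rowMismatches bad big l P a b (r + 1)).filter fun i =>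
    ¬ IsSwitch bad big l (r + 1) i ∧ ¬ IsSwitch bad big l (r + 1) (i - 1) with hY
  have hw := cellWidth_pos l (r + 1)
  have h1 : rowMismatches bad big l P a b (r + 1) ⊆ Y ∪ (S ∪ S.image (· + 1)) := by
    intro i hi
    by_cases hiY : i ∈ Y
    · exact Finset.mem_union_left _ hiY
    refine Finset.mem_union_right _ ?_
    have hi' := hi
    rw [rowMismatches, Finset.mem_filter, Finset.mem_Icc] at hi'
    have h2 : IsSwitch bad big l (r + 1) i ∨ IsSwitch bad big l (r + 1) (i - 1) := by
      by_contra hcon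
      push Not at hcon
      exact hiY (Finset.mem_filter.2 ⟨hi, hcon⟩)
    rw [Finset.mem_union]
    rcases h2 with h2 | h2
    · left
      rw [hS, rowSwitches, Finset.mem_filter, Finset.mem_Icc]
      exact ⟨hi'.1, h2, by linarith [hi'.2.2]⟩
    · right
      refine Finset.mem_image.2 ⟨i - 1, ?_, by simp⟩
      rw [hS, rowSwitches, Finset.mem_filter, Finset.mem_Icc]
      refine ⟨⟨?_, by omega⟩, h2, ?_⟩
      · rw [IsSwitch] at h2
        by_contra hneg
        have h3 : ¬ IsInside bad big l (r + 1) (i - 1) := fun h => hneg (h.mem_range h0).1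
        have h4 : ¬ IsInside bad big l r (parentCell l r (i - 1)) := fun h => by
          have := (h.mem_range h0).1
          unfold parentCell at this
          split_ifs at this <;> omega
        tauto
      · push_cast
        have h5 := abs_le.1 hi'.2.2
        rw [abs_le]
        constructor <;> nlinarith
  have h2 : Y.card ≤ (rowMismatches bad big l P a b r).card := by
    refine Finset.card_le_card_of_injOn (parentCell l r) ?_ ?_
    · intro i hi
      rw [hY, Finset.mem_coe, Finset.mem_filter, rowMismatches, Finset.mem_filter, Finset.mem_Icc] at hi
      obtain ⟨⟨hi1, hi2, hi3⟩, hi4, hi5⟩ := hi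
      rw [IsSwitch, not_not] at hi4 hi5
      rw [IsLeftMismatch, hi4, hi5] at hi2
      have hne : parentCell l r (i - 1) ≠ parentCell l r i := by
        intro h; rw [h] at hi2; exact hi2 Iff.rfl
      rw [rowMismatches, Finset.mem_coe, Finset.mem_filter, Finset.mem_Icc]
      refine ⟨parentCell_mem_range hi1, ?_, ?_⟩
      · rw [IsLeftMismatch]
        rcases parentCell_sub_one (l := l) (r := r) (i := i) with h | h
        · exact absurd h hne
        · rwa [← h]
      · rw [parentCell_mul_of_ne hne]; exact hi3
    · have key : ∀ i ∈ Y, (parentCell l r i : ℝ) * cellWidth l r = i * cellWidth l (r + 1) := by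
        intro i hi
        rw [hY, Finset.mem_filter, rowMismatches, Finset.mem_filter, Finset.mem_Icc] at hi
        obtain ⟨⟨hi1, hi2, hi3⟩, hi4, hi5⟩ := hi
        rw [IsSwitch, not_not] at hi4 hi5
        rw [IsLeftMismatch, hi4, hi5] at hi2
        refine parentCell_mul_of_ne ?_
        intro h; rw [h] at hi2; exact hi2 Iff.rfl
      intro i hi j hj hij
      have h3 := key i hi
      rw [hij, key j hj] at h3
      exact_mod_cast (mul_right_cancel₀ hw.ne' h3).symm
  have h3 := Finset.card_le_card h1
  have h4 := Finset.card_union_le Y (S ∪ S.image (· + 1))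
  have h5 := Finset.card_union_le S (S.image (· + 1))
  have h6 : (S.image (· + 1)).card ≤ S.card := Finset.card_image_le
  omega

theorem sum_rowMismatches_le (h0 : ∀ r i, bad r i → 0 ≤ i ∧ i < 2 ^ (r / 2 ^ l + l + 1))
    {a b b' : ℝ} {r₀ R : ℕ} (hb : b + cellWidth l r₀ ≤ b') (hR : r₀ ≤ R) :
    ∑ r ∈ Finset.Ico r₀ R, cellWidth l r * (rowMismatches bad big l P a b r).card +
      rowTop l R * (rowMismatches bad big l P a b R).card ≤
    rowTop l r₀ * (rowMismatches bad big l P a b r₀).card +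
      2 * ∑ r ∈ Finset.Ico r₀ R, rowTop l (r + 1) * (rowSwitches bad big l P a b' (r + 1)).card := by
  induction R, hR using Nat.le_induction with
  | base => simp
  | succ R hR ih =>
    rw [Finset.sum_Ico_succ_top hR, Finset.sum_Ico_succ_top hR]
    have h1 : b + cellWidth l (R + 1) ≤ b' := by
      have := cellWidth_antitone l (show r₀ ≤ R + 1 by omega)
      linarith
    have h2 := card_rowMismatches_succ_le (P := P) (big := big) (a := a) h0 h1
    have h3 : ((rowMismatches bad big l P a b (R + 1)).card : ℝ) ≤
      (rowMismatches bad big l P a b R).card + 2 * (rowSwitches bad big l P a b' (R + 1)).card := by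
      exact_mod_cast h2
    have h4 := mul_le_mul_of_nonneg_left h3 (rowTop_pos l (R + 1)).le
    have h5 := rowTop_sub_succ l R
    rw [← h5] at *
    linarith

theorem sum_filter_row_eq (E : Finset (ℕ × ℤ)) (s : ℕ → Finset ℤ) (R : Finset ℕ)
    (hE : ∀ q, q ∈ E ↔ q.1 ∈ R ∧ q.2 ∈ s q.1) (w : ℕ → ℝ) :
    ∑ q ∈ E, w q.1 = ∑ r ∈ R, w r * (s r).card := by
  have : E = R.biUnion fun r => (s r).image fun i => (r, i) := by
    ext q
    rw [hE]
    simp only [Finset.mem_biUnion, Finset.mem_image]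
    constructor
    · exact fun h => ⟨q.1, h.1, q.2, h.2, rfl⟩
    · rintro ⟨r, hr, i, hi, rfl⟩; exact ⟨hr, hi⟩
  rw [this, Finset.sum_biUnion]
  · refine Finset.sum_congr rfl fun r _ => ?_
    rw [Finset.sum_image (fun i _ j _ hij => (Prod.ext_iff.1 hij).2)]
    simp only [Finset.sum_const, nsmul_eq_mul, mul_comm]
  · intro r _ r' _ hne
    rw [Function.onFun, Finset.disjoint_left]
    intro q hq hq'
    obtain ⟨i, _, rfl⟩ := Finset.mem_image.1 hq
    obtain ⟨j, _, h⟩ := Finset.mem_image.1 hq'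
    exact hne (Prod.ext_iff.1 h).1.symm

theorem rowTop_le_pow_mul (l r : ℕ) : rowTop l r ≤ 2 ^ (l + 1) * cellWidth l r := by
  have h := mul_rowTop_le_cellWidth l r
  rw [one_div_pow, one_div_mul_eq_div, div_le_iff₀ (by positivity)] at h
  linarith

theorem hasCarleson_leftMismatches
    (h0 : ∀ r i, bad r i → 0 ≤ i ∧ i < 2 ^ (r / 2 ^ l + l + 1))
    (h : HasCarleson l C ((gridCells l P).filter fun q => IsSwitch bad big l q.1 q.2)) :
    HasCarleson l (2 * 2 ^ (l + 1) + 1 + 4 * 2 ^ (l + 1) * C)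
      ((gridCells l P).filter fun q => IsLeftMismatch bad big l q.1 q.2) := by
  intro a b hb
  have hC := h.nonneg
  by_cases hex : ∃ r, r ≤ P ∧ rowTop l r ≤ b
  swap
  · rw [Finset.filter_false_of_mem, Finset.sum_empty]
    · positivity
    · intro q hq hq'
      exact hex ⟨q.1, (mem_gridCells.1 (Finset.mem_filter.1 hq).1).1, hq'.2⟩
  obtain ⟨r₀, hr₀, hr₀', hmin⟩ : ∃ r₀, r₀ ≤ P ∧ rowTop l r₀ ≤ b ∧ ∀ r, rowTop l r ≤ b → r₀ ≤ r := by
    have hex' : ∃ r, rowTop l r ≤ b := let ⟨r, _, h⟩ := hex; ⟨r, h⟩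
    obtain ⟨r, h1, h2⟩ := hex
    exact ⟨Nat.find hex', (Nat.find_min' hex' h2).trans h1, Nat.find_spec hex',
      fun r hr => Nat.find_min' hex' hr⟩
  rw [sum_filter_row_eq _ (rowMismatches bad big l P a b) (Finset.Ico r₀ (P + 1)) ?_ (cellWidth l)]
  swap
  · intro q
    rw [Finset.mem_filter, Finset.mem_filter, mem_gridCells, rowMismatches, Finset.mem_filter,
      Finset.mem_Icc, Finset.mem_Ico, cellPos]
    constructor
    · rintro ⟨⟨⟨h1, h2⟩, h3⟩, h4, h5⟩
      exact ⟨⟨hmin _ h5, by omega⟩, h2, h3, h4⟩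
    · rintro ⟨⟨h1, h2⟩, h3, h4, h5⟩
      exact ⟨⟨⟨by omega, h3⟩, h4⟩, h5, (rowTop_antitone l h1).trans hr₀'⟩
  have hw₀ : cellWidth l r₀ ≤ b := (cellWidth_le_rowTop l r₀).trans hr₀'
  have h1 := sum_rowMismatches_le (P := P) (big := big) (a := a) (b := b) (b' := 2 * b) (R := P)
    h0 (r₀ := r₀) (by linarith) hr₀
  have h2 : cellWidth l P * (rowMismatches bad big l P a b P).card ≤
      rowTop l P * (rowMismatches bad big l P a b P).card :=
    mul_le_mul_of_nonneg_right (cellWidth_le_rowTop l P) (Nat.cast_nonneg _)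
  have h3 : rowTop l r₀ * (rowMismatches bad big l P a b r₀).card ≤ (2 * 2 ^ (l + 1) + 1) * b := by
    have h4 := card_cells_le (l := l) (rowMismatches bad big l P a b r₀) r₀ (a := a) hb.le
      fun i hi => (Finset.mem_filter.1 hi).2.2
    have h5 := rowTop_le_pow_mul l r₀
    have h6 := cellWidth_pos l r₀
    have h8 := rowTop_pos l r₀
    calc _ ≤ rowTop l r₀ * (2 * b / cellWidth l r₀ + 1) := by gcongr
      _ = rowTop l r₀ / cellWidth l r₀ * (2 * b) + rowTop l r₀ := by ring
      _ ≤ 2 ^ (l + 1) * (2 * b) + b := by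
          gcongr
          rwa [div_le_iff₀ h6]
      _ = _ := by ring
  have h4 : ∑ r ∈ Finset.Ico r₀ P, rowTop l (r + 1) *
      ((rowSwitches bad big l P a (2 * b) (r + 1)).card : ℝ) ≤ 2 ^ (l + 1) * (C * (2 * b)) := by
    rw [Finset.sum_Ico_add' (fun r => rowTop l r * ((rowSwitches bad big l P a (2 * b) r).card : ℝ))]
    calc _ ≤ ∑ r ∈ Finset.Ico (r₀ + 1) (P + 1), 2 ^ (l + 1) *
            (cellWidth l r * ((rowSwitches bad big l P a (2 * b) r).card : ℝ)) := by
          refine Finset.sum_le_sum fun r _ => ?_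
          rw [← mul_assoc]
          exact mul_le_mul_of_nonneg_right (rowTop_le_pow_mul l r) (Nat.cast_nonneg _)
      _ = 2 ^ (l + 1) * ∑ q ∈ ((gridCells l P).filter fun q => IsSwitch bad big l q.1 q.2).filter
            (fun q => q.1 ∈ Finset.Ico (r₀ + 1) (P + 1) ∧ |cellPos l q - a| ≤ 2 * b),
            cellWidth l q.1 := by
          rw [← Finset.mul_sum, sum_filter_row_eq _ (rowSwitches bad big l P a (2 * b))
            (Finset.Ico (r₀ + 1) (P + 1)) ?_ (cellWidth l)]
          intro q
          rw [Finset.mem_filter, Finset.mem_filter, mem_gridCells, rowSwitches, Finset.mem_filter,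
            Finset.mem_Icc, Finset.mem_Ico, cellPos]
          constructor
          · rintro ⟨⟨⟨_, h2⟩, h3⟩, h4, h5⟩
            exact ⟨h4, h2, h3, h5⟩
          · rintro ⟨h1, h2, h3, h5⟩
            exact ⟨⟨⟨by omega, h2⟩, h3⟩, h1, h5⟩
      _ ≤ _ := by
          gcongr
          refine le_trans (Finset.sum_le_sum_of_subset_of_nonneg ?_ fun q _ _ =>
            (cellWidth_pos l q.1).le) (h a (2 * b) (by linarith))
          intro q hq
          rw [Finset.mem_filter, Finset.mem_Ico] at hq
          rw [Finset.mem_filter]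
          have h6 : rowTop l q.1 ≤ rowTop l r₀ := rowTop_antitone l (by omega)
          exact ⟨hq.1, hq.2.2, by linarith⟩
  rw [Finset.sum_Ico_succ_top hr₀]
  linarith

end

section
open Set MeasureTheory
open scoped Classical

variable {l r : ℕ} {a : ℝ}

/-- Bound for the number of cells of comparable size near a given one. -/
noncomputable def nearbyCount (l : ℕ) : ℝ := 4 * 2 ^ l * (36 * 2 ^ (l + 1) + 1)

/-- Separation constant for the rays. -/
noncomputable def sepConst (l : ℕ) (a : ℝ) : ℝ := a / (8 * (nearbyCount l + 1))

theorem nearbyCount_nonneg (l : ℕ) : 0 ≤ nearbyCount l := by unfold nearbyCount; positivity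

theorem sepConst_pos (l : ℕ) (ha : 0 < a) : 0 < sepConst l a := by
  have := nearbyCount_nonneg l
  unfold sepConst; positivity

theorem sepConst_mul (l : ℕ) (a : ℝ) : sepConst l a * (nearbyCount l + 1) = a / 8 := by
  have := nearbyCount_nonneg l
  unfold sepConst
  field_simp

theorem sepConst_le (l : ℕ) (ha : 0 < a) : sepConst l a ≤ a := by
  have := nearbyCount_nonneg l
  have h := sepConst_pos l ha
  nlinarith [sepConst_mul l a]

theorem card_comparable_le (s : Finset (ℕ × ℤ)) (r : ℕ) (p : ℝ)
    (hs : ∀ u ∈ s, u.1 ≤ r ∧ r < u.1 + 2 ^ l * 4 ∧ |cellPos l u - p| ≤ 18 * rowTop l r) :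
    (s.card : ℝ) ≤ nearbyCount l := by
  set R : Finset ℕ := (Finset.range (r + 1)).filter fun k => r < k + 2 ^ l * 4 with hR
  have hRc : R.card ≤ 2 ^ l * 4 := by
    have : R ⊆ Finset.Ico (r + 1 - 2 ^ l * 4) (r + 1) := by
      intro k hk
      rw [hR, Finset.mem_filter, Finset.mem_range] at hk
      rw [Finset.mem_Ico]; omega
    have h := Finset.card_le_card this
    rw [Nat.card_Ico] at h
    omega
  have h2 : ∀ u ∈ s, u.1 ∈ R := by
    intro u hu
    have := hs u hu
    rw [hR, Finset.mem_filter, Finset.mem_range]; omega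
  rw [Finset.card_eq_sum_card_fiberwise h2]
  push_cast
  have h3 : ∀ k ∈ R, ((s.filter fun u => u.1 = k).card : ℝ) ≤ 36 * 2 ^ (l + 1) + 1 := by
    intro k hk
    rw [hR, Finset.mem_filter, Finset.mem_range] at hk
    have h4 : (s.filter fun u => u.1 = k).card = ((s.filter fun u => u.1 = k).image Prod.snd).card := by
      rw [Finset.card_image_of_injOn]
      intro u hu v hv huv
      rw [Finset.mem_coe, Finset.mem_filter] at hu hv
      exact Prod.ext (hu.2.trans hv.2.symm) huv
    have hT := rowTop_pos l r
    have hw := cellWidth_pos l k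
    have hTk : rowTop l r ≤ rowTop l k := rowTop_antitone l (by omega)
    rw [h4]
    refine (card_cells_le (l := l) _ k (a := p) (b := 18 * rowTop l r) (by positivity) ?_).trans ?_
    · intro i hi
      obtain ⟨u, hu, rfl⟩ := Finset.mem_image.1 hi
      rw [Finset.mem_filter] at hu
      have := (hs u hu.1).2.2
      rw [cellPos, hu.2] at this
      exact this
    · have := rowTop_le_pow_mul l k
      gcongr
      rw [div_le_iff₀ hw]
      nlinarith
  refine (Finset.sum_le_sum h3).trans ?_
  rw [Finset.sum_const, nsmul_eq_mul, nearbyCount]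
  gcongr
  have : (R.card : ℝ) ≤ (2 ^ l * 4 : ℕ) := by exact_mod_cast hRc
  push_cast at this
  linarith

theorem exists_separated_points (ha : 0 < a) (ha1 : a ≤ 1) (V : Finset (ℕ × ℤ)) (G : ℕ × ℤ → Set ℝ)
    (hG : ∀ v ∈ V, ∀ x ∈ G v, |x - cellPos l v| ≤ a * rowTop l v.1)
    (hvol : ∀ v ∈ V, ENNReal.ofReal (a * rowTop l v.1) ≤ volume (G v)) :
    ∃ x : ℕ × ℤ → ℝ, (∀ v ∈ V, x v ∈ G v) ∧ ∀ u ∈ V, ∀ v ∈ V, u ≠ v → u.1 ≤ v.1 →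
      sepConst l a * rowTop l v.1 ≤ |x u - x v| := by
  induction V using Finset.induction_on_max_value (fun v : ℕ × ℤ => v.1) with
  | empty => exact ⟨fun _ => 0, by simp, by simp⟩
  | insert v s hvs hmax ih =>
    obtain ⟨x, hx, hsep⟩ := ih (fun u hu => hG u (Finset.mem_insert_of_mem hu))
      (fun u hu => hvol u (Finset.mem_insert_of_mem hu))
    have hκ := sepConst_pos l ha
    have hκa := sepConst_le l ha
    set κ := sepConst l a with hκdef
    have hT := rowTop_pos l v.1
    set T := rowTop l v.1 with hTdef
    obtain ⟨y, hy, hyx⟩ : ∃ y ∈ G v, ∀ u ∈ s, κ * T ≤ |x u - y| := by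
      by_contra hcon
      push Not at hcon
      set s' := s.filter fun u => |x u - cellPos l v| ≤ 2 * a * T with hs'
      have hcover : G v ⊆ ⋃ u ∈ s', Metric.ball (x u) (κ * T) := by
        intro y hy
        obtain ⟨u, hu, huy⟩ := hcon y hy
        refine mem_iUnion₂.2 ⟨u, ?_, ?_⟩
        · rw [hs', Finset.mem_filter]
          refine ⟨hu, ?_⟩
          have h1 := hG v (Finset.mem_insert_self _ _) y hy
          calc |x u - cellPos l v| ≤ |x u - y| + |y - cellPos l v| := abs_sub_le _ _ _
            _ ≤ κ * T + a * T := by gcongr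
            _ ≤ a * T + a * T := by gcongr
            _ = _ := by ring
        · rw [Metric.mem_ball, Real.dist_eq, abs_sub_comm]; exact huy
      have h1 : ENNReal.ofReal (a * T) ≤ ENNReal.ofReal (s'.card * (2 * (κ * T))) := by
        refine (hvol v (Finset.mem_insert_self _ _)).trans ((measure_mono hcover).trans ?_)
        refine (measure_biUnion_finset_le _ _).trans ?_
        simp only [Real.volume_ball, Finset.sum_const, nsmul_eq_mul]
        rw [ENNReal.ofReal_mul (p := (s'.card : ℝ)) (by positivity), ENNReal.ofReal_natCast]
      rw [ENNReal.ofReal_le_ofReal_iff (by positivity)] at h1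
      set near := s'.filter fun u => v.1 < u.1 + 2 ^ l * 4 with hnear
      set far := s'.filter fun u => ¬ v.1 < u.1 + 2 ^ l * 4 with hfar
      have h2 : (near.card : ℝ) ≤ nearbyCount l := by
        refine card_comparable_le near v.1 (cellPos l v) ?_
        intro u hu
        rw [hnear, Finset.mem_filter, hs', Finset.mem_filter] at hu
        refine ⟨hmax u hu.1.1, hu.2, ?_⟩
        have h3 := hG u (Finset.mem_insert_of_mem hu.1.1) _ (hx u hu.1.1)
        have h4 : rowTop l u.1 ≤ 16 * T := by
          have h5 := rowTop_add_mul l u.1 4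
          have h6 := rowTop_antitone l hu.2.le
          rw [h5] at h6
          norm_num at h6
          linarith
        have h5 := rowTop_pos l u.1
        calc |cellPos l u - cellPos l v| ≤ |cellPos l u - x u| + |x u - cellPos l v| :=
              abs_sub_le _ _ _
          _ ≤ a * rowTop l u.1 + 2 * a * T := by
              rw [abs_sub_comm]; exact add_le_add h3 hu.1.2
          _ ≤ 1 * (16 * T) + 2 * 1 * T := by gcongr
          _ = _ := by ring
      have h3 : (far.card : ℝ) ≤ (cellPos l v + 2 * a * T - (cellPos l v - 2 * a * T)) / (κ * (16 * T)) + 1 := by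
        refine card_le_of_separated far x (by positivity) (by nlinarith) ?_ ?_
        · intro u hu
          rw [hfar, Finset.mem_filter, hs', Finset.mem_filter] at hu
          have := abs_le.1 hu.1.2
          constructor <;> linarith
        · have key : ∀ u ∈ far, ∀ w ∈ far, u ≠ w → u.1 ≤ w.1 → κ * (16 * T) ≤ |x u - x w| := by
            intro u hu w hw huw hle
            rw [hfar, Finset.mem_filter, hs', Finset.mem_filter] at hu hw
            refine le_trans ?_ (hsep u hu.1.1 w hw.1.1 huw hle)
            have h5 := rowTop_add_mul l w.1 4
            have h6 := rowTop_antitone l (not_lt.1 hw.2)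
            rw [h5] at h6
            norm_num at h6
            gcongr
            linarith
          intro u hu w hw huw
          rcases le_total u.1 w.1 with h | h
          · exact key u hu w hw huw h
          · rw [abs_sub_comm]; exact key w hw u hu huw.symm h
      have h4 : (s'.card : ℝ) = near.card + far.card := by
        exact_mod_cast (Finset.card_filter_add_card_filter_not _).symm
      have h5 : (cellPos l v + 2 * a * T - (cellPos l v - 2 * a * T)) / (κ * (16 * T)) = a / (4 * κ) := by
        field_simp
        ring
      rw [h5] at h3
      have h6 : (s'.card : ℝ) * κ ≤ (nearbyCount l + 1) * κ + a / 4 := by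
        calc (s'.card : ℝ) * κ ≤ (nearbyCount l + (a / (4 * κ) + 1)) * κ := by
              gcongr; linarith
          _ = _ := by field_simp; ring
      have h7 := sepConst_mul l a
      rw [← hκdef] at h7
      nlinarith
    refine ⟨Function.update x v y, ?_, ?_⟩
    · intro u hu
      by_cases h : u = v
      · rw [h, Function.update_self]; exact hy
      · rw [Function.update_of_ne h]
        exact hx u (Finset.mem_of_mem_insert_of_ne hu h)
    · intro u hu w hw huw hle
      by_cases h : u = v
      · have hw' : w ≠ v := fun h' => huw (h.trans h'.symm)
        have hws := Finset.mem_of_mem_insert_of_ne hw hw'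
        rw [h, Function.update_self, Function.update_of_ne hw', abs_sub_comm]
        have e : w.1 = v.1 := le_antisymm (hmax w hws) (h ▸ hle)
        rw [e]
        exact hyx w hws
      · have hus := Finset.mem_of_mem_insert_of_ne hu h
        rw [Function.update_of_ne h]
        by_cases h' : w = v
        · rw [h', Function.update_self]; exact hyx u hus
        · rw [Function.update_of_ne h']
          exact hsep u hus w (Finset.mem_of_mem_insert_of_ne hw h') huw hle
end

section
open Set
open scoped Classical

variable {l P r : ℕ} {i : ℤ} {a κ C : ℝ} {V : Finset (ℕ × ℤ)} {x : ℕ × ℤ → ℝ}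

/-- The cells met by the vertical rays going down from the cells of `V` at the abscissae `x`. -/
noncomputable def rayCells (l P : ℕ) (V : Finset (ℕ × ℤ)) (x : ℕ × ℤ → ℝ) : Finset (ℕ × ℤ) :=
  V.biUnion fun v => (Finset.Icc v.1 P).image fun k => (k, cellAt l k (x v))

theorem mem_rayCells {q : ℕ × ℤ} : q ∈ rayCells l P V x ↔
    q.1 ≤ P ∧ ∃ v ∈ V, v.1 ≤ q.1 ∧ cellAt l q.1 (x v) = q.2 := by
  simp only [rayCells, Finset.mem_biUnion, Finset.mem_image, Finset.mem_Icc]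
  constructor
  · rintro ⟨v, hv, k, hk, rfl⟩; exact ⟨hk.2, v, hv, hk.1, rfl⟩
  · rintro ⟨h, v, hv, h1, h2⟩; exact ⟨v, hv, q.1, ⟨h1, h⟩, Prod.ext rfl h2⟩

theorem card_rays_le (hκ : 0 < κ)
    (hsep : ∀ u ∈ V, ∀ v ∈ V, u ≠ v → u.1 ≤ v.1 → κ * rowTop l v.1 ≤ |x u - x v|)
    {s : Finset (ℕ × ℤ)} (hs : s ⊆ V) {A B d : ℝ} (hAB : A ≤ B) (hd : 0 < d)
    (hsx : ∀ v ∈ s, x v ∈ Icc A B) (hT : ∀ v ∈ s, d ≤ rowTop l v.1) :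
    (s.card : ℝ) ≤ (B - A) / (κ * d) + 1 := by
  refine card_le_of_separated s x (by positivity) hAB hsx ?_
  have key : ∀ u ∈ s, ∀ w ∈ s, u ≠ w → u.1 ≤ w.1 → κ * d ≤ |x u - x w| := by
    intro u hu w hw huw hle
    refine le_trans ?_ (hsep u (hs hu) w (hs hw) huw hle)
    exact mul_le_mul_of_nonneg_left (hT w hw) hκ.le
  intro u hu w hw huw
  rcases le_total u.1 w.1 with h | h
  · exact key u hu w hw huw h
  · rw [abs_sub_comm]; exact key w hw u hu huw.symm h

theorem card_rays_cell_le (hκ : 0 < κ)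
    (hsep : ∀ u ∈ V, ∀ v ∈ V, u ≠ v → u.1 ≤ v.1 → κ * rowTop l v.1 ≤ |x u - x v|) (r : ℕ) (i : ℤ) :
    ((V.filter fun v => v.1 ≤ r ∧ cellAt l r (x v) = i).card : ℝ) ≤ 1 / κ + 1 := by
  have hw := cellWidth_pos l r
  have hT := rowTop_pos l r
  refine (card_rays_le hκ hsep (Finset.filter_subset _ _) (A := i * cellWidth l r)
    (B := (i + 1) * cellWidth l r) (by nlinarith) hT ?_ ?_).trans ?_
  · intro v hv
    have := cellAt_eq_iff.1 (Finset.mem_filter.1 hv).2.2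
    exact ⟨this.1, this.2.le⟩
  · intro v hv
    exact rowTop_antitone l (Finset.mem_filter.1 hv).2.1
  · have := cellWidth_le_rowTop l r
    have h : ((i + 1) * cellWidth l r - i * cellWidth l r) / (κ * rowTop l r) ≤ 1 / κ := by
      rw [div_le_div_iff₀ (by positivity) hκ]
      nlinarith
    linarith

theorem hasCarleson_rayCells (hV : HasCarleson l C V) (ha : 0 ≤ a) (ha1 : a ≤ 1)
    (hx : ∀ v ∈ V, |x v - cellPos l v| ≤ a * rowTop l v.1) (hκ : 0 < κ)
    (hsep : ∀ u ∈ V, ∀ v ∈ V, u ≠ v → u.1 ≤ v.1 → κ * rowTop l v.1 ≤ |x u - x v|) :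
    HasCarleson l (3 * 2 ^ (l + 1) * C + 4 / κ + 1) (rayCells l P V x) := by
  intro c b hb
  have hC := hV.nonneg
  by_cases hex : ∃ r, rowTop l r ≤ b
  swap
  · rw [Finset.filter_false_of_mem, Finset.sum_empty]
    · positivity
    · intro q hq hq'
      exact hex ⟨q.1, hq'.2⟩
  obtain ⟨r₀, hr₀, hmin⟩ : ∃ r₀, rowTop l r₀ ≤ b ∧ ∀ r, rowTop l r ≤ b → r₀ ≤ r :=
    ⟨Nat.find hex, Nat.find_spec hex, fun r hr => Nat.find_min' hex hr⟩
  set F := V.filter fun v => |x v - c| ≤ 2 * b with hF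
  set D : ℕ × ℤ → Finset (ℕ × ℤ) := fun v =>
    (Finset.Ico (max r₀ v.1) (P + 1)).image fun k => (k, cellAt l k (x v)) with hD
  have hcov := sum_le_of_cover (A := ∅) (F := F) (D := D) (w := fun q => cellWidth l q.1)
    (s := (rayCells l P V x).filter fun q => |cellPos l q - c| ≤ b ∧ rowTop l q.1 ≤ b)
    (fun q => (cellWidth_pos l q.1).le) (by
      intro q hq
      right
      rw [Finset.mem_filter, mem_rayCells] at hq
      obtain ⟨⟨hqP, v, hv, hvq, hqx⟩, h1, h2⟩ := hq
      refine ⟨v, ?_, ?_⟩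
      · rw [hF, Finset.mem_filter]
        refine ⟨hv, ?_⟩
        have h3 := cellAt_eq_iff.1 hqx
        have h4 := cellWidth_le_rowTop l q.1
        rw [cellPos, abs_le] at h1
        rw [abs_le]
        constructor <;> linarith
      · refine Finset.mem_image.2 ⟨q.1, ?_, Prod.ext rfl hqx⟩
        rw [Finset.mem_Ico]
        have := hmin _ h2
        omega)
  rw [Finset.sum_empty, zero_add] at hcov
  refine hcov.trans ?_
  have hDle : ∀ v, ∑ q ∈ D v, cellWidth l q.1 ≤ rowTop l (max r₀ v.1) := by
    intro v
    rw [hD]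
    simp only
    rw [Finset.sum_image (fun k _ k' _ h => (Prod.ext_iff.1 h).1)]
    exact sum_cellWidth_le l _
  refine (Finset.sum_le_sum fun v _ => hDle v).trans ?_
  rw [← Finset.sum_filter_add_sum_filter_not F (fun v => rowTop l v.1 ≤ b)]
  have h1 : ∑ v ∈ F.filter (fun v => rowTop l v.1 ≤ b), rowTop l (max r₀ v.1) ≤
      2 ^ (l + 1) * (C * (3 * b)) := by
    calc _ ≤ ∑ v ∈ F.filter (fun v => rowTop l v.1 ≤ b), 2 ^ (l + 1) * cellWidth l v.1 :=
          Finset.sum_le_sum fun v _ =>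
            (rowTop_antitone l (le_max_right r₀ v.1)).trans (rowTop_le_pow_mul l v.1)
      _ ≤ _ := by
          rw [← Finset.mul_sum]
          gcongr
          refine le_trans (Finset.sum_le_sum_of_subset_of_nonneg ?_ fun q _ _ =>
            (cellWidth_pos l q.1).le) (hV c (3 * b) (by linarith))
          intro v hv
          rw [Finset.mem_filter, hF, Finset.mem_filter] at hv
          rw [Finset.mem_filter]
          have h3 := hx v hv.1.1
          have hT := rowTop_pos l v.1
          have h4 : |x v - cellPos l v| ≤ b := h3.trans (by nlinarith [hv.2])
          refine ⟨hv.1.1, ?_, by linarith [hv.2]⟩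
          calc |cellPos l v - c| ≤ |cellPos l v - x v| + |x v - c| := abs_sub_le _ _ _
            _ ≤ b + 2 * b := by rw [abs_sub_comm]; exact add_le_add h4 hv.1.2
            _ = _ := by ring
  have h2 : ∑ v ∈ F.filter (fun v => ¬ rowTop l v.1 ≤ b), rowTop l (max r₀ v.1) ≤
      (4 / κ + 1) * b := by
    have h3 := card_rays_le hκ hsep (s := F.filter fun v => ¬ rowTop l v.1 ≤ b)
      ((Finset.filter_subset _ _).trans (Finset.filter_subset _ _)) (A := c - 2 * b)
      (B := c + 2 * b) (by linarith) hb (fun v hv => by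
        rw [Finset.mem_filter, hF, Finset.mem_filter] at hv
        have := abs_le.1 hv.1.2
        constructor <;> linarith) (fun v hv => (not_le.1 (Finset.mem_filter.1 hv).2).le)
    calc _ ≤ ∑ v ∈ F.filter (fun v => ¬ rowTop l v.1 ≤ b), b :=
          Finset.sum_le_sum fun v _ => (rowTop_antitone l (le_max_left r₀ v.1)).trans hr₀
      _ = (F.filter (fun v => ¬ rowTop l v.1 ≤ b)).card * b := by rw [Finset.sum_const, nsmul_eq_mul]
      _ ≤ ((c + 2 * b - (c - 2 * b)) / (κ * b) + 1) * b := by gcongr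
      _ = _ := by field_simp; ring
  calc _ ≤ 2 ^ (l + 1) * (C * (3 * b)) + (4 / κ + 1) * b := add_le_add h1 h2
    _ = _ := by ring
end

section
open Set
open scoped Classical

variable {l P r : ℕ} {i k : ℤ} {bl bt : ℕ → ℤ → ℤ} {V : Finset (ℕ × ℤ)} {x : ℕ × ℤ → ℝ}

/-- The circulation of the jumps `bl` (across left edges) and `bt` (across top edges) around the
upper left corner of a cell. -/
def gridCharge (l : ℕ) (bl bt : ℕ → ℤ → ℤ) : ℕ → ℤ → ℤ
  | 0, _ => 0
  | r + 1, k => bl (r + 1) k -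
      (if parentCell l r k = parentCell l r (k - 1) then 0 else bl r (parentCell l r k)) -
      bt r k + bt r (k - 1)

/-- An integer valued function on the cells whose jumps are `bl` and `bt` up to multiples of the
charges along rays. -/
noncomputable def gridHeight (l : ℕ) (bl bt : ℕ → ℤ → ℤ) (V : Finset (ℕ × ℤ)) (x : ℕ × ℤ → ℝ)
    (r : ℕ) (i : ℤ) : ℤ :=
  ∑ k ∈ Finset.Icc 0 i, bl r k -
    ∑ v ∈ V, gridCharge l bl bt v.1 v.2 * if v.1 ≤ r ∧ cellAt l r (x v) ≤ i then 1 else 0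

theorem Icc_zero_eq_insert (hi : 0 ≤ i) : Finset.Icc 0 i = insert i (Finset.Icc 0 (i - 1)) := by
  ext j
  rw [Finset.mem_insert, Finset.mem_Icc, Finset.mem_Icc]
  omega

theorem sum_Icc_zero_sub (f : ℤ → ℤ) (hf : ∀ i < 0, f i = 0) (i : ℤ) :
    ∑ k ∈ Finset.Icc 0 i, f k = ∑ k ∈ Finset.Icc 0 (i - 1), f k + f i := by
  rcases le_or_gt 0 i with h | h
  · rw [Icc_zero_eq_insert h, Finset.sum_insert (by simp), add_comm]
  · rw [hf i h, Finset.Icc_eq_empty (by omega), Finset.Icc_eq_empty (by omega)]; simp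

theorem gridHeight_sub_left (hbl : ∀ i < 0, bl r i = 0) :
    gridHeight l bl bt V x r i - gridHeight l bl bt V x r (i - 1) = bl r i -
      ∑ v ∈ V, gridCharge l bl bt v.1 v.2 *
        if v.1 ≤ r ∧ cellAt l r (x v) = i then 1 else 0 := by
  unfold gridHeight
  rw [sum_Icc_zero_sub _ hbl]
  have : ∑ v ∈ V, gridCharge l bl bt v.1 v.2 * (if v.1 ≤ r ∧ cellAt l r (x v) ≤ i then 1 else 0) =
      ∑ v ∈ V, gridCharge l bl bt v.1 v.2 * (if v.1 ≤ r ∧ cellAt l r (x v) ≤ i - 1 then 1 else 0) +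
      ∑ v ∈ V, gridCharge l bl bt v.1 v.2 * (if v.1 ≤ r ∧ cellAt l r (x v) = i then 1 else 0) := by
    rw [← Finset.sum_add_distrib]
    refine Finset.sum_congr rfl fun v _ => ?_
    rw [← mul_add]
    congr 1
    split_ifs <;> omega
  rw [this]
  ring

theorem sum_bl_sub_parent (hbl : ∀ r, ∀ i < 0, bl r i = 0) (hbt : ∀ i < 0, bt r i = 0) (i : ℤ) :
    ∑ k ∈ Finset.Icc 0 i, bl (r + 1) k - ∑ k ∈ Finset.Icc 0 (parentCell l r i), bl r k =
      ∑ k ∈ Finset.Icc 0 i, gridCharge l bl bt (r + 1) k + bt r i := by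
  rcases lt_or_ge i 0 with h | h
  · have h1 : parentCell l r i < 0 := by unfold parentCell; split_ifs <;> omega
    rw [Finset.Icc_eq_empty (by omega), Finset.Icc_eq_empty (by omega), hbt i h]; simp
  obtain ⟨n, hn⟩ : ∃ n : ℕ, i = n - 1 := ⟨(i + 1).toNat, by omega⟩
  clear h
  induction n generalizing i with
  | zero =>
    have h : i = -1 := by simpa using hn
    have h1 : parentCell l r i < 0 := by unfold parentCell; split_ifs <;> omega
    rw [Finset.Icc_eq_empty (by omega), Finset.Icc_eq_empty (by omega), hbt i (by omega)]; simp
  | succ n ih =>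
    push_cast at hn
    have hi : 0 ≤ i := by omega
    have h2 := ih (i - 1) (by omega)
    rw [Icc_zero_eq_insert hi, Finset.sum_insert (by simp), Finset.sum_insert (by simp)]
    have h3 : ∑ k ∈ Finset.Icc 0 (parentCell l r i), bl r k =
        ∑ k ∈ Finset.Icc 0 (parentCell l r (i - 1)), bl r k +
        if parentCell l r i = parentCell l r (i - 1) then 0 else bl r (parentCell l r i) := by
      split_ifs with h
      · rw [h, add_zero]
      · rcases parentCell_sub_one (l := l) (r := r) (i := i) with h' | h'
        · exact absurd h'.symm h
        · rw [h']; exact sum_Icc_zero_sub _ (hbl r) _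
    rw [h3]
    simp only [gridCharge] at h2 ⊢
    linarith

theorem gridHeight_sub_parent (hbl : ∀ r, ∀ i < 0, bl r i = 0) (hbt : ∀ i < 0, bt r i = 0)
    (hV : ∀ k, gridCharge l bl bt (r + 1) k ≠ 0 → (r + 1, k) ∈ V) (hV0 : ∀ v ∈ V, 0 ≤ v.2) :
    gridHeight l bl bt V x (r + 1) i - gridHeight l bl bt V x r (parentCell l r i) = bt r i +
      ∑ v ∈ V, gridCharge l bl bt v.1 v.2 *
        ((if v.1 = r + 1 ∧ v.2 ≤ i then 1 else 0) -
          (if v.1 ≤ r + 1 ∧ cellAt l (r + 1) (x v) ≤ i then 1 else 0) +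
          (if v.1 ≤ r ∧ cellAt l r (x v) ≤ parentCell l r i then 1 else 0)) := by
  have h1 : ∑ k ∈ Finset.Icc 0 i, gridCharge l bl bt (r + 1) k =
      ∑ v ∈ V, gridCharge l bl bt v.1 v.2 * (if v.1 = r + 1 ∧ v.2 ≤ i then 1 else 0) := by
    simp only [mul_ite, mul_one, mul_zero]
    rw [← Finset.sum_filter]
    have h2 : V.filter (fun v => v.1 = r + 1 ∧ v.2 ≤ i) =
        ((Finset.Icc 0 i).filter fun k => (r + 1, k) ∈ V).image fun k => (r + 1, k) := by
      ext v
      simp only [Finset.mem_filter, Finset.mem_image, Finset.mem_Icc]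
      constructor
      · rintro ⟨h, h', h''⟩
        exact ⟨v.2, ⟨⟨hV0 v h, h''⟩, by rw [← h']; exact h⟩, by rw [← h']⟩
      · rintro ⟨k, ⟨⟨h, h'⟩, h''⟩, rfl⟩
        exact ⟨h'', rfl, h'⟩
    rw [h2, Finset.sum_image (fun k _ k' _ h => (Prod.ext_iff.1 h).2), Finset.sum_filter]
    refine Finset.sum_congr rfl fun k _ => ?_
    split_ifs with h
    · rfl
    · by_contra hne; exact h (hV k hne)
  have h3 := sum_bl_sub_parent (l := l) hbl hbt i
  simp only [mul_add, mul_sub, Finset.sum_add_distrib, Finset.sum_sub_distrib, ← h1]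
  unfold gridHeight
  linarith

theorem abs_sum_mul_le {ι : Type*} (V : Finset ι) (c t : ι → ℤ) (p : ι → Prop) {A : ℤ} (hA : 0 ≤ A)
    (hc : ∀ v ∈ V, |c v| ≤ A) (ht : ∀ v ∈ V, |t v| ≤ 1) (htp : ∀ v ∈ V, t v ≠ 0 → p v) :
    |∑ v ∈ V, c v * t v| ≤ A * (V.filter p).card := by
  have : ∑ v ∈ V, c v * t v = ∑ v ∈ V.filter p, c v * t v := by
    rw [Finset.sum_filter]
    refine Finset.sum_congr rfl fun v hv => ?_
    split_ifs with h
    · rfl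
    · have : t v = 0 := by by_contra hne; exact h (htp v hv hne)
      rw [this, mul_zero]
  rw [this]
  refine (Finset.abs_sum_le_sum_abs _ _).trans ?_
  refine (Finset.sum_le_card_nsmul _ _ A ?_).trans (by rw [nsmul_eq_mul, mul_comm])
  intro v hv
  rw [Finset.mem_filter] at hv
  rw [abs_mul]
  calc |c v| * |t v| ≤ A * 1 := mul_le_mul (hc v hv.1) (ht v hv.1) (abs_nonneg _) hA
    _ = A := mul_one A

theorem abs_gridCharge_le (hbl : ∀ r i, |bl r i| ≤ 1) (hbt : ∀ r i, |bt r i| ≤ 1) (r : ℕ) (k : ℤ) :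
    |gridCharge l bl bt r k| ≤ 4 := by
  cases r with
  | zero => simp [gridCharge]
  | succ r =>
    have h1 := hbl (r + 1) k
    have h2 := hbl r (parentCell l r k)
    have h3 := hbt r k
    have h4 := hbt r (k - 1)
    simp only [gridCharge]
    rw [abs_le] at *
    split_ifs <;> omega
end

section
open Set MeasureTheory
open scoped Classical

variable {bad big : ℕ → ℤ → Prop} {l P r : ℕ} {i k : ℤ} {bl bt : ℕ → ℤ → ℤ} {V : Finset (ℕ × ℤ)}
  {x : ℕ × ℤ → ℝ} {a κ C : ℝ} {good : ℕ → ℤ → Prop}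

/-- Cells at the boundary of the inside region. -/
def IsFrontier (bad big : ℕ → ℤ → Prop) (l r : ℕ) (i : ℤ) : Prop :=
  IsSwitch bad big l r i ∨ IsLeftMismatch bad big l r i

theorem isFrontier_of_gridCharge_ne_zero
    (hbl : ∀ r i, bl r i ≠ 0 → IsInside bad big l r i ∧ IsInside bad big l r (i - 1))
    (hbt : ∀ r i, bt r i ≠ 0 → IsInside bad big l (r + 1) i ∧ IsInside bad big l r (parentCell l r i))
    (hclosed : ∀ r k, IsInside bad big l (r + 1) k → IsInside bad big l (r + 1) (k - 1) →
      IsInside bad big l r (parentCell l r k) → IsInside bad big l r (parentCell l r (k - 1)) →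
      gridCharge l bl bt (r + 1) k = 0)
    (h : gridCharge l bl bt r k ≠ 0) :
    IsFrontier bad big l r k ∨ IsFrontier bad big l r (k - 1) := by
  cases r with
  | zero => exact absurd rfl h
  | succ r =>
    by_contra hcon
    simp only [IsFrontier, IsSwitch, IsLeftMismatch, not_or, not_not] at hcon
    obtain ⟨⟨h1, h2⟩, h3, -⟩ := hcon
    by_cases h4 : IsInside bad big l (r + 1) k
    · exact h (hclosed r k h4 (h2.1 h4) (h1.1 h4) (h3.1 (h2.1 h4)))
    · have h5 : ¬ IsInside bad big l r (parentCell l r k) := fun h' => h4 (h1.2 h')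
      have e1 : bl (r + 1) k = 0 := by by_contra h'; exact h4 (hbl _ _ h').1
      have e2 : bl r (parentCell l r k) = 0 := by by_contra h'; exact h5 (hbl _ _ h').1
      have e3 : bt r k = 0 := by by_contra h'; exact h4 (hbt _ _ h').1
      have e4 : bt r (k - 1) = 0 := by
        by_contra h'; exact h4 (h2.2 (hbt _ _ h').1)
      exact h (by simp [gridCharge, e1, e2, e3, e4])

theorem IsFrontier.mem_range (h0 : ∀ r i, bad r i → 0 ≤ i ∧ i < 2 ^ (r / 2 ^ l + l + 1))
    (h : IsFrontier bad big l r i) : 0 ≤ i ∧ i ≤ 2 ^ (r / 2 ^ l + l + 1) := by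
  have key : ∀ {r i}, IsInside bad big l r i → 0 ≤ i ∧ i < 2 ^ (r / 2 ^ l + l + 1) :=
    fun h => h.mem_range h0
  rcases h with h | h
  · cases r with
    | zero => exact h.elim
    | succ r =>
      by_cases h1 : IsInside bad big l (r + 1) i
      · have := key h1; omega
      · have h2 : IsInside bad big l r (parentCell l r i) := by rw [IsSwitch] at h; tauto
        have h3 := key h2
        rcases succ_div_mod_cases l r with ⟨e1, e2, -⟩ | ⟨e1, e2, -⟩
        · rw [parentCell, if_neg e1] at h3; rw [e2]; omega
        · rw [parentCell, if_pos e1] at h3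
          rw [e2, show r / 2 ^ l + 1 + l + 1 = (r / 2 ^ l + l + 1) + 1 by ring, pow_succ]
          omega
  · by_cases h1 : IsInside bad big l r i
    · have := key h1; omega
    · have h2 : IsInside bad big l r (i - 1) := by rw [IsLeftMismatch] at h; tauto
      have := key h2
      omega

theorem IsFrontier.mem_gridCells (h0 : ∀ r i, bad r i → 0 ≤ i ∧ i < 2 ^ (r / 2 ^ l + l + 1))
    (h : IsFrontier bad big l r i) (hr : r ≤ P) : (r, i) ∈ gridCells l P := by
  have := h.mem_range h0
  rw [_root_.mem_gridCells]
  refine ⟨hr, this.1, this.2.trans ?_⟩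
  refine pow_le_pow_right₀ (by norm_num) ?_
  have := Nat.div_le_self r (2 ^ l)
  omega

theorem abs_cellAt_sub_le (ha1 : a ≤ 1) {v : ℕ × ℤ} {y : ℝ}
    (hx : |y - cellPos l v| ≤ a * rowTop l v.1) : |cellAt l v.1 y - v.2| ≤ 2 ^ (l + 1) := by
  have hw := cellWidth_pos l v.1
  have hT := rowTop_pos l v.1
  have h1 := rowTop_le_pow_mul l v.1
  have h2 : |y / cellWidth l v.1 - v.2| ≤ 2 ^ (l + 1) := by
    have e : y / cellWidth l v.1 - v.2 = (y - cellPos l v) / cellWidth l v.1 := by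
      rw [cellPos]; field_simp
    rw [e, abs_div, abs_of_pos hw, div_le_iff₀ hw]
    nlinarith
  rw [abs_le] at h2 ⊢
  have h3 := Int.floor_le (y / cellWidth l v.1)
  have h4 : (v.2 - 2 ^ (l + 1) : ℤ) ≤ ⌊y / cellWidth l v.1⌋ := by
    rw [Int.le_floor]; push_cast; linarith
  have h5 : (⌊y / cellWidth l v.1⌋ : ℤ) ≤ v.2 + 2 ^ (l + 1) := by
    have : (⌊y / cellWidth l v.1⌋ : ℝ) ≤ v.2 + 2 ^ (l + 1) := by linarith
    exact_mod_cast this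
  rw [cellAt]
  constructor <;> omega

/-- A cell between the corner `v` and the ray starting next to it. -/
def IsLink (l : ℕ) (x : ℕ × ℤ → ℝ) (v : ℕ × ℤ) (i : ℤ) : Prop :=
  ¬ (v.2 ≤ i ↔ cellAt l v.1 (x v) ≤ i)

theorem IsLink.abs_cellPos_sub_le {v : ℕ × ℤ} (h : IsLink l x v i)
    (hx : |x v - cellPos l v| ≤ a * rowTop l v.1) :
    |cellPos l (v.1, i) - cellPos l v| ≤ a * rowTop l v.1 + cellWidth l v.1 := by
  have hw := cellWidth_pos l v.1
  have h1 := (cellAt_eq_iff (l := l) (r := v.1) (x := x v) (i := cellAt l v.1 (x v))).1 rfl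
  simp only [cellPos] at *
  rw [abs_le] at *
  by_cases h2 : v.2 ≤ i
  · have h3 : i + 1 ≤ cellAt l v.1 (x v) := by rw [IsLink] at h; by_contra h'; exact h (by omega)
    have h4 : (v.2 : ℝ) ≤ i := by exact_mod_cast h2
    have h5 : (i : ℝ) + 1 ≤ cellAt l v.1 (x v) := by exact_mod_cast h3
    constructor <;> nlinarith
  · have h3 : cellAt l v.1 (x v) ≤ i := by rw [IsLink] at h; by_contra h'; exact h (by omega)
    have h4 : (i : ℝ) + 1 ≤ v.2 := by exact_mod_cast not_le.1 h2
    have h5 : (cellAt l v.1 (x v) : ℝ) ≤ i := by exact_mod_cast h3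
    constructor <;> nlinarith

theorem IsLink.abs_sub_le {v : ℕ × ℤ} (h : IsLink l x v i) (ha1 : a ≤ 1)
    (hx : |x v - cellPos l v| ≤ a * rowTop l v.1) : |i - v.2| ≤ 2 ^ (l + 1) := by
  have h1 := abs_cellAt_sub_le ha1 hx
  rw [abs_le] at *
  rw [IsLink] at h
  constructor <;> omega

theorem card_link_le (ha1 : a ≤ 1) (hx : ∀ v ∈ V, |x v - cellPos l v| ≤ a * rowTop l v.1) (r : ℕ) (i : ℤ) :
    (V.filter fun v => v.1 = r ∧ IsLink l x v i).card ≤ 2 * 2 ^ (l + 1) + 1 := by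
  have h1 : (V.filter fun v => v.1 = r ∧ IsLink l x v i).card ≤
      (Finset.Icc (i - 2 ^ (l + 1)) (i + 2 ^ (l + 1))).card := by
    refine Finset.card_le_card_of_injOn Prod.snd ?_ ?_
    · intro v hv
      rw [Finset.mem_coe, Finset.mem_filter] at hv
      have := abs_le.1 (hv.2.2.abs_sub_le ha1 (hx v hv.1))
      rw [Finset.mem_coe, Finset.mem_Icc]
      omega
    · intro u hu v hv huv
      rw [Finset.mem_coe, Finset.mem_filter] at hu hv
      exact Prod.ext (hu.2.1.trans hv.2.1.symm) huv
  rw [Int.card_Icc] at h1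
  refine h1.trans ?_
  have : (0 : ℤ) < 2 ^ (l + 1) := by positivity
  zify
  omega
end

section
open Set MeasureTheory
open scoped Classical

variable {bad big : ℕ → ℤ → Prop} {l P r : ℕ} {i k : ℤ} {bl bt : ℕ → ℤ → ℤ} {V : Finset (ℕ × ℤ)}
  {x : ℕ × ℤ → ℝ} {a κ C : ℝ} {good : ℕ → ℤ → Prop}

/-- Bound for the jumps of the height function. -/
noncomputable def jumpConst (l : ℕ) (a : ℝ) : ℝ :=
  4 * ((1 / sepConst l a + 1) + (2 * 2 ^ (l + 1) + 1)) + 1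

/-- Carleson constant of the set of cells at which the height function jumps. -/
noncomputable def seedConst (l : ℕ) (a C : ℝ) : ℝ :=
  C + (3 * 2 ^ (l + 1) * (120 * C) + 4 / sepConst l a + 1) +
    120 * (3 * 2 ^ (l + 1) * (120 * C) + 4 / sepConst l a + 1) +
    6 * (4 * 2 ^ (l + 1) + 1) * (2 + 2 * 2 ^ (l + 1)) * (120 * C)

/-- The cells below the cells of a set. -/
noncomputable def childCells (l P : ℕ) (R : Finset (ℕ × ℤ)) : Finset (ℕ × ℤ) :=
  (R.biUnion fun e => {(e.1 + 1, 2 * e.2), (e.1 + 1, 2 * e.2 + 1), (e.1 + 1, e.2)}).filter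
    fun q => q.1 ≤ P ∧ ∃ r, q.1 = r + 1 ∧ (r, parentCell l r q.2) ∈ R

/-- The cells between the cells of `V` and the rays starting next to them. -/
noncomputable def linkCells (l : ℕ) (V : Finset (ℕ × ℤ)) (x : ℕ × ℤ → ℝ) : Finset (ℕ × ℤ) :=
  V.biUnion fun v => ((Finset.Icc (v.2 - 2 ^ (l + 1)) (v.2 + 2 ^ (l + 1))).filter
    (IsLink l x v)).image fun i => (v.1, i)

theorem mem_childCells {R : Finset (ℕ × ℤ)} : (r + 1, i) ∈ childCells l P R ↔
    r + 1 ≤ P ∧ (r, parentCell l r i) ∈ R := by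
  rw [childCells, Finset.mem_filter]
  constructor
  · rintro ⟨-, h, s, hs, h'⟩
    obtain rfl : r = s := by simpa using hs
    exact ⟨h, h'⟩
  · rintro ⟨h, h'⟩
    refine ⟨Finset.mem_biUnion.2 ⟨_, h', ?_⟩, h, r, rfl, h'⟩
    simp only [Finset.mem_insert, Finset.mem_singleton, Prod.mk.injEq, true_and]
    unfold parentCell
    split_ifs <;> omega

theorem abs_cellPos_sub_parent_le :
    |cellPos l (r + 1, i) - cellPos l (r, parentCell l r i)| ≤ cellWidth l r := by
  have h1 := (cellAt_eq_iff (l := l) (r := r + 1) (i := i)).1 (cellAt_mul l (r + 1) i)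
  have h2 := parentCell_cellAt l r (i * cellWidth l (r + 1))
  rw [cellAt_mul] at h2
  have h3 := cellAt_eq_iff.1 h2.symm
  simp only [cellPos]
  rw [abs_le]
  constructor <;> linarith [cellWidth_pos l r]

theorem ray_term (m r : ℕ) (b : ℤ) {c c' p : ℤ} (h1 : c' ≤ i → c ≤ p) (h2 : ¬ c' ≤ i → p ≤ c) :
    |((if m = r + 1 ∧ b ≤ i then 1 else 0) - (if m ≤ r + 1 ∧ c' ≤ i then 1 else 0) +
        (if m ≤ r ∧ c ≤ p then 1 else 0) : ℤ)| ≤ 1 ∧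
      (((if m = r + 1 ∧ b ≤ i then 1 else 0) - (if m ≤ r + 1 ∧ c' ≤ i then 1 else 0) +
        (if m ≤ r ∧ c ≤ p then 1 else 0) : ℤ) ≠ 0 →
        (m = r + 1 ∧ ¬ (b ≤ i ↔ c' ≤ i)) ∨ (m ≤ r ∧ c = p)) := by
  rw [abs_le]
  split_ifs <;> refine ⟨by omega, fun h => ?_⟩ <;> omega

theorem gridHeight_zero (hbl0 : ∀ i, bl 0 i = 0) (hV1 : ∀ v ∈ V, v.1 ≠ 0) (i : ℤ) :
    gridHeight l bl bt V x 0 i = 0 := by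
  rw [gridHeight, Finset.sum_eq_zero fun k _ => hbl0 k, Finset.sum_eq_zero, sub_zero]
  intro v hv
  have := hV1 v hv
  rw [if_neg (by omega), mul_zero]

theorem gridHeight_eq_zero_left {B : ℤ} (hB : 0 ≤ B) (hx : ∀ v ∈ V, -B ≤ cellAt l r (x v)) (hi : i < -B) :
    gridHeight l bl bt V x r i = 0 := by
  rw [gridHeight, Finset.Icc_eq_empty (by omega), Finset.sum_empty, Finset.sum_eq_zero, sub_zero]
  intro v hv
  have := hx v hv
  rw [if_neg (by omega), mul_zero]

theorem gridHeight_eq_zero_right {B : ℤ} (hB : 0 ≤ B) (hbl0 : ∀ i, bl 0 i = 0)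
    (hV1 : ∀ v ∈ V, v.1 ≠ 0) (hVB : ∀ v ∈ V, v.2 ≤ B)
    (hx : ∀ v ∈ V, ∀ r ≤ P, cellAt l r (x v) ≤ B)
    (hbtB : ∀ r < P, ∀ i, B < i → bt r i = 0)
    (hup : ∀ r < P, ∀ i, gridHeight l bl bt V x (r + 1) i -
      gridHeight l bl bt V x r (parentCell l r i) = bt r i +
      ∑ v ∈ V, gridCharge l bl bt v.1 v.2 *
        ((if v.1 = r + 1 ∧ v.2 ≤ i then 1 else 0) -
          (if v.1 ≤ r + 1 ∧ cellAt l (r + 1) (x v) ≤ i then 1 else 0) +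
          (if v.1 ≤ r ∧ cellAt l r (x v) ≤ parentCell l r i then 1 else 0))) :
    ∀ r ≤ P, ∀ i, (B + 1) * 2 ^ r ≤ i → gridHeight l bl bt V x r i = 0 := by
  intro r
  induction r with
  | zero =>
    intro _ i _
    exact gridHeight_zero hbl0 hV1 i
  | succ r ih =>
    intro hr i hi
    have h1 : (B + 1) * 2 ^ r ≤ parentCell l r i := by
      rw [pow_succ, ← mul_assoc] at hi
      have : 0 ≤ (B + 1) * 2 ^ r := by positivity
      unfold parentCell
      split_ifs <;> omega
    have h2 : B < parentCell l r i := by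
      have : (1 : ℤ) ≤ 2 ^ r := one_le_pow₀ (by norm_num)
      nlinarith
    have h3 : B < i := by
      have : (1 : ℤ) ≤ 2 ^ (r + 1) := one_le_pow₀ (by norm_num)
      nlinarith
    have h4 := hup r hr i
    rw [ih (by omega) _ h1, hbtB r hr i h3, zero_add, sub_zero] at h4
    rw [h4]
    refine Finset.sum_eq_zero fun v hv => ?_
    have e1 := hVB v hv
    have e2 := hx v hv r (by omega)
    have e3 := hx v hv (r + 1) hr
    have : ((if v.1 = r + 1 ∧ v.2 ≤ i then 1 else 0) -
          (if v.1 ≤ r + 1 ∧ cellAt l (r + 1) (x v) ≤ i then 1 else 0) +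
          (if v.1 ≤ r ∧ cellAt l r (x v) ≤ parentCell l r i then 1 else 0) : ℤ) = 0 := by
      split_ifs <;> omega
    rw [this, mul_zero]

set_option maxHeartbeats 1600000 in
theorem exists_gridHeight (ha : 0 < a) (ha1 : a ≤ 1)
    (h0 : ∀ r i, bad r i → 0 ≤ i ∧ i < 2 ^ (r / 2 ^ l + l + 1))
    (hC : HasCarleson l C ((gridCells l P).filter fun q => IsFrontier bad big l q.1 q.2))
    (hbl : ∀ r i, bl r i ≠ 0 → IsInside bad big l r i ∧ IsInside bad big l r (i - 1))
    (hbt : ∀ r i, bt r i ≠ 0 → IsInside bad big l (r + 1) i ∧ IsInside bad big l r (parentCell l r i))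
    (hbl1 : ∀ r i, |bl r i| ≤ 1) (hbt1 : ∀ r i, |bt r i| ≤ 1)
    (hclosed : ∀ r k, IsInside bad big l (r + 1) k → IsInside bad big l (r + 1) (k - 1) →
      IsInside bad big l r (parentCell l r k) → IsInside bad big l r (parentCell l r (k - 1)) →
      gridCharge l bl bt (r + 1) k = 0)
    (hgood : ∀ v : ℕ × ℤ, v.1 ≤ P → IsFrontier bad big l v.1 v.2 ∨ IsFrontier bad big l v.1 (v.2 - 1) →
      ∃ G : Set ℝ, (∀ y ∈ G, |y - cellPos l v| ≤ a * rowTop l v.1) ∧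
        ENNReal.ofReal (a * rowTop l v.1) ≤ volume G ∧
        ∀ y ∈ G, ∀ k, v.1 ≤ k → k ≤ P → good k (cellAt l k y)) :
    ∃ (n : ℕ → ℤ → ℤ) (E : Finset (ℕ × ℤ)), HasCarleson l (seedConst l a C) E ∧
      (∀ i, n 0 i = 0) ∧ (∃ B : ℤ, ∀ r ≤ P, ∀ i, n r i ≠ 0 → |i| ≤ B) ∧
      (∀ r ≤ P, ∀ i, |(n r i - n r (i - 1) : ℝ)| ≤ jumpConst l a ∧
        (n r i - n r (i - 1) ≠ bl r i → (r, i) ∈ E)) ∧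
      (∀ r < P, ∀ i, |(n (r + 1) i - n r (parentCell l r i) : ℝ)| ≤ jumpConst l a ∧
        (n (r + 1) i - n r (parentCell l r i) ≠ bt r i → (r + 1, i) ∈ E)) ∧
      (∀ r ≤ P, ∀ i, IsFrontier bad big l r i → (r, i) ∈ E) ∧
      ∀ q ∈ E, q.1 ≤ P ∧ (IsFrontier bad big l q.1 q.2 ∨ good q.1 q.2 ∨
        (∃ r, q.1 = r + 1 ∧ good r (parentCell l r q.2)) ∨
        ∃ v : ℕ × ℤ, v.1 = q.1 ∧ |cellPos l q - cellPos l v| ≤ a * rowTop l v.1 + cellWidth l v.1 ∧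
          (IsFrontier bad big l v.1 v.2 ∨ IsFrontier bad big l v.1 (v.2 - 1))) := by
  set V : Finset (ℕ × ℤ) := (gridCells l P ∪ (gridCells l P).image fun q => (q.1, q.2 + 1)).filter
    fun v => gridCharge l bl bt v.1 v.2 ≠ 0 with hVdef
  have hfr : ∀ {r k}, gridCharge l bl bt r k ≠ 0 → IsFrontier bad big l r k ∨
      IsFrontier bad big l r (k - 1) := fun h => isFrontier_of_gridCharge_ne_zero hbl hbt hclosed h
  have hV : ∀ r ≤ P, ∀ k, gridCharge l bl bt r k ≠ 0 → (r, k) ∈ V := by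
    intro r hr k hk
    rw [hVdef, Finset.mem_filter, Finset.mem_union]
    refine ⟨?_, hk⟩
    rcases hfr hk with h | h
    · exact Or.inl (h.mem_gridCells h0 hr)
    · exact Or.inr (Finset.mem_image.2 ⟨_, h.mem_gridCells h0 hr, by simp⟩)
  have hVP : ∀ v ∈ V, v.1 ≤ P := by
    intro v hv
    rw [hVdef, Finset.mem_filter, Finset.mem_union, mem_gridCells, Finset.mem_image] at hv
    rcases hv.1 with h | ⟨q, hq, rfl⟩
    · exact h.1
    · exact (mem_gridCells.1 hq).1
  have hVc : ∀ v ∈ V, gridCharge l bl bt v.1 v.2 ≠ 0 := fun v hv => (Finset.mem_filter.1 hv).2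
  have hVf : ∀ v ∈ V, IsFrontier bad big l v.1 v.2 ∨ IsFrontier bad big l v.1 (v.2 - 1) :=
    fun v hv => hfr (hVc v hv)
  have hV0 : ∀ v ∈ V, 0 ≤ v.2 := by
    intro v hv
    rcases hVf v hv with h | h
    · exact (h.mem_range h0).1
    · have := (h.mem_range h0).1; omega
  have hVrow : ∀ v ∈ V, v.1 ≠ 0 := by
    intro v hv h
    have h2 := hVc v hv
    rw [h] at h2
    exact h2 rfl
  have hCV : HasCarleson l (120 * C) V := by
    have := hC.of_near (E' := V) (A := 1) zero_le_one (by
      intro v hv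
      have hw := cellWidth_pos l v.1
      rcases hVf v hv with h | h
      · exact ⟨v, Finset.mem_filter.2 ⟨h.mem_gridCells h0 (hVP v hv), h⟩, by omega, by omega,
          by simp [hw.le]⟩
      · refine ⟨(v.1, v.2 - 1), Finset.mem_filter.2 ⟨h.mem_gridCells h0 (hVP v hv), h⟩, by simp,
          by simp, ?_⟩
        simp only [cellPos]
        push_cast
        rw [← sub_mul, sub_sub_cancel, abs_of_nonneg (by linarith)])
    norm_num at this
    exact this
  choose! G hG1 hG2 hG3 using fun v (hv : v ∈ V) => hgood v (hVP v hv) (hVf v hv)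
  obtain ⟨x, hx, hsep⟩ := exists_separated_points ha ha1 V G hG1 hG2
  have hκ := sepConst_pos l ha
  have hxd : ∀ v ∈ V, |x v - cellPos l v| ≤ a * rowTop l v.1 := fun v hv => hG1 v hv _ (hx v hv)
  have hxg : ∀ v ∈ V, ∀ k, v.1 ≤ k → k ≤ P → good k (cellAt l k (x v)) :=
    fun v hv => hG3 v hv _ (hx v hv)
  have hR := hasCarleson_rayCells (P := P) hCV ha.le ha1 hxd hκ hsep
  set R := rayCells l P V x with hRdef
  have hR' := hR.of_near (E' := childCells l P R) (A := 1) zero_le_one (by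
    intro q hq
    obtain ⟨r, hr, -⟩ := (Finset.mem_filter.1 hq).2.2
    obtain ⟨q1, q2⟩ := q
    simp only at hr
    subst hr
    refine ⟨_, (mem_childCells.1 hq).2, by simp only; omega, by simp, ?_⟩
    rw [one_mul]
    exact abs_cellPos_sub_parent_le)
  norm_num at hR'
  have hL := hCV.of_near (E' := linkCells l V x) (A := 2 ^ (l + 1)) (by positivity) (by
    intro q hq
    rw [linkCells, Finset.mem_biUnion] at hq
    obtain ⟨v, hv, hq⟩ := hq
    obtain ⟨i, hi, rfl⟩ := Finset.mem_image.1 hq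
    refine ⟨v, hv, by simp, by simp, ?_⟩
    have hw := cellWidth_pos l v.1
    rw [Finset.mem_filter, Finset.mem_Icc] at hi
    simp only [cellPos]
    rw [← sub_mul, abs_mul, abs_of_pos hw]
    gcongr
    have : |i - v.2| ≤ 2 ^ (l + 1) := by rw [abs_le]; constructor <;> omega
    exact_mod_cast this)
  set M := (gridCells l P).filter fun q => IsFrontier bad big l q.1 q.2 with hM
  have hcl := abs_gridCharge_le (l := l) hbl1 hbt1
  have hblneg : ∀ r, ∀ i < 0, bl r i = 0 := by
    intro r i hi
    by_contra h
    have := ((hbl r i h).1.mem_range h0).1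
    omega
  have hbtneg : ∀ r, ∀ i < 0, bt r i = 0 := by
    intro r i hi
    by_contra h
    have := ((hbt r i h).1.mem_range h0).1
    omega
  have hleft : ∀ r i, gridHeight l bl bt V x r i - gridHeight l bl bt V x r (i - 1) = bl r i -
      ∑ v ∈ V, gridCharge l bl bt v.1 v.2 *
        if v.1 ≤ r ∧ cellAt l r (x v) = i then 1 else 0 := fun r i => gridHeight_sub_left (hblneg r)
  have hup : ∀ r < P, ∀ i, gridHeight l bl bt V x (r + 1) i -
      gridHeight l bl bt V x r (parentCell l r i) = bt r i +
      ∑ v ∈ V, gridCharge l bl bt v.1 v.2 *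
        ((if v.1 = r + 1 ∧ v.2 ≤ i then 1 else 0) -
          (if v.1 ≤ r + 1 ∧ cellAt l (r + 1) (x v) ≤ i then 1 else 0) +
          (if v.1 ≤ r ∧ cellAt l r (x v) ≤ parentCell l r i then 1 else 0)) := fun r hr i =>
    gridHeight_sub_parent hblneg (hbtneg r) (hV (r + 1) hr) hV0
  have hterm : ∀ r i, ∀ v ∈ V, |((if v.1 = r + 1 ∧ v.2 ≤ i then 1 else 0) -
          (if v.1 ≤ r + 1 ∧ cellAt l (r + 1) (x v) ≤ i then 1 else 0) +
          (if v.1 ≤ r ∧ cellAt l r (x v) ≤ parentCell l r i then 1 else 0) : ℤ)| ≤ 1 ∧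
        (((if v.1 = r + 1 ∧ v.2 ≤ i then 1 else 0) -
          (if v.1 ≤ r + 1 ∧ cellAt l (r + 1) (x v) ≤ i then 1 else 0) +
          (if v.1 ≤ r ∧ cellAt l r (x v) ≤ parentCell l r i then 1 else 0) : ℤ) ≠ 0 →
          (v.1 = r + 1 ∧ IsLink l x v i) ∨ (v.1 ≤ r ∧ cellAt l r (x v) = parentCell l r i)) := by
    intro r i v hv
    have h1 : cellAt l (r + 1) (x v) ≤ i → cellAt l r (x v) ≤ parentCell l r i := by
      intro h
      rw [← parentCell_cellAt]
      exact parentCell_mono h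
    have h2 : ¬ cellAt l (r + 1) (x v) ≤ i → parentCell l r i ≤ cellAt l r (x v) := by
      intro h
      rw [← parentCell_cellAt]
      exact parentCell_mono (by omega)
    obtain ⟨h3, h4⟩ := ray_term v.1 r v.2 h1 h2
    refine ⟨h3, fun h => ?_⟩
    rcases h4 h with ⟨h5, h6⟩ | h5
    · exact Or.inl ⟨h5, by rw [IsLink, h5]; exact h6⟩
    · exact Or.inr h5
  refine ⟨gridHeight l bl bt V x, M ∪ R ∪ childCells l P R ∪ linkCells l V x, ?_, ?_, ?_, ?_, ?_, ?_, ?_⟩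
  · exact ((hC.union hR).union hR').union hL
  · exact gridHeight_zero (fun i => by by_contra h'; exact (hbl 0 i h').1) hVrow
  · obtain ⟨B, hB0, hB⟩ : ∃ B : ℤ, 0 ≤ B ∧ ∀ v ∈ V, v.2 ≤ B ∧ ∀ r ≤ P, |cellAt l r (x v)| ≤ B := by
      refine ⟨∑ v ∈ V, (|v.2| + ∑ r ∈ Finset.range (P + 1), |cellAt l r (x v)|), by positivity,
        fun v hv => ?_⟩
      have h1 := Finset.single_le_sum (f := fun v : ℕ × ℤ => |v.2| + ∑ r ∈ Finset.range (P + 1),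
        |cellAt l r (x v)|) (fun v _ => by positivity) hv
      have h2 : 0 ≤ ∑ r ∈ Finset.range (P + 1), |cellAt l r (x v)| := by positivity
      refine ⟨by linarith [le_abs_self v.2], fun r hr => ?_⟩
      have h3 := Finset.single_le_sum (f := fun r => |cellAt l r (x v)|) (fun r _ => abs_nonneg _)
        (Finset.mem_range.2 (Nat.lt_succ_of_le hr))
      linarith [abs_nonneg v.2]
    set B' : ℤ := B + 2 ^ (P + l + 1) with hB'
    have hB'0 : 0 ≤ B' := by positivity
    have hBB : B ≤ B' := by rw [hB']; linarith [pow_pos (two_pos (α := ℤ)) (P + l + 1)]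
    refine ⟨(B' + 1) * 2 ^ P, fun r hr i hi => ?_⟩
    by_contra hcon
    apply hi
    have hP1 : (1 : ℤ) ≤ 2 ^ P := one_le_pow₀ (by norm_num)
    have hP2 : (2 : ℤ) ^ r ≤ 2 ^ P := pow_le_pow_right₀ (by norm_num) hr
    rw [not_le, lt_abs] at hcon
    rcases hcon with h | h
    · refine gridHeight_eq_zero_right (B := B') (P := P) hB'0 ?_ hVrow
        (fun v hv => (hB v hv).1.trans hBB)
        (fun v hv r hr => (le_abs_self _).trans (((hB v hv).2 r hr).trans hBB)) ?_ hup r hr i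
        (by nlinarith)
      · intro i
        by_contra h'
        exact (hbl 0 i h').1
      · intro r hr i hi
        by_contra h'
        have h1 := ((hbt r i h').1.mem_range h0).2
        have h2 : (2 : ℤ) ^ ((r + 1) / 2 ^ l + l + 1) ≤ 2 ^ (P + l + 1) := by
          refine pow_le_pow_right₀ (by norm_num) ?_
          have := Nat.div_le_self (r + 1) (2 ^ l)
          omega
        omega
    · refine gridHeight_eq_zero_left (B := B') hB'0
        (fun v hv => ?_) (by nlinarith)
      have := abs_le.1 ((hB v hv).2 r hr)
      omega
  · intro r hr i
    have h1 := hleft r i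
    have h2 := abs_sum_mul_le V (fun v => gridCharge l bl bt v.1 v.2)
      (fun v => if v.1 ≤ r ∧ cellAt l r (x v) = i then 1 else 0)
      (fun v => v.1 ≤ r ∧ cellAt l r (x v) = i) (A := 4) (by norm_num) (fun v _ => hcl _ _)
      (fun v _ => by split_ifs <;> simp) (fun v _ h => by by_contra h'; simp [h'] at h)
    have h3 := card_rays_cell_le hκ hsep r i
    constructor
    · have h4 : |gridHeight l bl bt V x r i - gridHeight l bl bt V x r (i - 1)| ≤
          4 * ((V.filter fun v => v.1 ≤ r ∧ cellAt l r (x v) = i).card : ℤ) + 1 := by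
        rw [h1]
        refine (abs_sub _ _).trans ?_
        rw [add_comm (4 * _)]
        exact add_le_add (hbl1 r i) (by convert h2; rfl)
      have h5 : |(gridHeight l bl bt V x r i - gridHeight l bl bt V x r (i - 1) : ℝ)| ≤
          4 * ((V.filter fun v => v.1 ≤ r ∧ cellAt l r (x v) = i).card : ℝ) + 1 := by
        exact_mod_cast h4
      refine h5.trans ?_
      have : (0 : ℝ) ≤ 2 * 2 ^ (l + 1) + 1 := by positivity
      rw [jumpConst]
      linarith
    · intro h4
      obtain ⟨v, hv, hne⟩ := Finset.exists_ne_zero_of_sum_ne_zero (s := V)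
        (f := fun v => gridCharge l bl bt v.1 v.2 * if v.1 ≤ r ∧ cellAt l r (x v) = i then 1 else 0)
        (by intro h; apply h4; rw [h1, h, sub_zero])
      have h5 : v.1 ≤ r ∧ cellAt l r (x v) = i := by by_contra h'; simp [h'] at hne
      have : (r, i) ∈ R := mem_rayCells.2 ⟨hr, v, hv, h5.1, h5.2⟩
      simp [this]
  · intro r hr i
    have h1 := hup r hr i
    have h2 := abs_sum_mul_le V (fun v => gridCharge l bl bt v.1 v.2) _
      (fun v => (v.1 = r + 1 ∧ IsLink l x v i) ∨ (v.1 ≤ r ∧ cellAt l r (x v) = parentCell l r i))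
      (A := 4) (by norm_num) (fun v _ => hcl _ _) (fun v hv => (hterm r i v hv).1)
      (fun v hv => (hterm r i v hv).2)
    have h3 := card_rays_cell_le hκ hsep r (parentCell l r i)
    have h3' := card_link_le ha1 hxd (r + 1) i
    constructor
    · have h4 : |gridHeight l bl bt V x (r + 1) i - gridHeight l bl bt V x r (parentCell l r i)| ≤
          4 * (((V.filter fun v => (v.1 = r + 1 ∧ IsLink l x v i) ∨
            (v.1 ≤ r ∧ cellAt l r (x v) = parentCell l r i)).card : ℕ) : ℤ) + 1 := by
        rw [h1]
        refine (abs_add_le _ _).trans ?_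
        rw [add_comm (4 * _)]
        exact add_le_add (hbt1 r i) (by convert h2; rfl)
      have h5 : |(gridHeight l bl bt V x (r + 1) i - gridHeight l bl bt V x r (parentCell l r i) : ℝ)| ≤
          4 * ((V.filter fun v => (v.1 = r + 1 ∧ IsLink l x v i) ∨
            (v.1 ≤ r ∧ cellAt l r (x v) = parentCell l r i)).card : ℝ) + 1 := by
        exact_mod_cast h4
      refine h5.trans ?_
      have h6 : ((V.filter fun v => (v.1 = r + 1 ∧ IsLink l x v i) ∨
            (v.1 ≤ r ∧ cellAt l r (x v) = parentCell l r i)).card : ℝ) ≤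
          (V.filter fun v => v.1 = r + 1 ∧ IsLink l x v i).card +
          (V.filter fun v => v.1 ≤ r ∧ cellAt l r (x v) = parentCell l r i).card := by
        rw [Finset.filter_or]
        exact_mod_cast Finset.card_union_le _ _
      have h7 : ((V.filter fun v => v.1 = r + 1 ∧ IsLink l x v i).card : ℝ) ≤ 2 * 2 ^ (l + 1) + 1 := by
        exact_mod_cast h3'
      rw [jumpConst]
      linarith
    · intro h4
      obtain ⟨v, hv, hne⟩ := Finset.exists_ne_zero_of_sum_ne_zero (s := V) (f := fun v => _ * _)
        (by intro h; apply h4; rw [h1, h, add_zero])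
      rcases (hterm r i v hv).2 (right_ne_zero_of_mul hne) with ⟨h5, h6⟩ | h5
      · have : (r + 1, i) ∈ linkCells l V x := by
          rw [linkCells, Finset.mem_biUnion]
          refine ⟨v, hv, Finset.mem_image.2 ⟨i, ?_, by rw [h5]⟩⟩
          rw [Finset.mem_filter, Finset.mem_Icc]
          have := abs_le.1 (h6.abs_sub_le ha1 (hxd v hv))
          exact ⟨by omega, h6⟩
        simp [this]
      · have : (r, parentCell l r i) ∈ R := mem_rayCells.2 ⟨by simp; omega, v, hv, h5.1, h5.2⟩
        have : (r + 1, i) ∈ childCells l P R := mem_childCells.2 ⟨hr, this⟩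
        simp [this]
  · intro r hr i h
    have : (r, i) ∈ M := Finset.mem_filter.2 ⟨h.mem_gridCells h0 hr, h⟩
    simp [this]
  · intro q hq
    have hgR : ∀ q ∈ R, q.1 ≤ P ∧ good q.1 q.2 := by
      intro q hq
      obtain ⟨h1, v, hv, h2, h3⟩ := mem_rayCells.1 hq
      exact ⟨h1, h3 ▸ hxg v hv q.1 h2 h1⟩
    rcases Finset.mem_union.1 hq with hq | hq
    · rcases Finset.mem_union.1 hq with hq | hq
      · rcases Finset.mem_union.1 hq with hq | hq
        · rw [hM, Finset.mem_filter, mem_gridCells] at hq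
          exact ⟨hq.1.1, Or.inl hq.2⟩
        · exact ⟨(hgR q hq).1, Or.inr (Or.inl (hgR q hq).2)⟩
      · obtain ⟨h1, r, h2, h3⟩ := (Finset.mem_filter.1 hq).2
        exact ⟨h1, Or.inr (Or.inr (Or.inl ⟨r, h2, (hgR _ h3).2⟩))⟩
    · rw [linkCells, Finset.mem_biUnion] at hq
      obtain ⟨v, hv, hq⟩ := hq
      obtain ⟨i, hi, rfl⟩ := Finset.mem_image.1 hq
      exact ⟨hVP v hv, Or.inr (Or.inr (Or.inr ⟨v, rfl,
        (Finset.mem_filter.1 hi).2.abs_cellPos_sub_le (hxd v hv), hVf v hv⟩))⟩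
end

section
open Set MeasureTheory Metric
open scoped ComplexConjugate Classical

variable {l P r : ℕ} {i : ℤ} {g : ℂ → ℂ} {z w p : ℂ} {δ ε η e γ H : ℝ} {q : ℕ × ℤ}

theorem norm_sub_le_of_norm_sub_lt (hg : DifferentiableOn ℂ g {z | 0 < z.im})
    (hg1 : ∀ z, 0 < z.im → ‖g z‖ ≤ 1) (h : ‖z - w‖ < w.im) : ‖g z - g w‖ ≤ 3 * ‖z - w‖ / w.im := by
  have hw : 0 < w.im := (norm_nonneg _).trans_lt h
  have hsub : ∀ y ∈ ball w w.im, 0 < y.im := by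
    intro y hy
    rw [mem_ball, dist_eq_norm] at hy
    have := (abs_le.1 (Complex.abs_im_le_norm (y - w))).1
    rw [Complex.sub_im] at this
    linarith
  have := Complex.dist_le_div_mul_dist_of_mapsTo_ball (f := g) (c := w) (z := z) (R₁ := w.im) (R₂ := 3)
    (hg.mono hsub) (fun y hy => by
      rw [mem_closedBall, dist_eq_norm]
      linarith [norm_sub_le (g y) (g w), hg1 y (hsub y hy), hg1 w hw])
    (by rw [mem_ball, dist_eq_norm]; exact h)
  rw [dist_eq_norm, dist_eq_norm] at this
  rw [mul_div_right_comm]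
  exact this

/-- Center of a cell. -/
noncomputable def cellCenter (l : ℕ) (q : ℕ × ℤ) : ℂ :=
  ⟨cellPos l q + cellWidth l q.1 / 2, rowTop l q.1 - cellWidth l q.1 / 2⟩

theorem cellCenter_im (l : ℕ) (q : ℕ × ℤ) :
    (cellCenter l q).im = rowTop l (q.1 + 1) + cellWidth l q.1 / 2 := by
  rw [cellCenter]; linarith [rowTop_sub_succ l q.1]

theorem cellCenter_im_pos (l : ℕ) (q : ℕ × ℤ) : 0 < (cellCenter l q).im := by
  rw [cellCenter_im]
  linarith [rowTop_pos l (q.1 + 1), cellWidth_pos l q.1]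

theorem norm_sub_cellCenter_le (h : ‖z - cellCenter l q‖ ≤ 8 * cellWidth l q.1) (hl : 6 ≤ l)
    (hg : DifferentiableOn ℂ g {z | 0 < z.im}) (hg1 : ∀ z, 0 < z.im → ‖g z‖ ≤ 1) :
    ‖g z - g (cellCenter l q)‖ ≤ 48 * (1 / 2) ^ (l + 1) := by
  have hp : (1 / 2 : ℝ) ^ (l + 1) ≤ (1 / 2) ^ 7 := pow_le_pow_of_le_one (by norm_num) (by norm_num) (by omega)
  have hc := cellCenter_im l q
  have hw := cellWidth_pos l q.1
  have hT := rowTop_pos l (q.1 + 1)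
  have h1 := cellWidth_le_mul_rowTop_succ l q.1
  have h2 : 8 * cellWidth l q.1 < (cellCenter l q).im := by rw [hc]; nlinarith
  refine (norm_sub_le_of_norm_sub_lt hg hg1 (h.trans_lt h2)).trans ?_
  rw [div_le_iff₀ (cellCenter_im_pos l q), hc]
  have h3 : 0 < (1 / 2 : ℝ) ^ (l + 1) := by positivity
  nlinarith

theorem im_pos_of_norm_sub_cellCenter_le (h : ‖z - cellCenter l q‖ ≤ 8 * cellWidth l q.1) (hl : 6 ≤ l) :
    0 < z.im := by
  have hp : (1 / 2 : ℝ) ^ (l + 1) ≤ (1 / 2) ^ 7 := pow_le_pow_of_le_one (by norm_num) (by norm_num) (by omega)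
  have hc := cellCenter_im l q
  have hw := cellWidth_pos l q.1
  have hT := rowTop_pos l (q.1 + 1)
  have h1 := cellWidth_le_mul_rowTop_succ l q.1
  have h2 : 8 * cellWidth l q.1 < (cellCenter l q).im := by rw [hc]; nlinarith
  have := (abs_le.1 (Complex.abs_im_le_norm (z - cellCenter l q))).1
  rw [Complex.sub_im] at this
  linarith

/-- The cell contains a point of `s`. -/
def CellMeets (l : ℕ) (s : Set ℂ) (r : ℕ) (i : ℤ) : Prop :=
  ∃ z ∈ s, cellAt l r z.re = i ∧ rowTop l (r + 1) < z.im ∧ z.im ≤ rowTop l r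

theorem norm_sub_cellCenter_le_of_mem (h : cellAt l q.1 z.re = q.2) (h1 : rowTop l (q.1 + 1) ≤ z.im)
    (h2 : z.im ≤ rowTop l q.1) : ‖z - cellCenter l q‖ ≤ cellWidth l q.1 := by
  have h3 := cellAt_eq_iff.1 h
  have h4 := rowTop_sub_succ l q.1
  refine (Complex.norm_le_abs_re_add_abs_im _).trans ?_
  have e1 : |(z - cellCenter l q).re| ≤ cellWidth l q.1 / 2 := by
    rw [abs_le, Complex.sub_re, cellCenter]
    simp only [cellPos]
    constructor <;> linarith
  have e2 : |(z - cellCenter l q).im| ≤ cellWidth l q.1 / 2 := by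
    rw [abs_le, Complex.sub_im, cellCenter]
    simp only
    constructor <;> linarith
  linarith

theorem sum_cellWidth_le_of_small {F : Finset (ℕ × ℤ)} {A : ℝ}
    (hη : 0 < η) (hg : DifferentiableOn ℂ g {z | -η < z.im}) (hg1 : ∀ z, -η < z.im → ‖g z‖ ≤ 1)
    (hF : ∀ q ∈ F, ∀ p ∈ F, q.1 < p.1 → cellAt l q.1 (cellPos l p) ≠ q.2)
    (he : ∀ q ∈ F, ∀ z, ‖z - cellCenter l q‖ ≤ cellWidth l q.1 → ‖g z‖ ≤ e) (he0 : 0 < e)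
    (heγ : e < γ) (hγ : γ ≤ 1) (hp : 0 < p.im) (hγp : γ ≤ ‖g p‖)
    (hA : ∀ q ∈ F, |p.re - (cellCenter l q).re| + (cellCenter l q).im ≤ A * p.im) :
    ∑ q ∈ F, cellWidth l q.1 ≤
      (A + 1) ^ 2 * p.im * ((800 / Real.log (1 / e) + (1 / 2) ^ (l + 1)) * Real.log (1 / γ)) := by
  have hall := sum_length_le (s := F) (w := cellCenter l) (l := fun q => cellWidth l q.1) (p := p)
    (θ := (1 / 2) ^ (l + 1)) (γ := γ) (e := e) (by positivity) hη (fun q _ => cellCenter_im_pos l q) ?_ ?_ ?_ hg hg1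
    (fun q hq z hz _ => he q hq z (by
      rw [mem_closedBall, dist_eq_norm] at hz
      linarith [cellWidth_pos l q.1])) he0 (heγ.trans_le hγ) hp ?_ (he0.trans heγ) hγp
  · rw [mul_assoc]
    rcases F.eq_empty_or_nonempty with rfl | ⟨q0, hq0⟩
    · simp only [Finset.sum_empty] at hall ⊢
      positivity
    have hA0 : 0 < A := by
      have h1 := hA q0 hq0
      have h2 := cellCenter_im_pos l q0
      have h3 := abs_nonneg (p.re - (cellCenter l q0).re)
      by_contra h4
      nlinarith
    have h1 : ∀ q ∈ F, cellWidth l q.1 ≤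
        (A + 1) ^ 2 * p.im * (cellWidth l q.1 * (p.im / ‖p - conj (cellCenter l q)‖ ^ 2)) := by
      intro q hq
      have hn : ‖p - conj (cellCenter l q)‖ ≤ (A + 1) * p.im := by
        refine (Complex.norm_le_abs_re_add_abs_im _).trans ?_
        simp only [Complex.sub_re, Complex.sub_im, Complex.conj_re, Complex.conj_im, sub_neg_eq_add]
        rw [abs_of_pos (add_pos hp (cellCenter_im_pos l q))]
        linarith [hA q hq]
      have hn0 : 0 < ‖p - conj (cellCenter l q)‖ :=
        norm_pos_iff.2 (sub_conj_ne_zero (add_pos hp (cellCenter_im_pos l q)))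
      have hw := cellWidth_pos l q.1
      have h2 : ‖p - conj (cellCenter l q)‖ ^ 2 ≤ ((A + 1) * p.im) ^ 2 := by gcongr
      rw [show (A + 1) ^ 2 * p.im * (cellWidth l q.1 * (p.im / ‖p - conj (cellCenter l q)‖ ^ 2)) =
        cellWidth l q.1 * (((A + 1) * p.im) ^ 2 / ‖p - conj (cellCenter l q)‖ ^ 2) by ring]
      exact le_mul_of_one_le_right hw.le ((one_le_div (by positivity)).2 h2)
    refine (Finset.sum_le_sum h1).trans ?_
    rw [← Finset.mul_sum, mul_assoc]
    gcongr
  · intro q _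
    rw [cellCenter]
    have := mul_rowTop_le_cellWidth l q.1
    have h2 : 0 < (1 / 2 : ℝ) ^ (l + 1) := by positivity
    have := cellWidth_pos l q.1
    simp only
    nlinarith
  · intro q _
    rw [cellCenter_im]
    have := cellWidth_le_mul_rowTop_succ l q.1
    have h2 : 0 < (1 / 2 : ℝ) ^ (l + 1) := by positivity
    have := cellWidth_pos l q.1
    nlinarith
  · intro q hq q' hq' hne
    have hd : Disjoint (Ico (cellPos l q) (cellPos l q + cellWidth l q.1))
        (Ico (cellPos l q') (cellPos l q' + cellWidth l q'.1)) := by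
      rcases lt_trichotomy q.1 q'.1 with h | h | h
      · exact disjoint_cells h.le (hF q hq q' hq' h)
      · refine disjoint_cells h.le fun h' => hne ?_
        rw [h, cellPos, cellAt_mul] at h'
        exact Prod.ext h h'.symm
      · exact (disjoint_cells h.le (hF q' hq' q hq h)).symm
    rw [Ico_disjoint_Ico] at hd
    simp only [cellCenter]
    have w1 := cellWidth_pos l q.1
    have w2 := cellWidth_pos l q'.1
    rcases min_le_iff.1 hd with h | h <;> rcases le_max_iff.1 h with h | h
    · linarith
    · left; linarith
    · right; linarith
    · linarith
  · intro q hq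
    by_contra h
    have := he q hq p (by linarith [cellWidth_pos l q.1])
    linarith
end

section
open Set MeasureTheory Metric
open scoped ComplexConjugate Classical

/-- Normalized corona data on the half plane `-η < Im z`. -/
structure IsNormalizedPair (δ ε η : ℝ) (f g : ℂ → ℂ) : Prop where
  η_pos : 0 < η
  hf : DifferentiableOn ℂ f {z | -η < z.im}
  hg : DifferentiableOn ℂ g {z | -η < z.im}
  f_le : ∀ z, -η < z.im → ‖f z‖ ≤ 1
  g_le : ∀ z, -η < z.im → ‖g z‖ ≤ 1
  le_add : ∀ z, -η < z.im → δ ≤ ‖f z‖ + ‖g z‖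
  of_small : ∀ z, -η < z.im → ‖g z‖ < ε → (0 ≤ z.re ∧ z.re < 1) ∧ z.im ≤ 1 / 2

/-- Compatibility of the parameters of the construction. -/
structure IsGridParams (l : ℕ) (δ ε ε' : ℝ) : Prop where
  δ_le : δ ≤ 1
  ε_pos : 0 < ε
  ε'_pos : 0 < ε'
  ε_le : 16 * ε ≤ δ
  ε'_le : 32 * ε' ≤ ε
  l_ge : 6 ≤ l
  width_le : 48 * (1 / 2) ^ (l + 1) ≤ ε' / 32
  hall : 25 * ((800 / Real.log (1 / (2 * ε)) + (1 / 2) ^ (l + 1)) * Real.log (1 / (δ / 4))) ≤ 1 / 4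
  hall' : 25 * ((800 / Real.log (1 / (2 * ε')) + (1 / 2) ^ (l + 1)) * Real.log (1 / (ε / 2))) ≤ ε / 100

variable {l P r : ℕ} {i : ℤ} {f g : ℂ → ℂ} {z w p : ℂ} {δ ε ε' η : ℝ} {q v : ℕ × ℤ}

/-- Cells containing points at which `g` is small. -/
def IsBadCell (ε : ℝ) (g : ℂ → ℂ) (l : ℕ) : ℕ → ℤ → Prop := CellMeets l {z | ‖g z‖ < ε}

/-- Cells containing points at which `g` is not small. -/
def IsBigCell (δ : ℝ) (g : ℂ → ℂ) (l : ℕ) : ℕ → ℤ → Prop := CellMeets l {z | δ / 4 ≤ ‖g z‖}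

namespace IsNormalizedPair

theorem hg0 (h : IsNormalizedPair δ ε η f g) : DifferentiableOn ℂ g {z | 0 < z.im} :=
  h.hg.mono fun z (hz : 0 < z.im) => show -η < z.im by linarith [h.η_pos]

theorem hf0 (h : IsNormalizedPair δ ε η f g) : DifferentiableOn ℂ f {z | 0 < z.im} :=
  h.hf.mono fun z (hz : 0 < z.im) => show -η < z.im by linarith [h.η_pos]

theorem osc_g (h : IsNormalizedPair δ ε η f g) (hp : IsGridParams l δ ε ε')
    (hz : ‖z - cellCenter l q‖ ≤ 8 * cellWidth l q.1) :
    ‖g z - g (cellCenter l q)‖ ≤ ε' / 32 :=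
  (norm_sub_cellCenter_le hz hp.l_ge h.hg0
    (fun z hz => h.g_le z (by linarith [h.η_pos]))).trans hp.width_le

theorem osc_f (h : IsNormalizedPair δ ε η f g) (hp : IsGridParams l δ ε ε')
    (hz : ‖z - cellCenter l q‖ ≤ 8 * cellWidth l q.1) :
    ‖f z - f (cellCenter l q)‖ ≤ ε' / 32 :=
  (norm_sub_cellCenter_le hz hp.l_ge h.hf0
    (fun z hz => h.f_le z (by linarith [h.η_pos]))).trans hp.width_le

theorem osc_g₂ (h : IsNormalizedPair δ ε η f g) (hp : IsGridParams l δ ε ε')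
    (hz : ‖z - cellCenter l q‖ ≤ 8 * cellWidth l q.1)
    (hw : ‖w - cellCenter l q‖ ≤ 8 * cellWidth l q.1) : ‖g z‖ ≤ ‖g w‖ + ε' / 16 := by
  have h1 := norm_sub_norm_le (g z) (g (cellCenter l q))
  have h2 := norm_sub_norm_le (g (cellCenter l q)) (g w)
  rw [norm_sub_rev] at h2
  linarith [h.osc_g hp hz, h.osc_g hp hw]

theorem not_isBigCell (h : IsNormalizedPair δ ε η f g) (hp : IsGridParams l δ ε ε') (r : ℕ) (i : ℤ)
    (hb : IsBadCell ε g l r i) : ¬ IsBigCell δ g l r i := by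
  obtain ⟨z, hz, h1, h2, h3⟩ := hb
  rintro ⟨w, hw, h4, h5, h6⟩
  have hwid := cellWidth_pos l r
  have := h.osc_g₂ hp (q := (r, i)) (z := w) (w := z)
    ((norm_sub_cellCenter_le_of_mem h4 h5.le h6).trans (by simp only; linarith))
    ((norm_sub_cellCenter_le_of_mem h1 h2.le h3).trans (by simp only; linarith))
  simp only [mem_ofPred_eq] at hz hw
  linarith [hp.ε'_le, hp.ε_le, hp.ε'_pos, hp.ε_pos]

theorem isBadCell_range (h : IsNormalizedPair δ ε η f g) (r : ℕ) (i : ℤ)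
    (hb : IsBadCell ε g l r i) : 0 ≤ i ∧ i < 2 ^ (r / 2 ^ l + l + 1) := by
  obtain ⟨z, hz, h1, h2, h3⟩ := hb
  obtain ⟨⟨h4, h5⟩, -⟩ := h.of_small z (by linarith [h.η_pos, rowTop_pos l (r + 1)]) hz
  have hw := cellWidth_pos l r
  rw [← h1, cellAt]
  refine ⟨Int.floor_nonneg.2 (by positivity), ?_⟩
  rw [Int.floor_lt, div_lt_iff₀ hw, cellWidth]
  push_cast
  rw [← mul_pow]
  norm_num
  exact h5

theorem not_isBadCell_zero (h : IsNormalizedPair δ ε η f g) (i : ℤ) : ¬ IsBadCell ε g l 0 i := by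
  rintro ⟨z, hz, -, h2, -⟩
  have h3 := (h.of_small z (by linarith [h.η_pos, rowTop_pos l (0 + 1)]) hz).2
  have := half_gen_le_succ l 0
  simp at this
  norm_num at h2
  linarith

theorem hall_big (h : IsNormalizedPair δ ε η f g) (hp : IsGridParams l δ ε ε') (n : ℕ) (j : ℤ)
    (hb : IsBigBox (IsBigCell δ g l) l P n j) (F : Finset (ℕ × ℤ))
    (hF : ∀ q ∈ F, IsBadCell ε g l q.1 q.2 ∧ n ≤ q.1 / 2 ^ l ∧ dyadicAt n (cellPos l q) = j)
    (hF' : ∀ q ∈ F, ∀ p ∈ F, q.1 < p.1 → cellAt l q.1 (cellPos l p) ≠ q.2) :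
    ∑ q ∈ F, cellWidth l q.1 ≤ 1 / 4 * (1 / 2) ^ n := by
  obtain ⟨q₀, hq₀, ⟨p, hpb, hp1, hp2, hp3⟩, hq1, hq2⟩ := hb
  have hε := hp.ε_pos
  have hε' := hp.ε'_pos
  have hδ : 0 < δ := by linarith [hp.ε_le]
  have hX : (0 : ℝ) < (1 / 2) ^ n := by positivity
  have hlow : (1 / 2) ^ n * (1 / 2) ≤ p.im := by
    rw [← hq1]; exact (half_gen_le_succ l q₀.1).trans hp2.le
  have hup : p.im ≤ (1 / 2) ^ n := by
    rw [← hq1]; exact hp3.trans (rowTop_le_gen l q₀.1)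
  have hcell := cell_le_dyadic (l := l) (q := q₀) (by rw [← hq1]; omega) hq2
  have hpc := mem_Ico_cell.2 hp1
  have h1 := sum_cellWidth_le_of_small (F := F) (l := l) (A := 4) (e := 2 * ε) (γ := δ / 4) (p := p)
    h.η_pos h.hg h.g_le hF' ?_ (by linarith) (by linarith [hp.ε_le]) (by linarith [hp.δ_le])
    (by linarith) hpb ?_
  · refine h1.trans ?_
    rw [mul_right_comm]
    norm_num only [show ((4 : ℝ) + 1) ^ 2 = 25 by norm_num] at *
    have := hp.hall
    norm_num at this ⊢
    calc _ ≤ 1 / 4 * p.im := by gcongr; linarith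
      _ ≤ _ := by gcongr
  · intro q hq z hz
    obtain ⟨w, hw, e1, e2, e3⟩ := (hF q hq).1
    have hwid := cellWidth_pos l q.1
    have := h.osc_g₂ hp (q := q) (z := z) (w := w) (by linarith)
      ((norm_sub_cellCenter_le_of_mem e1 e2.le e3).trans (by linarith))
    simp only [mem_ofPred_eq] at hw
    linarith [hp.ε'_le]
  · intro q hq
    obtain ⟨-, e2, e3⟩ := hF q hq
    have hcell' := cell_le_dyadic (l := l) (q := q) (by omega) e3
    have hw := cellWidth_pos l q.1
    have e4 : rowTop l q.1 ≤ (1 / 2) ^ n := (rowTop_le_gen l q.1).trans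
      (pow_le_pow_of_le_one (by norm_num) (by norm_num) e2)
    have e5 : |p.re - (cellCenter l q).re| ≤ (1 / 2) ^ n := by
      rw [abs_le, cellCenter]
      simp only
      constructor <;> linarith [hpc.1, hpc.2]
    have e6 : (cellCenter l q).im ≤ rowTop l q.1 := by
      rw [cellCenter]; simp only; linarith
    linarith

/-- Carleson constant of the frontier. -/
noncomputable def frontierConst (l : ℕ) : ℝ :=
  6 * (4 + 2 ^ l * (l + 1)) + (2 * 2 ^ (l + 1) + 1 + 4 * 2 ^ (l + 1) * (6 * (4 + 2 ^ l * (l + 1))))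

theorem hasCarleson_frontier (h : IsNormalizedPair δ ε η f g) (hp : IsGridParams l δ ε ε') :
    HasCarleson l (frontierConst l) ((gridCells l P).filter fun q =>
      IsFrontier (IsBadCell ε g l) (IsBigCell δ g l) l q.1 q.2) := by
  have h1 := hasCarleson_switches (bad := IsBadCell ε g l) (big := IsBigCell δ g l) (l := l) (P := P)
    (M := 4 + 2 ^ l * (l + 1)) (by positivity)
    (sum_boxSwitches_le fun n j hb F _ hF hF' => h.hall_big hp n j hb F hF hF')
  have h2 := hasCarleson_leftMismatches h.isBadCell_range h1
  refine (h1.union h2).subset fun q hq => ?_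
  rw [Finset.mem_filter] at hq
  rcases hq.2 with h3 | h3
  · exact Finset.mem_union_left _ (Finset.mem_filter.2 ⟨hq.1, h3⟩)
  · exact Finset.mem_union_right _ (Finset.mem_filter.2 ⟨hq.1, h3⟩)

theorem exists_mem_cell (l : ℕ) (q : ℕ × ℤ) : ∃ z : ℂ, cellAt l q.1 z.re = q.2 ∧
    rowTop l (q.1 + 1) < z.im ∧ z.im ≤ rowTop l q.1 :=
  ⟨⟨cellPos l q, rowTop l q.1⟩, cellAt_mul _ _ _, by
    simp only; linarith [rowTop_sub_succ l q.1, cellWidth_pos l q.1], le_rfl⟩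

theorem norm_g_le_of_isInside (h : IsNormalizedPair δ ε η f g) (hp : IsGridParams l δ ε ε')
    (hi : IsInside (IsBadCell ε g l) (IsBigCell δ g l) l q.1 q.2)
    (hz : ‖z - cellCenter l q‖ ≤ 8 * cellWidth l q.1) : ‖g z‖ ≤ δ / 2 := by
  obtain ⟨w, h1, h2, h3⟩ := exists_mem_cell l q
  have h4 : ‖g w‖ < δ / 4 := by
    by_contra h5
    exact hi.not_big (h.not_isBigCell hp) ⟨w, not_lt.1 h5, h1, h2, h3⟩
  have := h.osc_g₂ hp hz ((norm_sub_cellCenter_le_of_mem h1 h2.le h3).trans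
    (by linarith [cellWidth_pos l q.1]))
  linarith [hp.ε'_le, hp.ε_le, hp.ε'_pos]

theorem le_norm_f_of_isInside (h : IsNormalizedPair δ ε η f g) (hp : IsGridParams l δ ε ε')
    (hi : IsInside (IsBadCell ε g l) (IsBigCell δ g l) l q.1 q.2)
    (hz : ‖z - cellCenter l q‖ ≤ 8 * cellWidth l q.1) : δ / 2 ≤ ‖f z‖ := by
  have := h.le_add z (by linarith [h.η_pos, im_pos_of_norm_sub_cellCenter_le hz hp.l_ge])
  linarith [h.norm_g_le_of_isInside hp hi hz]

theorem le_norm_g_of_not_isInside (h : IsNormalizedPair δ ε η f g) (hp : IsGridParams l δ ε ε')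
    (hi : ¬ IsInside (IsBadCell ε g l) (IsBigCell δ g l) l q.1 q.2)
    (hz : ‖z - cellCenter l q‖ ≤ 8 * cellWidth l q.1) : ε / 2 ≤ ‖g z‖ := by
  obtain ⟨w, h1, h2, h3⟩ := exists_mem_cell l q
  have h4 : ε ≤ ‖g w‖ := by
    by_contra h5
    exact not_bad_of_not_isInside (h.not_isBigCell hp) h.not_isBadCell_zero hi
      ⟨w, not_le.1 h5, h1, h2, h3⟩
  have := h.osc_g₂ hp ((norm_sub_cellCenter_le_of_mem h1 h2.le h3).trans
    (by linarith [cellWidth_pos l q.1])) hz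
  linarith [hp.ε'_le, hp.ε_le, hp.ε'_pos]

end IsNormalizedPair

theorem norm_cellCenter_sub_left (r : ℕ) (i : ℤ) :
    ‖cellCenter l (r, i) - cellCenter l (r, i - 1)‖ ≤ cellWidth l r := by
  have hw := cellWidth_pos l r
  refine (Complex.norm_le_abs_re_add_abs_im _).trans (le_of_eq ?_)
  simp only [cellCenter, cellPos, Complex.sub_re, Complex.sub_im]
  push_cast
  rw [show (i * cellWidth l r + cellWidth l r / 2 - ((i - 1) * cellWidth l r + cellWidth l r / 2)) =
    cellWidth l r by ring, sub_self, abs_zero, add_zero, abs_of_pos hw]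

theorem norm_cellCenter_sub_parent (r : ℕ) (i : ℤ) :
    ‖cellCenter l (r + 1, i) - cellCenter l (r, parentCell l r i)‖ ≤ 3 * cellWidth l r := by
  have hw := cellWidth_pos l r
  have hw' := cellWidth_pos l (r + 1)
  have h1 := abs_le.1 (abs_cellPos_sub_parent_le (l := l) (r := r) (i := i))
  have h2 := cellWidth_succ_le (l := l) (r := r)
  have h3 := rowTop_sub_succ l r
  refine (Complex.norm_le_abs_re_add_abs_im _).trans ?_
  have e1 : |(cellCenter l (r + 1, i) - cellCenter l (r, parentCell l r i)).re| ≤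
      3 / 2 * cellWidth l r := by
    rw [abs_le, Complex.sub_re]
    simp only [cellCenter]
    constructor <;> linarith
  have e2 : |(cellCenter l (r + 1, i) - cellCenter l (r, parentCell l r i)).im| ≤
      3 / 2 * cellWidth l r := by
    rw [abs_le, Complex.sub_im]
    simp only [cellCenter]
    constructor <;> linarith
  linarith

theorem exists_not_isInside_of_isFrontier {bad big : ℕ → ℤ → Prop} (h : IsFrontier bad big l r i) :
    ∃ q : ℕ × ℤ, ¬ IsInside bad big l q.1 q.2 ∧ cellWidth l r ≤ cellWidth l q.1 ∧
      ‖cellCenter l (r, i) - cellCenter l q‖ ≤ 3 * cellWidth l q.1 := by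
  by_cases h1 : IsInside bad big l r i
  swap
  · exact ⟨(r, i), h1, le_rfl, by simp [(cellWidth_pos l r).le]⟩
  rcases h with h | h
  · cases r with
    | zero => exact h.elim
    | succ r =>
      exact ⟨(r, parentCell l r i), by rw [IsSwitch] at h; tauto, cellWidth_succ_le,
        norm_cellCenter_sub_parent r i⟩
  · exact ⟨(r, i - 1), by rw [IsLeftMismatch] at h; tauto, le_rfl,
      (norm_cellCenter_sub_left r i).trans (by simp only; linarith [cellWidth_pos l r])⟩

namespace IsNormalizedPair

theorem le_norm_g_of_isFrontier (h : IsNormalizedPair δ ε η f g) (hp : IsGridParams l δ ε ε')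
    (hf : IsFrontier (IsBadCell ε g l) (IsBigCell δ g l) l q.1 q.2)
    (hz : ‖z - cellCenter l q‖ ≤ 5 * cellWidth l q.1) : ε / 2 ≤ ‖g z‖ := by
  obtain ⟨p, h1, h2, h3⟩ := exists_not_isInside_of_isFrontier hf
  refine h.le_norm_g_of_not_isInside hp h1 ?_
  have := norm_sub_le_norm_sub_add_norm_sub z (cellCenter l q) (cellCenter l p)
  linarith

theorem le_norm_g_of_isFrontier_or (h : IsNormalizedPair δ ε η f g) (hp : IsGridParams l δ ε ε')
    (hf : IsFrontier (IsBadCell ε g l) (IsBigCell δ g l) l v.1 v.2 ∨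
      IsFrontier (IsBadCell ε g l) (IsBigCell δ g l) l v.1 (v.2 - 1))
    (hz : ‖z - cellCenter l v‖ ≤ 4 * cellWidth l v.1) : ε / 2 ≤ ‖g z‖ := by
  rcases hf with hf | hf
  · exact h.le_norm_g_of_isFrontier hp hf (by linarith [cellWidth_pos l v.1])
  · refine h.le_norm_g_of_isFrontier hp (q := (v.1, v.2 - 1)) hf ?_
    have h1 := norm_sub_le_norm_sub_add_norm_sub z (cellCenter l v) (cellCenter l (v.1, v.2 - 1))
    have h2 := norm_cellCenter_sub_left (l := l) v.1 v.2
    simp only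
    linarith

theorem le_norm_g_of_link (h : IsNormalizedPair δ ε η f g) (hp : IsGridParams l δ ε ε')
    (hf : IsFrontier (IsBadCell ε g l) (IsBigCell δ g l) l v.1 v.2 ∨
      IsFrontier (IsBadCell ε g l) (IsBigCell δ g l) l v.1 (v.2 - 1)) (hv : v.1 = q.1)
    (hd : |cellPos l q - cellPos l v| ≤ ε / 100 * rowTop l v.1 + cellWidth l v.1)
    (hz : ‖z - cellCenter l q‖ ≤ 8 * cellWidth l q.1) : ε / 4 ≤ ‖g z‖ := by
  have hw := cellWidth_pos l v.1
  have h1 := h.le_norm_g_of_isFrontier_or hp hf (z := cellCenter l v) (by simp [hw.le])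
  have h2 : ‖cellCenter l q - cellCenter l v‖ ≤ ε / 100 * rowTop l v.1 + cellWidth l v.1 := by
    refine (Complex.norm_le_abs_re_add_abs_im _).trans ?_
    simp only [cellCenter, Complex.sub_re, Complex.sub_im, hv]
    rw [hv] at hd
    rw [sub_self, abs_zero, add_zero, add_sub_add_right_eq_sub]
    exact hd
  have hT := rowTop_pos l (v.1 + 1)
  have hc := cellCenter_im l v
  have h4 := cellWidth_le_mul_rowTop_succ l v.1
  have h5 := rowTop_le_two_mul_succ l v.1
  have h6 := hp.width_le
  have hε := hp.ε_pos
  have hε1 : ε ≤ 1 / 16 := by linarith [hp.ε_le, hp.δ_le]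
  have hε' := hp.ε'_le
  have hε'0 := hp.ε'_pos
  have h7 : ε / 100 * rowTop l v.1 ≤ ε / 50 * rowTop l (v.1 + 1) := by nlinarith
  have h8 : cellWidth l v.1 ≤ ε / 10000 * rowTop l (v.1 + 1) := by
    refine h4.trans ?_
    gcongr
    linarith
  have h9 := norm_sub_le_of_norm_sub_lt h.hg0 (fun z hz => h.g_le z (by linarith [h.η_pos]))
    (z := cellCenter l q) (w := cellCenter l v) (by rw [hc]; nlinarith)
  have h10 : ‖g (cellCenter l q) - g (cellCenter l v)‖ ≤ ε / 10 := by
    refine h9.trans ?_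
    rw [div_le_iff₀ (cellCenter_im_pos l v), hc]
    nlinarith
  have h11 := h.osc_g hp hz
  have h12 := norm_sub_norm_le (g (cellCenter l q)) (g z)
  have h13 := norm_sub_norm_le (g (cellCenter l v)) (g (cellCenter l q))
  rw [norm_sub_rev] at h12 h13
  linarith

end IsNormalizedPair
end

section
open Set MeasureTheory Metric
open scoped ComplexConjugate Classical

variable {l P r : ℕ} {i : ℤ} {f g : ℂ → ℂ} {z w p : ℂ} {δ ε ε' η : ℝ} {q v : ℕ × ℤ}

/-- Cells around which `g` is bounded below. -/
def IsGoodCell (ε' : ℝ) (g : ℂ → ℂ) (l r : ℕ) (i : ℤ) : Prop :=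
  ∀ z, ‖z - cellCenter l (r, i)‖ ≤ 8 * cellWidth l r → ε' ≤ ‖g z‖

theorem norm_g_le_of_not_isGoodCell (h : IsNormalizedPair δ ε η f g) (hp : IsGridParams l δ ε ε')
    (hq : ¬ IsGoodCell ε' g l q.1 q.2) (hz : ‖z - cellCenter l q‖ ≤ 8 * cellWidth l q.1) :
    ‖g z‖ ≤ 2 * ε' := by
  rw [IsGoodCell] at hq
  push Not at hq
  obtain ⟨w, hw, hw'⟩ := hq
  have := h.osc_g₂ hp hz hw
  linarith [hp.ε'_pos]

theorem exists_finset_cellAt (l P : ℕ) (Y : ℝ) : ∃ S : Finset (ℕ × ℤ),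
    ∀ k ≤ P, ∀ y : ℝ, |y| ≤ Y → (k, cellAt l k y) ∈ S := by
  obtain ⟨M, hM⟩ := exists_nat_ge (Y / cellWidth l P)
  refine ⟨Finset.range (P + 1) ×ˢ Finset.Icc (-(M : ℤ) - 1) (M + 1), fun k hk y hy => ?_⟩
  rw [Finset.mem_product, Finset.mem_range, Finset.mem_Icc]
  have h1 := cellWidth_antitone l hk
  have hP := cellWidth_pos l P
  have hk' := cellWidth_pos l k
  have h2 : |y / cellWidth l k| ≤ M := by
    rw [abs_div, abs_of_pos hk']
    refine le_trans ?_ hM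
    have : 0 ≤ Y := (abs_nonneg y).trans hy
    gcongr
  rw [abs_le] at h2
  refine ⟨by simp only; omega, ?_, ?_⟩
  · rw [cellAt, Int.le_floor]; push_cast; linarith
  · simp only
    have : cellAt l k y ≤ M := by
      have := (Int.floor_le (y / cellWidth l k)).trans h2.2
      exact_mod_cast this
    omega

/-- Above a frontier point, most vertical lines avoid the region where `g` is very small. -/
theorem exists_good_fibre (h : IsNormalizedPair δ ε η f g) (hp : IsGridParams l δ ε ε') (P : ℕ)
    (hv : IsFrontier (IsBadCell ε g l) (IsBigCell δ g l) l v.1 v.2 ∨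
      IsFrontier (IsBadCell ε g l) (IsBigCell δ g l) l v.1 (v.2 - 1)) :
    ∃ G : Set ℝ, (∀ y ∈ G, |y - cellPos l v| ≤ ε / 100 * rowTop l v.1) ∧
      ENNReal.ofReal (ε / 100 * rowTop l v.1) ≤ volume G ∧
      ∀ y ∈ G, ∀ k, v.1 ≤ k → k ≤ P → IsGoodCell ε' g l k (cellAt l k y) := by
  set x₀ := cellPos l v
  set T := rowTop l v.1
  have hT : 0 < T := rowTop_pos l v.1
  have hε := hp.ε_pos
  have hε' := hp.ε'_pos
  have hεle := hp.ε'_le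
  have hεδ := hp.ε_le
  have hδ := hp.δ_le
  have haT : 0 < ε / 100 * T := by positivity
  have haT' : ε / 100 * T ≤ T := by nlinarith
  set I := Icc (x₀ - ε / 100 * T) (x₀ + ε / 100 * T)
  obtain ⟨S, hS⟩ := exists_finset_cellAt l P (|x₀| + ε / 100 * T)
  have hI : ∀ y ∈ I, |y - x₀| ≤ ε / 100 * T := fun y hy => by
    rw [abs_le]; constructor <;> linarith [hy.1, hy.2]
  set F := S.filter fun q => v.1 ≤ q.1 ∧ ∃ y ∈ I, cellAt l q.1 y = q.2 ∧
    ¬ IsGoodCell ε' g l q.1 q.2 ∧ ∀ k < q.1, v.1 ≤ k → IsGoodCell ε' g l k (cellAt l k y) with hF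
  have hmem : ∀ q ∈ F, v.1 ≤ q.1 ∧ ∃ y ∈ I, cellAt l q.1 y = q.2 ∧
    ¬ IsGoodCell ε' g l q.1 q.2 ∧ ∀ k < q.1, v.1 ≤ k → IsGoodCell ε' g l k (cellAt l k y) :=
    fun q hq => (Finset.mem_filter.1 hq).2
  have hp1 := norm_sub_cellCenter_le_of_mem (l := l) (q := v) (z := ⟨x₀, T⟩) (cellAt_cellPos ..)
    (rowTop_antitone l (Nat.le_succ _)) le_rfl
  have hp2 := h.le_norm_g_of_isFrontier_or hp hv (hp1.trans (by linarith [cellWidth_pos l v.1]))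
  have hsum : ∑ q ∈ F, cellWidth l q.1 ≤ ε / 100 * T := by
    refine (sum_cellWidth_le_of_small (F := F) (l := l) (A := 4) (e := 2 * ε') (γ := ε / 2)
      (p := ⟨x₀, T⟩) h.η_pos h.hg h.g_le ?_ ?_ (by linarith) (by linarith) (by linarith) hT hp2
      ?_).trans ?_
    · intro q hq p hp hlt heq
      obtain ⟨h1, -, -, -, h2, -⟩ := hmem q hq
      obtain ⟨-, y, -, h4, -, h5⟩ := hmem p hp
      refine h2 ?_
      have := cellAt_congr (l := l) (r' := q.1) (h4.trans (cellAt_cellPos ..).symm) hlt.le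
      rw [← heq, ← this]
      exact h5 _ hlt h1
    · intro q hq z hz
      obtain ⟨-, -, -, -, h2, -⟩ := hmem q hq
      exact norm_g_le_of_not_isGoodCell h hp h2 (hz.trans (by linarith [cellWidth_pos l q.1]))
    · intro q hq
      obtain ⟨h1, y, h2, h3, -⟩ := hmem q hq
      have h4 := mem_Ico_cell.2 h3
      have h5 := abs_le.1 (hI y h2)
      have h6 := cellWidth_antitone l h1
      have h7 := cellWidth_le_rowTop l v.1
      have h8 := rowTop_antitone l h1
      have h9 := cellWidth_pos l q.1
      have e1 : |x₀ - (cellCenter l q).re| ≤ 2 * T := by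
        rw [abs_le, cellCenter]
        simp only
        constructor <;> linarith [h4.1, h4.2]
      have e2 : (cellCenter l q).im ≤ T := by
        rw [cellCenter]; simp only; linarith
      simp only
      linarith
    · have := hp.hall'
      simp only
      nlinarith
  refine ⟨I \ ⋃ q ∈ F, Ico (cellPos l q) (cellPos l q + cellWidth l q.1), fun y hy => hI y hy.1,
    ?_, ?_⟩
  · have h1 : volume (⋃ q ∈ F, Ico (cellPos l q) (cellPos l q + cellWidth l q.1)) ≤
        ENNReal.ofReal (ε / 100 * T) := by
      refine (measure_biUnion_finset_le _ _).trans ?_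
      simp only [Real.volume_Ico, add_sub_cancel_left]
      rw [← ENNReal.ofReal_sum_of_nonneg fun q _ => (cellWidth_pos l q.1).le]
      exact ENNReal.ofReal_le_ofReal hsum
    have h2 : volume I = ENNReal.ofReal (ε / 100 * T) + ENNReal.ofReal (ε / 100 * T) := by
      rw [Real.volume_Icc, ← ENNReal.ofReal_add haT.le haT.le]
      congr 1
      ring
    refine le_trans ?_ (le_measure_sdiff)
    rw [h2]
    refine le_trans ?_ (tsub_le_tsub_left h1 _)
    rw [ENNReal.add_sub_cancel_right ENNReal.ofReal_ne_top]
  · intro y hy k hk hkP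
    by_contra hbad
    obtain ⟨k', h1, h2, h3, h4⟩ := exists_first_cell (p := fun k => ¬ IsGoodCell ε' g l k (cellAt l k y))
      ⟨k, hk, hkP, hbad⟩
    refine hy.2 (mem_biUnion (x := (k', cellAt l k' y)) ?_ (mem_Ico_cell.2 rfl))
    refine Finset.mem_coe.2 (Finset.mem_filter.2 ⟨hS k' h2 y ?_, h1, y, hy.1, rfl, h3, fun k'' h5 h6 =>
      not_not.1 (h4 k'' h5 h6)⟩)
    have := abs_sub_abs_le_abs_sub y x₀
    linarith [hI y hy.1]
end

section
open Set MeasureTheory Metric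
open scoped ComplexConjugate Classical

variable {l P r : ℕ} {i : ℤ} {f g : ℂ → ℂ} {z w : ℂ} {δ ε ε' η : ℝ} {p q v : ℕ × ℤ}

/-- The branch of `log f` on a cell. -/
noncomputable def cellLog (f : ℂ → ℂ) (l : ℕ) (q : ℕ × ℤ) (z : ℂ) : ℂ :=
  Complex.log (f (cellCenter l q)) + Complex.log (f z / f (cellCenter l q))

theorem log_sub_log {a b : ℂ} (ha : ‖a - 1‖ ≤ 1 / 100) (hb : ‖b - 1‖ ≤ 1 / 100) :
    Complex.log a - Complex.log b = Complex.log (a / b) := by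
  have hb1 := (abs_le.1 ((Complex.abs_re_le_norm _).trans hb)).1
  rw [Complex.sub_re, Complex.one_re] at hb1
  have hb0 : b ≠ 0 := by rintro rfl; norm_num at hb1
  have hb2 : 99 / 100 ≤ ‖b‖ := by
    have := norm_sub_norm_le (1 : ℂ) b
    rw [norm_sub_rev, norm_one] at this
    linarith
  have hc : ‖a / b - 1‖ ≤ 1 / 2 := by
    rw [div_sub_one hb0, norm_div, div_le_iff₀ (by linarith)]
    have := norm_sub_le (a - 1) (b - 1)
    rw [sub_sub_sub_cancel_right] at this
    linarith
  have hc1 := (abs_le.1 ((Complex.abs_re_le_norm _).trans hc)).1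
  rw [Complex.sub_re, Complex.one_re] at hc1
  have hc0 : a / b ≠ 0 := by intro h; rw [h] at hc1; norm_num at hc1
  have h1 := abs_lt.1 (Complex.abs_arg_lt_pi_div_two_iff.2 (Or.inl (show 0 < b.re by linarith)))
  have h2 := abs_lt.1 (Complex.abs_arg_lt_pi_div_two_iff.2 (Or.inl (show 0 < (a / b).re by linarith)))
  have h3 := Complex.log_mul hb0 hc0 ⟨by linarith, by linarith⟩
  rw [mul_div_cancel₀ _ hb0] at h3
  rw [h3, add_sub_cancel_left]

namespace IsNormalizedPair

theorem norm_div_sub_one_le (h : IsNormalizedPair δ ε η f g) (hp : IsGridParams l δ ε ε')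
    (hi : IsInside (IsBadCell ε g l) (IsBigCell δ g l) l q.1 q.2)
    (hz : ‖z - cellCenter l q‖ ≤ 8 * cellWidth l q.1) :
    ‖f z / f (cellCenter l q) - 1‖ ≤ 1 / 100 := by
  have h1 := h.le_norm_f_of_isInside hp hi (z := cellCenter l q)
    (by simpa using (cellWidth_pos l q.1).le)
  have hε' := hp.ε'_pos
  have hδ : 0 < δ := by linarith [hp.ε_le, hp.ε'_le]
  have h2 : f (cellCenter l q) ≠ 0 := by rw [← norm_pos_iff]; linarith
  have h3 := h.osc_f hp hz
  rw [div_sub_one h2, norm_div, div_le_iff₀ (by linarith)]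
  linarith [hp.ε_le, hp.ε'_le]

theorem re_div_pos (h : IsNormalizedPair δ ε η f g) (hp : IsGridParams l δ ε ε')
    (hi : IsInside (IsBadCell ε g l) (IsBigCell δ g l) l q.1 q.2)
    (hz : ‖z - cellCenter l q‖ ≤ 8 * cellWidth l q.1) :
    0 < (f z / f (cellCenter l q)).re := by
  have h1 := (Complex.abs_re_le_norm _).trans (h.norm_div_sub_one_le hp hi hz)
  rw [Complex.sub_re, Complex.one_re] at h1
  linarith [(abs_le.1 h1).1]

theorem exp_cellLog (h : IsNormalizedPair δ ε η f g) (hp : IsGridParams l δ ε ε')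
    (hi : IsInside (IsBadCell ε g l) (IsBigCell δ g l) l q.1 q.2)
    (hz : ‖z - cellCenter l q‖ ≤ 8 * cellWidth l q.1) : Complex.exp (cellLog f l q z) = f z := by
  have h1 := h.le_norm_f_of_isInside hp hi (z := cellCenter l q)
    (by simpa using (cellWidth_pos l q.1).le)
  have hδ : 0 < δ := by linarith [hp.ε_le, hp.ε'_le, hp.ε'_pos]
  have h2 : f (cellCenter l q) ≠ 0 := by rw [← norm_pos_iff]; linarith
  have h3 : f z / f (cellCenter l q) ≠ 0 := by
    intro h4
    have := h.re_div_pos hp hi hz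
    rw [h4] at this
    simp at this
  rw [cellLog, Complex.exp_add, Complex.exp_log h2, Complex.exp_log h3, mul_div_cancel₀ _ h2]

theorem differentiableAt_cellLog (h : IsNormalizedPair δ ε η f g) (hp : IsGridParams l δ ε ε')
    (hi : IsInside (IsBadCell ε g l) (IsBigCell δ g l) l q.1 q.2)
    (hz : ‖z - cellCenter l q‖ ≤ 8 * cellWidth l q.1) :
    DifferentiableAt ℂ (cellLog f l q) z := by
  have h1 : DifferentiableAt ℂ f z := h.hf0.differentiableAt
    ((isOpen_lt continuous_const Complex.continuous_im).mem_nhds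
      (im_pos_of_norm_sub_cellCenter_le hz hp.l_ge))
  exact ((h1.div_const _).clog (Or.inl (h.re_div_pos hp hi hz))).const_add _

theorem abs_re_cellLog_le (h : IsNormalizedPair δ ε η f g) (hp : IsGridParams l δ ε ε')
    (hi : IsInside (IsBadCell ε g l) (IsBigCell δ g l) l q.1 q.2)
    (hz : ‖z - cellCenter l q‖ ≤ 8 * cellWidth l q.1) :
    |(cellLog f l q z).re| ≤ Real.log (2 / δ) := by
  have hδ : 0 < δ := by linarith [hp.ε_le, hp.ε'_le, hp.ε'_pos]
  have h1 := h.le_norm_f_of_isInside hp hi hz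
  have h2 := h.f_le z (by linarith [h.η_pos, im_pos_of_norm_sub_cellCenter_le hz hp.l_ge])
  have h3 : (cellLog f l q z).re = Real.log ‖f z‖ := by
    rw [← h.exp_cellLog hp hi hz, Complex.norm_exp, Real.log_exp]
  rw [h3, abs_of_nonpos (Real.log_nonpos (norm_nonneg _) h2), ← Real.log_inv]
  have h4 : 0 < ‖f z‖ := by linarith
  refine Real.log_le_log (by positivity) ?_
  rw [show 2 / δ = (δ / 2)⁻¹ by rw [inv_div]]
  gcongr

theorem abs_im_cellLog_le (h : IsNormalizedPair δ ε η f g) (hp : IsGridParams l δ ε ε')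
    (hi : IsInside (IsBadCell ε g l) (IsBigCell δ g l) l q.1 q.2)
    (hz : ‖z - cellCenter l q‖ ≤ 8 * cellWidth l q.1) :
    |(cellLog f l q z).im| < 3 / 2 * Real.pi := by
  rw [cellLog, Complex.add_im, Complex.log_im, Complex.log_im]
  have h1 := Complex.abs_arg_lt_pi_div_two_iff.2 (Or.inl (h.re_div_pos hp hi hz))
  have h2 := Complex.abs_arg_le_pi (f (cellCenter l q))
  refine (abs_add_le _ _).trans_lt ?_
  linarith

theorem cellLog_sub_cellLog (h : IsNormalizedPair δ ε η f g) (hp : IsGridParams l δ ε ε')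
    (hi : IsInside (IsBadCell ε g l) (IsBigCell δ g l) l p.1 p.2)
    (hi' : IsInside (IsBadCell ε g l) (IsBigCell δ g l) l q.1 q.2)
    (hz : ‖z - cellCenter l p‖ ≤ 8 * cellWidth l p.1)
    (hz' : ‖z - cellCenter l q‖ ≤ 8 * cellWidth l q.1) :
    cellLog f l p z - cellLog f l q z = Complex.log (f (cellCenter l p)) -
      Complex.log (f (cellCenter l q)) +
      Complex.log (f (cellCenter l q) / f (cellCenter l p)) := by
  have h1 := log_sub_log (h.norm_div_sub_one_le hp hi hz) (h.norm_div_sub_one_le hp hi' hz')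
  have hδ : 0 < δ := by linarith [hp.ε_le, hp.ε'_le, hp.ε'_pos]
  have h2 : f z ≠ 0 := by
    rw [← norm_pos_iff]
    linarith [h.le_norm_f_of_isInside hp hi hz]
  rw [div_div_div_cancel_left' _ _ h2] at h1
  rw [cellLog, cellLog, ← h1]
  ring

theorem exists_cellLog_sub (h : IsNormalizedPair δ ε η f g) (hp : IsGridParams l δ ε ε') (p q : ℕ × ℤ) :
    ∃ b : ℤ, |b| ≤ 1 ∧ (IsInside (IsBadCell ε g l) (IsBigCell δ g l) l p.1 p.2 →
      IsInside (IsBadCell ε g l) (IsBigCell δ g l) l q.1 q.2 →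
      ∀ z, ‖z - cellCenter l p‖ ≤ 8 * cellWidth l p.1 → ‖z - cellCenter l q‖ ≤ 8 * cellWidth l q.1 →
      cellLog f l p z - cellLog f l q z = b * (2 * Real.pi * Complex.I)) := by
  by_cases hex : IsInside (IsBadCell ε g l) (IsBigCell δ g l) l p.1 p.2 ∧
      IsInside (IsBadCell ε g l) (IsBigCell δ g l) l q.1 q.2 ∧
      ∃ z, ‖z - cellCenter l p‖ ≤ 8 * cellWidth l p.1 ∧ ‖z - cellCenter l q‖ ≤ 8 * cellWidth l q.1
  swap
  · exact ⟨0, by simp, fun h1 h2 z h3 h4 => (hex ⟨h1, h2, z, h3, h4⟩).elim⟩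
  obtain ⟨h1, h2, z, h3, h4⟩ := hex
  have h5 := (h.exp_cellLog hp h1 h3).trans (h.exp_cellLog hp h2 h4).symm
  obtain ⟨b, hb⟩ := Complex.exp_eq_exp_iff_exists_int.1 h5
  have hb' := sub_eq_iff_eq_add'.2 hb
  refine ⟨b, ?_, fun _ _ w h6 h7 => ?_⟩
  · have h6 := h.abs_im_cellLog_le hp h1 h3
    have h7 := h.abs_im_cellLog_le hp h2 h4
    have h8 := congrArg Complex.im hb'
    simp only [Complex.sub_im, Complex.mul_im, Complex.intCast_re, Complex.intCast_im, zero_mul,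
      add_zero, Complex.mul_re, Complex.I_re, Complex.I_im, mul_zero, mul_one, Complex.ofReal_re,
      Complex.ofReal_im, Complex.re_ofNat, Complex.im_ofNat, sub_zero] at h8
    have h9 : |(b : ℝ) * (2 * Real.pi)| < 3 * Real.pi := by
      rw [← h8]
      exact (abs_sub _ _).trans_lt (by linarith)
    rw [abs_mul, abs_of_pos Real.two_pi_pos] at h9
    have h10 : |(b : ℝ)| < 2 := by nlinarith [Real.pi_pos]
    have h11 : |b| < 2 := by exact_mod_cast h10
    omega
  · rw [h.cellLog_sub_cellLog hp h1 h2 h6 h7, ← h.cellLog_sub_cellLog hp h1 h2 h3 h4, hb']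

end IsNormalizedPair

/-- The corrected branch of `log f` on a cell. -/
noncomputable def cellVal (ins : ℕ → ℤ → Prop) (f : ℂ → ℂ) (l : ℕ) (n : ℕ → ℤ → ℤ) (q : ℕ × ℤ)
    (z : ℂ) : ℂ :=
  (if ins q.1 q.2 then cellLog f l q z else 0) + n q.1 q.2 * (2 * Real.pi * Complex.I)

theorem cellVal_eq_of_sub {ins : ℕ → ℤ → Prop} {n : ℕ → ℤ → ℤ} {b : ℤ}
    (h1 : ins p.1 p.2 ↔ ins q.1 q.2)
    (h2 : ins p.1 p.2 → ins q.1 q.2 → cellLog f l p z - cellLog f l q z = b * (2 * Real.pi * Complex.I))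
    (h3 : n p.1 p.2 - n q.1 q.2 = if ins p.1 p.2 ∧ ins q.1 q.2 then -b else 0) :
    cellVal ins f l n p z = cellVal ins f l n q z := by
  rw [cellVal, cellVal]
  by_cases hi : ins p.1 p.2
  · have hi' := h1.1 hi
    rw [if_pos ⟨hi, hi'⟩] at h3
    rw [if_pos hi, if_pos hi']
    have h4 := h2 hi hi'
    have h5 : (n p.1 p.2 : ℂ) - n q.1 q.2 = -b := by exact_mod_cast h3
    linear_combination h4 + h5 * (2 * Real.pi * Complex.I)
  · have hi' := fun h => hi (h1.2 h)
    rw [if_neg (fun h => hi h.1)] at h3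
    rw [if_neg hi, if_neg hi', sub_eq_zero.1 h3]

/-- Local logarithms of `f` with a Carleson set of exceptional cells. -/
theorem exists_cellVal (h : IsNormalizedPair δ ε η f g) (hp : IsGridParams l δ ε ε') (P : ℕ) :
    ∃ (n : ℕ → ℤ → ℤ) (E : Finset (ℕ × ℤ)),
      HasCarleson l (seedConst l (ε / 100) (IsNormalizedPair.frontierConst l)) E ∧
      (∀ i, n 0 i = 0) ∧
      (∃ B : ℤ, ∀ r ≤ P, ∀ i, n r i ≠ 0 ∨ IsInside (IsBadCell ε g l) (IsBigCell δ g l) l r i → |i| ≤ B) ∧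
      (∀ r ≤ P, ∀ i, |(n r i - n r (i - 1) : ℝ)| ≤ jumpConst l (ε / 100) ∧ ((r, i) ∉ E →
        ∀ z, ‖z - cellCenter l (r, i)‖ ≤ 8 * cellWidth l r →
          ‖z - cellCenter l (r, i - 1)‖ ≤ 8 * cellWidth l r →
          cellVal (IsInside (IsBadCell ε g l) (IsBigCell δ g l) l) f l n (r, i) z =
            cellVal (IsInside (IsBadCell ε g l) (IsBigCell δ g l) l) f l n (r, i - 1) z)) ∧
      (∀ r < P, ∀ i, |(n (r + 1) i - n r (parentCell l r i) : ℝ)| ≤ jumpConst l (ε / 100) ∧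
        ((r + 1, i) ∉ E → ∀ z, ‖z - cellCenter l (r + 1, i)‖ ≤ 8 * cellWidth l (r + 1) →
          ‖z - cellCenter l (r, parentCell l r i)‖ ≤ 8 * cellWidth l r →
          cellVal (IsInside (IsBadCell ε g l) (IsBigCell δ g l) l) f l n (r + 1, i) z =
            cellVal (IsInside (IsBadCell ε g l) (IsBigCell δ g l) l) f l n (r, parentCell l r i) z)) ∧
      ∀ q ∈ E, q.1 ≤ P ∧ ∀ z, ‖z - cellCenter l q‖ ≤ 4 * cellWidth l q.1 → ε' ≤ ‖g z‖ := by
  choose b hb1 hb using h.exists_cellLog_sub (l := l) hp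
  set ins := IsInside (IsBadCell ε g l) (IsBigCell δ g l) l with hins
  have hδ := hp.δ_le
  have hε := hp.ε_pos
  have hε' := hp.ε'_le
  have hεδ := hp.ε_le
  refine Exists.elim (exists_gridHeight (bad := IsBadCell ε g l)
    (big := IsBigCell δ g l) (l := l) (P := P) (a := ε / 100) (C := IsNormalizedPair.frontierConst l)
    (bl := fun r i => if ins r i ∧ ins r (i - 1) then -b (r, i) (r, i - 1) else 0)
    (bt := fun r i => if ins (r + 1) i ∧ ins r (parentCell l r i) then
      -b (r + 1, i) (r, parentCell l r i) else 0)
    (good := IsGoodCell ε' g l) (by positivity) (by linarith) h.isBadCell_range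
    (h.hasCarleson_frontier hp) ?_ ?_ ?_ ?_ ?_ (fun v _ hv => exists_good_fibre h hp P hv)) ?_
  rotate_left 5
  · rintro n ⟨E, h1, h2, ⟨B, hB⟩, h3, h4, h5, h6⟩
    refine ⟨n, E, h1, h2, ?_, ?_, ?_, ?_⟩
    · refine ⟨max B (2 ^ (P + l + 1)), fun r hr i hi => ?_⟩
      rcases hi with hi | hi
      · exact (hB r hr i hi).trans (le_max_left _ _)
      · obtain ⟨h7, h8⟩ := hi.mem_range h.isBadCell_range
        refine le_trans ?_ (le_max_right _ _)
        rw [abs_of_nonneg h7]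
        refine h8.le.trans (pow_le_pow_right₀ (by norm_num) ?_)
        have := Nat.div_le_self r (2 ^ l)
        omega
    · refine fun r hr i => ⟨(h3 r hr i).1, fun hE z hz hz' => ?_⟩
      have h7 : ins r i ↔ ins r (i - 1) := by
        by_contra hcon
        exact hE (h5 r hr i (Or.inr hcon))
      exact cellVal_eq_of_sub (p := (r, i)) (q := (r, i - 1)) (b := b (r, i) (r, i - 1)) h7
        (fun hi hi' => hb _ _ hi hi' z hz hz') (not_not.1 fun h8 => hE ((h3 r hr i).2 h8))
    · refine fun r hr i => ⟨(h4 r hr i).1, fun hE z hz hz' => ?_⟩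
      have h7 : ins (r + 1) i ↔ ins r (parentCell l r i) := by
        by_contra hcon
        exact hE (h5 (r + 1) hr i (Or.inl hcon))
      exact cellVal_eq_of_sub (p := (r + 1, i)) (q := (r, parentCell l r i))
        (b := b (r + 1, i) (r, parentCell l r i)) h7
        (fun hi hi' => hb _ _ hi hi' z hz hz') (not_not.1 fun h8 => hE ((h4 r hr i).2 h8))
    · refine fun q hq => ⟨(h6 q hq).1, fun z hz => ?_⟩
      have hw := cellWidth_pos l q.1
      rcases (h6 q hq).2 with h7 | h7 | ⟨r, hr, h7⟩ | ⟨v, h7, h8, h9⟩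
      · linarith [h.le_norm_g_of_isFrontier hp h7 (hz.trans (by linarith))]
      · exact h7 z (hz.trans (by linarith))
      · refine h7 z ?_
        have h8 := norm_cellCenter_sub_parent (l := l) r q.2
        have h9 := norm_sub_le_norm_sub_add_norm_sub z (cellCenter l q)
          (cellCenter l (r, parentCell l r q.2))
        rw [← hr] at h8
        have h10 : cellWidth l q.1 ≤ cellWidth l r := by rw [hr]; exact cellWidth_succ_le
        linarith [cellWidth_pos l r, show ‖cellCenter l q - cellCenter l (r, parentCell l r q.2)‖ ≤
          3 * cellWidth l r from h8]
      · linarith [h.le_norm_g_of_link hp h9 h7 h8 (hz.trans (by linarith))]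
  · intro r i hne
    by_contra hcon
    exact hne (if_neg hcon)
  · intro r i hne
    by_contra hcon
    exact hne (if_neg hcon)
  · intro r i
    split_ifs
    · rw [abs_neg]; exact hb1 _ _
    · simp
  · intro r i
    split_ifs
    · rw [abs_neg]; exact hb1 _ _
    · simp
  · intro r k i1 i2 i3 i4
    have hw := cellWidth_pos l r
    have hw' := cellWidth_pos l (r + 1)
    have hww := cellWidth_succ_le (l := l) (r := r)
    have d1 : ‖cellCenter l (r + 1, k) - cellCenter l (r + 1, k)‖ ≤ 8 * cellWidth l (r + 1) := by
      simp [hw'.le]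
    have d2 : ‖cellCenter l (r + 1, k) - cellCenter l (r + 1, k - 1)‖ ≤ 8 * cellWidth l (r + 1) :=
      (norm_cellCenter_sub_left _ _).trans (by linarith)
    have d3 : ‖cellCenter l (r + 1, k) - cellCenter l (r, parentCell l r k)‖ ≤ 8 * cellWidth l r :=
      (norm_cellCenter_sub_parent _ _).trans (by linarith)
    have d4 : ‖cellCenter l (r + 1, k) - cellCenter l (r, parentCell l r (k - 1))‖ ≤ 8 * cellWidth l r := by
      have e1 := norm_cellCenter_sub_left (l := l) (r + 1) k
      have e2 := norm_cellCenter_sub_parent (l := l) r (k - 1)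
      have := norm_sub_le_norm_sub_add_norm_sub (cellCenter l (r + 1, k)) (cellCenter l (r + 1, k - 1))
        (cellCenter l (r, parentCell l r (k - 1)))
      linarith
    have e1 := hb (r + 1, k) (r + 1, k - 1) i1 i2 _ d1 d2
    have e2 := hb (r + 1, k) (r, parentCell l r k) i1 i3 _ d1 d3
    have e3 := hb (r + 1, k - 1) (r, parentCell l r (k - 1)) i2 i4 _ d2 d4
    have hpi : (2 * Real.pi * Complex.I : ℂ) ≠ 0 := by simp [Real.pi_ne_zero]
    simp only [gridCharge]
    have c1 : ins (r + 1) k ∧ ins (r + 1) (k - 1) := ⟨i1, i2⟩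
    have c2 : ins (r + 1) k ∧ ins r (parentCell l r k) := ⟨i1, i3⟩
    have c3 : ins (r + 1) (k - 1) ∧ ins r (parentCell l r (k - 1)) := ⟨i2, i4⟩
    simp only [if_pos c1, if_pos c2, if_pos c3]
    rcases parentCell_sub_one (l := l) (r := r) (i := k) with h7 | h7
    · rw [if_pos h7.symm]
      rw [h7] at e3 ⊢
      have : ((b (r + 1, k) (r + 1, k - 1) : ℂ) - b (r + 1, k) (r, parentCell l r k) +
          b (r + 1, k - 1) (r, parentCell l r k)) * (2 * Real.pi * Complex.I) = 0 := by
        linear_combination e2 - e1 - e3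
      have := (mul_eq_zero.1 this).resolve_right hpi
      have h8 : b (r + 1, k) (r + 1, k - 1) - b (r + 1, k) (r, parentCell l r k) +
          b (r + 1, k - 1) (r, parentCell l r k) = 0 := by exact_mod_cast this
      omega
    · rw [if_neg (show ¬ parentCell l r k = parentCell l r (k - 1) by omega)]
      rw [h7] at i4 d4
      have e4 := hb (r, parentCell l r k) (r, parentCell l r k - 1) i3 i4 _ d3 d4
      have c4 : ins r (parentCell l r k) ∧ ins r (parentCell l r k - 1) := ⟨i3, i4⟩
      rw [if_pos c4]
      rw [h7] at e3 ⊢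
      have : ((b (r + 1, k) (r + 1, k - 1) : ℂ) - b (r + 1, k) (r, parentCell l r k) +
          b (r + 1, k - 1) (r, parentCell l r k - 1) -
          b (r, parentCell l r k) (r, parentCell l r k - 1)) * (2 * Real.pi * Complex.I) = 0 := by
        linear_combination e2 - e1 - e3 + e4
      have := (mul_eq_zero.1 this).resolve_right hpi
      have h8 : b (r + 1, k) (r + 1, k - 1) - b (r + 1, k) (r, parentCell l r k) +
          b (r + 1, k - 1) (r, parentCell l r k - 1) -
          b (r, parentCell l r k) (r, parentCell l r k - 1) = 0 := by exact_mod_cast this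
      omega
end

section
open Set MeasureTheory Metric Complex
open scoped ComplexConjugate Classical

variable {l P r : ℕ} {i : ℤ} {z w : ℂ} {t x y : ℝ} {p q : ℕ × ℤ}

/-- A smooth step from `0` to `1` between `-1/4` and `1/4`. -/
noncomputable def stepFun (t : ℝ) : ℝ := Real.smoothTransition (2 * t + 1 / 2)

theorem stepFun_nonneg (t : ℝ) : 0 ≤ stepFun t := Real.smoothTransition.nonneg _

theorem stepFun_le_one (t : ℝ) : stepFun t ≤ 1 := Real.smoothTransition.le_one _

theorem stepFun_of_le (h : t ≤ -(1 / 4)) : stepFun t = 0 :=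
  Real.smoothTransition.zero_of_nonpos (by linarith)

theorem stepFun_of_ge (h : 1 / 4 ≤ t) : stepFun t = 1 :=
  Real.smoothTransition.one_of_one_le (by linarith)

theorem contDiff_stepFun : ContDiff ℝ 2 stepFun :=
  (Real.smoothTransition.contDiff (n := 2)).comp (by fun_prop)

theorem hasDerivAt_stepFun (t : ℝ) : HasDerivAt stepFun (deriv stepFun t) t :=
  (contDiff_stepFun.differentiable (by norm_num) t).hasDerivAt

theorem contDiff_deriv_stepFun : ContDiff ℝ 1 (deriv stepFun) :=
  ((contDiff_succ_iff_deriv (n := 1)).1 (by norm_num; exact contDiff_stepFun)).2.2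

theorem exists_abs_deriv_stepFun_le : ∃ K : ℝ, 0 < K ∧ ∀ t, |deriv stepFun t| ≤ K := by
  obtain ⟨K, hK⟩ := (isCompact_Icc (a := (-1 : ℝ)) (b := 1)).exists_bound_of_continuousOn
    contDiff_deriv_stepFun.continuous.continuousOn
  refine ⟨max K 1, by positivity, fun t => ?_⟩
  by_cases ht : t ∈ Icc (-1 : ℝ) 1
  · exact (hK t ht).trans (le_max_left _ _)
  · have : deriv stepFun t = 0 := by
      rw [mem_Icc, not_and_or, not_le, not_le] at ht
      rcases ht with ht | ht
      · have : stepFun =ᶠ[nhds t] fun _ => 0 := by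
          filter_upwards [Iio_mem_nhds ht] with u hu
          exact stepFun_of_le (by linarith [mem_Iio.1 hu])
        rw [this.deriv_eq]; simp
      · have : stepFun =ᶠ[nhds t] fun _ => 1 := by
          filter_upwards [Ioi_mem_nhds ht] with u hu
          exact stepFun_of_ge (by linarith [mem_Ioi.1 hu])
        rw [this.deriv_eq]; simp
    rw [this, abs_zero]
    positivity

/-- A bound for the derivative of `stepFun`. -/
noncomputable def stepConst : ℝ := Classical.choose exists_abs_deriv_stepFun_le

theorem stepConst_pos : 0 < stepConst := (Classical.choose_spec exists_abs_deriv_stepFun_le).1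

theorem abs_deriv_stepFun_le (t : ℝ) : |deriv stepFun t| ≤ stepConst :=
  (Classical.choose_spec exists_abs_deriv_stepFun_le).2 t

/-- The step at the top of a row. -/
noncomputable def rowStep (l r : ℕ) (y : ℝ) : ℝ := stepFun ((y - rowTop l r) / cellWidth l r)

theorem rowStep_of_le (h : y ≤ rowTop l r - cellWidth l r / 4) : rowStep l r y = 0 := by
  refine stepFun_of_le ?_
  rw [div_le_iff₀ (cellWidth_pos l r)]
  linarith

theorem rowStep_of_ge (h : rowTop l r + cellWidth l r / 4 ≤ y) : rowStep l r y = 1 := by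
  refine stepFun_of_ge ?_
  rw [le_div_iff₀ (cellWidth_pos l r)]
  linarith

/-- The step at the left of a cell. -/
noncomputable def colStep (l r : ℕ) (i : ℤ) (x : ℝ) : ℝ := stepFun (x / cellWidth l r - i)

theorem colStep_of_le (h : x ≤ (i - 1 / 4) * cellWidth l r) : colStep l r i x = 0 := by
  refine stepFun_of_le ?_
  rw [sub_le_iff_le_add, div_le_iff₀ (cellWidth_pos l r)]
  linarith

theorem colStep_of_ge (h : (i + 1 / 4) * cellWidth l r ≤ x) : colStep l r i x = 1 := by
  refine stepFun_of_ge ?_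
  rw [le_sub_iff_add_le, le_div_iff₀ (cellWidth_pos l r)]
  linarith

theorem hasDerivAt_rowStep (l r : ℕ) (y : ℝ) : HasDerivAt (rowStep l r)
    (deriv stepFun ((y - rowTop l r) / cellWidth l r) / cellWidth l r) y := by
  have := (hasDerivAt_stepFun ((y - rowTop l r) / cellWidth l r)).comp y
    (((hasDerivAt_id y).sub_const (rowTop l r)).div_const (cellWidth l r))
  rwa [mul_one_div] at this

theorem hasDerivAt_colStep (l r : ℕ) (i : ℤ) (x : ℝ) : HasDerivAt (colStep l r i)
    (deriv stepFun (x / cellWidth l r - i) / cellWidth l r) x := by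
  have := (hasDerivAt_stepFun (x / cellWidth l r - i)).comp x
    (((hasDerivAt_id x).div_const (cellWidth l r)).sub_const (i : ℝ))
  rwa [mul_one_div] at this

theorem contDiff_rowStep (l r : ℕ) : ContDiff ℝ 1 (rowStep l r) :=
  (contDiff_stepFun.of_le (by norm_num)).comp (by fun_prop)

theorem contDiff_colStep (l r : ℕ) (i : ℤ) : ContDiff ℝ 1 (colStep l r i) :=
  (contDiff_stepFun.of_le (by norm_num)).comp (by fun_prop)

theorem contDiff_deriv_rowStep (l r : ℕ) : ContDiff ℝ 1 (deriv (rowStep l r)) := by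
  have : deriv (rowStep l r) = fun y => deriv stepFun ((y - rowTop l r) / cellWidth l r) / cellWidth l r :=
    funext fun y => (hasDerivAt_rowStep l r y).deriv
  rw [this]
  exact (contDiff_deriv_stepFun.comp (by fun_prop)).div_const _

theorem contDiff_deriv_colStep (l r : ℕ) (i : ℤ) : ContDiff ℝ 1 (deriv (colStep l r i)) := by
  have : deriv (colStep l r i) = fun x => deriv stepFun (x / cellWidth l r - i) / cellWidth l r :=
    funext fun y => (hasDerivAt_colStep l r i y).deriv
  rw [this]
  exact (contDiff_deriv_stepFun.comp (by fun_prop)).div_const _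

theorem abs_deriv_rowStep_le (l r : ℕ) (y : ℝ) : |deriv (rowStep l r) y| ≤ stepConst / cellWidth l r := by
  have hw := cellWidth_pos l r
  rw [(hasDerivAt_rowStep l r y).deriv, abs_div, abs_of_pos hw]
  gcongr
  exact abs_deriv_stepFun_le _

theorem abs_deriv_colStep_le (l r : ℕ) (i : ℤ) (x : ℝ) :
    |deriv (colStep l r i) x| ≤ stepConst / cellWidth l r := by
  have hw := cellWidth_pos l r
  rw [(hasDerivAt_colStep l r i x).deriv, abs_div, abs_of_pos hw]
  gcongr
  exact abs_deriv_stepFun_le _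

/-- The smooth bump of a cell. -/
noncomputable def cellBump (l : ℕ) (q : ℕ × ℤ) (z : ℂ) : ℂ :=
  (((rowStep l (q.1 + 1) z.im - rowStep l q.1 z.im) *
    (colStep l q.1 q.2 z.re - colStep l q.1 (q.2 + 1) z.re) : ℝ) : ℂ)

/-- The `∂̄` derivative of the bump of a cell. -/
noncomputable def cellBumpDbar (l : ℕ) (q : ℕ × ℤ) (z : ℂ) : ℂ :=
  1 / 2 * (((rowStep l (q.1 + 1) z.im - rowStep l q.1 z.im) *
    (deriv (colStep l q.1 q.2) z.re - deriv (colStep l q.1 (q.2 + 1)) z.re) : ℝ) +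
    I * ((deriv (rowStep l (q.1 + 1)) z.im - deriv (rowStep l q.1) z.im) *
    (colStep l q.1 q.2 z.re - colStep l q.1 (q.2 + 1) z.re) : ℝ))

/-- A closed set outside of which the bump of a cell vanishes. -/
def cellBox (l : ℕ) (q : ℕ × ℤ) : Set ℂ :=
  {z | rowTop l (q.1 + 1) - cellWidth l (q.1 + 1) / 4 ≤ z.im ∧ z.im ≤ rowTop l q.1 + cellWidth l q.1 / 4 ∧
    (q.2 - 1 / 4) * cellWidth l q.1 ≤ z.re ∧ z.re ≤ (q.2 + 5 / 4) * cellWidth l q.1}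

theorem hasDbarAt_cellBump (l : ℕ) (q : ℕ × ℤ) (z : ℂ) :
    HasDbarAt (cellBump l q) (cellBumpDbar l q z) z := by
  have hA : HasDerivAt (fun y => rowStep l (q.1 + 1) y - rowStep l q.1 y)
      (deriv (rowStep l (q.1 + 1)) z.im - deriv (rowStep l q.1) z.im) z.im :=
    (hasDerivAt_rowStep l _ _).differentiableAt.hasDerivAt.sub
      (hasDerivAt_rowStep l _ _).differentiableAt.hasDerivAt
  have hB : HasDerivAt (fun x => colStep l q.1 q.2 x - colStep l q.1 (q.2 + 1) x)
      (deriv (colStep l q.1 q.2) z.re - deriv (colStep l q.1 (q.2 + 1)) z.re) z.re :=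
    (hasDerivAt_colStep l _ _ _).differentiableAt.hasDerivAt.sub
      (hasDerivAt_colStep l _ _ _).differentiableAt.hasDerivAt
  have h1 := hA.comp_hasFDerivAt z imCLM.hasFDerivAt
  have h2 := hB.comp_hasFDerivAt z reCLM.hasFDerivAt
  have h3 := ofRealCLM.hasFDerivAt.comp z (h1.mul h2)
  refine ⟨_, h3, ?_⟩
  simp [cellBumpDbar]
  ring

theorem isClosed_cellBox (l : ℕ) (q : ℕ × ℤ) : IsClosed (cellBox l q) :=
  (isClosed_le continuous_const continuous_im).inter ((isClosed_le continuous_im continuous_const).inter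
    ((isClosed_le continuous_const continuous_re).inter (isClosed_le continuous_re continuous_const)))

theorem cellBump_eq_zero (h : z ∉ cellBox l q) : cellBump l q z = 0 := by
  have hw := cellWidth_pos l q.1
  have hw' := cellWidth_pos l (q.1 + 1)
  have h1 := rowTop_sub_succ l q.1
  have h2 := cellWidth_succ_le (l := l) (r := q.1)
  rw [cellBump]
  simp only [cellBox, mem_ofPred_eq, not_and_or, not_le] at h
  rw [ofReal_eq_zero, mul_eq_zero]
  rcases h with h | h | h | h
  · left; rw [rowStep_of_le h.le, rowStep_of_le (by linarith), sub_self]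
  · left; rw [rowStep_of_ge h.le, rowStep_of_ge (by linarith), sub_self]
  · right; rw [colStep_of_le h.le, colStep_of_le (by push_cast; nlinarith), sub_self]
  · right; rw [colStep_of_ge (by nlinarith), colStep_of_ge (by push_cast; nlinarith), sub_self]

theorem cellBump_eventuallyEq_zero (h : z ∉ cellBox l q) : cellBump l q =ᶠ[nhds z] fun _ => 0 := by
  filter_upwards [(isClosed_cellBox l q).isOpen_compl.mem_nhds h] with w hw
  exact cellBump_eq_zero hw

theorem cellBumpDbar_eq_zero (h : z ∉ cellBox l q) : cellBumpDbar l q z = 0 :=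
  (hasDbarAt_cellBump l q z).unique
    ((HasDbarAt.of_differentiableAt (differentiableAt_const (0 : ℂ))).congr_of_eventuallyEq
      (cellBump_eventuallyEq_zero h))

theorem contDiff_cellBump (l : ℕ) (q : ℕ × ℤ) : ContDiff ℝ 1 (cellBump l q) := by
  have h1 : ∀ r, ContDiff ℝ 1 fun z : ℂ => rowStep l r z.im := fun r =>
    (contDiff_rowStep l r).comp imCLM.contDiff
  have h2 : ∀ r i, ContDiff ℝ 1 fun z : ℂ => colStep l r i z.re := fun r i =>
    (contDiff_colStep l r i).comp reCLM.contDiff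
  exact ofRealCLM.contDiff.comp (((h1 _).sub (h1 _)).mul ((h2 _ _).sub (h2 _ _)))

theorem contDiff_cellBumpDbar (l : ℕ) (q : ℕ × ℤ) : ContDiff ℝ 1 (cellBumpDbar l q) := by
  have h1 : ∀ r, ContDiff ℝ 1 fun z : ℂ => rowStep l r z.im := fun r =>
    (contDiff_rowStep l r).comp imCLM.contDiff
  have h2 : ∀ r i, ContDiff ℝ 1 fun z : ℂ => colStep l r i z.re := fun r i =>
    (contDiff_colStep l r i).comp reCLM.contDiff
  have h3 : ∀ r, ContDiff ℝ 1 fun z : ℂ => deriv (rowStep l r) z.im := fun r =>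
    (contDiff_deriv_rowStep l r).comp imCLM.contDiff
  have h4 : ∀ r i, ContDiff ℝ 1 fun z : ℂ => deriv (colStep l r i) z.re := fun r i =>
    (contDiff_deriv_colStep l r i).comp reCLM.contDiff
  exact contDiff_const.mul ((ofRealCLM.contDiff.comp (((h1 _).sub (h1 _)).mul ((h4 _ _).sub (h4 _ _)))).add
    (contDiff_const.mul (ofRealCLM.contDiff.comp (((h3 _).sub (h3 _)).mul ((h2 _ _).sub (h2 _ _))))))

theorem abs_sub_le_one_of_mem {a b : ℝ} (ha : 0 ≤ a ∧ a ≤ 1) (hb : 0 ≤ b ∧ b ≤ 1) : |a - b| ≤ 1 := by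
  rw [abs_le]; constructor <;> linarith [ha.1, ha.2, hb.1, hb.2]

theorem norm_cellBump_le (l : ℕ) (q : ℕ × ℤ) (z : ℂ) : ‖cellBump l q z‖ ≤ 1 := by
  rw [cellBump, norm_real, Real.norm_eq_abs, abs_mul]
  exact mul_le_one₀
    (abs_sub_le_one_of_mem ⟨stepFun_nonneg _, stepFun_le_one _⟩ ⟨stepFun_nonneg _, stepFun_le_one _⟩)
    (abs_nonneg _)
    (abs_sub_le_one_of_mem ⟨stepFun_nonneg _, stepFun_le_one _⟩ ⟨stepFun_nonneg _, stepFun_le_one _⟩)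

theorem norm_cellBumpDbar_le (l : ℕ) (q : ℕ × ℤ) (z : ℂ) :
    ‖cellBumpDbar l q z‖ ≤ 3 * stepConst / cellWidth l q.1 := by
  have hw := cellWidth_pos l q.1
  have hw' := cellWidth_pos l (q.1 + 1)
  have hK := stepConst_pos
  have h1 : |rowStep l (q.1 + 1) z.im - rowStep l q.1 z.im| ≤ 1 :=
    abs_sub_le_one_of_mem ⟨stepFun_nonneg _, stepFun_le_one _⟩ ⟨stepFun_nonneg _, stepFun_le_one _⟩
  have h2 : |colStep l q.1 q.2 z.re - colStep l q.1 (q.2 + 1) z.re| ≤ 1 :=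
    abs_sub_le_one_of_mem ⟨stepFun_nonneg _, stepFun_le_one _⟩ ⟨stepFun_nonneg _, stepFun_le_one _⟩
  have h3 : |deriv (colStep l q.1 q.2) z.re - deriv (colStep l q.1 (q.2 + 1)) z.re| ≤
      2 * (stepConst / cellWidth l q.1) := by
    refine (abs_sub _ _).trans ?_
    linarith [abs_deriv_colStep_le l q.1 q.2 z.re, abs_deriv_colStep_le l q.1 (q.2 + 1) z.re]
  have h4 : |deriv (rowStep l (q.1 + 1)) z.im - deriv (rowStep l q.1) z.im| ≤
      3 * (stepConst / cellWidth l q.1) := by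
    refine (abs_sub _ _).trans ?_
    have h5 : stepConst / cellWidth l (q.1 + 1) ≤ 2 * (stepConst / cellWidth l q.1) := by
      rw [← mul_div_assoc, div_le_div_iff₀ hw' hw]
      nlinarith [cellWidth_le_two_mul_succ (l := l) (r := q.1)]
    linarith [abs_deriv_rowStep_le l (q.1 + 1) z.im, abs_deriv_rowStep_le l q.1 z.im]
  have h5 : 0 ≤ stepConst / cellWidth l q.1 := by positivity
  rw [cellBumpDbar, norm_mul]
  have h6 := norm_add_le ((((rowStep l (q.1 + 1) z.im - rowStep l q.1 z.im) *
    (deriv (colStep l q.1 q.2) z.re - deriv (colStep l q.1 (q.2 + 1)) z.re) : ℝ)) : ℂ)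
    (I * ((deriv (rowStep l (q.1 + 1)) z.im - deriv (rowStep l q.1) z.im) *
    (colStep l q.1 q.2 z.re - colStep l q.1 (q.2 + 1) z.re) : ℝ))
  rw [norm_mul, norm_I, one_mul, norm_real, norm_real, Real.norm_eq_abs, Real.norm_eq_abs, abs_mul,
    abs_mul] at h6
  have h7 := mul_le_mul h1 h3 (abs_nonneg _) zero_le_one
  have h8 := mul_le_mul h4 h2 (abs_nonneg _) (by positivity)
  rw [show ‖(1 / 2 : ℂ)‖ = 1 / 2 by norm_num, mul_div_assoc]
  linarith

theorem norm_sub_cellCenter_le_of_mem_cellBox (h : z ∈ cellBox l q) :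
    ‖z - cellCenter l q‖ ≤ 2 * cellWidth l q.1 := by
  obtain ⟨h1, h2, h3, h4⟩ := h
  have hw := cellWidth_pos l q.1
  have h5 := rowTop_sub_succ l q.1
  have h6 := cellWidth_succ_le (l := l) (r := q.1)
  refine (norm_le_abs_re_add_abs_im _).trans ?_
  have e1 : |(z - cellCenter l q).re| ≤ cellWidth l q.1 := by
    rw [abs_le, sub_re]
    simp only [cellCenter, cellPos]
    constructor <;> linarith
  have e2 : |(z - cellCenter l q).im| ≤ cellWidth l q.1 := by
    rw [abs_le, sub_im]
    simp only [cellCenter]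
    constructor <;> linarith
  linarith

theorem cellBox_subset_closedBall (l : ℕ) (q : ℕ × ℤ) :
    cellBox l q ⊆ closedBall (cellCenter l q) (2 * cellWidth l q.1) := fun z hz => by
  rw [mem_closedBall, dist_eq_norm]
  exact norm_sub_cellCenter_le_of_mem_cellBox hz

/-- The row containing a height. -/
theorem exists_row (hy : rowTop l (P + 1) < y) :
    ∃ r ≤ P, rowTop l (r + 1) < y ∧ (r = 0 ∨ y ≤ rowTop l r) := by
  induction P with
  | zero => exact ⟨0, le_rfl, hy, Or.inl rfl⟩
  | succ P ih =>
    by_cases h : rowTop l (P + 1) < y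
    · obtain ⟨r, h1, h2⟩ := ih h
      exact ⟨r, h1.trans (Nat.le_succ _), h2⟩
    · exact ⟨P + 1, le_rfl, hy, Or.inr (not_lt.1 h)⟩

theorem near_of_mem_cellBox (h : z ∈ cellBox l q) (h1 : rowTop l (r + 1) < z.im)
    (h2 : r = 0 ∨ z.im ≤ rowTop l r) :
    q.1 ≤ r + 1 ∧ r ≤ q.1 + 1 ∧ cellAt l q.1 z.re - 1 ≤ q.2 ∧ q.2 ≤ cellAt l q.1 z.re + 1 := by
  obtain ⟨h3, h4, h5, h6⟩ := h
  have hw := cellWidth_pos l q.1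
  refine ⟨?_, ?_, ?_, ?_⟩
  · by_contra! hlt
    have e1 := rowTop_antitone l (show r + 2 ≤ q.1 by omega)
    have e2 := rowTop_sub_succ l (r + 1)
    have e3 := cellWidth_antitone l (show r + 1 ≤ q.1 by omega)
    have e4 := cellWidth_pos l (r + 1)
    linarith
  · by_contra! hlt
    have e1 := rowTop_antitone l (show q.1 + 2 ≤ r by omega)
    have e2 := rowTop_sub_succ l (q.1 + 1)
    have e4 := cellWidth_pos l (q.1 + 1)
    rcases h2 with h2 | h2
    · omega
    · linarith
  · have : cellAt l q.1 z.re < q.2 + 2 := by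
      rw [cellAt, Int.floor_lt, div_lt_iff₀ hw]
      push_cast
      linarith
    omega
  · have : q.2 - 1 ≤ cellAt l q.1 z.re := by
      rw [cellAt, Int.le_floor, le_div_iff₀ hw]
      push_cast
      linarith
    omega

theorem sum_cellBump (l P M : ℕ) (z : ℂ) :
    ∑ q ∈ Finset.range (P + 1) ×ˢ Finset.Ico (-(M : ℤ)) M, cellBump l q z =
      ∑ r ∈ Finset.range (P + 1), (((rowStep l (r + 1) z.im - rowStep l r z.im) *
        (colStep l r (-M) z.re - colStep l r M z.re) : ℝ) : ℂ) := by
  rw [Finset.sum_product]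
  refine Finset.sum_congr rfl fun r _ => ?_
  simp only [cellBump]
  rw [← ofReal_sum, ← Finset.mul_sum]
  congr 2
  induction M with
  | zero => simp
  | succ M ih =>
    have : Finset.Ico (-((M + 1 : ℕ) : ℤ)) ((M + 1 : ℕ) : ℤ) =
        insert (-(M : ℤ) - 1) (insert (M : ℤ) (Finset.Ico (-(M : ℤ)) M)) := by
      ext j
      simp only [Finset.mem_Ico, Finset.mem_insert]
      push_cast
      omega
    rw [this, Finset.sum_insert, Finset.sum_insert, ih]
    · push_cast
      rw [show -(M : ℤ) - 1 + 1 = -M by ring, show -((M : ℤ) + 1) = -M - 1 by ring]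
      ring
    · simp
    · simp only [Finset.mem_insert, Finset.mem_Ico]; omega

theorem sum_cellBump_eq_one {M : ℕ} (h1 : rowTop l (P + 1) + cellWidth l (P + 1) / 4 ≤ z.im)
    (h2 : z.im ≤ rowTop l 0 - cellWidth l 0 / 4) (h3 : |z.re| ≤ (M - 1) * cellWidth l P) :
    ∑ q ∈ Finset.range (P + 1) ×ˢ Finset.Ico (-(M : ℤ)) M, cellBump l q z = 1 := by
  rw [sum_cellBump, ← ofReal_sum]
  have hP := cellWidth_pos l P
  have hM : (0 : ℝ) ≤ M - 1 := by
    by_contra! hneg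
    have := (abs_nonneg z.re).trans h3
    nlinarith
  have : ∑ r ∈ Finset.range (P + 1), (rowStep l (r + 1) z.im - rowStep l r z.im) *
        (colStep l r (-M) z.re - colStep l r M z.re) =
      ∑ r ∈ Finset.range (P + 1), (rowStep l (r + 1) z.im - rowStep l r z.im) := by
    refine Finset.sum_congr rfl fun r hr => ?_
    have h4 := cellWidth_antitone l (Nat.lt_succ_iff.1 (Finset.mem_range.1 hr))
    have h5 := abs_le.1 (h3.trans (mul_le_mul_of_nonneg_left h4 hM))
    have h6 := cellWidth_pos l r
    rw [colStep_of_ge (by push_cast; nlinarith [h5.1]), colStep_of_le (by push_cast; nlinarith [h5.2]),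
      sub_zero, mul_one]
  rw [this, Finset.sum_range_sub (fun r => rowStep l r z.im), rowStep_of_ge h1, rowStep_of_le h2, sub_zero, ofReal_one]
end

section
open Set MeasureTheory Metric Complex
open scoped ComplexConjugate Classical

variable {l N r : ℕ} {i : ℤ} {z w : ℂ} {A L : ℝ} {p q : ℕ × ℤ} {E : Finset (ℕ × ℤ)} {cv : ℕ × ℤ → ℂ → ℂ}

/-- Local holomorphic functions on cells whose jumps along the edges are controlled. -/
structure IsCellFamily (l N : ℕ) (E : Finset (ℕ × ℤ)) (A L : ℝ) (cv : ℕ × ℤ → ℂ → ℂ) : Prop where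
  nonneg : 0 ≤ A
  left : ∀ r ≤ N, ∀ i z, ‖z - cellCenter l (r, i)‖ ≤ 4 * cellWidth l r →
    ‖z - cellCenter l (r, i - 1)‖ ≤ 4 * cellWidth l r →
    ‖cv (r, i) z - cv (r, i - 1) z‖ ≤ A ∧ ((r, i) ∉ E → cv (r, i) z = cv (r, i - 1) z)
  top : ∀ r < N, ∀ i z, ‖z - cellCenter l (r + 1, i)‖ ≤ 4 * cellWidth l (r + 1) →
    ‖z - cellCenter l (r, parentCell l r i)‖ ≤ 4 * cellWidth l r →
    ‖cv (r + 1, i) z - cv (r, parentCell l r i) z‖ ≤ A ∧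
      ((r + 1, i) ∉ E → cv (r + 1, i) z = cv (r, parentCell l r i) z)
  diff : ∀ p, p.1 ≤ N → ∀ z, ‖z - cellCenter l p‖ ≤ 4 * cellWidth l p.1 → DifferentiableAt ℂ (cv p) z
  zero : ∃ B : ℕ, ∀ p, p.1 ≤ N → p.1 = 0 ∨ (B : ℤ) < |p.2| → ∀ z, cv p z = 0
  re_le : ∀ p, p.1 ≤ N → ∀ z, ‖z - cellCenter l p‖ ≤ 4 * cellWidth l p.1 → |(cv p z).re| ≤ L

/-- `p` is one of the at most nine cells surrounding `z`, where `z` lies in row `r`. -/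
def IsNear (l r : ℕ) (z : ℂ) (p : ℕ × ℤ) : Prop :=
  p.1 ≤ r + 1 ∧ r ≤ p.1 + 1 ∧ cellAt l p.1 z.re - 1 ≤ p.2 ∧ p.2 ≤ cellAt l p.1 z.re + 1

/-- The point `z` lies in row `r` (where row `0` is extended a bit upwards). -/
def InRow (l r : ℕ) (z : ℂ) : Prop :=
  rowTop l (r + 1) < z.im ∧ (r = 0 ∨ z.im ≤ rowTop l r) ∧ z.im ≤ rowTop l 0 + cellWidth l 0 / 4

theorem mem_cellAt (l r : ℕ) (x : ℝ) :
    cellAt l r x * cellWidth l r ≤ x ∧ x < (cellAt l r x + 1) * cellWidth l r := by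
  have hw := cellWidth_pos l r
  rw [← le_div_iff₀ hw, ← div_lt_iff₀ hw]
  exact ⟨Int.floor_le _, Int.lt_floor_add_one _⟩

theorem IsNear.width_le (h : IsNear l r z p) : cellWidth l r ≤ 2 * cellWidth l p.1 :=
  cellWidth_le_two_mul_of_le_succ h.1

theorem IsNear.le_width (h : IsNear l r z p) : cellWidth l p.1 ≤ 2 * cellWidth l r :=
  cellWidth_le_two_mul_of_le_succ h.2.1

theorem IsNear.abs_cellPos_sub (h : IsNear l r z p) : |cellPos l p - z.re| ≤ 2 * cellWidth l p.1 := by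
  have hw := cellWidth_pos l p.1
  obtain ⟨h1, h2⟩ := mem_cellAt l p.1 z.re
  obtain ⟨-, -, h3, h4⟩ := h
  have h3' : (cellAt l p.1 z.re : ℝ) - 1 ≤ p.2 := by exact_mod_cast h3
  have h4' : (p.2 : ℝ) ≤ cellAt l p.1 z.re + 1 := by exact_mod_cast h4
  rw [cellPos, abs_le]
  constructor <;> nlinarith

theorem isNear_center (l r : ℕ) (z : ℂ) : IsNear l r z (r, cellAt l r z.re) := by
  refine ⟨?_, ?_, ?_, ?_⟩ <;> simp

theorem IsNear.abs_cellPos_sub_center (h : IsNear l r z p) :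
    |cellPos l p - cellPos l (r, cellAt l r z.re)| ≤ 5 * cellWidth l r ∧
    |cellPos l p - cellPos l (r, cellAt l r z.re)| ≤ 5 * cellWidth l p.1 := by
  have h1 := h.abs_cellPos_sub
  have h2 := h.width_le
  have h3 := h.le_width
  obtain ⟨h4, h5⟩ := mem_cellAt l r z.re
  have h6 : |z.re - cellPos l (r, cellAt l r z.re)| ≤ cellWidth l r := by
    rw [cellPos, abs_le]
    constructor <;> nlinarith [cellWidth_pos l r]
  have h7 := abs_sub_le (cellPos l p) z.re (cellPos l (r, cellAt l r z.re))
  constructor <;> linarith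

theorem IsNear.norm_sub_le (h : IsNear l r z p) (hr : InRow l r z) :
    ‖z - cellCenter l p‖ ≤ 4 * cellWidth l p.1 := by
  have hw := cellWidth_pos l p.1
  have h1 : |z.re - (cellCenter l p).re| ≤ 3 / 2 * cellWidth l p.1 := by
    obtain ⟨h1, h2⟩ := mem_cellAt l p.1 z.re
    obtain ⟨-, -, h3, h4⟩ := h
    have h3' : (cellAt l p.1 z.re : ℝ) - 1 ≤ p.2 := by exact_mod_cast h3
    have h4' : (p.2 : ℝ) ≤ cellAt l p.1 z.re + 1 := by exact_mod_cast h4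
    rw [cellCenter, cellPos, abs_le]
    constructor <;> simp only <;> nlinarith
  have h2 : |z.im - (cellCenter l p).im| ≤ 3 * cellWidth l p.1 := by
    rw [cellCenter_im]
    obtain ⟨h3, h4, h5⟩ := hr
    have h6 := h.width_le
    have h7 := h.le_width
    have h8 := rowTop_sub_succ l p.1
    have h9 := rowTop_sub_succ l r
    have hwr := cellWidth_pos l r
    have h4' : z.im ≤ rowTop l r + cellWidth l r / 4 := by
      rcases h4 with rfl | h4 <;> linarith
    obtain ⟨k1, k2, -, -⟩ := h
    have hc : p.1 = r ∨ p.1 = r + 1 ∨ r = p.1 + 1 := by omega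
    rw [abs_le]
    rcases hc with hc | hc | hc
    · rw [hc] at h8 ⊢; constructor <;> linarith
    · rw [hc] at h6 h8 hw ⊢
      constructor <;> linarith
    · have hr0 : z.im ≤ rowTop l r := h4.resolve_left (by omega)
      have := cellWidth_succ_le (l := l) (r := p.1)
      subst hc
      constructor <;> linarith
  have h3 : ‖z - cellCenter l p‖ ^ 2 ≤ (4 * cellWidth l p.1) ^ 2 := by
    rw [Complex.sq_norm, Complex.normSq_apply, Complex.sub_re, Complex.sub_im]
    have := sq_le_sq' (abs_le.1 h1).1 (abs_le.1 h1).2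
    have := sq_le_sq' (abs_le.1 h2).1 (abs_le.1 h2).2
    nlinarith
  exact le_of_sq_le_sq h3 (by positivity)

namespace IsCellFamily

theorem horizontal (h : IsCellFamily l N E A L cv) (hr : InRow l r z) (hp : IsNear l r z p) (hpN : p.1 ≤ N) :
    ‖cv p z - cv (p.1, cellAt l p.1 z.re) z‖ ≤ A ∧
      (cv p z ≠ cv (p.1, cellAt l p.1 z.re) z → ∃ e ∈ E, e.1 ≤ N ∧ IsNear l r z e) := by
  obtain ⟨ρ, i⟩ := p
  set k := cellAt l ρ z.re with hk
  have hnear : ∀ j, k - 1 ≤ j → j ≤ k + 1 → IsNear l r z (ρ, j) := fun j h1 h2 => ⟨hp.1, hp.2.1, h1, h2⟩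
  have hc : i = k ∨ i = k - 1 ∨ i = k + 1 := by
    have := hp.2.2
    simp only at this
    omega
  rcases hc with rfl | rfl | rfl
  · simp [hk, h.nonneg]
  · have n1 := hnear k (by omega) (by omega)
    obtain ⟨h1, h2⟩ := h.left ρ hpN k z (n1.norm_sub_le hr) (hp.norm_sub_le hr)
    refine ⟨by rw [norm_sub_rev]; exact h1, fun hne => ⟨(ρ, k), ?_, hpN, n1⟩⟩
    by_contra hE
    exact hne (h2 hE).symm
  · have n1 := hnear k (by omega) (by omega)
    obtain ⟨h1, h2⟩ := h.left ρ hpN (k + 1) z (hp.norm_sub_le hr)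
      (by rw [add_sub_cancel_right]; exact n1.norm_sub_le hr)
    rw [add_sub_cancel_right] at h1 h2
    refine ⟨h1, fun hne => ⟨(ρ, k + 1), ?_, hpN, hp⟩⟩
    by_contra hE
    exact hne (h2 hE)

theorem vertical (h : IsCellFamily l N E A L cv) (hr : InRow l r z) (hp : IsNear l r z p) (hpN : p.1 ≤ N)
    (hrN : r ≤ N) :
    ‖cv (p.1, cellAt l p.1 z.re) z - cv (r, cellAt l r z.re) z‖ ≤ A ∧
      (cv (p.1, cellAt l p.1 z.re) z ≠ cv (r, cellAt l r z.re) z → ∃ e ∈ E, e.1 ≤ N ∧ IsNear l r z e) := by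
  obtain ⟨ρ, i⟩ := p
  have hρ : IsNear l r z (ρ, cellAt l ρ z.re) := ⟨hp.1, hp.2.1, by simp, by simp⟩
  have hr' := isNear_center l r z
  have hc : ρ = r ∨ ρ = r + 1 ∨ r = ρ + 1 := by
    have h1 := hp.1
    have h2 := hp.2.1
    simp only at h1 h2
    omega
  rcases hc with rfl | rfl | rfl
  · simp [h.nonneg]
  · obtain ⟨h1, h2⟩ := h.top r hpN (cellAt l (r + 1) z.re) z (hρ.norm_sub_le hr)
      (by rw [parentCell_cellAt]; exact hr'.norm_sub_le hr)
    rw [parentCell_cellAt] at h1 h2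
    refine ⟨h1, fun hne => ⟨(r + 1, cellAt l (r + 1) z.re), ?_, hpN, hρ⟩⟩
    by_contra hE
    exact hne (h2 hE)
  · obtain ⟨h1, h2⟩ := h.top ρ hrN (cellAt l (ρ + 1) z.re) z (hr'.norm_sub_le hr)
      (by rw [parentCell_cellAt]; exact hρ.norm_sub_le hr)
    rw [parentCell_cellAt] at h1 h2
    refine ⟨by rw [norm_sub_rev]; exact h1, fun hne => ⟨_, ?_, hrN, hr'⟩⟩
    by_contra hE
    exact hne (h2 hE).symm

theorem near (h : IsCellFamily l N E A L cv) (hr : InRow l r z) (hp : IsNear l r z p) (hpN : p.1 ≤ N)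
    (hrN : r ≤ N) :
    ‖cv p z - cv (r, cellAt l r z.re) z‖ ≤ 2 * A ∧
      (cv p z ≠ cv (r, cellAt l r z.re) z → ∃ e ∈ E, e.1 ≤ N ∧ IsNear l r z e) := by
  obtain ⟨h1, h2⟩ := h.horizontal hr hp hpN
  obtain ⟨h3, h4⟩ := h.vertical hr hp hpN hrN
  refine ⟨(norm_sub_le_norm_sub_add_norm_sub _ (cv (p.1, cellAt l p.1 z.re) z) _).trans (by linarith),
    fun hne => ?_⟩
  by_cases h5 : cv p z = cv (p.1, cellAt l p.1 z.re) z
  · exact h4 (h5 ▸ hne)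
  · exact h2 h5

end IsCellFamily

/-- There are at most nine cells surrounding a point. -/
theorem card_filter_isNear_le (S : Finset (ℕ × ℤ)) (l r : ℕ) (z : ℂ) :
    (S.filter (IsNear l r z)).card ≤ 9 := by
  have hsub : S.filter (IsNear l r z) ⊆ (Finset.Icc (r - 1) (r + 1)).biUnion fun ρ =>
      (Finset.Icc (cellAt l ρ z.re - 1) (cellAt l ρ z.re + 1)).image fun i => (ρ, i) := by
    rintro ⟨ρ, i⟩ hp
    obtain ⟨-, h1, h2, h3, h4⟩ := Finset.mem_filter.1 hp
    simp only [Finset.mem_biUnion, Finset.mem_image, Finset.mem_Icc]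
    simp only at h1 h2
    exact ⟨ρ, by omega, i, ⟨h3, h4⟩, rfl⟩
  have hcard := Finset.card_biUnion_le_card_mul (Finset.Icc (r - 1) (r + 1)) (fun ρ =>
      (Finset.Icc (cellAt l ρ z.re - 1) (cellAt l ρ z.re + 1)).image fun i => (ρ, i)) 3 fun ρ _ => by
    refine Finset.card_image_le.trans ?_
    rw [Int.card_Icc]
    omega
  refine (Finset.card_le_card hsub).trans (hcard.trans ?_)
  rw [Nat.card_Icc]
  omega

theorem inRow_of_mem_cellBox (hz : z ∈ cellBox l p) (h1 : rowTop l (r + 1) < z.im)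
    (h2 : r = 0 ∨ z.im ≤ rowTop l r) : InRow l r z := by
  refine ⟨h1, h2, hz.2.1.trans ?_⟩
  have := rowTop_antitone l p.1.zero_le
  have := cellWidth_antitone l p.1.zero_le
  linarith
end

section
open Set MeasureTheory Metric Complex
open scoped ComplexConjugate Classical

variable {l N r : ℕ} {i : ℤ} {z w : ℂ} {A L Y : ℝ} {p q : ℕ × ℤ} {E S : Finset (ℕ × ℤ)} {cv : ℕ × ℤ → ℂ → ℂ}

/-- A sum of local functions against the bumps of the cells. -/
noncomputable def patchSum (l : ℕ) (S : Finset (ℕ × ℤ)) (cv : ℕ × ℤ → ℂ → ℂ) (z : ℂ) : ℂ :=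
  ∑ p ∈ S, cellBump l p z * cv p z

/-- The `∂̄` derivative of `patchSum`. -/
noncomputable def patchDbar (l : ℕ) (S : Finset (ℕ × ℤ)) (cv : ℕ × ℤ → ℂ → ℂ) (z : ℂ) : ℂ :=
  ∑ p ∈ S, cellBumpDbar l p z * cv p z

/-- The finite set `S` of cells is so large that the bumps sum up to `1` where this matters. -/
def IsPatchSet (l N : ℕ) (cv : ℕ × ℤ → ℂ → ℂ) (Y : ℝ) (S : Finset (ℕ × ℤ)) : Prop :=
  (∀ p ∈ S, p.1 ≤ N) ∧ ∀ z : ℂ, rowTop l (N + 1) + cellWidth l (N + 1) / 4 < z.im →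
    ((∀ p, p.1 ≤ N → z ∈ cellBox l p → ∀ w, cv p w = 0) ∨
      (|z.re| ≤ Y ∧ ∀ᶠ w in nhds z, ∑ p ∈ S, cellBump l p w = 1)) ∧
    (|z.re| ≤ 1 → z.im ≤ 1 / 2 → ∑ p ∈ S, cellBump l p z = 1)

theorem IsCellFamily.exists_isPatchSet (h : IsCellFamily l N E A L cv) : ∃ Y S, IsPatchSet l N cv Y S := by
  obtain ⟨B, hB⟩ := h.zero
  have hN := cellWidth_pos l N
  have h0 := cellWidth_pos l 0
  obtain ⟨M, hM⟩ := exists_nat_ge (((B + 4) * cellWidth l 0 + 2) / cellWidth l N + 1)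
  rw [← le_sub_iff_add_le, div_le_iff₀ hN] at hM
  have htop : rowTop l 0 = 1 := by simp [rowTop]
  have hw0 : cellWidth l 0 ≤ 1 / 2 := by
    have : (1 / 2 : ℝ) ^ l ≤ 1 := pow_le_one₀ (by norm_num) (by norm_num)
    simp only [cellWidth, Nat.zero_div, zero_add, pow_succ]
    linarith
  refine ⟨(M - 1) * cellWidth l N, Finset.range (N + 1) ×ˢ Finset.Ico (-(M : ℤ)) M, fun p hp => ?_,
    fun z hz => ⟨?_, fun h1 h2 => sum_cellBump_eq_one hz.le (by linarith) ?_⟩⟩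
  · exact Nat.lt_succ_iff.1 (Finset.mem_range.1 (Finset.mem_product.1 hp).1)
  · by_cases hx : |z.re| < (M - 1) * cellWidth l N
    · by_cases hy : z.im < rowTop l 0 - cellWidth l 0 / 4
      · right
        refine ⟨hx.le, ?_⟩
        filter_upwards [(isOpen_lt continuous_const continuous_im).mem_nhds hz,
          (isOpen_lt continuous_im continuous_const).mem_nhds hy,
          (isOpen_lt continuous_re.abs continuous_const).mem_nhds hx] with w h1 h2 h3
        exact sum_cellBump_eq_one (le_of_lt h1) (le_of_lt h2) (le_of_lt h3)
      · left
        intro p hp hzp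
        refine hB p hp (Or.inl ?_)
        by_contra hp0
        have h1 := hzp.2.1
        have h2 := rowTop_antitone l (Nat.one_le_iff_ne_zero.2 hp0)
        have h3 := cellWidth_antitone l p.1.zero_le
        have h4 := rowTop_sub_succ l 0
        rw [zero_add] at h4
        linarith
    · left
      intro p hp hzp
      refine hB p hp (Or.inr ?_)
      have h3 := cellWidth_antitone l p.1.zero_le
      have h4 := cellWidth_pos l p.1
      have h5 : |z.re| ≤ (|(p.2 : ℝ)| + 5 / 4) * cellWidth l p.1 := by
        have h6 := neg_abs_le (p.2 : ℝ)
        have h7 := le_abs_self (p.2 : ℝ)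
        rw [abs_le]
        constructor
        · refine le_trans ?_ hzp.2.2.1
          nlinarith
        · refine hzp.2.2.2.trans ?_
          nlinarith
      have h6 : (|(p.2 : ℝ)| + 5 / 4) * cellWidth l p.1 ≤ (|(p.2 : ℝ)| + 5 / 4) * cellWidth l 0 := by
        gcongr
      have h7 : ((B : ℝ) + 4) * cellWidth l 0 < (|(p.2 : ℝ)| + 5 / 4) * cellWidth l 0 := by
        linarith [not_lt.1 hx]
      have h8 := lt_of_mul_lt_mul_right h7 h0.le
      have : ((B : ℤ) : ℝ) < ((|p.2| : ℤ) : ℝ) := by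
        push_cast
        linarith
      exact_mod_cast this
  · have : (0 : ℝ) ≤ (B + 4) * cellWidth l 0 := by positivity
    linarith

namespace IsCellFamily

theorem exists_inRow (hz : rowTop l (N + 1) + cellWidth l (N + 1) / 4 < z.im) :
    ∃ r ≤ N, ∀ p, z ∈ cellBox l p → InRow l r z ∧ IsNear l r z p := by
  have hw := cellWidth_pos l (N + 1)
  obtain ⟨r, h1, h2, h3⟩ := exists_row (l := l) (P := N) (y := z.im) (by linarith)
  exact ⟨r, h1, fun p hp => ⟨inRow_of_mem_cellBox hp h2 h3, near_of_mem_cellBox hp h2 h3⟩⟩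

theorem hasDbarAt_patchSum (h : IsCellFamily l N E A L cv) (hS : ∀ p ∈ S, p.1 ≤ N) (z : ℂ) :
    HasDbarAt (patchSum l S cv) (patchDbar l S cv z) z := by
  refine HasDbarAt.sum fun p hp => ?_
  by_cases hz : z ∈ cellBox l p
  · have hw := cellWidth_pos l p.1
    have := (hasDbarAt_cellBump l p z).mul (HasDbarAt.of_differentiableAt (h.diff p (hS p hp) z
      ((norm_sub_cellCenter_le_of_mem_cellBox hz).trans (by linarith))))
    rwa [mul_zero, zero_add] at this
  · rw [cellBumpDbar_eq_zero hz, zero_mul]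
    refine (HasDbarAt.of_differentiableAt (differentiableAt_const (0 : ℂ))).congr_of_eventuallyEq ?_
    filter_upwards [cellBump_eventuallyEq_zero hz] with w hw
    rw [hw, zero_mul]

theorem contDiffAt_patchDbar (h : IsCellFamily l N E A L cv) (hS : ∀ p ∈ S, p.1 ≤ N) (z : ℂ) :
    ContDiffAt ℝ 1 (patchDbar l S cv) z := by
  refine ContDiffAt.sum fun p hp => ?_
  by_cases hz : z ∈ cellBox l p
  · have hw := cellWidth_pos l p.1
    refine (contDiff_cellBumpDbar l p).contDiffAt.mul ?_
    have hball : DifferentiableOn ℂ (cv p) (ball (cellCenter l p) (4 * cellWidth l p.1)) := fun w hw' =>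
      (h.diff p (hS p hp) w (by rw [← dist_eq_norm]; exact (mem_ball.1 hw').le)).differentiableWithinAt
    have hmem : ball (cellCenter l p) (4 * cellWidth l p.1) ∈ nhds z := by
      refine isOpen_ball.mem_nhds ?_
      rw [mem_ball, dist_eq_norm]
      exact (norm_sub_cellCenter_le_of_mem_cellBox hz).trans_lt (by linarith)
    exact ((hball.analyticAt hmem).contDiffAt (n := 1)).restrict_scalars ℝ
  · refine (contDiffAt_const (c := (0 : ℂ))).congr_of_eventuallyEq ?_
    filter_upwards [(isClosed_cellBox l p).isOpen_compl.mem_nhds hz] with w hw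
    rw [cellBumpDbar_eq_zero hw, zero_mul]

theorem abs_re_patchSum_le (h : IsCellFamily l N E A L cv) (hS : ∀ p ∈ S, p.1 ≤ N)
    (hz : rowTop l (N + 1) + cellWidth l (N + 1) / 4 < z.im) (hL : 0 ≤ L) :
    |(patchSum l S cv z).re| ≤ 9 * L := by
  obtain ⟨r, hr, hnear⟩ := exists_inRow hz
  rw [patchSum, re_sum, ← Finset.sum_filter_of_ne (p := IsNear l r z)]
  · refine (Finset.abs_sum_le_sum_abs _ _).trans ?_
    have : ∀ p ∈ S.filter (IsNear l r z), |(cellBump l p z * cv p z).re| ≤ L := by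
      intro p hp
      by_cases hzp : z ∈ cellBox l p
      · have hw := cellWidth_pos l p.1
        have h1 := h.re_le p (hS p (Finset.mem_filter.1 hp).1) z
          ((norm_sub_cellCenter_le_of_mem_cellBox hzp).trans (by linarith))
        have h2 : (cellBump l p z).im = 0 := by rw [cellBump, ofReal_im]
        rw [mul_re, h2, zero_mul, sub_zero, abs_mul]
        have h3 := (abs_re_le_norm _).trans (norm_cellBump_le l p z)
        nlinarith [abs_nonneg (cv p z).re]
      · rw [cellBump_eq_zero hzp, zero_mul, zero_re, abs_zero]
        exact hL
    refine (Finset.sum_le_card_nsmul _ _ _ this).trans ?_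
    rw [nsmul_eq_mul]
    gcongr
    exact_mod_cast card_filter_isNear_le S l r z
  · intro p hp hne
    by_cases hzp : z ∈ cellBox l p
    · exact (hnear p hzp).2
    · rw [cellBump_eq_zero hzp, zero_mul, zero_re] at hne
      exact absurd rfl hne

theorem patchDbar_eq_of_sum_eq_one (h1 : ∀ᶠ w in nhds z, ∑ p ∈ S, cellBump l p w = 1) (c : ℂ) :
    patchDbar l S cv z = ∑ p ∈ S, cellBumpDbar l p z * (cv p z - c) := by
  have h2 : ∑ p ∈ S, cellBumpDbar l p z = 0 := by
    refine (HasDbarAt.sum fun p _ => hasDbarAt_cellBump l p z).unique ?_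
    exact (HasDbarAt.of_differentiableAt (differentiableAt_const (1 : ℂ))).congr_of_eventuallyEq h1
  simp only [mul_sub, Finset.sum_sub_distrib, ← Finset.sum_mul, h2, zero_mul, sub_zero, patchDbar]

/-- Where the patched function is not holomorphic, its `∂̄` derivative is controlled and there is a nearby
exceptional edge. -/
theorem patchDbar_cases (h : IsCellFamily l N E A L cv) (hS : IsPatchSet l N cv Y S)
    (hz : rowTop l (N + 1) + cellWidth l (N + 1) / 4 < z.im) (hD : patchDbar l S cv z ≠ 0) :
    ∑ p ∈ S, cellBump l p z = 1 ∧ |z.re| ≤ Y ∧ ∃ r ≤ N, InRow l r z ∧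
      (∀ p, z ∈ cellBox l p → IsNear l r z p) ∧ (∃ e ∈ E, e.1 ≤ N ∧ IsNear l r z e) ∧
      ‖patchDbar l S cv z‖ ≤ 108 * A * stepConst / cellWidth l r := by
  obtain ⟨r, hr, hnear⟩ := exists_inRow hz
  have hex : ∃ p ∈ S, z ∈ cellBox l p ∧ cv p z ≠ 0 := by
    by_contra! hcon
    refine hD (Finset.sum_eq_zero fun p hp => ?_)
    by_cases hzp : z ∈ cellBox l p
    · rw [hcon p hp hzp, mul_zero]
    · rw [cellBumpDbar_eq_zero hzp, zero_mul]
  obtain ⟨p₀, hp₀, hzp₀, hcv₀⟩ := hex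
  obtain ⟨hY, h1⟩ := ((hS.2 z hz).1).resolve_left fun hcon => hcv₀ (hcon p₀ (hS.1 p₀ hp₀) hzp₀ z)
  have hrow := (hnear p₀ hzp₀).1
  refine ⟨h1.self_of_nhds, hY, r, hr, hrow, fun p hp => (hnear p hp).2, ?_, ?_⟩
  · by_contra hcon
    refine hD ?_
    rw [patchDbar_eq_of_sum_eq_one h1 (cv (r, cellAt l r z.re) z)]
    refine Finset.sum_eq_zero fun p hp => ?_
    by_cases hzp : z ∈ cellBox l p
    · rw [sub_eq_zero.2, mul_zero]
      by_contra hne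
      exact hcon ((h.near hrow (hnear p hzp).2 (hS.1 p hp) hr).2 hne)
    · rw [cellBumpDbar_eq_zero hzp, zero_mul]
  · have hA := h.nonneg
    have hw := cellWidth_pos l r
    have hs := stepConst_pos
    rw [patchDbar_eq_of_sum_eq_one h1 (cv (r, cellAt l r z.re) z),
      ← Finset.sum_filter_of_ne (p := IsNear l r z)]
    · refine (norm_sum_le _ _).trans ?_
      have : ∀ p ∈ S.filter (IsNear l r z), ‖cellBumpDbar l p z * (cv p z - cv (r, cellAt l r z.re) z)‖ ≤
          12 * A * stepConst / cellWidth l r := by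
        intro p hp
        obtain ⟨hpS, hpn⟩ := Finset.mem_filter.1 hp
        rw [norm_mul]
        have hw' := cellWidth_pos l p.1
        calc _ ≤ (3 * stepConst / cellWidth l p.1) * (2 * A) :=
              mul_le_mul (norm_cellBumpDbar_le l p z) (h.near hrow hpn (hS.1 p hpS) hr).1
                (norm_nonneg _) (by positivity)
          _ ≤ (3 * stepConst / (cellWidth l r / 2)) * (2 * A) := by
              gcongr
              linarith [hpn.width_le]
          _ = _ := by field_simp; ring
      refine (Finset.sum_le_card_nsmul _ _ _ this).trans ?_
      rw [nsmul_eq_mul]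
      calc _ ≤ (9 : ℝ) * (12 * A * stepConst / cellWidth l r) := by
            gcongr
            exact_mod_cast card_filter_isNear_le S l r z
        _ = _ := by ring
    · intro p hp hne
      by_cases hzp : z ∈ cellBox l p
      · exact (hnear p hzp).2
      · rw [cellBumpDbar_eq_zero hzp, zero_mul] at hne
        exact absurd rfl hne

/-- The patched function away from exceptional edges. -/
theorem patchSum_eq (h : IsCellFamily l N E A L cv) (hS : IsPatchSet l N cv Y S)
    (hz : rowTop l (N + 1) + cellWidth l (N + 1) / 4 < z.im) (hx : |z.re| ≤ 1) (hy : z.im ≤ 1 / 2)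
    (hE : ∀ e ∈ E, e.1 ≤ N → 4 * cellWidth l e.1 < ‖z - cellCenter l e‖) :
    patchDbar l S cv z = 0 ∧ ∃ c, c.1 ≤ N ∧ ‖z - cellCenter l c‖ ≤ 4 * cellWidth l c.1 ∧
      patchSum l S cv z = cv c z := by
  refine ⟨?_, ?_⟩
  · by_contra hD
    obtain ⟨-, -, r, -, hr, -, ⟨e, he, heN, hen⟩, -⟩ := h.patchDbar_cases hS hz hD
    exact absurd (hen.norm_sub_le hr) (hE e he heN).not_ge
  · obtain ⟨r, hr, hnear⟩ := exists_inRow hz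
    have h1 := (hS.2 z hz).2 hx hy
    have hex : ∃ p ∈ S, z ∈ cellBox l p := by
      by_contra! hcon
      rw [Finset.sum_eq_zero fun p hp => cellBump_eq_zero (hcon p hp)] at h1
      exact zero_ne_one h1
    obtain ⟨p₀, hp₀, hzp₀⟩ := hex
    have hrow := (hnear p₀ hzp₀).1
    refine ⟨(r, cellAt l r z.re), hr, (isNear_center l r z).norm_sub_le hrow, ?_⟩
    rw [patchSum, ← one_mul (cv (r, cellAt l r z.re) z), ← h1, Finset.sum_mul]
    refine Finset.sum_congr rfl fun p hp => ?_
    by_cases hzp : z ∈ cellBox l p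
    · congr 1
      by_contra hne
      obtain ⟨e, he, heN, hen⟩ := (h.near hrow (hnear p hzp).2 (hS.1 p hp) hr).2 hne
      exact absurd (hen.norm_sub_le hrow) (hE e he heN).not_ge
    · rw [cellBump_eq_zero hzp, zero_mul, zero_mul]

end IsCellFamily
end

section
open Set MeasureTheory Metric Complex
open scoped ComplexConjugate Classical

variable {l P r : ℕ} {z w : ℂ} {A L C ε' : ℝ} {p q : ℕ × ℤ} {E : Finset (ℕ × ℤ)} {cv : ℕ × ℤ → ℂ → ℂ}
  {g : ℂ → ℂ}

theorem lt_im_of_mem_cellBox (hz : z ∈ cellBox l q) (hq : q.1 ≤ P) :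
    rowTop l (P + 1 + 1) + cellWidth l (P + 1 + 1) / 4 < z.im := by
  have h1 := hz.1
  have h2 := rowTop_sub_succ l (q.1 + 1)
  have h3 := rowTop_antitone l (show q.1 + 1 + 1 ≤ P + 1 + 1 by omega)
  have h4 := cellWidth_antitone l (show q.1 + 1 ≤ P + 1 + 1 by omega)
  have h5 := cellWidth_pos l (q.1 + 1)
  linarith

/-- Patching local functions: the `∂̄` derivative is `g` times a sum of pieces supported in a Carleson family of
cells. -/
theorem IsCellFamily.exists_patch (h : IsCellFamily l (P + 1) E A L cv) (hC : HasCarleson l C E) (hL : 0 ≤ L)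
    (hε' : 0 < ε') (hg : DifferentiableOn ℂ g {z | 0 < z.im})
    (hsmall : ∀ z : ℂ, 0 < z.im → ‖g z‖ < ε' → |z.re| ≤ 1 ∧ z.im ≤ 1 / 2)
    (hE : ∀ e ∈ E, e.1 ≤ P + 1 → ∀ z, ‖z - cellCenter l e‖ ≤ 4 * cellWidth l e.1 → ε' ≤ ‖g z‖) :
    ∃ (Λ : ℂ → ℂ) (s : Finset (ℕ × ℤ)) (ρ : ℕ × ℤ → ℂ → ℂ),
      (∀ z : ℂ, rowTop l (P + 1) + cellWidth l (P + 1) / 4 < z.im →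
        HasDbarAt Λ (g z * ∑ q ∈ s, ρ q z) z ∧ |(Λ z).re| ≤ 9 * L ∧
        (‖g z‖ < ε' → (∀ q ∈ s, ρ q z = 0) ∧ ∃ c : ℕ × ℤ, c.1 ≤ P + 1 ∧
          ‖z - cellCenter l c‖ ≤ 4 * cellWidth l c.1 ∧ Λ z = cv c z)) ∧
      (∀ q ∈ s, q.1 ≤ P ∧ ContDiff ℝ 1 (ρ q) ∧ tsupport (ρ q) ⊆ cellBox l q ∧
        ∀ z, ‖ρ q z‖ ≤ 216 * A * stepConst / ε' / cellWidth l q.1) ∧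
      HasCarleson l (1512 * (1512 * C)) s := by
  obtain ⟨Y, S, hS⟩ := h.exists_isPatchSet
  set D := patchDbar l S cv with hD
  have hUpos : ∀ z : ℂ, rowTop l (P + 1 + 1) + cellWidth l (P + 1 + 1) / 4 < z.im → 0 < z.im := fun z hz => by
    have := rowTop_pos l (P + 1 + 1)
    have := cellWidth_pos l (P + 1 + 1)
    linarith
  have hDg : ∀ z : ℂ, rowTop l (P + 1 + 1) + cellWidth l (P + 1 + 1) / 4 < z.im → ‖g z‖ < ε' →
      D z = 0 ∧ ∃ c : ℕ × ℤ, c.1 ≤ P + 1 ∧ ‖z - cellCenter l c‖ ≤ 4 * cellWidth l c.1 ∧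
        patchSum l S cv z = cv c z := fun z hz hgz => by
    obtain ⟨h1, h2⟩ := hsmall z (hUpos z hz) hgz
    exact h.patchSum_eq hS hz h1 h2 fun e he heP => by
      by_contra! hcon
      exact absurd (hE e he heP z hcon) hgz.not_ge
  have hH : IsOpen {z : ℂ | 0 < z.im} := isOpen_lt continuous_const continuous_im
  have hbox0 : ∀ q z, z ∉ cellBox l q → cellBump l q z * (D z / g z) = 0 := fun q z hz => by
    rw [cellBump_eq_zero hz, zero_mul]
  refine ⟨patchSum l S cv, S.filter fun q => q.1 ≤ P ∧ ∃ z ∈ cellBox l q, D z ≠ 0,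
    fun q z => cellBump l q z * (D z / g z), fun z hz => ?_, fun q hq => ?_, ?_⟩
  · have hz' : rowTop l (P + 1 + 1) + cellWidth l (P + 1 + 1) / 4 < z.im := by
      have h2 := rowTop_sub_succ l (P + 1)
      have h4 := cellWidth_antitone l (show P + 1 ≤ P + 1 + 1 by omega)
      have h5 := cellWidth_pos l (P + 1)
      linarith
    refine ⟨?_, h.abs_re_patchSum_le hS.1 hz' hL, fun hgz => ⟨fun q _ => ?_, (hDg z hz' hgz).2⟩⟩
    swap
    · simp only [(hDg z hz' hgz).1, zero_div, mul_zero]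
    have h1 := h.hasDbarAt_patchSum hS.1 z
    convert h1 using 1
    by_cases hDz : D z = 0
    · rw [← hD, hDz]
      simp only [hDz, zero_div, mul_zero, Finset.sum_const_zero]
    · have hgz : g z ≠ 0 := fun hgz => hDz (hDg z hz' (by rwa [hgz, norm_zero])).1
      obtain ⟨h2, -⟩ := h.patchDbar_cases hS hz' hDz
      rw [← Finset.sum_mul, Finset.sum_filter_of_ne, h2, one_mul, mul_div_cancel₀ _ hgz]
      intro q hq hne
      have hzq : z ∈ cellBox l q := by
        by_contra hcon
        exact hne (cellBump_eq_zero hcon)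
      refine ⟨?_, z, hzq, hDz⟩
      by_contra! hlt
      have h3 := hzq.2.1
      have h4 := rowTop_antitone l (show P + 1 ≤ q.1 by omega)
      have h5 := cellWidth_antitone l (show P + 1 ≤ q.1 by omega)
      linarith
  · obtain ⟨hqS, hqP, -⟩ := Finset.mem_filter.1 hq
    have hA := h.nonneg
    have hs := stepConst_pos
    refine ⟨hqP, contDiff_iff_contDiffAt.2 fun z => ?_, ?_, fun z => ?_⟩
    · by_cases hz : z ∈ cellBox l q
      · have hzU := lt_im_of_mem_cellBox hz hqP
        have hgz' := hg.analyticAt (hH.mem_nhds (hUpos z hzU))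
        by_cases hgz : ‖g z‖ < ε'
        · refine (contDiffAt_const (c := (0 : ℂ))).congr_of_eventuallyEq ?_
          filter_upwards [(isOpen_lt continuous_const continuous_im).mem_nhds hzU,
            hgz'.continuousAt.norm.eventually (gt_mem_nhds hgz)] with w h1 h2
          rw [(hDg w h1 h2).1, zero_div, mul_zero]
        · have : g z ≠ 0 := fun h0 => hgz (by rwa [h0, norm_zero])
          simp only [div_eq_mul_inv]
          exact (contDiff_cellBump l q).contDiffAt.mul ((h.contDiffAt_patchDbar hS.1 z).mul
            (((hgz'.contDiffAt (n := 1)).restrict_scalars ℝ).inv this))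
      · refine (contDiffAt_const (c := (0 : ℂ))).congr_of_eventuallyEq ?_
        filter_upwards [(isClosed_cellBox l q).isOpen_compl.mem_nhds hz] with w hw
        exact hbox0 q w hw
    · refine closure_minimal (fun z hz => ?_) (isClosed_cellBox l q)
      by_contra hcon
      exact hz (hbox0 q z hcon)
    · have hwq := cellWidth_pos l q.1
      by_cases hz : z ∈ cellBox l q
      · have hzU := lt_im_of_mem_cellBox hz hqP
        by_cases hDz : D z = 0
        · simp only [hDz, zero_div, mul_zero, norm_zero]
          positivity
        · have hgz : ε' ≤ ‖g z‖ := by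
            by_contra! hgz
            exact hDz (hDg z hzU hgz).1
          obtain ⟨-, -, r, -, hr, hnear, -, hDle⟩ := h.patchDbar_cases hS hzU hDz
          have hwr := cellWidth_pos l r
          have := (hnear q hz).le_width
          simp only [norm_mul, norm_div]
          calc _ ≤ 1 * (108 * A * stepConst / cellWidth l r / ε') := by
                gcongr
                exact norm_cellBump_le l q z
            _ ≤ 1 * (108 * A * stepConst / (cellWidth l q.1 / 2) / ε') := by
                gcongr
                linarith
            _ = _ := by field_simp; ring
      · simp only [hbox0 q z hz, norm_zero]
        positivity
  · obtain ⟨F, hF⟩ := exists_finset_cellAt l (P + 1) Y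
    have h1 : HasCarleson l (6 * (4 * 5 + 1) * (2 + 2 * 5) * C) (F.filter fun c => ∃ e ∈ E, e.1 ≤ c.1 + 1 ∧
        c.1 ≤ e.1 + 1 ∧ |cellPos l c - cellPos l e| ≤ 5 * cellWidth l e.1) :=
      hC.of_near (by norm_num) fun c hc => (Finset.mem_filter.1 hc).2
    have h2 : HasCarleson l (6 * (4 * 5 + 1) * (2 + 2 * 5) * (6 * (4 * 5 + 1) * (2 + 2 * 5) * C))
        (S.filter fun q => q.1 ≤ P ∧ ∃ z ∈ cellBox l q, D z ≠ 0) := by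
      refine h1.of_near (by norm_num) fun q hq => ?_
      obtain ⟨hqS, hqP, z, hz, hDz⟩ := Finset.mem_filter.1 hq
      obtain ⟨-, hY, r, hrN, hr, hnear, ⟨e, heE, -, he⟩, -⟩ :=
        h.patchDbar_cases hS (lt_im_of_mem_cellBox hz hqP) hDz
      refine ⟨(r, cellAt l r z.re), Finset.mem_filter.2 ⟨hF r hrN _ hY, e, heE, he.1, he.2.1, ?_⟩,
        (hnear q hz).2.1, (hnear q hz).1, (hnear q hz).abs_cellPos_sub_center.1⟩
      rw [abs_sub_comm]
      exact he.abs_cellPos_sub_center.2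
    norm_num at h2
    convert h2 using 1
end

section
open Set MeasureTheory Metric
open scoped ComplexConjugate Classical

variable {l P r : ℕ} {f g : ℂ → ℂ} {z w : ℂ} {δ ε ε' η J : ℝ} {p q : ℕ × ℤ} {n : ℕ → ℤ → ℤ}

namespace IsNormalizedPair

theorem norm_cellVal_sub_le (h : IsNormalizedPair δ ε η f g) (hp : IsGridParams l δ ε ε')
    (hz : ‖z - cellCenter l q‖ ≤ 8 * cellWidth l q.1) :
    ‖cellVal (IsInside (IsBadCell ε g l) (IsBigCell δ g l) l) f l n q z -
      n q.1 q.2 * (2 * Real.pi * Complex.I)‖ ≤ Real.log (2 / δ) + 3 / 2 * Real.pi := by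
  have hδ : 0 < δ := by linarith [hp.ε_le, hp.ε'_le, hp.ε'_pos]
  have hlog : 0 ≤ Real.log (2 / δ) := Real.log_nonneg (by rw [le_div_iff₀ hδ]; linarith [hp.δ_le])
  rw [cellVal, add_sub_cancel_right]
  split_ifs with hi
  · exact (Complex.norm_le_abs_re_add_abs_im _).trans
      (add_le_add (h.abs_re_cellLog_le hp hi hz) (h.abs_im_cellLog_le hp hi hz).le)
  · rw [norm_zero]
    positivity

theorem norm_cellVal_sub_cellVal_le (h : IsNormalizedPair δ ε η f g) (hp : IsGridParams l δ ε ε')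
    (hz : ‖z - cellCenter l q‖ ≤ 8 * cellWidth l q.1) (hw : ‖z - cellCenter l p‖ ≤ 8 * cellWidth l p.1)
    (hn : |(n q.1 q.2 - n p.1 p.2 : ℝ)| ≤ J) :
    ‖cellVal (IsInside (IsBadCell ε g l) (IsBigCell δ g l) l) f l n q z -
      cellVal (IsInside (IsBadCell ε g l) (IsBigCell δ g l) l) f l n p z‖ ≤
        2 * Real.log (2 / δ) + 3 * Real.pi + 2 * Real.pi * J := by
  have h1 := h.norm_cellVal_sub_le hp (n := n) hz
  have h2 := h.norm_cellVal_sub_le hp (n := n) hw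
  set a := cellVal (IsInside (IsBadCell ε g l) (IsBigCell δ g l) l) f l n q z
  set b := cellVal (IsInside (IsBadCell ε g l) (IsBigCell δ g l) l) f l n p z
  have h3 : a - b = (a - n q.1 q.2 * (2 * Real.pi * Complex.I)) -
      (b - n p.1 p.2 * (2 * Real.pi * Complex.I)) +
      ((n q.1 q.2 - n p.1 p.2 : ℝ) : ℂ) * (2 * Real.pi * Complex.I) := by
    push_cast
    ring
  have h4 : ‖((n q.1 q.2 - n p.1 p.2 : ℝ) : ℂ) * (2 * Real.pi * Complex.I)‖ ≤ J * (2 * Real.pi) := by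
    rw [norm_mul, Complex.norm_real, Real.norm_eq_abs, norm_mul, Complex.norm_I, mul_one, norm_mul,
      Complex.norm_real, Real.norm_eq_abs, abs_of_pos Real.pi_pos, Complex.norm_ofNat]
    gcongr
  rw [h3]
  refine (norm_add_le _ _).trans ((add_le_add_left (norm_sub_le _ _) _).trans ?_)
  linarith

theorem exists_isCellFamily (h : IsNormalizedPair δ ε η f g) (hp : IsGridParams l δ ε ε') (P : ℕ) :
    ∃ (cv : ℕ × ℤ → ℂ → ℂ) (E : Finset (ℕ × ℤ)),
      HasCarleson l (seedConst l (ε / 100) (IsNormalizedPair.frontierConst l)) E ∧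
      IsCellFamily l P E (2 * Real.log (2 / δ) + 3 * Real.pi + 2 * Real.pi * jumpConst l (ε / 100))
        (Real.log (2 / δ)) cv ∧
      (∀ q, ∀ z, ‖z - cellCenter l q‖ ≤ 4 * cellWidth l q.1 → ‖g z‖ < ε' → Complex.exp (cv q z) = f z) ∧
      ∀ e ∈ E, ∀ z, ‖z - cellCenter l e‖ ≤ 4 * cellWidth l e.1 → ε' ≤ ‖g z‖ := by
  obtain ⟨n, E, h1, h2, ⟨B, hB⟩, h3, h4, h5⟩ := exists_cellVal h hp P
  have hδ : 0 < δ := by linarith [hp.ε_le, hp.ε'_le, hp.ε'_pos]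
  have hlog : 0 ≤ Real.log (2 / δ) := Real.log_nonneg (by rw [le_div_iff₀ hδ]; linarith [hp.δ_le])
  have h48 : ∀ r (x : ℝ), x ≤ 4 * cellWidth l r → x ≤ 8 * cellWidth l r := fun r x hx => by
    linarith [cellWidth_pos l r]
  refine ⟨cellVal (IsInside (IsBadCell ε g l) (IsBigCell δ g l) l) f l n, E, h1,
    ⟨?_, fun r hr i z hz hz' => ?_, fun r hr i z hz hz' => ?_, fun q _ z hz => ?_, ?_, fun q _ z hz => ?_⟩,
    fun q z hz hgz => ?_, fun e he => (h5 e he).2⟩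
  · have := (abs_nonneg _).trans (h3 0 (Nat.zero_le _) 0).1
    positivity
  · obtain ⟨h6, h7⟩ := h3 r hr i
    exact ⟨h.norm_cellVal_sub_cellVal_le hp (h48 _ _ hz) (h48 _ _ hz') h6,
      fun hE => h7 hE z (h48 _ _ hz) (h48 _ _ hz')⟩
  · obtain ⟨h6, h7⟩ := h4 r hr i
    exact ⟨h.norm_cellVal_sub_cellVal_le hp (h48 _ _ hz) (h48 _ _ hz') h6,
      fun hE => h7 hE z (h48 _ _ hz) (h48 _ _ hz')⟩
  · have hfun : cellVal (IsInside (IsBadCell ε g l) (IsBigCell δ g l) l) f l n q = fun w =>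
        (if IsInside (IsBadCell ε g l) (IsBigCell δ g l) l q.1 q.2 then cellLog f l q w else 0) +
          n q.1 q.2 * (2 * Real.pi * Complex.I) := rfl
    rw [hfun]
    refine DifferentiableAt.add_const _ ?_
    split_ifs with hi
    · exact h.differentiableAt_cellLog hp hi (h48 _ _ hz)
    · exact differentiableAt_const _
  · refine ⟨B.toNat, fun q hqP hq z => ?_⟩
    have hqB : ¬ |q.2| ≤ B ∨ q.1 = 0 := by
      rcases hq with hq | hq
      · exact Or.inr hq
      · left
        have := Int.self_le_toNat B
        omega
    have hn : n q.1 q.2 = 0 := by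
      rcases hqB with hq | hq
      · by_contra hne
        exact hq (hB q.1 hqP q.2 (Or.inl hne))
      · rw [hq]; exact h2 _
    have hi : ¬ IsInside (IsBadCell ε g l) (IsBigCell δ g l) l q.1 q.2 := by
      rcases hqB with hq | hq
      · exact fun hi => hq (hB q.1 hqP q.2 (Or.inr hi))
      · rw [hq]; exact id
    rw [cellVal, if_neg hi, hn]
    simp
  · rw [cellVal]
    have h6 : ((n q.1 q.2 : ℂ) * (2 * Real.pi * Complex.I)).re = 0 := by simp
    rw [Complex.add_re, h6, add_zero]
    split_ifs with hi
    · exact h.abs_re_cellLog_le hp hi (h48 _ _ hz)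
    · simpa using hlog
  · have hi : IsInside (IsBadCell ε g l) (IsBigCell δ g l) l q.1 q.2 := by
      by_contra hi
      have := h.le_norm_g_of_not_isInside hp hi (h48 _ _ hz)
      linarith [hp.ε'_le, hp.ε'_pos]
    rw [cellVal, if_pos hi, Complex.exp_add, Complex.exp_int_mul_two_pi_mul_I, mul_one]
    exact h.exp_cellLog hp hi (h48 _ _ hz)

end IsNormalizedPair
end

section
open Set MeasureTheory Metric Complex
open scoped ComplexConjugate Classical

variable {l P r : ℕ} {z w c : ℂ} {M₁ C : ℝ} {p q : ℕ × ℤ} {s : Finset (ℕ × ℤ)} {ρ : ℕ × ℤ → ℂ → ℂ}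

theorem HasDbarAt.comp_sub_const {f : ℂ → ℂ} {d : ℂ} (h : HasDbarAt f d (z - c)) :
    HasDbarAt (fun w => f (w - c)) d z := by
  obtain ⟨f', hf, h0⟩ := h
  exact ⟨f', (hasFDerivAt_comp_sub c).2 hf, h0⟩

/-- The `∂̄` equation on a half plane for data supported in a Carleson family of cells. -/
theorem exists_dbar_solution_of_hasCarleson (hM₁ : 0 ≤ M₁)
    (hs : ∀ q ∈ s, q.1 ≤ P ∧ ContDiff ℝ 1 (ρ q) ∧ tsupport (ρ q) ⊆ cellBox l q ∧
      ∀ z, ‖ρ q z‖ ≤ M₁ / cellWidth l q.1) (hC : HasCarleson l C s) :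
    ∃ W : ℂ → ℂ, (∀ z, 0 < z.im → HasDbarAt W (∑ q ∈ s, ρ q z) z) ∧
      (∃ B, ∀ z, rowTop l P ≤ z.im → ‖W z‖ ≤ B) ∧
      ∀ z, z.im = rowTop l P → ‖W z‖ ≤ jonesConst (2 ^ (l + 1) * M₁) 4 (2 ^ (l + 1) * C) := by
  set c : ℂ := ⟨0, rowTop l P⟩ with hc
  have hP := rowTop_pos l P
  have htop : ∀ q ∈ s, rowTop l P ≤ rowTop l q.1 := fun q hq => rowTop_antitone l (hs q hq).1
  have hcomp : ∀ q ∈ s, HasCompactSupport (ρ q) := fun q hq =>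
    (isCompact_closedBall (cellCenter l q) (2 * cellWidth l q.1)).of_isClosed_subset (isClosed_tsupport _)
      ((hs q hq).2.2.1.trans (cellBox_subset_closedBall l q))
  refine Exists.elim (exists_dbar_solution s (fun q => ⟨cellPos l q, rowTop l q.1⟩)
    (fun q z => ρ q (z + c)) (M := 2 ^ (l + 1) * M₁) (K := 4) (C₀ := 2 ^ (l + 1) * C) (by positivity)
    (by norm_num) (fun q _ => rowTop_pos l q.1) (fun q hq => (hs q hq).2.1.comp (by fun_prop))
    (fun q hq => (hcomp q hq).comp_homeomorph (Homeomorph.addRight c)) (fun q hq z => ?_)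
    (fun q hq z hz => ?_) (fun a b hb => ?_)) ?_
  rotate_left 3
  · rintro W ⟨h1, ⟨B, hB⟩, h3⟩
    refine ⟨fun z => W (z - c), fun z hz => ?_, ⟨B, fun z hz => hB _ ?_⟩, fun z hz => ?_⟩
    · have := h1 (z - c) fun q hq => by
        have := htop q hq
        simp only [hc, sub_im]
        linarith
      simp only [sub_add_cancel] at this
      exact this.comp_sub_const
    · simp only [hc, sub_im]
      linarith
    · have : z - c = ((z.re : ℝ) : ℂ) := by
        apply Complex.ext <;> simp [hc, hz]
      simp only [this]
      exact h3 _
  · refine ((hs q hq).2.2.2 _).trans ?_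
    have h4 := rowTop_le_pow_mul l q.1
    have h5 := cellWidth_pos l q.1
    have h6 := rowTop_pos l q.1
    simp only
    rw [div_le_div_iff₀ h5 h6]
    nlinarith
  · have hz' : z + c ∈ cellBox l q := by
      refine (hs q hq).2.2.1 ?_
      exact tsupport_comp_subset_preimage (f := fun z => z + c) (ρ q) (by fun_prop) hz
    have h5 := cellWidth_pos l q.1
    have h6 := cellWidth_le_rowTop l q.1
    have h7 := htop q hq
    constructor
    · have e1 := norm_sub_cellCenter_le_of_mem_cellBox hz'
      have e2 : ‖cellCenter l q - c - ⟨cellPos l q, rowTop l q.1⟩‖ ≤ 2 * rowTop l q.1 := by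
        refine (norm_le_abs_re_add_abs_im _).trans ?_
        simp only [cellCenter, hc, sub_re, sub_im]
        rw [show cellPos l q + cellWidth l q.1 / 2 - 0 - cellPos l q = cellWidth l q.1 / 2 by ring,
          show rowTop l q.1 - cellWidth l q.1 / 2 - rowTop l P - rowTop l q.1 =
            -(cellWidth l q.1 / 2 + rowTop l P) by ring, abs_neg, abs_of_pos (by positivity),
          abs_of_pos (by positivity)]
        linarith
      have e3 : z - ⟨cellPos l q, rowTop l q.1⟩ =
          (z + c - cellCenter l q) + (cellCenter l q - c - ⟨cellPos l q, rowTop l q.1⟩) := by ring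
      rw [e3]
      exact (norm_add_le _ _).trans (by linarith)
    · intro j hj _
      have e1 := hz'.1
      have e2 := htop j hj
      have e3 := cellWidth_le_rowTop l (q.1 + 1)
      have e4 := rowTop_le_two_mul_succ l q.1
      have e5 := rowTop_pos l q.1
      simp only [hc, add_im] at e1 ⊢
      linarith
  · simp only
    refine (Finset.sum_le_sum fun q _ => rowTop_le_pow_mul l q.1).trans ?_
    rw [← Finset.mul_sum, mul_assoc]
    exact mul_le_mul_of_nonneg_left (hC a b hb) (by positivity)

/-- The Phragmén–Lindelöf principle for bounded functions on a half plane. -/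
theorem norm_le_of_bounded_of_im_eq {h : ℂ → ℂ} {t₀ s₀ B C : ℝ} (ht : t₀ < s₀)
    (hd : DifferentiableOn ℂ h {z | t₀ < z.im}) (hB : ∀ z, s₀ ≤ z.im → ‖h z‖ ≤ B)
    (hC : ∀ z, z.im = s₀ → ‖h z‖ ≤ C) (hz : s₀ ≤ z.im) : ‖h z‖ ≤ C := by
  set φ : ℂ → ℂ := fun w => I * w + s₀ * I with hφ
  have him : ∀ w : ℂ, (φ w).im = w.re + s₀ := fun w => by simp [hφ]
  have key := PhragmenLindelof.right_half_plane_of_bounded_on_real (f := fun w => h (φ w)) (C := C)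
    (z := -I * (z - s₀ * I)) ?_ ?_ ?_ (fun x => hC _ ?_) ?_
  · have : φ (-I * (z - s₀ * I)) = z := by
      simp only [hφ]
      linear_combination (-(z - s₀ * I)) * I_sq
    simpa only [this] using key
  · refine DifferentiableOn.diffContOnCl ?_
    have : closure {w : ℂ | 0 < w.re} = {w | 0 ≤ w.re} := Complex.closure_setOfPred_lt_re 0
    rw [this]
    refine hd.comp (by fun_prop) fun w (hw : 0 ≤ w.re) => ?_
    show t₀ < (φ w).im
    rw [him]
    linarith
  · refine ⟨1, by norm_num, 0, ?_⟩
    refine Asymptotics.IsBigO.of_bound B ?_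
    refine Filter.Eventually.filter_mono inf_le_right ?_
    refine Filter.eventually_principal.2 fun w (hw : 0 < w.re) => ?_
    simpa using hB (φ w) (by rw [him]; linarith)
  · refine ⟨B, Filter.eventually_map.2 ?_⟩
    filter_upwards [Filter.eventually_ge_atTop (0 : ℝ)] with x hx
    exact hB _ (by rw [him]; simpa using hx)
  · rw [him]; simp
  · simp; linarith
end

section
open Set Complex

/-- The bound for the reducing function in terms of the bounds `R` for `|Re Λ|` and `b` for `|W|`. -/
noncomputable def reducerBound (e R b : ℝ) : ℝ :=
  b * Real.exp b + (Real.exp (R + b) + 1) / e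

/-- The function `G` with `f + g G = exp (Λ - g W)`. -/
noncomputable def reducer (f g Λ W : ℂ → ℂ) (z : ℂ) : ℂ := by
  classical exact if g z = 0 then -f z * W z else (exp (Λ z - g z * W z) - f z) / g z

variable {f g Λ W S : ℂ → ℂ} {z : ℂ} {ε' R b : ℝ} {U : Set ℂ}

theorem norm_dslope_exp_le (x : ℂ) : ‖dslope exp 0 x‖ ≤ Real.exp ‖x‖ := by
  by_cases hx : x = 0
  · subst hx
    simp [dslope_same, (hasDerivAt_exp (0 : ℂ)).deriv]
  · rw [dslope_of_ne _ hx, slope_def_field, exp_zero, sub_zero, norm_div]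
    have h := norm_exp_sub_sum_le_norm_mul_exp x 1
    simp only [Finset.range_one, Finset.sum_singleton, pow_zero, Nat.factorial_zero, Nat.cast_one,
      div_one, pow_one] at h
    rw [div_le_iff₀ (norm_pos_iff.2 hx)]
    linarith

theorem add_mul_reducer (h : g z = 0 → exp (Λ z) = f z) :
    f z + g z * reducer f g Λ W z = exp (Λ z - g z * W z) := by
  rw [reducer]
  split_ifs with h0
  · simp [h0, h h0]
  · field_simp
    ring

theorem reducer_eq (h : exp (Λ z) = f z) :
    reducer f g Λ W z = -f z * W z * dslope exp 0 (-(g z * W z)) := by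
  rw [reducer]
  split_ifs with h0
  · simp [h0, dslope_same, (hasDerivAt_exp (0 : ℂ)).deriv]
  · have h1 := sub_smul_dslope exp (0 : ℂ) (-(g z * W z))
    rw [smul_eq_mul, exp_zero, sub_zero] at h1
    have h2 : exp (Λ z - g z * W z) = f z * exp (-(g z * W z)) := by
      rw [sub_eq_add_neg, exp_add, h]
    rw [h2, div_eq_iff h0]
    linear_combination (-f z) * h1

theorem differentiableAt_exp_sub (hg : DifferentiableAt ℂ g z) (hΛ : HasDbarAt Λ (g z * S z) z)
    (hW : HasDbarAt W (S z) z) : DifferentiableAt ℂ (fun w => exp (Λ w - g w * W w)) z := by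
  have h1 := (hΛ.sub ((HasDbarAt.of_differentiableAt hg).mul hW)).exp
  refine HasDbarAt.differentiableAt (f := fun w => exp (Λ w - g w * W w)) ?_
  convert h1 using 1
  ring

theorem differentiableOn_reducer (hε' : 0 < ε') (hU : IsOpen U) (hf : DifferentiableOn ℂ f U)
    (hg : DifferentiableOn ℂ g U) (hΛ : ∀ z ∈ U, HasDbarAt Λ (g z * S z) z)
    (hW : ∀ z ∈ U, HasDbarAt W (S z) z)
    (hsmall : ∀ z ∈ U, ‖g z‖ < ε' → S z = 0 ∧ exp (Λ z) = f z) :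
    DifferentiableOn ℂ (reducer f g Λ W) U := by
  intro z hz
  have hUz := hU.mem_nhds hz
  have hgz := hg.differentiableAt hUz
  have hfz := hf.differentiableAt hUz
  refine DifferentiableAt.differentiableWithinAt ?_
  by_cases h0 : g z = 0
  · have hlt : ‖g z‖ < ε' := by simpa [h0] using hε'
    have hev : ∀ᶠ w in nhds z, ‖g w‖ < ε' := hgz.continuousAt.norm.eventually_lt_const hlt
    have hWz : DifferentiableAt ℂ W z := by
      have := hW z hz
      rw [(hsmall z hz hlt).1] at this
      exact this.differentiableAt
    have hd : Differentiable ℂ (dslope exp (0 : ℂ)) := by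
      rw [← differentiableOn_univ]
      exact (differentiableOn_dslope Filter.univ_mem).2 differentiable_exp.differentiableOn
    refine ((hfz.neg.mul hWz).mul ((hd _).comp z (hgz.mul hWz).neg)).congr_of_eventuallyEq ?_
    filter_upwards [hev, hUz] with w hw hwU
    exact reducer_eq (hsmall w hwU hw).2
  · have hev : ∀ᶠ w in nhds z, g w ≠ 0 := hgz.continuousAt.eventually_ne h0
    refine (((differentiableAt_exp_sub hgz (hΛ z hz) (hW z hz)).sub hfz).div hgz h0).congr_of_eventuallyEq ?_
    filter_upwards [hev] with w hw
    simp [reducer, hw]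

theorem norm_exp_sub_le (hg : ‖g z‖ ≤ 1) (hR : |(Λ z).re| ≤ R) (hb : ‖W z‖ ≤ b) :
    ‖exp (Λ z - g z * W z)‖ ≤ Real.exp (R + b) ∧ ‖(exp (Λ z - g z * W z))⁻¹‖ ≤ Real.exp (R + b) := by
  have h1 : ‖g z * W z‖ ≤ b := by
    rw [norm_mul]
    nlinarith [norm_nonneg (W z), norm_nonneg (g z)]
  have h2 := abs_le.1 ((abs_re_le_norm (g z * W z)).trans h1)
  have h3 := abs_le.1 hR
  rw [← exp_neg, norm_exp, norm_exp, Real.exp_le_exp, Real.exp_le_exp]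
  simp only [sub_re, neg_re]
  constructor <;> linarith

theorem norm_reducer_le (hε' : 0 < ε') (hf : ‖f z‖ ≤ 1) (hg : ‖g z‖ ≤ 1) (hR : |(Λ z).re| ≤ R)
    (hb : ‖W z‖ ≤ b) (h : ‖g z‖ < ε' → exp (Λ z) = f z) :
    ‖reducer f g Λ W z‖ ≤ reducerBound ε' R b := by
  have hb0 := (norm_nonneg _).trans hb
  rcases lt_or_ge ‖g z‖ ε' with hlt | hge
  · rw [reducer_eq (h hlt), norm_mul, norm_mul, norm_neg, reducerBound]
    have h1 : ‖g z * W z‖ ≤ b := by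
      rw [norm_mul]
      nlinarith [norm_nonneg (W z), norm_nonneg (g z)]
    have h2 : ‖dslope exp 0 (-(g z * W z))‖ ≤ Real.exp b :=
      (norm_dslope_exp_le _).trans (Real.exp_le_exp.2 (by rwa [norm_neg]))
    have h3 : ‖f z‖ * ‖W z‖ ≤ b := by nlinarith [norm_nonneg (W z), norm_nonneg (f z)]
    have h4 : 0 ≤ (Real.exp (R + b) + 1) / ε' := by positivity
    have := mul_le_mul h3 h2 (norm_nonneg _) hb0
    linarith
  · have h0 : g z ≠ 0 := fun h0 => by simp [h0] at hge; linarith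
    rw [reducer, if_neg h0, norm_div, reducerBound]
    have h1 := (norm_exp_sub_le hg hR hb).1
    have h2 := norm_sub_le (exp (Λ z - g z * W z)) (f z)
    have h3 : 0 ≤ b * Real.exp b := by positivity
    have h4 : ‖exp (Λ z - g z * W z) - f z‖ / ‖g z‖ ≤ (Real.exp (R + b) + 1) / ε' :=
      div_le_div₀ (by positivity) (by linarith) hε' hge
    linarith
end
section
open Set Complex

theorem IsGridParams.exists_bound {l : ℕ} {δ ε ε' : ℝ} (hp : IsGridParams l δ ε ε') (hδ : 0 < δ) :
    ∃ C, ∀ η f g, IsNormalizedPair δ ε η f g → ∀ t, 0 < t → ∃ G : ℂ → ℂ,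
      DifferentiableOn ℂ G {z | t < z.im} ∧
      ∀ z, t < z.im → ‖G z‖ ≤ C ∧ f z + g z * G z ≠ 0 ∧ ‖(f z + g z * G z)⁻¹‖ ≤ C := by
  set L := Real.log (2 / δ) with hL
  set A := 2*Real.log (2/δ)+3*Real.pi+2*Real.pi*jumpConst l (ε/100) with hA
  set M₁ := 216 * A * stepConst / ε' with hM₁
  set C₁ := seedConst l (ε/100) (IsNormalizedPair.frontierConst l) with hC₁
  set J := jonesConst (2 ^ (l + 1) * M₁) 4 (2 ^ (l + 1) * (1512 * (1512 * C₁))) with hJ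
  have hL0 : 0 ≤ L := Real.log_nonneg (by
    rw [le_div_iff₀ hδ]
    linarith [hp.δ_le])
  refine ⟨max (reducerBound ε' (9 * L) J) (Real.exp (9 * L + J)), fun η f g h t ht => ?_⟩
  obtain ⟨P, hP⟩ : ∃ P, rowTop l P < t := by
    obtain ⟨m, hm⟩ := exists_pow_lt_of_lt_one (div_pos ht (rowTop_pos l 0)) (by norm_num : (1 / 2 : ℝ) < 1)
    refine ⟨0 + 2 ^ l * m, ?_⟩
    rw [rowTop_add_mul]
    exact (lt_div_iff₀ (rowTop_pos l 0)).1 hm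
  obtain ⟨cv, E, hE, hcell, hcv, hEbig⟩ := h.exists_isCellFamily hp (P + 1)
  have hA0 : 0 ≤ A := hcell.nonneg
  obtain ⟨Λ, s, ρ, hΛ, hs, hsC⟩ := hcell.exists_patch hE hL0 hp.ε'_pos h.hg0
    (fun z hz hgz => by
      have h1 : ‖g z‖ < ε := by linarith [hp.ε'_le, hp.ε'_pos]
      obtain ⟨⟨h2, h3⟩, h4⟩ := h.of_small z (by linarith [h.η_pos]) h1
      exact ⟨abs_le.2 ⟨by linarith, h3.le⟩, h4⟩)
    (fun e he _ z hz => hEbig e he z hz)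
  have hM₁0 : 0 ≤ M₁ := by
    have := hp.ε'_pos
    have : 0 ≤ stepConst := stepConst_pos.le
    positivity
  obtain ⟨W, hW, ⟨B, hB⟩, hWJ⟩ := exists_dbar_solution_of_hasCarleson hM₁0 hs hsC
  have hlow : rowTop l (P + 1) + cellWidth l (P + 1) / 4 < rowTop l P := by
    have h1 := rowTop_sub_succ l P
    have h2 := cellWidth_antitone l (Nat.le_succ P)
    have h3 := cellWidth_pos l P
    simp only [Nat.succ_eq_add_one] at h2
    linarith
  set t₀ := rowTop l (P + 1) + cellWidth l (P + 1) / 4 with ht₀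
  have ht₀0 : 0 < t₀ := by
    have := cellWidth_pos l (P + 1)
    have := rowTop_pos l (P + 1)
    positivity
  have hpos : ∀ z : ℂ, t₀ < z.im → 0 < z.im := fun z hz => ht₀0.trans hz
  have hηz : ∀ z : ℂ, t₀ < z.im → -η < z.im := fun z hz => by linarith [h.η_pos]
  have hsm : ∀ z : ℂ, t₀ < z.im → ‖g z‖ < ε' → ∑ q ∈ s, ρ q z = 0 ∧ exp (Λ z) = f z := by
    intro z hz hgz
    obtain ⟨h1, c, -, h2, h3⟩ := (hΛ z hz).2.2 hgz
    exact ⟨Finset.sum_eq_zero h1, by rw [h3]; exact hcv c z h2 hgz⟩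
  have hU : IsOpen {z : ℂ | t₀ < z.im} := isOpen_lt continuous_const continuous_im
  have hfU : DifferentiableOn ℂ f {z | t₀ < z.im} := h.hf0.mono hpos
  have hgU : DifferentiableOn ℂ g {z | t₀ < z.im} := h.hg0.mono hpos
  have hGd : DifferentiableOn ℂ (reducer f g Λ W) {z | t₀ < z.im} :=
    differentiableOn_reducer (S := fun z => ∑ q ∈ s, ρ q z) hp.ε'_pos hU hfU hgU
      (fun z hz => (hΛ z hz).1) (fun z hz => hW z (hpos z hz)) hsm
  have hFd : DifferentiableOn ℂ (fun z => (exp (Λ z - g z * W z))⁻¹) {z | t₀ < z.im} := by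
    refine DifferentiableOn.inv (fun z hz => ?_) fun z _ => exp_ne_zero _
    exact (differentiableAt_exp_sub (S := fun z => ∑ q ∈ s, ρ q z) (hgU.differentiableAt (hU.mem_nhds hz))
      (hΛ z hz).1 (hW z (hpos z hz))).differentiableWithinAt
  have hGb : ∀ b z, t₀ < z.im → ‖W z‖ ≤ b → ‖reducer f g Λ W z‖ ≤ reducerBound ε' (9 * L) b :=
    fun b z hz hb => norm_reducer_le hp.ε'_pos (h.f_le z (hηz z hz)) (h.g_le z (hηz z hz))
      (hΛ z hz).2.1 hb fun hg => (hsm z hz hg).2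
  have hFb : ∀ b z, t₀ < z.im → ‖W z‖ ≤ b → ‖(exp (Λ z - g z * W z))⁻¹‖ ≤ Real.exp (9 * L + b) :=
    fun b z hz hb => (norm_exp_sub_le (h.g_le z (hηz z hz)) (hΛ z hz).2.1 hb).2
  refine ⟨reducer f g Λ W, hGd.mono fun z (hz : t < z.im) => ?_, fun z hz => ⟨?_, ?_⟩⟩
  · show t₀ < z.im
    linarith
  · refine le_trans ?_ (le_max_left _ _)
    exact norm_le_of_bounded_of_im_eq hlow hGd (fun z hz => hGb B z (by linarith) (hB z hz))
      (fun z hz => hGb J z (by linarith) (hWJ z hz)) (by linarith)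
  · rw [add_mul_reducer fun hg => (hsm z (by linarith) (by rw [hg, norm_zero]; exact hp.ε'_pos)).2]
    refine ⟨exp_ne_zero _, le_trans ?_ (le_max_right _ _)⟩
    exact norm_le_of_bounded_of_im_eq (h := fun z => (exp (Λ z - g z * W z))⁻¹) hlow hFd (fun z hz => hFb B z (by linarith) (hB z hz))
      (fun z hz => hFb J z (by linarith) (hWJ z hz)) (by linarith)
end

section
open Set Metric Complex

theorem exists_le_log_bound {X c m : ℝ} (hX : 0 ≤ X) (hc : 0 < c) (hm : 0 < m) :
    ∃ ε, 0 < ε ∧ ε ≤ m ∧ 25 * (800 / Real.log (1 / (2 * ε)) * X) ≤ c := by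
  set K := 20000 * X / c + 1 with hK
  have hK0 : 0 < K := by positivity
  have hε : 0 < min m (Real.exp (-K) / 2) := lt_min hm (by positivity)
  refine ⟨_, hε, min_le_left _ _, ?_⟩
  have h1 : K ≤ Real.log (1 / (2 * min m (Real.exp (-K) / 2))) := by
    rw [Real.le_log_iff_exp_le (by positivity), le_div_iff₀ (by positivity)]
    have h2 : 2 * min m (Real.exp (-K) / 2) ≤ Real.exp (-K) := by
      linarith [min_le_right m (Real.exp (-K) / 2)]
    calc Real.exp K * _ ≤ Real.exp K * Real.exp (-K) := by gcongr
      _ = 1 := by rw [← Real.exp_add]; simp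
  calc _ ≤ 25 * (800 / K * X) := by gcongr
    _ = 20000 * X / K := by ring
    _ ≤ c := by
      rw [div_le_iff₀ hK0, hK]
      have : c * (20000 * X / c + 1) = 20000 * X + c := by field_simp
      linarith

theorem exists_isGridParams {δ : ℝ} (hδ : 0 < δ) (hδ1 : δ ≤ 1) :
    ∃ l ε ε', IsGridParams l δ ε ε' := by
  set X := Real.log (1 / (δ / 4)) with hX
  have hX0 : 0 ≤ X := Real.log_nonneg (by rw [le_div_iff₀ (by positivity)]; linarith)
  obtain ⟨ε, hε, hε1, hε2⟩ := exists_le_log_bound hX0 (by norm_num : (0 : ℝ) < 1 / 8)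
    (by positivity : 0 < δ / 16)
  set Y := Real.log (1 / (ε / 2)) with hY
  have hY0 : 0 ≤ Y := Real.log_nonneg (by rw [le_div_iff₀ (by positivity)]; linarith)
  obtain ⟨ε', hε', hε'1, hε'2⟩ := exists_le_log_bound hY0 (by positivity : 0 < ε / 200)
    (by positivity : 0 < ε / 32)
  set m := min (min (1 / 8 / (25 * (X + 1))) (ε / 200 / (25 * (Y + 1)))) (ε' / 32 / 48) with hm
  have hm0 : 0 < m := by positivity
  obtain ⟨n, hn⟩ := exists_pow_lt_of_lt_one hm0 (by norm_num : (1 / 2 : ℝ) < 1)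
  have hl : (1 / 2 : ℝ) ^ (n + 6 + 1) ≤ m :=
    (pow_le_pow_of_le_one (by norm_num) (by norm_num) (by omega)).trans hn.le
  have h1 := hl.trans ((min_le_left _ _).trans (min_le_left _ _))
  have h2 := hl.trans ((min_le_left _ _).trans (min_le_right _ _))
  have h3 := hl.trans (min_le_right _ _)
  have hp : 0 < (1 / 2 : ℝ) ^ (n + 6 + 1) := by positivity
  rw [le_div_iff₀ (by positivity)] at h1 h2 h3
  refine ⟨n + 6, ε, ε', hδ1, hε, hε', by linarith, by linarith, by omega, by linarith, ?_, ?_⟩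
  · rw [add_mul, mul_add, ← hX]
    linarith
  · rw [add_mul, mul_add, ← hY]
    linarith

theorem normSq_sub_I (w : ℂ) : ‖w - I‖ ^ 2 = ‖w + I‖ ^ 2 - 4 * w.im := by
  rw [← normSq_eq_norm_sq, ← normSq_eq_norm_sq]
  simp only [normSq_apply, sub_re, sub_im, add_re, add_im, I_re, I_im]
  ring

/-- The half plane estimate transported to a disk by a Cayley transform, for data holomorphic
across the unit circle. -/
theorem exists_ball_bound_of_one_lt {l : ℕ} {δ ε ε' C R R₁ : ℝ} {f g : ℂ → ℂ}
    (hp : IsGridParams l δ ε ε')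
    (hC : ∀ η f g, IsNormalizedPair δ ε η f g → ∀ t, 0 < t → ∃ G : ℂ → ℂ,
      DifferentiableOn ℂ G {z | t < z.im} ∧
      ∀ z, t < z.im → ‖G z‖ ≤ C ∧ f z + g z * G z ≠ 0 ∧ ‖(f z + g z * G z)⁻¹‖ ≤ C)
    (hR : R < 1) (hR₁ : 1 < R₁)
    (hf : DifferentiableOn ℂ f (ball 0 R₁)) (hg : DifferentiableOn ℂ g (ball 0 R₁))
    (hf1 : ∀ z ∈ ball (0 : ℂ) R₁, ‖f z‖ ≤ 1) (hg1 : ∀ z ∈ ball (0 : ℂ) R₁, ‖g z‖ ≤ 1)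
    (hfg : ∀ z ∈ ball (0 : ℂ) R₁, δ ≤ ‖f z‖ + ‖g z‖) :
    ∃ G : ℂ → ℂ, DifferentiableOn ℂ G (ball 0 R) ∧ ∀ z ∈ ball (0 : ℂ) R,
      ‖G z‖ ≤ max C (2 / δ) ∧ f z + g z * G z ≠ 0 ∧ ‖(f z + g z * G z)⁻¹‖ ≤ max C (2 / δ) := by
  have hε := hp.ε_pos
  have hδ : 0 < δ := by linarith [hp.ε_le]
  rcases le_or_gt R 0 with hR0 | hR0
  · refine ⟨0, differentiableOn_const 0, fun z hz => ?_⟩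
    rw [ball_eq_empty.2 hR0] at hz
    exact hz.elim
  by_cases hcirc : ∀ z : ℂ, ‖z‖ = 1 → ‖g z‖ < 2 * ε
  · refine ⟨fun _ => 0, differentiableOn_const 0, fun z hz => ?_⟩
    have hzR : ‖z‖ < R := by simpa using hz
    have hz1 : ‖g z‖ ≤ 2 * ε := by
      refine norm_le_of_forall_mem_frontier_norm_le (U := ball (0 : ℂ) 1) isBounded_ball
        ?_ (fun w hw => ?_) ?_
      · refine DifferentiableOn.diffContOnCl (hg.mono ?_)
        rw [closure_ball _ one_ne_zero]
        exact closedBall_subset_ball hR₁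
      · rw [frontier_ball _ one_ne_zero] at hw
        exact (hcirc w (by simpa using hw)).le
      · exact subset_closure (by simpa using hzR.trans hR)
    have h1 : δ / 2 ≤ ‖f z‖ := by
      have := hfg z (by simpa using (hzR.trans hR).trans hR₁)
      linarith [hp.ε_le]
    have h2 : 0 < ‖f z‖ := by linarith
    rw [mul_zero, add_zero, norm_zero, norm_inv]
    refine ⟨le_max_of_le_right (by positivity), norm_pos_iff.1 h2, le_max_of_le_right ?_⟩
    calc ‖f z‖⁻¹ ≤ (δ / 2)⁻¹ := inv_anti₀ (by positivity) h1
      _ = 2 / δ := by rw [inv_div]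
  push Not at hcirc
  obtain ⟨ζ, hζ, hgζ⟩ := hcirc
  have hζ0 : ζ ≠ 0 := norm_pos_iff.1 (by rw [hζ]; norm_num)
  have hcont : ContinuousAt g ζ := hg.continuousOn.continuousAt
    (isOpen_ball.mem_nhds (by simpa [hζ] using hR₁))
  have hev : ∀ᶠ z in nhds ζ, ε < ‖g z‖ := hcont.norm.eventually_const_lt (by linarith)
  obtain ⟨κ, hκ, hκg⟩ := Metric.eventually_nhds_iff.1 hev
  set μ := 2 * (2 / κ + 1) + 1 with hμ
  have hμ0 : 0 < μ := by positivity
  set η₁ := min (1 / 2) ((R₁ ^ 2 - 1) / 16) with hη₁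
  have hη₁0 : 0 < η₁ := lt_min (by norm_num) (by nlinarith)
  have hη₁a : η₁ ≤ 1 / 2 := min_le_left _ _
  have hη₁b : η₁ ≤ (R₁ ^ 2 - 1) / 16 := min_le_right _ _
  set φ : ℂ → ℂ := fun w => ζ * ((w - I) / (w + I)) with hφ
  have hden : ∀ w : ℂ, -η₁ < w.im → 1 / 2 ≤ ‖w + I‖ := fun w hw => by
    have := (abs_im_le_norm (w + I))
    rw [add_im, I_im] at this
    linarith [le_abs_self (w.im + 1)]
  have hφball : ∀ w : ℂ, -η₁ < w.im → φ w ∈ ball (0 : ℂ) R₁ := fun w hw => by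
    have h1 := hden w hw
    have h2 := normSq_sub_I w
    simp only [hφ, mem_ball_zero_iff, norm_mul, hζ, one_mul, norm_div]
    rw [div_lt_iff₀ (by linarith)]
    refine lt_of_pow_lt_pow_left₀ 2 (by positivity) ?_
    rw [h2, mul_pow]
    have h3 : (1 / 2) ^ 2 ≤ ‖w + I‖ ^ 2 := pow_le_pow_left₀ (by norm_num) h1 2
    have h4 := mul_le_mul_of_nonneg_left h3 (show 0 ≤ R₁ ^ 2 - 1 by linarith)
    linarith
  set ψ : ℂ → ℂ := fun v => φ (μ * (v - 1 / 2)) with hψ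
  have him : ∀ v : ℂ, (μ * (v - 1 / 2) : ℂ).im = μ * v.im := fun v => by simp
  have hηim : ∀ v : ℂ, -(η₁ / μ) < v.im → -η₁ < (μ * (v - 1 / 2) : ℂ).im := fun v hv => by
    rw [him]
    have := mul_lt_mul_of_pos_left hv hμ0
    rwa [mul_neg, mul_div_cancel₀ _ hμ0.ne'] at this
  have hψball : ∀ v : ℂ, -(η₁ / μ) < v.im → ψ v ∈ ball (0 : ℂ) R₁ := fun v hv => hφball _ (hηim v hv)
  have hψd : DifferentiableOn ℂ ψ {v | -(η₁ / μ) < v.im} := by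
    intro v hv
    have : (μ * (v - 1 / 2) : ℂ) + I ≠ 0 := norm_pos_iff.1 (by linarith [hden _ (hηim v hv)])
    refine DifferentiableAt.differentiableWithinAt ?_
    have h1 : DifferentiableAt ℂ (fun v : ℂ => (μ * (v - 1 / 2) : ℂ) - I) v := by fun_prop
    have h2 : DifferentiableAt ℂ (fun v : ℂ => (μ * (v - 1 / 2) : ℂ) + I) v := by fun_prop
    exact (h1.div h2 this).const_mul ζ
  have hpair : IsNormalizedPair δ ε (η₁ / μ) (f ∘ ψ) (g ∘ ψ) := by
    refine ⟨by positivity, hf.comp hψd hψball, hg.comp hψd hψball, fun v hv => hf1 _ (hψball v hv),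
      fun v hv => hg1 _ (hψball v hv), fun v hv => hfg _ (hψball v hv), fun v hv hgv => ?_⟩
    have h1 := hden _ (hηim v hv)
    set w : ℂ := μ * (v - 1 / 2) with hw
    have h2 : w + I ≠ 0 := norm_pos_iff.1 (by linarith)
    have h3 : κ ≤ dist (φ w) ζ := by
      by_contra! hlt
      exact absurd (hκg hlt) (not_lt.2 hgv.le)
    have h4 : φ w - ζ = ζ * (-2 * I) / (w + I) := by
      simp only [hφ]
      field_simp
      ring
    rw [dist_eq_norm, h4, norm_div, norm_mul, hζ, norm_mul, norm_neg, norm_I, le_div_iff₀ (by linarith)] at h3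
    have h5 : ‖w + I‖ ≤ 2 / κ := by
      rw [le_div_iff₀ hκ]
      norm_num at h3
      linarith
    have h6 : ‖w‖ ≤ 2 / κ + 1 := by
      have := norm_sub_le (w + I) I
      rw [add_sub_cancel_right, norm_I] at this
      linarith
    have h7 : ‖v - 1 / 2‖ < 1 / 2 := by
      rw [hw, norm_mul, norm_real, Real.norm_of_nonneg hμ0.le] at h6
      have h8 : 2 / κ + 1 < μ * (1 / 2) := by rw [hμ]; linarith
      exact lt_of_mul_lt_mul_left (h6.trans_lt h8) hμ0.le
    have h8 := abs_lt.1 ((abs_re_le_norm _).trans_lt h7)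
    have h9 := abs_lt.1 ((abs_im_le_norm _).trans_lt h7)
    have e1 : (v - 1 / 2).re = v.re - 1 / 2 := by simp
    have e2 : (v - 1 / 2).im = v.im := by simp
    rw [e1] at h8
    rw [e2] at h9
    refine ⟨⟨?_, ?_⟩, ?_⟩ <;> linarith
  have ht : 0 < (1 - R ^ 2) / (4 * μ) := div_pos (by nlinarith) (by positivity)
  obtain ⟨G, hGd, hG⟩ := hC _ _ _ hpair _ ht
  set τ : ℂ → ℂ := fun z => I * ((ζ + z) / (ζ - z)) / μ + 1 / 2 with hτ
  have hne : ∀ z ∈ ball (0 : ℂ) R, ζ - z ≠ 0 := fun z hz h0 => by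
    rw [mem_ball_zero_iff, ← sub_eq_zero.1 h0, hζ] at hz
    linarith
  have hμc : (μ : ℂ) ≠ 0 := by exact_mod_cast hμ0.ne'
  have hτψ : ∀ z ∈ ball (0 : ℂ) R, ψ (τ z) = z ∧ (1 - R ^ 2) / (4 * μ) < (τ z).im := fun z hz => by
    have h0 := hne z hz
    have e1 : (μ * (τ z - 1 / 2) : ℂ) = I * ((ζ + z) / (ζ - z)) := by
      simp only [hτ]
      field_simp
      ring
    have e2 : I * ((ζ + z) / (ζ - z)) + I = 2 * I * ζ / (ζ - z) := by
      field_simp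
      ring
    have e3 : I * ((ζ + z) / (ζ - z)) - I = 2 * I * z / (ζ - z) := by
      field_simp
      ring
    have e4 : ψ (τ z) = z := by
      simp only [hψ, hφ, e1, e2, e3]
      field_simp
    refine ⟨e4, ?_⟩
    have h1 := normSq_sub_I (I * ((ζ + z) / (ζ - z)))
    rw [e2, e3, ← e1, him] at h1
    simp only [norm_div, norm_mul, norm_I, hζ, norm_ofNat, mul_one] at h1
    have h2 : 0 < ‖ζ - z‖ := norm_pos_iff.2 h0
    have h3 : ‖z‖ < R := by simpa using hz
    have h4 : ‖ζ - z‖ ≤ 2 := (norm_sub_le _ _).trans (by linarith)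
    have h5 : 1 ≤ 2 / ‖ζ - z‖ := by rwa [le_div_iff₀ h2, one_mul]
    have h6 : 2 * ‖z‖ / ‖ζ - z‖ = 2 / ‖ζ - z‖ * ‖z‖ := by ring
    rw [h6, mul_pow] at h1
    have h7 : ‖z‖ ^ 2 < R ^ 2 := by nlinarith [norm_nonneg z]
    rw [div_lt_iff₀ (by positivity)]
    have h8 : 1 ≤ (2 / ‖ζ - z‖) ^ 2 := one_le_pow₀ h5
    have h9 : 0 < 1 - R ^ 2 := by nlinarith
    nlinarith
  refine ⟨G ∘ τ, hGd.comp ?_ fun z hz => (hτψ z hz).2, fun z hz => ?_⟩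
  · intro z hz
    refine DifferentiableAt.differentiableWithinAt ?_
    simp only [hτ]
    exact (((DifferentiableAt.div (by fun_prop) (by fun_prop) (hne z hz)).const_mul _).div_const _).add_const _
  · obtain ⟨h1, h2, h3⟩ := hG (τ z) (hτψ z hz).2
    simp only [Function.comp_apply, (hτψ z hz).1] at h1 h2 h3 ⊢
    exact ⟨h1.trans (le_max_left _ _), h2, h3.trans (le_max_left _ _)⟩

theorem exists_ball_bound {δ : ℝ} (hδ : 0 < δ) (hδ1 : δ ≤ 1) :
    ∃ C, ∀ f g : ℂ → ℂ, DifferentiableOn ℂ f (ball 0 1) → DifferentiableOn ℂ g (ball 0 1) →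
      (∀ z ∈ ball (0 : ℂ) 1, ‖f z‖ ≤ 1 ∧ ‖g z‖ ≤ 1 ∧ δ ≤ ‖f z‖ + ‖g z‖) → ∀ R < 1,
      ∃ G : ℂ → ℂ, DifferentiableOn ℂ G (ball 0 R) ∧ ∀ z ∈ ball (0 : ℂ) R,
        ‖G z‖ ≤ C ∧ f z + g z * G z ≠ 0 ∧ ‖(f z + g z * G z)⁻¹‖ ≤ C := by
  obtain ⟨l, ε, ε', hp⟩ := exists_isGridParams hδ hδ1
  obtain ⟨C, hC⟩ := hp.exists_bound hδ
  refine ⟨max C (2 / δ), fun f g hf hg hb R hR => ?_⟩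
  rcases le_or_gt R 0 with hR0 | hR0
  · refine ⟨0, differentiableOn_const 0, fun z hz => ?_⟩
    rw [ball_eq_empty.2 hR0] at hz
    exact hz.elim
  set r := (1 + R) / 2 with hr
  have hr0 : 0 < r := by positivity
  have hr1 : r < 1 := by rw [hr]; linarith
  have hRr : R / r < 1 := by rw [div_lt_one hr0, hr]; linarith
  have hm : MapsTo (fun z : ℂ => (r : ℂ) * z) (ball 0 (1 / r)) (ball 0 1) := fun z hz => by
    rw [mem_ball_zero_iff] at hz ⊢
    rw [lt_div_iff₀ hr0] at hz
    rw [norm_mul, norm_real, Real.norm_of_nonneg hr0.le]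
    linarith
  have hd : DifferentiableOn ℂ (fun z : ℂ => (r : ℂ) * z) (ball 0 (1 / r)) := by fun_prop
  obtain ⟨G, hGd, hG⟩ := exists_ball_bound_of_one_lt hp hC hRr ((one_lt_div hr0).2 hr1)
    (hf.comp hd hm) (hg.comp hd hm) (fun z hz => (hb _ (hm hz)).1) (fun z hz => (hb _ (hm hz)).2.1)
    (fun z hz => (hb _ (hm hz)).2.2)
  have hm' : MapsTo (fun z : ℂ => z / r) (ball 0 R) (ball 0 (R / r)) := fun z hz => by
    rw [mem_ball_zero_iff] at hz ⊢
    rw [norm_div, norm_real, Real.norm_of_nonneg hr0.le]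
    gcongr
  refine ⟨fun z => G (z / r), hGd.comp (by fun_prop) hm', fun z hz => ?_⟩
  have := hG _ (hm' hz)
  have hrc : (r : ℂ) ≠ 0 := by exact_mod_cast hr0.ne'
  simpa only [Function.comp_apply, mul_div_cancel₀ z hrc] using this
end

section
open Set Metric Complex Filter Topology

/-- Along an ultrafilter, a bounded sequence of holomorphic functions on the unit disk has a
holomorphic pointwise limit. -/
theorem exists_differentiableOn_tendsto {ι : Type*} (u : Ultrafilter ι) {F : ι → ℂ → ℂ} {C : ℝ}
    (hd : ∀ i, DifferentiableOn ℂ (F i) (ball 0 1)) (hC : ∀ i, ∀ z ∈ ball (0 : ℂ) 1, ‖F i z‖ ≤ C) :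
    ∃ G : ℂ → ℂ, DifferentiableOn ℂ G (ball 0 1) ∧
      ∀ z ∈ ball (0 : ℂ) 1, Tendsto (fun i => F i z) u (𝓝 (G z)) := by
  have hlim : ∀ z : ℂ, ∃ y : ℂ, z ∈ ball (0 : ℂ) 1 → Tendsto (fun i => F i z) u (𝓝 y) := fun z => by
    by_cases hz : z ∈ ball (0 : ℂ) 1
    · have h1 : ↑(u.map fun i => F i z) ≤ 𝓟 (closedBall (0 : ℂ) C) :=
        tendsto_principal.2 (Eventually.of_forall fun i => by simpa using hC i z hz)
      obtain ⟨y, -, hy⟩ := (isCompact_closedBall (0 : ℂ) C).ultrafilter_le_nhds _ h1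
      exact ⟨y, fun _ => hy⟩
    · exact ⟨0, fun h => absurd h hz⟩
  choose G hG using hlim
  refine ⟨G, ?_, hG⟩
  have heq : EquicontinuousOn F (ball 0 1) := by
    intro z hz
    refine EquicontinuousAt.equicontinuousWithinAt ?_ _
    have hz1 : 0 < 1 - ‖z‖ := by simpa using hz
    refine equicontinuousAt_of_continuity_modulus
      (fun w => 2 * C / (1 - ‖z‖) * dist w z) ?_ F ?_
    · have : Continuous fun w : ℂ => 2 * C / (1 - ‖z‖) * dist w z := by fun_prop
      simpa using this.tendsto z
    · filter_upwards [ball_mem_nhds z hz1] with w hw i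
      have hsub : ball z (1 - ‖z‖) ⊆ ball 0 1 := ball_subset_ball' (by simp)
      rw [dist_comm]
      refine dist_le_div_mul_dist_of_mapsTo_ball ((hd i).mono hsub) (fun x hx => ?_) hw
      rw [mem_closedBall, dist_eq_norm]
      exact (norm_sub_le _ _).trans (by linarith [hC i x (hsub hx), hC i z hz])
  refine TendstoLocallyUniformlyOn.differentiableOn (F := F) (φ := (u : Filter ι)) ?_
    (Eventually.of_forall hd) isOpen_ball
  rw [tendstoLocallyUniformlyOn_iff_forall_isCompact isOpen_ball]
  have h2 := (EquicontinuousOn.tendsto_uniformOnFun_iff_pi' (F := F)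
    (𝔖 := {K : Set ℂ | K ⊆ ball 0 1 ∧ IsCompact K}) (fun K hK => hK.2)
    (fun K hK => heq.mono hK.1) (u : Filter ι) G).2 ?_
  · intro K hK hKc
    exact UniformOnFun.tendsto_iff_tendstoUniformlyOn.1 h2 K ⟨hK, hKc⟩
  · rw [tendsto_pi_nhds]
    rintro ⟨z, K, hK, hz⟩
    exact hG z (hK.1 hz)

theorem exists_unit_ball_bound {δ : ℝ} (hδ : 0 < δ) (hδ1 : δ ≤ 1) :
    ∃ C, 0 < C ∧ ∀ f g : ℂ → ℂ, DifferentiableOn ℂ f (ball 0 1) → DifferentiableOn ℂ g (ball 0 1) →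
      (∀ z ∈ ball (0 : ℂ) 1, ‖f z‖ ≤ 1 ∧ ‖g z‖ ≤ 1 ∧ δ ≤ ‖f z‖ + ‖g z‖) →
      ∃ G : ℂ → ℂ, DifferentiableOn ℂ G (ball 0 1) ∧ ∀ z ∈ ball (0 : ℂ) 1,
        ‖G z‖ ≤ C ∧ C⁻¹ ≤ ‖f z + g z * G z‖ := by
  obtain ⟨C₀, hC₀⟩ := exists_ball_bound hδ hδ1
  set C := max C₀ 1 with hC
  have hC1 : 0 < C := lt_max_of_lt_right one_pos
  refine ⟨C, hC1, fun f g hf hg hb => ?_⟩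
  set R : ℕ → ℝ := fun k => 1 - 1 / ((k : ℝ) + 2) with hR
  have hR0 : ∀ k, 0 < R k := fun k => by
    have : (0 : ℝ) ≤ k := k.cast_nonneg
    simp only [hR, sub_pos]
    rw [div_lt_one (by positivity)]
    linarith
  have hR1 : ∀ k, R k < 1 := fun k => by
    have : (0 : ℝ) < 1 / ((k : ℝ) + 2) := by positivity
    simp only [hR]
    linarith
  have hRlim : Tendsto R atTop (𝓝 1) := by
    have h1 := (tendsto_one_div_add_atTop_nhds_zero_nat (𝕜 := ℝ)).comp (tendsto_add_atTop_nat 1)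
    have h2 := h1.const_sub 1
    rw [sub_zero] at h2
    refine h2.congr fun k => ?_
    simp only [Function.comp_apply, hR]
    push_cast
    ring
  choose H hHd hH using fun k => hC₀ f g hf hg hb (R k) (hR1 k)
  have hm : ∀ k, MapsTo (fun z : ℂ => (R k : ℂ) * z) (ball 0 1) (ball 0 (R k)) := fun k z hz => by
    rw [mem_ball_zero_iff] at hz ⊢
    rw [norm_mul, norm_real, Real.norm_of_nonneg (hR0 k).le]
    nlinarith [hR0 k]
  set u : Ultrafilter ℕ := hyperfilter ℕ with hu
  have hut : (u : Filter ℕ) ≤ atTop := by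
    rw [← Nat.cofinite_eq_atTop]
    exact hyperfilter_le_cofinite
  obtain ⟨G, hGd, hG⟩ := exists_differentiableOn_tendsto u (F := fun k z => H k (R k * z)) (C := C₀)
    (fun k => (hHd k).comp (by fun_prop) (hm k)) (fun k z hz => (hH k _ (hm k hz)).1)
  refine ⟨G, hGd, fun z hz => ⟨?_, ?_⟩⟩
  · exact le_of_tendsto (hG z hz).norm
      (Eventually.of_forall fun k => (hH k _ (hm k hz)).1.trans (le_max_left _ _))
  · have h1 : Tendsto (fun k => (R k : ℂ) * z) u (𝓝 z) := by
      have := ((continuous_ofReal.tendsto 1).comp hRlim).mul_const z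
      rw [ofReal_one, one_mul] at this
      exact this.mono_left hut
    have hnz := isOpen_ball.mem_nhds hz
    have hf1 := ((hf.continuousOn.continuousAt hnz).tendsto.comp h1)
    have hg1 := ((hg.continuousOn.continuousAt hnz).tendsto.comp h1)
    refine ge_of_tendsto (hf1.add (hg1.mul (hG z hz))).norm (Eventually.of_forall fun k => ?_)
    obtain ⟨-, h2, h3⟩ := hH k _ (hm k hz)
    rw [norm_inv] at h3
    exact inv_le_of_inv_le₀ (norm_pos_iff.2 h2) (h3.trans (le_max_left _ _))
end

/-- **`H^∞(𝔻 × ℕ)` is a B-ring (Bass stable rank one).** If `(f, g)` is a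
unimodular pair in `H^∞(𝔻 × ℕ)`, i.e. `u·f + v·g = 1` on `𝔻 × ℕ` for some
`u, v ∈ H^∞(𝔻 × ℕ)`, then there exists `G ∈ H^∞(𝔻 × ℕ)` such that `f + g·G`
is invertible, i.e. `inf_{(z,n)} |f(z,n) + g(z,n)·G(z,n)| > 0`. -/
theorem HinfN_Bring (f g u v : ℂ → ℕ → ℂ)
    (hf : MemHinfN f) (hg : MemHinfN g) (hu : MemHinfN u) (hv : MemHinfN v)
    (hunim : ∀ z ∈ Metric.ball (0 : ℂ) 1, ∀ n : ℕ,
      u z n * f z n + v z n * g z n = 1) :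
    ∃ G : ℂ → ℕ → ℂ, MemHinfN G ∧
      ∃ ε : ℝ, 0 < ε ∧ ∀ z ∈ Metric.ball (0 : ℂ) 1, ∀ n : ℕ,
        ε ≤ ‖f z n + g z n * G z n‖ := by
  obtain ⟨Mf, hMf⟩ := hf.2
  obtain ⟨Mg, hMg⟩ := hg.2
  obtain ⟨Mu, hMu⟩ := hu.2
  obtain ⟨Mv, hMv⟩ := hv.2
  set M := max (max Mf Mg) (max (max Mu Mv) 1) with hM
  have hM1 : 1 ≤ M := (le_max_right _ _).trans (le_max_right _ _)
  have hM0 : 0 < M := one_pos.trans_le hM1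
  have hMf' : Mf ≤ M := (le_max_left _ _).trans (le_max_left _ _)
  have hMg' : Mg ≤ M := (le_max_right _ _).trans (le_max_left _ _)
  have hMu' : Mu ≤ M := ((le_max_left _ _).trans (le_max_left _ _)).trans (le_max_right _ _)
  have hMv' : Mv ≤ M := ((le_max_right _ _).trans (le_max_left _ _)).trans (le_max_right _ _)
  have hMn : ‖(M : ℂ)‖ = M := by rw [Complex.norm_real, Real.norm_of_nonneg hM0.le]
  have hMc : (M : ℂ) ≠ 0 := by exact_mod_cast hM0.ne'
  have hδ1 : (M ^ 2)⁻¹ ≤ 1 := inv_le_one_of_one_le₀ (one_le_pow₀ hM1)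
  obtain ⟨C, hC0, hC⟩ := exists_unit_ball_bound (by positivity : 0 < (M ^ 2)⁻¹) hδ1
  have key : ∀ n, ∃ G : ℂ → ℂ, DifferentiableOn ℂ G (Metric.ball 0 1) ∧
      ∀ z ∈ Metric.ball (0 : ℂ) 1, ‖G z‖ ≤ C ∧ C⁻¹ ≤ ‖f z n / M + g z n / M * G z‖ := fun n => by
    refine hC _ _ ((hf.1 n).div_const _) ((hg.1 n).div_const _) fun z hz => ?_
    have h1 := (hMf z hz n).trans hMf'
    have h2 := (hMg z hz n).trans hMg'
    have h3 := (hMu z hz n).trans hMu'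
    have h4 := (hMv z hz n).trans hMv'
    rw [norm_div, norm_div, hMn]
    refine ⟨div_le_one_of_le₀ h1 hM0.le, div_le_one_of_le₀ h2 hM0.le, ?_⟩
    have h5 : 1 ≤ ‖u z n‖ * ‖f z n‖ + ‖v z n‖ * ‖g z n‖ := by
      rw [← norm_mul, ← norm_mul]
      refine le_trans ?_ (norm_add_le _ _)
      rw [hunim z hz n, norm_one]
    have h6 := mul_le_mul_of_nonneg_right h3 (norm_nonneg (f z n))
    have h7 := mul_le_mul_of_nonneg_right h4 (norm_nonneg (g z n))
    rw [← add_div, le_div_iff₀ hM0, show (M ^ 2)⁻¹ * M = 1 / M by field_simp, div_le_iff₀ hM0]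
    linarith
  choose G hGd hG using key
  refine ⟨fun z n => G n z, ⟨hGd, C, fun z hz n => (hG n z hz).1⟩, C⁻¹, by positivity, fun z hz n => ?_⟩
  have h1 := (hG n z hz).2
  have h2 : f z n / M + g z n / M * G n z = (f z n + g z n * G n z) / M := by
    field_simp
  rw [h2, norm_div, hMn] at h1
  exact h1.trans (div_le_self (norm_nonneg _) hM1)
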